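/- Suppose the correlation length condition (CL) holds, and define ξ*(β) = χ(β)^{1/α} for 0 < β < β_c, where χ(β) = E_β|K|. Then P_β(x ↔ y) ≍ ‖x−y‖^{−d+α}·(1 ∨ ‖x−y‖/ξ*(β))^{−2α} for every β_c/2 ≤ β < β_c and all distinct x, y ∈ ℤ^d. As a consequence, ξ_p(β) ≍_p ξ*(β) for all 0 < p < α and β_c/2 ≤ β < β_c. -/

import Mathlib

open MeasureTheory ENNReal Filter
open scoped Classical

namespace LRP

/-! ## Generic Bernoulli bond percolation -/

/-- The probability that an edge with rate `t ≥ 0` is open: `1 - e^{-t}`. -/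
noncomputable def edgeProb (t : ℝ) : ℝ := 1 - Real.exp (-t)

/-- `μ` is the law of Bernoulli bond percolation in which every unordered pair `e`
of vertices is open independently with probability `p e`: every finite cylinder
event has the corresponding product probability.  (This characterises `μ` uniquely.) -/
def IsPerc {Vt : Type*} (μ : Measure (Sym2 Vt → Bool)) (p : Sym2 Vt → ℝ) : Prop :=
  IsProbabilityMeasure μ ∧
    ∀ (s : Finset (Sym2 Vt)) (f : Sym2 Vt → Bool),
      μ {ω | ∀ e ∈ s, ω e = f e} =
        ∏ e ∈ s, ENNReal.ofReal (if f e then p e else 1 - p e)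

/-- Two vertices are connected if they are joined by a path of open edges. -/
def Conn {Vt : Type*} (ω : Sym2 Vt → Bool) (x y : Vt) : Prop :=
  Relation.ReflTransGen (fun a b => ω s(a, b) = true) x y

/-- The open cluster of a vertex. -/
def cluster {Vt : Type*} (ω : Sym2 Vt → Bool) (x : Vt) : Set Vt := {y | Conn ω x y}

/-- The number of points of a set, as an extended nonnegative real. -/
noncomputable def eCard {Vt : Type*} (s : Set Vt) : ℝ≥0∞ :=
  if s.Finite then (s.ncard : ℝ≥0∞) else ∞

/-! ## Long-range percolation on `ℤ^d` -/

abbrev V (d : ℕ) := Fin d → ℤ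

abbrev Config (d : ℕ) := Sym2 (V d) → Bool

noncomputable def toR {d : ℕ} (x : V d) : Fin d → ℝ := fun i => (x i : ℝ)

/-- The Euclidean norm of a lattice point. -/
noncomputable def enorm2 {d : ℕ} (x : V d) : ℝ := Real.sqrt (∑ i, ((x i : ℝ)) ^ 2)

/-- The `p`-th moment of the volume of the cluster of the origin. -/
noncomputable def clMom {d : ℕ} (μ : Measure (Config d)) (p : ℕ) : ℝ≥0∞ :=
  ∫⁻ ω, (eCard (cluster ω (0 : V d))) ^ p ∂μ

/-- `E Σ_{x ∈ K} ‖x‖₂^p`. -/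
noncomputable def gyr {d : ℕ} (μ : Measure (Config d)) (p : ℝ) : ℝ≥0∞ :=
  ∫⁻ ω, ∑' x : cluster ω (0 : V d), ENNReal.ofReal (enorm2 (x : V d) ^ p) ∂μ

/-- The `L^p` radius of gyration. -/
noncomputable def xi {d : ℕ} (μ : Measure (Config d)) (p : ℝ) : ℝ≥0∞ :=
  (gyr μ p / clMom μ 1) ^ (1 / p)

/-- A decreasing function `(0, ∞) → (0, 1]` decaying faster than any power. -/
def RapidDecay (h : ℝ → ℝ) : Prop :=
  AntitoneOn h (Set.Ioi (0 : ℝ)) ∧ (∀ t : ℝ, 0 < t → 0 < h t ∧ h t ≤ 1) ∧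
    ∀ p : ℝ, 0 < p → Tendsto (fun t => h t * t ^ p) atTop (nhds 0)

/-- The data of a long-range percolation kernel `J(x,y) = 𝟙(x ≠ y) J(‖x - y‖)` on `ℤ^d`,
together with the standing regularity and normalisation assumptions: `‖⋅‖` is a norm
whose unit ball has unit Lebesgue measure, `J` is decreasing and differentiable with
`|J'(r)| = (1 + δ_r) r^{-d-α-1}`, `δ_r → 0`, and `∫_{r₀}^∞ |δ_r| dr/r < ∞`. -/
structure Kernel (d : ℕ) (α : ℝ) where
  N : Seminorm ℝ (Fin d → ℝ)
  N_pos : ∀ x : Fin d → ℝ, x ≠ 0 → 0 < N x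
  N_ball : volume {x : Fin d → ℝ | N x ≤ 1} = 1
  J : ℝ → ℝ
  J' : ℝ → ℝ
  δ : ℝ → ℝ
  J_nonneg : ∀ r : ℝ, 0 < r → 0 ≤ J r
  J_anti : AntitoneOn J (Set.Ioi (0 : ℝ))
  J_hasDeriv : ∀ r : ℝ, 0 < r → HasDerivAt J (J' r) r
  J'_eq : ∀ r : ℝ, 0 < r → |J' r| = (1 + δ r) * r ^ (-(d : ℝ) - α - 1)
  δ_lim : Tendsto δ atTop (nhds 0)
  δ_int : ∃ r₀ : ℝ, 0 < r₀ ∧ IntegrableOn (fun r => |δ r| / r) (Set.Ioi r₀)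

namespace Kernel

variable {d : ℕ} {α : ℝ} (κ : Kernel d α)

/-- The distance between two lattice points in the norm `N`. -/
noncomputable def nd (x y : V d) : ℝ := κ.N (toR x - toR y)

theorem nd_symm (x y : V d) : κ.nd x y = κ.nd y x := by
  show κ.N (toR x - toR y) = κ.N (toR y - toR x)
  rw [show toR y - toR x = -(toR x - toR y) by abel, map_neg_eq_map]

/-- The kernel `J(x, y)`. -/
noncomputable def ker (x y : V d) : ℝ := if x = y then 0 else κ.J (κ.nd x y)

theorem ker_symm (x y : V d) : κ.ker x y = κ.ker y x := by
  show (if x = y then 0 else κ.J (κ.nd x y)) = (if y = x then 0 else κ.J (κ.nd y x))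
  rw [κ.nd_symm x y]
  exact if_congr eq_comm rfl rfl

/-- The cut-off kernel `J_r(x, y)`. -/
noncomputable def kerCut (r : ℝ) (x y : V d) : ℝ :=
  if x ≠ y ∧ κ.nd x y ≤ r then ∫ s in Set.Ioc (κ.nd x y) r, |κ.J' s| else 0

theorem kerCut_symm (r : ℝ) (x y : V d) : κ.kerCut r x y = κ.kerCut r y x := by
  show (if x ≠ y ∧ κ.nd x y ≤ r then ∫ s in Set.Ioc (κ.nd x y) r, |κ.J' s| else 0) =
    (if y ≠ x ∧ κ.nd y x ≤ r then ∫ s in Set.Ioc (κ.nd y x) r, |κ.J' s| else 0)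
  rw [κ.nd_symm x y]
  exact if_congr (and_congr_left' ne_comm) rfl rfl

/-- Edge probabilities at inverse temperature `β` for the kernel `J`. -/
noncomputable def edgeP (β : ℝ) : Sym2 (V d) → ℝ :=
  Sym2.lift ⟨fun x y => edgeProb (β * κ.ker x y), fun x y => by
    show edgeProb (β * κ.ker x y) = edgeProb (β * κ.ker y x)
    rw [κ.ker_symm x y]⟩

/-- Edge probabilities at inverse temperature `β` for the cut-off kernel `J_r`. -/
noncomputable def edgePCut (β r : ℝ) : Sym2 (V d) → ℝ :=
  Sym2.lift ⟨fun x y => edgeProb (β * κ.kerCut r x y), fun x y => by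
    show edgeProb (β * κ.kerCut r x y) = edgeProb (β * κ.kerCut r y x)
    rw [κ.kerCut_symm r x y]⟩

/-- The ball of radius `r` about the origin of `ℤ^d`, in the norm `N`. -/
def ball (r : ℝ) : Set (V d) := {x : V d | κ.N (toR x) ≤ r}

/-- There is an infinite cluster with positive probability at `β`. -/
def percolates (β : ℝ) : Prop :=
  ∀ μ : Measure (Config d), IsPerc μ (κ.edgeP β) →
    0 < μ {ω | ∃ x : V d, (cluster ω x).Infinite}

/-- The critical point `β_c`. -/
noncomputable def betaC : ℝ := sInf {β : ℝ | 0 ≤ β ∧ κ.percolates β}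

/-- The correlation length condition for effectively long-range critical behaviour:
`β_c < ∞` and for every `p > 0` the `L^p` radius of gyration of the cut-off model
at `β_c` satisfies `ξ_p(β_c, r) ≤ C_p r`. -/
def CL : Prop :=
  (∃ β : ℝ, 0 ≤ β ∧ κ.percolates β) ∧
    ∀ p : ℝ, 0 < p → ∃ C : ℝ, 0 < C ∧
      ∀ r : ℝ, 1 ≤ r → ∀ μ : Measure (Config d), IsPerc μ (κ.edgePCut κ.betaC r) →
        xi μ p ≤ ENNReal.ofReal (C * r)

/-- The weak correlation length condition: `β_c < ∞` and for each `ε > 0` there is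
`C` with `E_{β_c,r}|K|^p ≤ (1+ε) E_{β_c,r}|K ∩ B_{Cr}|^p` for all `r ≥ 1`, `p = 1,2,3,4`. -/
def wCL : Prop :=
  (∃ β : ℝ, 0 ≤ β ∧ κ.percolates β) ∧
    ∀ ε : ℝ, 0 < ε → ∃ C : ℝ, 0 < C ∧
      ∀ r : ℝ, 1 ≤ r → ∀ p : ℕ, p ∈ ({1, 2, 3, 4} : Finset ℕ) →
        ∀ μ : Measure (Config d), IsPerc μ (κ.edgePCut κ.betaC r) →
          (∫⁻ ω, (eCard (cluster ω (0 : V d))) ^ p ∂μ) ≤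
            ENNReal.ofReal (1 + ε) *
              ∫⁻ ω, (eCard (cluster ω (0 : V d) ∩ κ.ball (C * r))) ^ p ∂μ

/-- The `p`-th moment `E_β |K|^p` (for the full kernel). -/
noncomputable def mom (β : ℝ) (p : ℕ) : ℝ≥0∞ :=
  ⨆ μ ∈ {μ : Measure (Config d) | IsPerc μ (κ.edgeP β)}, clMom μ p

/-- The susceptibility `χ(β) = E_β |K|`. -/
noncomputable def chi (β : ℝ) : ℝ≥0∞ := κ.mom β 1

/-- `ζ(β) = E_β|K|² / E_β|K|`. -/
noncomputable def zeta (β : ℝ) : ℝ≥0∞ := κ.mom β 2 / κ.mom β 1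

/-- The tail `P_β(|K| ≥ n)` of the cluster volume. -/
noncomputable def tailP (β : ℝ) (n : ℕ) : ℝ≥0∞ :=
  ⨆ μ ∈ {μ : Measure (Config d) | IsPerc μ (κ.edgeP β)},
    μ {ω | (n : ℝ≥0∞) ≤ eCard (cluster ω (0 : V d))}

/-- The `L^p` radius of gyration `ξ_p(β)` (for the full kernel). -/
noncomputable def xiFull (β : ℝ) (p : ℝ) : ℝ≥0∞ :=
  ⨆ μ ∈ {μ : Measure (Config d) | IsPerc μ (κ.edgeP β)}, xi μ p

/-- The `p`-th moment `E_{β,r} |K|^p` for the cut-off kernel. -/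
noncomputable def momCut (β r : ℝ) (p : ℕ) : ℝ≥0∞ :=
  ⨆ μ ∈ {μ : Measure (Config d) | IsPerc μ (κ.edgePCut β r)}, clMom μ p

/-- `ξ*(β) = χ(β)^{1/α}`. -/
noncomputable def xiStar (β : ℝ) : ℝ := (κ.chi β).toReal ^ α⁻¹

/-- `ζ*(β) = ζ(β_c, ξ*(β))`, where `ζ(β,r) = E_{β,r}|K|²/E_{β,r}|K|`. -/
noncomputable def zetaStar (β : ℝ) : ℝ :=
  (κ.momCut κ.betaC (κ.xiStar β) 2 / κ.momCut κ.betaC (κ.xiStar β) 1).toReal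

/-- The edian `M_r` of the maximal cluster volume in `B_r` under `P_{β_c, r}`. -/
noncomputable def MrCut (r : ℝ) : ℕ :=
  sInf {n : ℕ | ∀ μ : Measure (Config d), IsPerc μ (κ.edgePCut κ.betaC r) →
    μ {ω | ∃ x : V d, (n : ℝ≥0∞) ≤ eCard (cluster ω x ∩ κ.ball r)} ≤
      ENNReal.ofReal (Real.exp (-1))}

/-- The edian `M_r^*` of the maximal cluster volume in `B_r` under `P_{β_c}`. -/
noncomputable def MrFull (r : ℝ) : ℕ :=
  sInf {n : ℕ | ∀ μ : Measure (Config d), IsPerc μ (κ.edgeP κ.betaC) →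
    μ {ω | ∃ x : V d, (n : ℝ≥0∞) ≤ eCard (cluster ω x ∩ κ.ball r)} ≤
      ENNReal.ofReal (Real.exp (-1))}

/-- `f(β) = |β - β_c|^{-c ± o(1)}` as `β ↑ β_c`, i.e. the critical exponent of `f`
at `β_c` is well-defined and equal to `c`. -/
def HasExp (f : ℝ → ℝ≥0∞) (c : ℝ) : Prop :=
  Tendsto (fun β => Real.log (f β).toReal / Real.log (1 / (κ.betaC - β)))
    (nhdsWithin κ.betaC (Set.Iio κ.betaC)) (nhds c)

end Kernel

end LRP

namespace LRP

open scoped NNReal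

/-! ## Product measures on edge configurations -/

section Framework

variable {ι κ : Type*}

/-- The law of a single edge with rate `t`. -/
noncomputable def bern (t : ℝ≥0) : Measure Bool :=
  ENNReal.ofReal (Real.exp (-t)) • Measure.dirac false +
    ENNReal.ofReal (1 - Real.exp (-t)) • Measure.dirac true

theorem bern_false (t : ℝ≥0) : bern t {false} = ENNReal.ofReal (Real.exp (-t)) := by
  simp [bern]

theorem bern_true (t : ℝ≥0) : bern t {true} = ENNReal.ofReal (1 - Real.exp (-t)) := by
  simp [bern]

instance (t : ℝ≥0) : IsProbabilityMeasure (bern t) := by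
  constructor
  simp only [bern, Measure.coe_add, Measure.coe_smul, Pi.add_apply, Pi.smul_apply, measure_univ,
    smul_eq_mul, mul_one]
  rw [← ENNReal.ofReal_add (Real.exp_pos _).le (by simp)]
  simp

/-- Bernoulli percolation on the index set `ι` with rates `t`. -/
noncomputable def perc (t : ι → ℝ≥0) : Measure (ι → Bool) :=
  Measure.infinitePi fun i => bern (t i)

instance (t : ι → ℝ≥0) : IsProbabilityMeasure (perc t) := by
  unfold perc; infer_instance

theorem perc_cylinder (t : ι → ℝ≥0) (s : Finset ι) (f : ι → Bool) :
    perc t {ω | ∀ e ∈ s, ω e = f e} = ∏ e ∈ s, bern (t e) {f e} := by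
  rw [← Measure.infinitePi_pi (μ := fun i => bern (t i)) (s := s) (t := fun i => {f i})
    (fun _ _ => measurableSet_singleton _)]
  congr 1

/-- The event that all edges of `s` are closed. -/
def closedOn (s : Finset ι) : Set (ι → Bool) := {ω | ∀ e ∈ s, ω e = false}

theorem measurableSet_closedOn (s : Finset ι) : MeasurableSet (closedOn s) := by
  have : closedOn s = ⋂ e ∈ s, (fun ω : ι → Bool => ω e) ⁻¹' {false} := by
    ext ω; simp [closedOn]
  rw [this]
  exact s.measurableSet_biInter fun e _ => measurable_pi_apply e (measurableSet_singleton _)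

theorem perc_closedOn (t : ι → ℝ≥0) (s : Finset ι) :
    perc t (closedOn s) = ENNReal.ofReal (Real.exp (-∑ e ∈ s, (t e : ℝ))) := by
  have := perc_cylinder t s fun _ => false
  rw [closedOn, this]
  simp only [bern_false]
  rw [← ENNReal.ofReal_prod_of_nonneg (fun _ _ => (Real.exp_pos _).le), ← Real.exp_sum,
    Finset.sum_neg_distrib]

theorem measure_ext_closedOn {μ ν : Measure (ι → Bool)} [IsProbabilityMeasure μ]
    [IsProbabilityMeasure ν] (h : ∀ s : Finset ι, μ (closedOn s) = ν (closedOn s)) : μ = ν := by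
  refine MeasureTheory.ext_of_generate_finite (Set.range closedOn) ?_ ?_ ?_ (by simp)
  · apply le_antisymm
    · refine iSup_le fun e => ?_
      rw [← measurable_iff_comap_le]
      refine @measurable_to_bool _ (MeasurableSpace.generateFrom _) _ ?_
      have : (fun ω : ι → Bool => ω e) ⁻¹' {true} = (closedOn {e})ᶜ := by
        ext ω; simp [closedOn]
      rw [this]
      exact (MeasurableSpace.measurableSet_generateFrom (Set.mem_range_self ({e} : Finset ι))).compl
    · refine MeasurableSpace.generateFrom_le ?_
      rintro _ ⟨s, rfl⟩
      exact measurableSet_closedOn s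
  · rintro _ ⟨s, rfl⟩ _ ⟨s', rfl⟩ _
    refine ⟨s ∪ s', ?_⟩
    ext ω
    simp only [closedOn, Finset.mem_union, Set.mem_ofPred_eq, Set.mem_inter_iff]
    exact ⟨fun h => ⟨fun e he => h e (Or.inl he), fun e he => h e (Or.inr he)⟩,
      fun h e he => he.elim (h.1 e) (h.2 e)⟩
  · rintro _ ⟨s, rfl⟩
    exact h s

/-- An edge `j` of the new configuration is open iff some edge of `φ j` is. -/
noncomputable def merge (φ : κ → Finset ι) (ω : ι → Bool) : κ → Bool :=
  fun j => decide (∃ i ∈ φ j, ω i = true)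

theorem merge_closedOn (φ : κ → Finset ι) (s : Finset κ) :
    merge φ ⁻¹' closedOn s = closedOn (s.biUnion φ) := by
  ext ω
  simp only [closedOn, merge, Set.mem_preimage, Set.mem_ofPred_eq, Finset.mem_biUnion,
    decide_eq_false_iff_not, not_exists, not_and, Bool.not_eq_true]
  exact ⟨fun h e ⟨j, hj, he⟩ => h j hj e he, fun h j hj e he => h e ⟨j, hj, he⟩⟩

theorem measurable_merge (φ : κ → Finset ι) : Measurable (merge φ) := by
  refine measurable_pi_iff.2 fun j => ?_
  refine measurable_to_bool ?_
  have : (fun ω : ι → Bool => merge φ ω j) ⁻¹' {true} = (closedOn (φ j))ᶜ := by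
    ext ω; simp [closedOn, merge]
  rw [this]
  exact (measurableSet_closedOn _).compl

theorem map_merge_perc (φ : κ → Finset ι) (t : ι → ℝ≥0) (u : κ → ℝ≥0)
    (hφ : ∀ j k, j ≠ k → Disjoint (φ j) (φ k)) (hu : ∀ j, u j = ∑ i ∈ φ j, t i) :
    (perc t).map (merge φ) = perc u := by
  have : IsProbabilityMeasure ((perc t).map (merge φ)) :=
    Measure.isProbabilityMeasure_map (measurable_merge φ).aemeasurable
  refine measure_ext_closedOn fun s => ?_
  rw [Measure.map_apply (measurable_merge φ) (measurableSet_closedOn s), merge_closedOn,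
    perc_closedOn, perc_closedOn, Finset.sum_biUnion fun j _ k _ h => hφ j k h]
  simp [hu]

/-- Restriction of a configuration to a set of edges. -/
noncomputable def restr (s : Set ι) (ω : ι → Bool) : ι → Bool :=
  fun e => decide (e ∈ s ∧ ω e = true)

/-- Restriction of rates to a set of edges. -/
noncomputable def cutRate (s : Set ι) (t : ι → ℝ≥0) : ι → ℝ≥0 := fun e => if e ∈ s then t e else 0

theorem restr_apply (s : Set ι) (ω : ι → Bool) (e : ι) :
    restr s ω e = true ↔ e ∈ s ∧ ω e = true := by simp [restr]

theorem restr_eq_merge (s : Set ι) : restr s = merge (fun e => if e ∈ s then {e} else ∅) := by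
  ext ω e
  by_cases h : e ∈ s <;> simp [restr, merge, h]

theorem measurable_restr (s : Set ι) : Measurable (restr s) := by
  rw [restr_eq_merge]; exact measurable_merge _

theorem map_restr_perc (s : Set ι) (t : ι → ℝ≥0) :
    (perc t).map (restr s) = perc (cutRate s t) := by
  rw [restr_eq_merge]
  refine map_merge_perc _ _ _ (fun j k hjk => ?_) fun j => ?_
  · by_cases h : j ∈ s <;> by_cases h' : k ∈ s <;> simp [h, h', hjk]
  · by_cases h : j ∈ s <;> simp [cutRate, h]

/-- The union of the two layers of a configuration. -/
def joinL (ω : ι ⊕ ι → Bool) : ι → Bool := fun e => ω (Sum.inl e) || ω (Sum.inr e)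

/-- The first layer of a configuration. -/
def fstL (ω : ι ⊕ κ → Bool) : ι → Bool := fun e => ω (Sum.inl e)

theorem joinL_eq_merge : (joinL : (ι ⊕ ι → Bool) → _) =
    merge (fun e => ({Sum.inl e, Sum.inr e} : Finset (ι ⊕ ι))) := by
  ext ω e
  simp [joinL, merge]

theorem fstL_eq_merge : (fstL : (ι ⊕ κ → Bool) → _) =
    merge (fun e => ({Sum.inl e} : Finset (ι ⊕ κ))) := by
  ext ω e
  simp [fstL, merge]

theorem measurable_joinL : Measurable (joinL : (ι ⊕ ι → Bool) → _) := by
  rw [joinL_eq_merge]; exact measurable_merge _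

theorem measurable_fstL : Measurable (fstL : (ι ⊕ κ → Bool) → _) := by
  rw [fstL_eq_merge]; exact measurable_merge _

theorem map_joinL (t u : ι → ℝ≥0) : (perc (Sum.elim t u)).map joinL = perc (t + u) := by
  rw [joinL_eq_merge]
  refine map_merge_perc _ _ _ (fun j k h => ?_) fun j => ?_
  · simp [h.symm]
  · simp

theorem map_fstL (t : ι → ℝ≥0) (u : κ → ℝ≥0) : (perc (Sum.elim t u)).map fstL = perc t := by
  rw [fstL_eq_merge]
  refine map_merge_perc _ _ _ (fun j k h => ?_) fun j => ?_
  · simp [h]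
  · simp

theorem measurable_sumElim : Measurable
    (fun p : (ι → Bool) × (κ → Bool) => (Sum.elim p.1 p.2 : ι ⊕ κ → Bool)) := by
  refine measurable_pi_iff.2 fun j => ?_
  rcases j with j | j
  · exact (measurable_pi_apply j).comp measurable_fst
  · exact (measurable_pi_apply j).comp measurable_snd

theorem prod_perc (t : ι → ℝ≥0) (u : κ → ℝ≥0) :
    ((perc t).prod (perc u)).map (fun p => (Sum.elim p.1 p.2 : ι ⊕ κ → Bool)) =
      perc (Sum.elim t u) := by
  have : IsProbabilityMeasure (((perc t).prod (perc u)).map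
      (fun p => (Sum.elim p.1 p.2 : ι ⊕ κ → Bool))) :=
    Measure.isProbabilityMeasure_map measurable_sumElim.aemeasurable
  refine measure_ext_closedOn fun s => ?_
  rw [Measure.map_apply measurable_sumElim (measurableSet_closedOn s)]
  have h : (fun p : (ι → Bool) × (κ → Bool) => (Sum.elim p.1 p.2 : ι ⊕ κ → Bool)) ⁻¹' closedOn s =
      closedOn s.toLeft ×ˢ closedOn s.toRight := by
    ext p
    simp [closedOn]
  rw [h, Measure.prod_prod, perc_closedOn, perc_closedOn, perc_closedOn,
    ← ENNReal.ofReal_mul (Real.exp_pos _).le, ← Real.exp_add, ← neg_add]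
  congr 4
  conv_rhs => rw [← Finset.toLeft_disjSum_toRight (u := s), Finset.sum_disjSum]
  simp

theorem measurable_sup : Measurable (fun p : (ι → Bool) × (ι → Bool) => p.1 ⊔ p.2) := by
  have : (fun p : (ι → Bool) × (ι → Bool) => p.1 ⊔ p.2) =
      joinL ∘ (fun p => (Sum.elim p.1 p.2 : ι ⊕ ι → Bool)) := by
    ext p e; simp [joinL]
  rw [this]
  exact measurable_joinL.comp measurable_sumElim

theorem map_sup_perc (t u : ι → ℝ≥0) :
    ((perc t).prod (perc u)).map (fun p => p.1 ⊔ p.2) = perc (t + u) := by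
  have : (fun p : (ι → Bool) × (ι → Bool) => p.1 ⊔ p.2) =
      joinL ∘ (fun p => (Sum.elim p.1 p.2 : ι ⊕ ι → Bool)) := by
    ext p e; simp [joinL]
  rw [this, ← Measure.map_map measurable_joinL measurable_sumElim, prod_perc, map_joinL]

theorem perc_add_apply (t u : ι → ℝ≥0) {A : Set (ι → Bool)} (hA : MeasurableSet A) :
    perc (t + u) A = ∫⁻ ω, perc u {η | ω ⊔ η ∈ A} ∂perc t := by
  rw [← map_sup_perc, Measure.map_apply measurable_sup hA,
    Measure.prod_apply (measurable_sup hA)]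
  rfl

theorem perc_open_singleton (t : ι → ℝ≥0) (e : ι) :
    perc t {ω | ω e = true} = ENNReal.ofReal (1 - Real.exp (-t e)) := by
  have := perc_cylinder t {e} fun _ => true
  simpa [bern_true] using this

theorem perc_open_singleton_le (t : ι → ℝ≥0) (e : ι) : perc t {ω | ω e = true} ≤ t e := by
  rw [perc_open_singleton]
  refine (ENNReal.ofReal_le_ofReal (q := t e) ?_).trans (by simp)
  have := Real.add_one_le_exp (-(t e : ℝ))
  linarith

theorem perc_zero : perc (0 : ι → ℝ≥0) = Measure.dirac (fun _ => false) := by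
  refine measure_ext_closedOn fun s => ?_
  rw [perc_closedOn, Measure.dirac_apply' _ (measurableSet_closedOn s)]
  simp [closedOn]

/-- The configuration with a single open edge. -/
noncomputable def single (e : ι) : ι → Bool := fun i => decide (i = e)

theorem perc_single (e : ι) (c : ℝ≥0) : perc (Pi.single e c) =
    ENNReal.ofReal (Real.exp (-c)) • Measure.dirac (fun _ => false) +
      ENNReal.ofReal (1 - Real.exp (-c)) • Measure.dirac (single e) := by
  have : IsProbabilityMeasure (ENNReal.ofReal (Real.exp (-c)) •
      Measure.dirac (fun _ : ι => false) +
      ENNReal.ofReal (1 - Real.exp (-c)) • Measure.dirac (single e)) := by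
    constructor
    simp only [Measure.coe_add, Measure.coe_smul, Pi.add_apply, Pi.smul_apply, measure_univ,
      smul_eq_mul, mul_one]
    rw [← ENNReal.ofReal_add (Real.exp_pos _).le (by simp)]
    simp
  refine measure_ext_closedOn fun s => ?_
  rw [perc_closedOn]
  simp only [Measure.coe_add, Measure.coe_smul, Pi.add_apply, Pi.smul_apply, smul_eq_mul,
    Measure.dirac_apply' _ (measurableSet_closedOn s)]
  have h1 : (fun _ : ι => false) ∈ closedOn s := by simp [closedOn]
  have h3 : ∑ i ∈ s, ((Pi.single e c : ι → ℝ≥0) i : ℝ) = if e ∈ s then (c : ℝ) else 0 := by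
    rw [← NNReal.coe_sum]; simp only [Pi.single_apply, Finset.sum_ite_eq']; split_ifs <;> simp
  by_cases h : e ∈ s
  · have h2 : single e ∉ closedOn s := by
      intro hh; simpa [single] using hh e h
    simp [h1, h2, h]
  · have h2 : single e ∈ closedOn s := by
      intro i hi
      simp only [single, decide_eq_false_iff_not]
      rintro rfl; exact h hi
    simp only [h3, h1, h2, h, if_false, Set.indicator_of_mem, Pi.one_apply, mul_one]
    rw [← ENNReal.ofReal_add (Real.exp_pos _).le (by simp)]
    simp

theorem perc_add_single (t : ι → ℝ≥0) (e : ι) (c : ℝ≥0) {A : Set (ι → Bool)}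
    (hA : MeasurableSet A) :
    perc (t + Pi.single e c) A = ENNReal.ofReal (Real.exp (-c)) * perc t A +
      ENNReal.ofReal (1 - Real.exp (-c)) * perc t {ω | ω ⊔ single e ∈ A} := by
  have hm : ∀ ω : ι → Bool, MeasurableSet {η | ω ⊔ η ∈ A} := fun ω =>
    (measurable_sup.comp (measurable_prodMk_left (x := ω))) hA
  have hm' : MeasurableSet {ω | ω ⊔ single e ∈ A} :=
    (measurable_sup.comp (measurable_prodMk_right (y := single e))) hA
  have hb : ∀ ω : ι → Bool, ω ⊔ (fun _ => false) = ω := fun ω => by ext i; simp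
  rw [perc_add_apply _ _ hA, perc_single]
  simp only [Measure.coe_add, Measure.coe_smul, Pi.add_apply, Pi.smul_apply, smul_eq_mul]
  rw [lintegral_add_left, lintegral_const_mul, lintegral_const_mul]
  · congr 2
    · rw [← lintegral_indicator_one hA]
      refine lintegral_congr fun ω => ?_
      rw [Measure.dirac_apply' _ (hm ω)]
      simp [Set.indicator, hb]
    · rw [← lintegral_indicator_one hm']
      refine lintegral_congr fun ω => ?_
      rw [Measure.dirac_apply' _ (hm ω)]
      simp [Set.indicator]
  · have : (fun ω : ι → Bool => Measure.dirac (single e) {η | ω ⊔ η ∈ A}) =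
        Set.indicator {ω | ω ⊔ single e ∈ A} 1 := by
      ext ω
      rw [Measure.dirac_apply' _ (hm ω)]
      simp [Set.indicator]
    rw [this]
    exact measurable_one.indicator hm'
  · have : (fun ω : ι → Bool => Measure.dirac (fun _ : ι => false) {η | ω ⊔ η ∈ A}) =
        Set.indicator A 1 := by
      ext ω
      rw [Measure.dirac_apply' _ (hm ω)]
      simp [Set.indicator, hb]
    rw [this]
    exact measurable_one.indicator hA
  · refine Measurable.const_mul ?_ _
    have : (fun ω : ι → Bool => Measure.dirac (fun _ : ι => false) {η | ω ⊔ η ∈ A}) =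
        Set.indicator A 1 := by
      ext ω
      rw [Measure.dirac_apply' _ (hm ω)]
      simp [Set.indicator, hb]
    rw [this]
    exact measurable_one.indicator hA

/-! ## Increasing events determined by finitely many open edges -/

/-- Increasing events all of whose members have a finite witness. -/
structure Inc (A : Set (ι → Bool)) : Prop where
  up : IsUpperSet A
  fin : ∀ ω ∈ A, ∃ s : Finset ι, restr (s : Set ι) ω ∈ A

theorem restr_le (s : Set ι) (ω : ι → Bool) : restr s ω ≤ ω := by
  intro e
  rw [Bool.le_iff_imp, restr_apply]
  exact And.right

theorem restr_mono {s s' : Set ι} (h : s ⊆ s') (ω : ι → Bool) : restr s ω ≤ restr s' ω := by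
  intro e
  rw [Bool.le_iff_imp, restr_apply, restr_apply]
  exact fun h' => ⟨h h'.1, h'.2⟩

theorem restr_mono_right (s : Set ι) {ω ω' : ι → Bool} (h : ω ≤ ω') : restr s ω ≤ restr s ω' := by
  intro e
  rw [Bool.le_iff_imp, restr_apply, restr_apply]
  exact fun h' => ⟨h'.1, Bool.le_iff_imp.1 (h e) h'.2⟩

theorem Inc.measurableSet [Countable ι] {A : Set (ι → Bool)} (hA : Inc A) : MeasurableSet A := by
  have : A = ⋃ s ∈ {s : Finset ι | (fun e => decide (e ∈ s)) ∈ A},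
      ⋂ e ∈ s, (fun ω : ι → Bool => ω e) ⁻¹' {true} := by
    ext ω
    simp only [Set.mem_ofPred_eq, Set.mem_iUnion, Set.mem_iInter, Set.mem_preimage,
      Set.mem_singleton_iff, exists_prop]
    constructor
    · intro h
      obtain ⟨s, hs⟩ := hA.fin ω h
      refine ⟨s.filter fun e => ω e = true, ?_, by simp⟩
      refine hA.up ?_ hs
      intro e
      rw [Bool.le_iff_imp, restr_apply]
      simp
    · rintro ⟨s, hs, h⟩
      refine hA.up ?_ hs
      intro e
      rw [Bool.le_iff_imp]
      simpa using h e
  rw [this]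
  refine MeasurableSet.biUnion (Set.to_countable _) fun s _ => s.measurableSet_biInter fun e _ => ?_
  exact measurable_pi_apply e (measurableSet_singleton _)

theorem Inc.perc_eq_iSup [Countable ι] {A : Set (ι → Bool)} (hA : Inc A) (t : ι → ℝ≥0) :
    perc t A = ⨆ s : Finset ι, perc (cutRate (s : Set ι) t) A := by
  have h : A = ⋃ s : Finset ι, restr (s : Set ι) ⁻¹' A := by
    ext ω
    simp only [Set.mem_iUnion, Set.mem_preimage]
    exact ⟨hA.fin ω, fun ⟨s, hs⟩ => hA.up (restr_le _ _) hs⟩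
  conv_lhs => rw [h]
  rw [Directed.measure_iUnion]
  · refine iSup_congr fun s => ?_
    rw [← map_restr_perc, Measure.map_apply (measurable_restr _) hA.measurableSet]
  · intro s s'
    refine ⟨s ∪ s', fun ω h => hA.up (restr_mono ?_ ω) h, fun ω h => hA.up (restr_mono ?_ ω) h⟩ <;>
      simp

theorem Inc.perc_mono [Countable ι] {A : Set (ι → Bool)} (hA : Inc A) {t u : ι → ℝ≥0}
    (h : t ≤ u) : perc t A ≤ perc u A := by
  obtain ⟨v, rfl⟩ := exists_add_of_le h
  rw [← map_joinL, ← map_fstL t v, Measure.map_apply measurable_fstL hA.measurableSet,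
    Measure.map_apply measurable_joinL hA.measurableSet]
  refine measure_mono fun ω hω => hA.up ?_ hω
  intro e
  rw [Bool.le_iff_imp]
  intro h
  simp only [joinL, Bool.or_eq_true]
  exact Or.inl h

theorem Inc.inter {A B : Set (ι → Bool)} (hA : Inc A) (hB : Inc B) : Inc (A ∩ B) := by
  refine ⟨hA.up.inter hB.up, fun ω h => ?_⟩
  obtain ⟨s, hs⟩ := hA.fin ω h.1
  obtain ⟨s', hs'⟩ := hB.fin ω h.2
  exact ⟨s ∪ s', hA.up (restr_mono (by simp) _) hs, hB.up (restr_mono (by simp) _) hs'⟩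

theorem Inc.iUnion {β : Sort*} {A : β → Set (ι → Bool)} (hA : ∀ i, Inc (A i)) :
    Inc (⋃ i, A i) := by
  refine ⟨isUpperSet_iUnion fun i => (hA i).up, fun ω h => ?_⟩
  obtain ⟨i, hi⟩ := Set.mem_iUnion.1 h
  obtain ⟨s, hs⟩ := (hA i).fin ω hi
  exact ⟨s, Set.mem_iUnion.2 ⟨i, hs⟩⟩

theorem Inc.iInter_finset {β : Type*} (s : Finset β) {A : β → Set (ι → Bool)}
    (hA : ∀ i, Inc (A i)) : Inc (⋂ i ∈ s, A i) := by
  induction s using Finset.induction_on with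
  | empty => exact ⟨by simpa using isUpperSet_univ, fun ω _ => ⟨∅, by simp⟩⟩
  | insert a s _ ih => rw [Finset.set_biInter_insert]; exact (hA a).inter ih

theorem Inc.preimage_merge {A : Set (κ → Bool)} (hA : Inc A) (φ : κ → Finset ι) :
    Inc (merge φ ⁻¹' A) := by
  have mono : ∀ {ω ω' : ι → Bool}, ω ≤ ω' → merge φ ω ≤ merge φ ω' := by
    intro ω ω' h j
    rw [Bool.le_iff_imp]
    simp only [merge, decide_eq_true_eq]
    exact fun ⟨i, hi, h'⟩ => ⟨i, hi, Bool.le_iff_imp.1 (h i) h'⟩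
  refine ⟨fun ω ω' h hω => hA.up (mono h) hω, fun ω h => ?_⟩
  obtain ⟨s, hs⟩ := hA.fin _ h
  refine ⟨s.biUnion φ, hA.up ?_ hs⟩
  intro j
  rw [Bool.le_iff_imp, restr_apply]
  simp only [merge, decide_eq_true_eq, restr_apply, Finset.coe_biUnion, Set.mem_iUnion,
    Finset.mem_coe]
  exact fun ⟨hj, i, hi, h'⟩ => ⟨i, hi, ⟨j, hj, hi⟩, h'⟩

theorem Inc.open_edge (e : ι) : Inc {ω : ι → Bool | ω e = true} := by
  refine ⟨fun ω ω' h hω => Bool.le_iff_imp.1 (h e) hω, fun ω h => ⟨{e}, ?_⟩⟩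
  simpa [restr_apply] using h

theorem Inc.sup_single {A : Set (ι → Bool)} (hA : Inc A) (e : ι) :
    Inc {ω : ι → Bool | ω ⊔ single e ∈ A} := by
  refine ⟨fun ω ω' h hω => hA.up (sup_le_sup_right h _) hω, fun ω h => ?_⟩
  obtain ⟨s, hs⟩ := hA.fin _ h
  refine ⟨s, hA.up ?_ hs⟩
  intro i
  rw [Bool.le_iff_imp, restr_apply]
  simp only [Pi.sup_apply, Bool.max_eq_or, Bool.or_eq_true, restr_apply]
  tauto

/-- Induction over the finite set of edges of positive rate. -/
theorem perc_induction [Countable ι] {C : (ι → ℝ≥0) → Prop} (h0 : C 0)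
    (h1 : ∀ t e c, C t → C (t + Pi.single e c)) (t : ι → ℝ≥0) (s : Finset ι) :
    C (cutRate (s : Set ι) t) := by
  induction s using Finset.induction_on with
  | empty => convert h0; ext; simp [cutRate]
  | insert a s ha ih =>
    convert h1 _ a (t a) ih using 1
    ext i
    by_cases h : i = a
    · subst h; simp [cutRate, ha]
    · simp [cutRate, h]

/-- Disjoint occurrence. -/
def disj (A B : Set (ι → Bool)) : Set (ι → Bool) :=
  {ω | ∃ s : Set ι, restr s ω ∈ A ∧ restr sᶜ ω ∈ B}

theorem disj_mono {A A' B B' : Set (ι → Bool)} (h : A ⊆ A') (h' : B ⊆ B') :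
    disj A B ⊆ disj A' B' := fun _ ⟨s, hs, hs'⟩ => ⟨s, h hs, h' hs'⟩

theorem mem_disj {A B : Set (ι → Bool)} (hB : IsUpperSet B) {ω : ι → Bool}
    {s s' : Set ι} (h : Disjoint s s') (hs : restr s ω ∈ A) (hs' : restr s' ω ∈ B) :
    ω ∈ disj A B :=
  ⟨s, hs, hB (restr_mono h.subset_compl_left ω) hs'⟩

theorem Inc.disj {A B : Set (ι → Bool)} (hA : Inc A) (hB : Inc B) : Inc (disj A B) := by
  refine ⟨fun ω ω' h ⟨s, hs, hs'⟩ => ⟨s, hA.up (restr_mono_right s h) hs,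
    hB.up (restr_mono_right _ h) hs'⟩, ?_⟩
  rintro ω ⟨s, hs, hs'⟩
  obtain ⟨u, hu⟩ := hA.fin _ hs
  obtain ⟨v, hv⟩ := hB.fin _ hs'
  refine ⟨u ∪ v, s, hA.up ?_ hu, hB.up ?_ hv⟩
  all_goals
    intro i
    rw [Bool.le_iff_imp]
    simp only [restr_apply, Finset.coe_union, Set.mem_union]
    tauto

theorem disj_sup_single {A B : Set (ι → Bool)} (hA : IsUpperSet A) (hB : IsUpperSet B) (e : ι) :
    {ω | ω ⊔ single e ∈ disj A B} ⊆
      disj {ω | ω ⊔ single e ∈ A} B ∪ disj A {ω | ω ⊔ single e ∈ B} := by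
  rintro ω ⟨s, hs, hs'⟩
  by_cases h : e ∈ s
  · refine Or.inl ⟨s, hA ?_ hs, hB ?_ hs'⟩
    all_goals
      intro i
      rw [Bool.le_iff_imp]
      simp only [restr_apply, Pi.sup_apply, Bool.max_eq_or, Bool.or_eq_true, single,
        decide_eq_true_eq, Set.mem_compl_iff]
    · tauto
    · rintro ⟨hi, h' | rfl⟩
      · exact ⟨hi, h'⟩
      · exact absurd h hi
  · refine Or.inr ⟨s, hA ?_ hs, hB ?_ hs'⟩
    all_goals
      intro i
      rw [Bool.le_iff_imp]
      simp only [restr_apply, Pi.sup_apply, Bool.max_eq_or, Bool.or_eq_true, single,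
        decide_eq_true_eq, Set.mem_compl_iff]
    · rintro ⟨hi, h' | rfl⟩
      · exact ⟨hi, h'⟩
      · exact absurd hi h
    · tauto

theorem real_add_single [Countable ι] (t : ι → ℝ≥0) (e : ι) (c : ℝ≥0) {A : Set (ι → Bool)}
    (hA : Inc A) :
    (perc (t + Pi.single e c)).real A = Real.exp (-c) * (perc t).real A +
      (1 - Real.exp (-c)) * (perc t).real {ω | ω ⊔ single e ∈ A} := by
  have h1 : Real.exp (-(c : ℝ)) ≤ 1 := by simp
  rw [measureReal_def, perc_add_single _ _ _ hA.measurableSet,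
    ENNReal.toReal_add (by finiteness) (by finiteness), ENNReal.toReal_mul, ENNReal.toReal_mul,
    ENNReal.toReal_ofReal (Real.exp_pos _).le, ENNReal.toReal_ofReal (by linarith)]
  rfl

theorem bk_aux [Countable ι] (t : ι → ℝ≥0) (s : Finset ι) :
    ∀ A B : Set (ι → Bool), Inc A → Inc B →
      (perc (cutRate (s : Set ι) t)).real (disj A B) ≤
        (perc (cutRate (s : Set ι) t)).real A * (perc (cutRate (s : Set ι) t)).real B := by
  refine perc_induction (C := fun t => ∀ A B : Set (ι → Bool), Inc A → Inc B →
      (perc t).real (disj A B) ≤ (perc t).real A * (perc t).real B) ?_ ?_ t s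
  · intro A B hA hB
    simp only [measureReal_def, perc_zero]
    rw [Measure.dirac_apply' _ hA.measurableSet, Measure.dirac_apply' _ hB.measurableSet,
      Measure.dirac_apply' _ (hA.disj hB).measurableSet]
    have hb : ∀ s : Set ι, restr s (fun _ => false) = fun _ => false := by
      intro s; ext i; simp [restr]
    by_cases h : (fun _ => false) ∈ disj A B
    · obtain ⟨s, h1, h2⟩ := id h
      rw [hb] at h1 h2
      simp [h, h1, h2]
    · simp only [h, not_false_eq_true, Set.indicator_of_notMem, ENNReal.toReal_zero]
      positivity
  · intro t e c ih A B hA hB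
    rw [real_add_single _ _ _ hA, real_add_single _ _ _ hB, real_add_single _ _ _ (hA.disj hB)]
    set p := Real.exp (-(c : ℝ)) with hp
    have hp0 : 0 ≤ p := (Real.exp_pos _).le
    have hp1 : p ≤ 1 := by simp [hp]
    set A1 := {ω | ω ⊔ single e ∈ A} with hA1
    set B1 := {ω | ω ⊔ single e ∈ B} with hB1
    have iA1 : Inc A1 := hA.sup_single e
    have iB1 : Inc B1 := hB.sup_single e
    have sA : A ⊆ A1 := fun ω h => hA.up le_sup_left h
    have sB : B ⊆ B1 := fun ω h => hB.up le_sup_left h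
    have h00 := ih A B hA hB
    have h01 := ih A B1 hA iB1
    have h10 := ih A1 B iA1 hB
    have h11 := ih A1 B1 iA1 iB1
    have hU := measureReal_mono (μ := perc t) (disj_sup_single hA.up hB.up e)
    have hU11 := measureReal_mono (μ := perc t)
      (Set.union_subset (disj_mono (le_refl A1) sB) (disj_mono sA (le_refl B1)))
    have hI := measureReal_mono (μ := perc t)
      (Set.subset_inter (disj_mono sA (le_refl B)) (disj_mono (le_refl A) sB))
    have hUI := measureReal_union_add_inter (μ := perc t) (s := disj A1 B)
      (hA.disj iB1).measurableSet
    set U := (perc t).real (disj A1 B ∪ disj A B1)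
    set a0 := (perc t).real A
    set b0 := (perc t).real B
    set a1 := (perc t).real A1
    set b1 := (perc t).real B1
    set W := (perc t).real {ω | ω ⊔ single e ∈ disj A B}
    have q0 : 0 ≤ 1 - p := by linarith
    have e1 : p * p * (perc t).real (disj A B) ≤ p * p * (a0 * b0) :=
      mul_le_mul_of_nonneg_left h00 (by positivity)
    have e2 : p * (1 - p) * ((perc t).real (disj A B) + U) ≤ p * (1 - p) * (a0 * b1 + a1 * b0) :=
      mul_le_mul_of_nonneg_left (by linarith) (by positivity)
    have e3 : (1 - p) * (1 - p) * U ≤ (1 - p) * (1 - p) * (a1 * b1) :=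
      mul_le_mul_of_nonneg_left (by linarith) (by positivity)
    have e4 : (1 - p) * W ≤ (1 - p) * U := mul_le_mul_of_nonneg_left hU q0
    nlinarith [e1, e2, e3, e4]

/-- The van den Berg-Kesten inequality. -/
theorem perc_disj_le [Countable ι] (t : ι → ℝ≥0) {A B : Set (ι → Bool)} (hA : Inc A)
    (hB : Inc B) : perc t (disj A B) ≤ perc t A * perc t B := by
  rw [(hA.disj hB).perc_eq_iSup]
  refine iSup_le fun s => ?_
  have hc : cutRate (s : Set ι) t ≤ t := by
    intro e; simp only [cutRate]; split_ifs <;> simp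
  have h := bk_aux t s A B hA hB
  simp only [measureReal_def] at h
  rw [← ENNReal.toReal_mul, ENNReal.toReal_le_toReal (by finiteness) (by finiteness)] at h
  exact h.trans (mul_le_mul' (hA.perc_mono hc) (hB.perc_mono hc))

theorem harris_aux [Countable ι] (t : ι → ℝ≥0) (s : Finset ι) :
    ∀ A B : Set (ι → Bool), Inc A → Inc B →
      (perc (cutRate (s : Set ι) t)).real A * (perc (cutRate (s : Set ι) t)).real B ≤
        (perc (cutRate (s : Set ι) t)).real (A ∩ B) := by
  refine perc_induction (C := fun t => ∀ A B : Set (ι → Bool), Inc A → Inc B →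
      (perc t).real A * (perc t).real B ≤ (perc t).real (A ∩ B)) ?_ ?_ t s
  · intro A B hA hB
    simp only [measureReal_def, perc_zero]
    rw [Measure.dirac_apply' _ hA.measurableSet, Measure.dirac_apply' _ hB.measurableSet,
      Measure.dirac_apply' _ (hA.inter hB).measurableSet]
    by_cases h : (fun _ => false) ∈ A <;> by_cases h' : (fun _ => false) ∈ B <;> simp [h, h']
  · intro t e c ih A B hA hB
    rw [real_add_single _ _ _ hA, real_add_single _ _ _ hB, real_add_single _ _ _ (hA.inter hB)]
    set p := Real.exp (-(c : ℝ)) with hp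
    have hp0 : 0 ≤ p := (Real.exp_pos _).le
    have hp1 : p ≤ 1 := by simp [hp]
    have h00 := ih A B hA hB
    have h11 := ih _ _ (hA.sup_single e) (hB.sup_single e)
    have sA := measureReal_mono (μ := perc t)
      (show A ⊆ {ω | ω ⊔ single e ∈ A} from fun ω h => hA.up le_sup_left h)
    have sB := measureReal_mono (μ := perc t)
      (show B ⊆ {ω | ω ⊔ single e ∈ B} from fun ω h => hB.up le_sup_left h)
    change _ ≤ p * _ + (1 - p) * (perc t).real ({ω | ω ⊔ single e ∈ A} ∩ {ω | ω ⊔ single e ∈ B})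
    set a0 := (perc t).real A
    set b0 := (perc t).real B
    set a1 := (perc t).real {ω | ω ⊔ single e ∈ A}
    set b1 := (perc t).real {ω | ω ⊔ single e ∈ B}
    have q0 : 0 ≤ 1 - p := by linarith
    have e1 := mul_le_mul_of_nonneg_left h00 hp0
    have e2 := mul_le_mul_of_nonneg_left h11 q0
    have e3 := mul_nonneg (mul_nonneg hp0 q0) (mul_nonneg (sub_nonneg.2 sA) (sub_nonneg.2 sB))
    nlinarith [e1, e2, e3]

/-- The Harris inequality. -/
theorem perc_mul_le_inter [Countable ι] (t : ι → ℝ≥0) {A B : Set (ι → Bool)} (hA : Inc A)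
    (hB : Inc B) : perc t A * perc t B ≤ perc t (A ∩ B) := by
  rw [hA.perc_eq_iSup, hB.perc_eq_iSup, ENNReal.iSup_mul]
  refine iSup_le fun s => ?_
  rw [ENNReal.mul_iSup]
  refine iSup_le fun s' => ?_
  have hc : ∀ s : Set ι, cutRate s t ≤ t := by
    intro s e; simp only [cutRate]; split_ifs <;> simp
  have hcc : ∀ {s s' : Set ι}, s ⊆ s' → cutRate s t ≤ cutRate s' t := by
    intro s s' h e
    simp only [cutRate]
    split_ifs with h1 h2
    · exact le_refl _
    · exact absurd (h h1) h2
    · simp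
    · exact le_refl _
  have h := harris_aux t (s ∪ s') A B hA hB
  simp only [measureReal_def] at h
  rw [← ENNReal.toReal_mul, ENNReal.toReal_le_toReal (by finiteness) (by finiteness)] at h
  refine le_trans (mul_le_mul' (hA.perc_mono (hcc ?_)) (hB.perc_mono (hcc ?_)))
    (h.trans ((hA.inter hB).perc_mono (hc _))) <;> simp

end Framework

end LRP

namespace LRP

open scoped NNReal

/-! ## Connectivity -/

section Connectivity

variable {W : Type*}

theorem edgeProb_rate (t : ℝ≥0) (b : Bool) :
    ENNReal.ofReal (if b then edgeProb t else 1 - edgeProb t) = bern t {b} := by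
  cases b
  · simp [edgeProb, bern_false]
  · simp [edgeProb, bern_true]

theorem isPerc_perc (t : Sym2 W → ℝ≥0) : IsPerc (perc t) (fun e => edgeProb (t e)) := by
  refine ⟨inferInstance, fun s f => ?_⟩
  rw [perc_cylinder]
  exact Finset.prod_congr rfl fun e _ => (edgeProb_rate _ _).symm

theorem IsPerc.eq_perc {t : Sym2 W → ℝ≥0} {μ : Measure (Sym2 W → Bool)}
    (h : IsPerc μ (fun e => edgeProb (t e))) : μ = perc t := by
  have := h.1
  refine measure_ext_closedOn fun s => ?_
  have h1 := h.2 s (fun _ => false)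
  have h2 := (isPerc_perc t).2 s (fun _ => false)
  exact h1.trans h2.symm

theorem conn_refl (ω : Sym2 W → Bool) (x : W) : Conn ω x x := Relation.ReflTransGen.refl

theorem Conn.trans {ω : Sym2 W → Bool} {x y z : W} (h : Conn ω x y) (h' : Conn ω y z) :
    Conn ω x z := Relation.ReflTransGen.trans h h'

theorem Conn.symm {ω : Sym2 W → Bool} {x y : W} (h : Conn ω x y) : Conn ω y x := by
  induction h with
  | refl => exact Relation.ReflTransGen.refl
  | tail _ hbc ih => exact Relation.ReflTransGen.head (by rwa [Sym2.eq_swap]) ih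

theorem conn_comm {ω : Sym2 W → Bool} {x y : W} : Conn ω x y ↔ Conn ω y x :=
  ⟨Conn.symm, Conn.symm⟩

theorem conn_of_open {ω : Sym2 W → Bool} {x y : W} (h : ω s(x, y) = true) : Conn ω x y :=
  Relation.ReflTransGen.single h

theorem Conn.mono {ω ω' : Sym2 W → Bool} (hω : ω ≤ ω') {x y : W} (h : Conn ω x y) :
    Conn ω' x y :=
  Relation.ReflTransGen.mono (fun a b hab => Bool.le_iff_imp.1 (hω s(a, b)) hab) _ _ h

theorem inc_conn (x y : W) : Inc {ω : Sym2 W → Bool | Conn ω x y} := by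
  refine ⟨fun ω ω' h hω => Conn.mono h hω, fun ω h => ?_⟩
  change Conn ω x y at h
  induction h with
  | refl => exact ⟨∅, conn_refl _ _⟩
  | @tail b c _ hbc ih =>
    obtain ⟨s, hs⟩ := ih
    refine ⟨insert s(b, c) s, ?_⟩
    refine Conn.trans (y := b) (Conn.mono (restr_mono (by simp) _) hs) (conn_of_open ?_)
    simp [restr_apply, hbc]

/-- The edges with both endpoints in `S`. -/
def inS (S : Set W) : Set (Sym2 W) := {e | ∀ v ∈ e, v ∈ S}

theorem mk_mem_inS {S : Set W} {a b : W} : s(a, b) ∈ inS S ↔ a ∈ S ∧ b ∈ S := by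
  simp [inS]

theorem disjoint_inS {S T : Set W} (h : Disjoint S T) : Disjoint (inS S) (inS T) := by
  rw [Set.disjoint_left]
  intro e h1 h2
  induction e with
  | h a b => exact Set.disjoint_left.1 h (mk_mem_inS.1 h1).1 (mk_mem_inS.1 h2).1

theorem conn_restr_cluster {ω : Sym2 W → Bool} {x y : W} (h : Conn ω x y) :
    Conn (restr (inS (cluster ω x)) ω) x y := by
  induction h with
  | refl => exact conn_refl _ _
  | @tail b c hb hbc ih =>
    refine ih.trans (conn_of_open ?_)
    rw [restr_apply, mk_mem_inS]
    exact ⟨⟨hb, hb.tail hbc⟩, hbc⟩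

theorem Conn.of_restr {s : Set (Sym2 W)} {ω : Sym2 W → Bool} {x y : W}
    (h : Conn (restr s ω) x y) : Conn ω x y := h.mono (restr_le _ _)

theorem conn_inS_mem {S : Set W} {ω : Sym2 W → Bool} {x y : W} (hx : x ∈ S)
    (h : Conn (restr (inS S) ω) x y) : y ∈ S := by
  induction h with
  | refl => exact hx
  | tail _ hbc _ => exact (mk_mem_inS.1 ((restr_apply _ _ _).1 hbc).1).2

/-- Last exit decomposition of a path from `S` to its complement. -/
theorem conn_last_exit {S : Set W} {ω : Sym2 W → Bool} {x y : W} (h : Conn ω x y) (hx : x ∈ S)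
    (hy : y ∉ S) : ∃ a ∈ S, ∃ b ∉ S, ω s(a, b) = true ∧ Conn (restr (inS Sᶜ) ω) b y := by
  induction h with
  | refl => exact absurd hx hy
  | @tail b c hb hbc ih =>
    by_cases hbS : b ∈ S
    · exact ⟨b, hbS, c, hy, hbc, conn_refl _ _⟩
    · obtain ⟨a, ha, b', hb', hab, h'⟩ := ih hbS
      refine ⟨a, ha, b', hb', hab, h'.trans (conn_of_open ?_)⟩
      rw [restr_apply, mk_mem_inS]
      exact ⟨⟨hbS, hy⟩, hbc⟩

/-! ## Two-point functions -/

/-- The two-point function. -/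
noncomputable def tau (t : Sym2 W → ℝ≥0) (x y : W) : ℝ≥0∞ := perc t {ω | Conn ω x y}

/-- The expected cluster size of a vertex. -/
noncomputable def sus (t : Sym2 W → ℝ≥0) (x : W) : ℝ≥0∞ := ∑' y, tau t x y

theorem tau_self (t : Sym2 W → ℝ≥0) (x : W) : tau t x x = 1 := by
  have : {ω : Sym2 W → Bool | Conn ω x x} = Set.univ := by
    ext ω; simp [conn_refl]
  rw [tau, this, measure_univ]

theorem tau_le_one (t : Sym2 W → ℝ≥0) (x y : W) : tau t x y ≤ 1 := prob_le_one

theorem tau_comm (t : Sym2 W → ℝ≥0) (x y : W) : tau t x y = tau t y x := by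
  simp only [tau, conn_comm (x := x) (y := y)]

theorem one_le_sus (t : Sym2 W → ℝ≥0) (x : W) : 1 ≤ sus t x := by
  rw [← tau_self t x]; exact ENNReal.le_tsum x

theorem eCard_eq_tsum (s : Set W) : eCard s = ∑' y, s.indicator (fun _ => (1 : ℝ≥0∞)) y := by
  rw [← tsum_subtype s (fun _ => (1 : ℝ≥0∞)), ENNReal.tsum_set_one, eCard]
  split_ifs with h
  · rw [← h.cast_ncard_eq]; rfl
  · rw [Set.encard_eq_top h]; rfl

variable [Countable W]

instance : Countable (Sym2 W) := by
  unfold Sym2; infer_instance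

theorem measurableSet_conn (x y : W) : MeasurableSet {ω : Sym2 W → Bool | Conn ω x y} :=
  (inc_conn x y).measurableSet

theorem lintegral_tsum_cluster (t : Sym2 W → ℝ≥0) (x : W) (f : W → ℝ≥0∞) :
    ∫⁻ ω, ∑' y, (cluster ω x).indicator f y ∂perc t = ∑' y, tau t x y * f y := by
  have h : ∀ y, (fun ω => (cluster ω x).indicator f y) =
      fun ω => {ω : Sym2 W → Bool | Conn ω x y}.indicator (fun _ => f y) ω := by
    intro y; ext ω; simp only [Set.indicator, cluster, Set.mem_ofPred_eq]; congr
  rw [lintegral_tsum]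
  · refine tsum_congr fun y => ?_
    rw [h, lintegral_indicator (measurableSet_conn x y), setLIntegral_const, mul_comm]
    rfl
  · intro y
    rw [h]
    exact (measurable_const.indicator (measurableSet_conn x y)).aemeasurable

theorem lintegral_eCard_cluster (t : Sym2 W → ℝ≥0) (x : W) :
    ∫⁻ ω, eCard (cluster ω x) ∂perc t = sus t x := by
  simp only [eCard_eq_tsum, lintegral_tsum_cluster, mul_one]
  rfl

theorem tau_mono {t u : Sym2 W → ℝ≥0} (h : t ≤ u) (x y : W) : tau t x y ≤ tau u x y :=
  (inc_conn x y).perc_mono h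

theorem sus_mono {t u : Sym2 W → ℝ≥0} (h : t ≤ u) (x : W) : sus t x ≤ sus u x :=
  ENNReal.tsum_le_tsum fun y => tau_mono h x y

theorem tau_eq_iSup (t : Sym2 W → ℝ≥0) (x y : W) :
    tau t x y = ⨆ s : Finset (Sym2 W), tau (cutRate (s : Set (Sym2 W)) t) x y :=
  (inc_conn x y).perc_eq_iSup t

theorem inc_joinL {A : Set (Sym2 W → Bool)} (hA : Inc A) : Inc (joinL ⁻¹' A) := by
  rw [joinL_eq_merge]; exact hA.preimage_merge _

theorem inc_fstL {A : Set (Sym2 W → Bool)} (hA : Inc A) :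
    Inc ((fstL : (Sym2 W ⊕ Sym2 W → Bool) → _) ⁻¹' A) := by
  rw [fstL_eq_merge]; exact hA.preimage_merge _

theorem conn_joinL_subset (x y : W) :
    {ω : Sym2 W ⊕ Sym2 W → Bool | Conn (joinL ω) x y} ⊆ {ω | Conn (fstL ω) x y} ∪
      ⋃ a, ⋃ b, disj {ω | Conn (fstL ω) x a}
        (disj {ω | ω (Sum.inr s(a, b)) = true} {ω | Conn (joinL ω) b y}) := by
  intro ω h
  by_cases hxy : Conn (fstL ω) x y
  · exact Or.inl hxy
  refine Or.inr ?_
  obtain ⟨a, ha, b, hb, hab, hby⟩ := conn_last_exit (S := cluster (fstL ω) x)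
    (show Conn (joinL ω) x y from h) (conn_refl _ _) hxy
  simp only [Set.mem_iUnion]
  refine ⟨a, b, ?_⟩
  set S := cluster (fstL ω) x with hS
  have hab' : ω (Sum.inr s(a, b)) = true := by
    simp only [joinL, Bool.or_eq_true] at hab
    refine hab.resolve_left fun h' => hb ?_
    exact Conn.trans (y := a) ha (conn_of_open h')
  have up1 := (inc_fstL (inc_conn x a)).up
  have up2 := (Inc.open_edge (Sum.inr s(a, b) : Sym2 W ⊕ Sym2 W))
  have up3 := (inc_joinL (inc_conn b y))
  refine mem_disj (up2.disj up3).up (s := Sum.inl '' inS S) (s' := (Sum.inl '' inS S)ᶜ)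
    disjoint_compl_right ?_ ?_
  · have := conn_restr_cluster (show Conn (fstL ω) x a from ha)
    refine Conn.mono ?_ this
    intro e
    rw [Bool.le_iff_imp]
    simp only [fstL, restr_apply]
    exact fun ⟨h1, h2⟩ => ⟨⟨e, h1, rfl⟩, h2⟩
  · refine mem_disj up3.up (s := {Sum.inr s(a, b)}) (s' := {Sum.inr s(a, b)}ᶜ)
      disjoint_compl_right ?_ ?_
    · simp [restr_apply, hab']
    · refine Conn.mono ?_ hby
      intro e
      rw [Bool.le_iff_imp]
      simp only [joinL, restr_apply, Bool.or_eq_true]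
      rintro ⟨h1, h2⟩
      have h3 : e ∉ inS S := fun h3 => Set.disjoint_left.1 (disjoint_inS disjoint_compl_right) h3 h1
      have h4 : e ≠ s(a, b) := by
        rintro rfl
        exact (mk_mem_inS.1 h1).1 ha
      simp [h3, h4, h2]

/-- Comparison of two-point functions when the rates are increased. -/
theorem tau_add_le (t u : Sym2 W → ℝ≥0) (x y : W) :
    tau (t + u) x y ≤ tau t x y +
      ∑' a, ∑' b, tau t x a * u s(a, b) * tau (t + u) b y := by
  have e1 : ∀ x y, tau (t + u) x y = perc (Sum.elim t u) {ω | Conn (joinL ω) x y} := by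
    intro x y
    rw [tau, ← map_joinL, Measure.map_apply measurable_joinL (measurableSet_conn _ _)]
    rfl
  have e2 : ∀ x y, tau t x y = perc (Sum.elim t u) {ω | Conn (fstL ω) x y} := by
    intro x y
    rw [tau, ← map_fstL t u, Measure.map_apply measurable_fstL (measurableSet_conn _ _)]
    rfl
  rw [e1 x y]
  refine (measure_mono (conn_joinL_subset x y)).trans ((measure_union_le _ _).trans ?_)
  rw [← e2]
  refine add_le_add_right ?_ _
  refine (measure_iUnion_le _).trans (ENNReal.tsum_le_tsum fun a => ?_)
  refine (measure_iUnion_le _).trans (ENNReal.tsum_le_tsum fun b => ?_)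
  have i1 := inc_fstL (inc_conn x a)
  have i2 := (Inc.open_edge (Sum.inr s(a, b) : Sym2 W ⊕ Sym2 W))
  have i3 := (inc_joinL (inc_conn b y))
  refine (perc_disj_le _ i1 (i2.disj i3)).trans ?_
  rw [mul_assoc]
  refine mul_le_mul' (e2 x a).ge ((perc_disj_le _ i2 i3).trans (mul_le_mul' ?_ (e1 b y).ge))
  exact perc_open_singleton_le (Sum.elim t u) (Sum.inr s(a, b))

end Connectivity

end LRP

namespace LRP

open scoped NNReal

namespace Kernel

variable {d : ℕ} {α : ℝ} (κ : Kernel d α)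

/-! ## Lattice geometry -/

/-- The norm of a lattice point. -/
noncomputable def nr (x : V d) : ℝ := κ.N (toR x)

theorem toR_sub (x y : V d) : toR (x - y) = toR x - toR y := by
  ext i; simp [toR]

theorem toR_add (x y : V d) : toR (x + y) = toR x + toR y := by
  ext i; simp [toR]

theorem nd_eq (x y : V d) : κ.nd x y = κ.nr (x - y) := by
  rw [nd, nr, toR_sub]

theorem nd_eq' (x y : V d) : κ.nd x y = κ.nr (y - x) := by
  rw [nd_symm, nd_eq]

theorem nr_zero : κ.nr 0 = 0 := by
  have : toR (0 : V d) = 0 := by ext i; simp [toR]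
  rw [nr, this, map_zero]

theorem nr_nonneg (x : V d) : 0 ≤ κ.nr x := apply_nonneg _ _

theorem nr_add_le (x y : V d) : κ.nr (x + y) ≤ κ.nr x + κ.nr y := by
  rw [nr, toR_add]; exact map_add_le_add _ _ _

theorem nr_pos {x : V d} (hx : x ≠ 0) : 0 < κ.nr x := by
  refine κ.N_pos _ fun h => hx ?_
  ext i
  have := congrFun h i
  simpa [toR] using this

theorem nd_self (x : V d) : κ.nd x x = 0 := by rw [nd_eq, sub_self, nr_zero]

theorem nd_nonneg (x y : V d) : 0 ≤ κ.nd x y := by rw [nd_eq]; exact κ.nr_nonneg _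

theorem nd_pos {x y : V d} (h : x ≠ y) : 0 < κ.nd x y := by
  rw [nd_eq]; exact κ.nr_pos (sub_ne_zero.2 h)

theorem nd_triangle (x y z : V d) : κ.nd x z ≤ κ.nd x y + κ.nd y z := by
  simp only [nd_eq]
  convert κ.nr_add_le (x - y) (y - z) using 2
  abel

theorem nd_add_right (x y z : V d) : κ.nd (x + z) (y + z) = κ.nd x y := by
  simp only [nd_eq]; congr 1; abel

theorem nd_zero_left (x : V d) : κ.nd 0 x = κ.nr x := by
  rw [nd_eq', sub_zero]

theorem N_le_sum (x : Fin d → ℝ) : κ.N x ≤ ∑ i, |x i| * κ.N (Pi.single i 1) := by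
  calc κ.N x = κ.N (∑ i, x i • Pi.single i (1 : ℝ)) := by
        congr 1; ext j; simp [Finset.sum_apply, Pi.single_apply]
    _ ≤ ∑ i, κ.N (x i • Pi.single i (1 : ℝ)) := Finset.le_sum_of_subadditive κ.N (map_zero κ.N).le (map_add_le_add _) _ _
    _ = _ := by simp [map_smul_eq_mul]

theorem exists_N_le : ∃ b : ℝ, 0 < b ∧ ∀ x : Fin d → ℝ, κ.N x ≤ b * ‖x‖ := by
  refine ⟨∑ i, κ.N (Pi.single i 1) + 1, ?_, fun x => (κ.N_le_sum x).trans ?_⟩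
  · have : 0 ≤ ∑ i, κ.N (Pi.single i 1) := Finset.sum_nonneg fun i _ => apply_nonneg _ _
    linarith
  · rw [add_mul, Finset.sum_mul]
    refine (Finset.sum_le_sum fun i _ => ?_).trans (le_add_of_nonneg_right (by positivity))
    rw [mul_comm]
    exact mul_le_mul_of_nonneg_left (norm_le_pi_norm x i) (apply_nonneg _ _)

theorem exists_le_N : ∃ a : ℝ, 0 < a ∧ ∀ x : Fin d → ℝ, a * ‖x‖ ≤ κ.N x := by
  obtain ⟨b, hb, hN⟩ := κ.exists_N_le
  have hcont : Continuous κ.N := by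
    refine Seminorm.continuous_of_le (q := b.toNNReal • normSeminorm ℝ (Fin d → ℝ)) ?_ ?_
    · have : Continuous fun x : Fin d → ℝ => b * ‖x‖ := by fun_prop
      convert this using 1
      ext x
      simp [NNReal.smul_def, hb.le]
    · intro x
      simpa [NNReal.smul_def, hb.le] using hN x
  rcases (Metric.sphere (0 : Fin d → ℝ) 1).eq_empty_or_nonempty with h | h
  · refine ⟨1, one_pos, fun x => ?_⟩
    have hx : x = 0 := by
      by_contra hx
      have : (‖x‖⁻¹ • x) ∈ Metric.sphere (0 : Fin d → ℝ) 1 := by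
        simp [norm_smul, hx]
      rw [h] at this
      exact this
    simp [hx]
  · obtain ⟨z, hz, hmin⟩ := (isCompact_sphere (0 : Fin d → ℝ) 1).exists_isMinOn h
      hcont.continuousOn
    have hz0 : z ≠ 0 := by
      rintro rfl; simp at hz
    refine ⟨κ.N z, κ.N_pos z hz0, fun x => ?_⟩
    by_cases hx : x = 0
    · simp [hx]
    have hmem : (‖x‖⁻¹ • x) ∈ Metric.sphere (0 : Fin d → ℝ) 1 := by
      simp [norm_smul, hx]
    have h1 := hmin hmem
    simp only [Set.mem_ofPred_eq, map_smul_eq_mul, norm_inv, norm_norm] at h1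
    have hx' : 0 < ‖x‖ := norm_pos_iff.2 hx
    rw [inv_mul_eq_div, le_div_iff₀ hx'] at h1
    exact h1

/-- The cube of radius `n` in the lattice. -/
noncomputable def cube (d : ℕ) (n : ℤ) : Finset (V d) := Finset.Icc (fun _ => -n) (fun _ => n)

theorem card_cube (n : ℕ) : (cube d n).card = (2 * n + 1) ^ d := by
  have h : ∀ i : Fin d, ((n : ℤ) + 1 - -(n : ℤ)).toNat = 2 * n + 1 := fun i => by omega
  simp only [cube, Pi.card_Icc, Int.card_Icc]
  rw [Finset.prod_congr rfl fun i _ => h i]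
  simp

theorem mem_cube (n : ℕ) (x : V d) : x ∈ cube d n ↔ ‖toR x‖ ≤ n := by
  rw [cube, Finset.mem_Icc, pi_norm_le_iff_of_nonneg (by positivity)]
  simp only [Pi.le_def, toR, Real.norm_eq_abs, abs_le]
  constructor
  · exact fun h i => ⟨by exact_mod_cast h.1 i, by exact_mod_cast h.2 i⟩
  · exact fun h => ⟨fun i => by exact_mod_cast (h i).1, fun i => by exact_mod_cast (h i).2⟩

theorem ball_finite (r : ℝ) : {x : V d | κ.nr x ≤ r}.Finite := by
  obtain ⟨a, ha, h⟩ := κ.exists_le_N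
  obtain ⟨n, hn⟩ := exists_nat_ge (r / a)
  refine (cube d n).finite_toSet.subset fun x hx => ?_
  rw [Finset.mem_coe, mem_cube]
  refine le_trans ?_ hn
  rw [le_div_iff₀ ha, mul_comm]
  exact (h _).trans hx

/-- The lattice ball, as a finset. -/
noncomputable def fball (r : ℝ) : Finset (V d) := (κ.ball_finite r).toFinset

theorem mem_fball {r : ℝ} {x : V d} : x ∈ κ.fball r ↔ κ.nr x ≤ r := by
  simp [fball]

theorem exists_min_nr : ∃ c : ℝ, 0 < c ∧ c ≤ 1 ∧ ∀ x : V d, x ≠ 0 → c ≤ κ.nr x := by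
  obtain ⟨a, ha, h⟩ := κ.exists_le_N
  refine ⟨min a 1, by positivity, min_le_right _ _, fun x hx => ?_⟩
  refine (min_le_left _ _).trans (le_trans ?_ (h (toR x)))
  have : 1 ≤ ‖toR x‖ := by
    obtain ⟨i, hi⟩ := Function.ne_iff.1 hx
    refine le_trans ?_ (norm_le_pi_norm _ i)
    simp only [toR, Real.norm_eq_abs]
    have h1 : (1 : ℤ) ≤ |x i| := Int.one_le_abs hi
    exact_mod_cast h1
  nlinarith

theorem exists_card_le : ∃ C : ℝ, 1 ≤ C ∧ (∀ r : ℝ, 1 ≤ r → ((κ.fball r).card : ℝ) ≤ C * r ^ d) ∧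
    ∀ r : ℝ, 0 < r → (((κ.fball r).erase 0).card : ℝ) ≤ C * r ^ d := by
  obtain ⟨a, ha, h⟩ := κ.exists_le_N
  have key : ∀ r : ℝ, 0 ≤ r → ((κ.fball r).card : ℝ) ≤ (2 * (r / a) + 1) ^ d := by
    intro r hr
    have hra : 0 ≤ r / a := by positivity
    have hsub : κ.fball r ⊆ cube d (⌊r / a⌋₊ : ℕ) := by
      intro x hx
      rw [mem_fball] at hx
      have hnat : ‖toR x‖ ≤ ⌊r / a⌋₊ := by
        rw [pi_norm_le_iff_of_nonneg (by positivity)]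
        intro i
        have h1 : ‖toR x i‖ ≤ r / a := by
          rw [le_div_iff₀ ha, mul_comm]
          exact (mul_le_mul_of_nonneg_left (norm_le_pi_norm _ i) ha.le).trans ((h _).trans hx)
        have h2 : ‖toR x i‖ = ((x i).natAbs : ℝ) := by
          simp [toR, Nat.cast_natAbs]
        rw [h2] at h1 ⊢
        exact_mod_cast Nat.le_floor h1
      rwa [mem_cube]
    calc ((κ.fball r).card : ℝ) ≤ ((cube d (⌊r / a⌋₊ : ℕ)).card : ℝ) := by
          exact_mod_cast Finset.card_le_card hsub
      _ = (2 * (⌊r / a⌋₊ : ℝ) + 1) ^ d := by rw [card_cube]; push_cast; rfl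
      _ ≤ _ := by
          have := Nat.floor_le hra
          gcongr
  obtain ⟨c, hc, hc1, hmin⟩ := κ.exists_min_nr
  have hM : 1 ≤ 2 / a + 1 / c := by
    have h1 : 1 ≤ 1 / c := by rw [le_div_iff₀ hc]; linarith
    have h2 : 0 < 2 / a := by positivity
    linarith
  have gen : ∀ r : ℝ, c ≤ r → ((κ.fball r).card : ℝ) ≤ (2 / a + 1 / c) ^ d * r ^ d := by
    intro r hr
    refine (key r (hc.le.trans hr)).trans ?_
    rw [← mul_pow]
    have h1 : 1 ≤ 1 / c * r := by rw [one_div, inv_mul_eq_div, le_div_iff₀ hc]; linarith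
    have hr0 : 0 < r := hc.trans_le hr
    have h2 : 0 ≤ r / a := by positivity
    refine pow_le_pow_left₀ (by positivity) ?_ d
    rw [add_mul, div_mul_eq_mul_div, mul_div_assoc]
    linarith
  refine ⟨(2 / a + 1 / c) ^ d, one_le_pow₀ hM, fun r hr => gen r (hc1.trans hr), fun r hr => ?_⟩
  rcases le_or_gt c r with h1 | h1
  · refine le_trans ?_ (gen r h1)
    exact_mod_cast Finset.card_le_card (Finset.erase_subset _ _)
  · have : (κ.fball r).erase 0 = ∅ := by
      ext x
      simp only [Finset.mem_erase, mem_fball, Finset.notMem_empty, iff_false, not_and, not_le]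
      exact fun hx => h1.trans_le (hmin x hx)
    rw [this]
    simp only [Finset.card_empty, Nat.cast_zero]
    positivity

theorem exists_le_card : ∃ c : ℝ, 0 < c ∧ ∀ r : ℝ, 0 ≤ r → c * r ^ d ≤ ((κ.fball r).card : ℝ) := by
  obtain ⟨b, hb, h⟩ := κ.exists_N_le
  refine ⟨(1 / b) ^ d, by positivity, fun r hr => ?_⟩
  have hrb : 0 ≤ r / b := by positivity
  have hsub : cube d (⌊r / b⌋₊ : ℕ) ⊆ κ.fball r := by
    intro x hx
    rw [mem_cube] at hx
    rw [mem_fball]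
    refine (h _).trans ?_
    rw [mul_comm, ← le_div_iff₀ hb]
    exact hx.trans (Nat.floor_le hrb)
  calc (1 / b) ^ d * r ^ d = (r / b) ^ d := by rw [← mul_pow]; ring
    _ ≤ (2 * (⌊r / b⌋₊ : ℝ) + 1) ^ d := by
        have := (Nat.lt_floor_add_one (r / b)).le
        have h0 : (0 : ℝ) ≤ ⌊r / b⌋₊ := by positivity
        gcongr
        linarith
    _ = ((cube d (⌊r / b⌋₊ : ℕ)).card : ℝ) := by rw [card_cube]; push_cast; rfl
    _ ≤ _ := by exact_mod_cast Finset.card_le_card hsub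

theorem tsum_indicator_finset (s : Finset (V d)) (c : ℝ) :
    ∑' x, (if x ∈ s then ENNReal.ofReal c else 0) = ENNReal.ofReal (s.card * c) := by
  rw [tsum_eq_sum (s := s) (fun x hx => if_neg hx)]
  rw [Finset.sum_congr rfl fun x hx => if_pos hx, Finset.sum_const, nsmul_eq_mul,
    ENNReal.ofReal_mul (by positivity), ENNReal.ofReal_natCast]

theorem exists_sum_tail {a : ℝ} (ha : 0 < a) : ∃ C : ℝ, 0 < C ∧ ∀ R : ℝ, 0 < R →
    ∑' x : V d, (if R ≤ κ.nr x then ENNReal.ofReal (κ.nr x ^ (-(d : ℝ) - a)) else 0) ≤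
      ENNReal.ofReal (C * R ^ (-a)) := by
  obtain ⟨C, hC, -, hcard⟩ := κ.exists_card_le
  have hq : (0 : ℝ) < (2 : ℝ) ^ (-a) := by positivity
  have hq1 : (2 : ℝ) ^ (-a) < 1 := Real.rpow_lt_one_of_one_lt_of_neg (by norm_num) (by linarith)
  refine ⟨C * 2 ^ d * (1 - (2 : ℝ) ^ (-a))⁻¹, ?_, fun R hR => ?_⟩
  · have := sub_pos.2 hq1
    positivity
  calc ∑' x : V d, (if R ≤ κ.nr x then ENNReal.ofReal (κ.nr x ^ (-(d : ℝ) - a)) else 0)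
      ≤ ∑' x : V d, ∑' k : ℕ, (if x ∈ (κ.fball (2 ^ (k + 1) * R)).erase 0 then
          ENNReal.ofReal ((2 ^ k * R) ^ (-(d : ℝ) - a)) else 0) := by
        refine ENNReal.tsum_le_tsum fun x => ?_
        split_ifs with hx
        · obtain ⟨k, hk1, hk2⟩ := exists_nat_pow_near (x := κ.nr x / R) (y := (2 : ℝ))
            (by rw [le_div_iff₀ hR]; linarith) (by norm_num)
          rw [le_div_iff₀ hR] at hk1
          rw [div_lt_iff₀ hR] at hk2
          refine le_trans ?_ (ENNReal.le_tsum k)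
          rw [if_pos]
          · refine ENNReal.ofReal_le_ofReal ?_
            refine Real.rpow_le_rpow_of_nonpos (by positivity) hk1 ?_
            have : (0 : ℝ) ≤ d := by positivity
            linarith
          · rw [Finset.mem_erase, mem_fball]
            refine ⟨?_, hk2.le⟩
            rintro rfl
            rw [nr_zero] at hx
            linarith
        · exact zero_le
    _ = ∑' k : ℕ, ENNReal.ofReal (((κ.fball (2 ^ (k + 1) * R)).erase 0).card *
          (2 ^ k * R) ^ (-(d : ℝ) - a)) := by
        rw [ENNReal.tsum_comm]
        refine tsum_congr fun k => ?_
        rw [tsum_indicator_finset _ _]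
    _ ≤ ∑' k : ℕ, ENNReal.ofReal (C * 2 ^ d * R ^ (-a) * ((2 : ℝ) ^ (-a)) ^ k) := by
        refine ENNReal.tsum_le_tsum fun k => ENNReal.ofReal_le_ofReal ?_
        have hp : (0 : ℝ) < 2 ^ k * R := by positivity
        calc _ ≤ C * (2 ^ (k + 1) * R) ^ d * (2 ^ k * R) ^ (-(d : ℝ) - a) := by
              have := hcard (2 ^ (k + 1) * R) (by positivity)
              gcongr
          _ = C * 2 ^ d * ((2 ^ k * R) ^ (d : ℝ) * (2 ^ k * R) ^ (-(d : ℝ) - a)) := by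
              rw [pow_succ, mul_comm ((2 : ℝ) ^ k) 2, mul_assoc 2, mul_pow 2, Real.rpow_natCast]
              ring
          _ = C * 2 ^ d * (2 ^ k * R) ^ (-a) := by
              rw [← Real.rpow_add hp]; congr 2; ring
          _ = _ := by
              rw [Real.mul_rpow (by positivity) hR.le, ← Real.rpow_natCast 2 k,
                ← Real.rpow_natCast ((2 : ℝ) ^ (-a)) k, ← Real.rpow_mul (by norm_num),
                ← Real.rpow_mul (by norm_num), mul_comm (k : ℝ)]
              ring
    _ = _ := by
        rw [← ENNReal.ofReal_tsum_of_nonneg (fun k => by positivity)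
          ((summable_geometric_of_lt_one hq.le hq1).mul_left _), tsum_mul_left,
          tsum_geometric_of_lt_one hq.le hq1]
        congr 1; ring

theorem exists_sum_head {a : ℝ} (ha : 0 < a) : ∃ C : ℝ, 0 < C ∧ ∀ R : ℝ, 0 < R →
    ∑' x : V d, (if x ≠ 0 ∧ κ.nr x ≤ R then ENNReal.ofReal (κ.nr x ^ (-(d : ℝ) + a)) else 0) ≤
      ENNReal.ofReal (C * R ^ a) := by
  obtain ⟨C, hC, -, hcard⟩ := κ.exists_card_le
  set q : ℝ := (1 / 2 : ℝ) ^ a with hqd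
  have hq : (0 : ℝ) < q := by positivity
  have hq1 : q < 1 := Real.rpow_lt_one (by norm_num) (by norm_num) ha
  set M : ℝ := max 1 ((1 / 2 : ℝ) ^ (-(d : ℝ) + a)) with hM
  have hM0 : 0 < M := lt_max_of_lt_left one_pos
  refine ⟨C * M * (1 - q)⁻¹, ?_, fun R hR => ?_⟩
  · have := sub_pos.2 hq1
    positivity
  calc ∑' x : V d, (if x ≠ 0 ∧ κ.nr x ≤ R then ENNReal.ofReal (κ.nr x ^ (-(d : ℝ) + a)) else 0)
      ≤ ∑' x : V d, ∑' k : ℕ, (if x ∈ (κ.fball ((1 / 2) ^ k * R)).erase 0 then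
          ENNReal.ofReal (M * ((1 / 2) ^ k * R) ^ (-(d : ℝ) + a)) else 0) := by
        refine ENNReal.tsum_le_tsum fun x => ?_
        split_ifs with hx
        · have hx0 := κ.nr_pos hx.1
          obtain ⟨k, hk1, hk2⟩ := exists_nat_pow_near (x := R / κ.nr x) (y := (2 : ℝ))
            (by rw [le_div_iff₀ hx0]; linarith [hx.2]) (by norm_num)
          rw [le_div_iff₀ hx0] at hk1
          rw [div_lt_iff₀ hx0] at hk2
          have e1 : κ.nr x ≤ (1 / 2) ^ k * R := by
            rw [one_div, inv_pow, inv_mul_eq_div, le_div_iff₀ (by positivity)]; linarith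
          have e2 : 1 / 2 * ((1 / 2) ^ k * R) ≤ κ.nr x := by
            rw [← mul_assoc, ← pow_succ', one_div, inv_pow, inv_mul_eq_div,
              div_le_iff₀ (by positivity)]
            linarith
          refine le_trans ?_ (ENNReal.le_tsum k)
          rw [if_pos]
          · refine ENNReal.ofReal_le_ofReal ?_
            have hp : (0 : ℝ) < (1 / 2) ^ k * R := by positivity
            rcases le_total 0 (-(d : ℝ) + a) with hs | hs
            · refine (Real.rpow_le_rpow hx0.le e1 hs).trans ?_
              exact le_mul_of_one_le_left (by positivity) (le_max_left _ _)
            · refine (Real.rpow_le_rpow_of_nonpos (by positivity) e2 hs).trans ?_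
              rw [Real.mul_rpow (by norm_num) hp.le]
              gcongr
              exact le_max_right _ _
          · rw [Finset.mem_erase, mem_fball]
            exact ⟨hx.1, e1⟩
        · exact zero_le
    _ = ∑' k : ℕ, ENNReal.ofReal (((κ.fball ((1 / 2) ^ k * R)).erase 0).card *
          (M * ((1 / 2) ^ k * R) ^ (-(d : ℝ) + a))) := by
        rw [ENNReal.tsum_comm]
        refine tsum_congr fun k => ?_
        rw [tsum_indicator_finset _ _]
    _ ≤ ∑' k : ℕ, ENNReal.ofReal (C * M * R ^ a * q ^ k) := by
        refine ENNReal.tsum_le_tsum fun k => ENNReal.ofReal_le_ofReal ?_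
        have hp : (0 : ℝ) < (1 / 2) ^ k * R := by positivity
        calc _ ≤ C * ((1 / 2) ^ k * R) ^ d * (M * ((1 / 2) ^ k * R) ^ (-(d : ℝ) + a)) := by
              have := hcard ((1 / 2) ^ k * R) hp
              gcongr
          _ = C * M * (((1 / 2) ^ k * R) ^ (d : ℝ) * ((1 / 2) ^ k * R) ^ (-(d : ℝ) + a)) := by
              rw [Real.rpow_natCast]
              ring
          _ = C * M * ((1 / 2) ^ k * R) ^ a := by
              rw [← Real.rpow_add hp]; congr 2; ring
          _ = _ := by
              rw [Real.mul_rpow (by positivity) hR.le, ← Real.rpow_natCast (1 / 2) k, hqd,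
                ← Real.rpow_natCast ((1 / 2 : ℝ) ^ a) k, ← Real.rpow_mul (by norm_num),
                ← Real.rpow_mul (by norm_num), mul_comm (k : ℝ)]
              ring
    _ = _ := by
        rw [← ENNReal.ofReal_tsum_of_nonneg (fun k => by positivity)
          ((summable_geometric_of_lt_one hq.le hq1).mul_left _), tsum_mul_left,
          tsum_geometric_of_lt_one hq.le hq1]
        congr 1; ring

end Kernel

end LRP

namespace LRP

open scoped NNReal

namespace Kernel

variable {d : ℕ} {α : ℝ} (κ : Kernel d α)

/-! ## The kernel and its truncations -/

theorem J_continuousOn : ContinuousOn κ.J (Set.Ioi 0) := fun r hr =>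
  (κ.J_hasDeriv r hr).continuousAt.continuousWithinAt

theorem J'_nonpos {r : ℝ} (hr : 0 < r) : κ.J' r ≤ 0 := by
  have h := (κ.J_hasDeriv r hr).hasDerivWithinAt (s := Set.Ioi r)
  refine le_of_tendsto ((hasDerivWithinAt_iff_tendsto_slope' (by simp)).1 h) ?_
  filter_upwards [self_mem_nhdsWithin] with s hs
  rw [slope_def_field]
  have hs' : r < s := hs
  have := κ.J_anti (Set.mem_Ioi.2 hr) (Set.mem_Ioi.2 (hr.trans hs')) hs'.le
  exact div_nonpos_of_nonpos_of_nonneg (by linarith) (by linarith)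

theorem integral_abs_J' {a b : ℝ} (ha : 0 < a) (hab : a ≤ b) :
    ∫ s in Set.Ioc a b, |κ.J' s| = κ.J a - κ.J b := by
  have hc : ContinuousOn (fun s => -κ.J s) (Set.Icc a b) :=
    (κ.J_continuousOn.mono fun s hs => ha.trans_le hs.1).neg
  have hd : ∀ x ∈ Set.Ioo a b, HasDerivAt (fun s => -κ.J s) (-κ.J' x) x := fun x hx =>
    (κ.J_hasDeriv x (ha.trans hx.1)).neg
  have hi : IntegrableOn (fun s => -κ.J' s) (Set.Ioc a b) :=
    intervalIntegral.integrableOn_deriv_of_nonneg hc hd fun x hx => by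
      have := κ.J'_nonpos (ha.trans hx.1); linarith
  have h1 : ∫ s in Set.Ioc a b, |κ.J' s| = ∫ s in Set.Ioc a b, -κ.J' s :=
    setIntegral_congr_fun measurableSet_Ioc fun s hs => abs_of_nonpos (κ.J'_nonpos (ha.trans hs.1))
  rw [h1, ← intervalIntegral.integral_of_le hab,
    intervalIntegral.integral_eq_sub_of_hasDerivAt_of_le hab hc hd
      ((intervalIntegrable_iff_integrableOn_Ioc_of_le hab).2 hi)]
  ring

theorem kerCut_eq {r : ℝ} (hr : 0 < r) {x y : V d} (h : x ≠ y) :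
    κ.kerCut r x y = max (κ.J (κ.nd x y) - κ.J r) 0 := by
  have hp := κ.nd_pos h
  rw [kerCut]
  by_cases h' : κ.nd x y ≤ r
  · rw [if_pos ⟨h, h'⟩, integral_abs_J' κ hp h', max_eq_left]
    have := κ.J_anti (Set.mem_Ioi.2 hp) (Set.mem_Ioi.2 hr) h'
    linarith
  · rw [if_neg fun hh => h' hh.2, max_eq_right]
    have := κ.J_anti (Set.mem_Ioi.2 hr) (Set.mem_Ioi.2 hp) (not_le.1 h').le
    linarith

theorem ker_of_ne {x y : V d} (h : x ≠ y) : κ.ker x y = κ.J (κ.nd x y) := if_neg h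

theorem ker_self (x : V d) : κ.ker x x = 0 := if_pos rfl

theorem kerCut_self (r : ℝ) (x : V d) : κ.kerCut r x x = 0 := by simp [kerCut]

theorem ker_nonneg (x y : V d) : 0 ≤ κ.ker x y := by
  by_cases h : x = y
  · rw [h, ker_self]
  · rw [κ.ker_of_ne h]; exact κ.J_nonneg _ (κ.nd_pos h)

theorem kerCut_nonneg (r : ℝ) (x y : V d) : 0 ≤ κ.kerCut r x y := by
  rw [kerCut]
  split_ifs
  · exact setIntegral_nonneg measurableSet_Ioc fun _ _ => abs_nonneg _
  · exact le_rfl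

theorem kerCut_le {r : ℝ} (hr : 0 < r) (x y : V d) : κ.kerCut r x y ≤ κ.ker x y := by
  by_cases h : x = y
  · rw [h, ker_self, kerCut_self]
  · rw [κ.kerCut_eq hr h, κ.ker_of_ne h]
    have h1 := κ.J_nonneg _ (κ.nd_pos h)
    have h2 := κ.J_nonneg r hr
    exact max_le (by linarith) h1

theorem kerCut_mono {r s : ℝ} (hr : 0 < r) (hrs : r ≤ s) (x y : V d) :
    κ.kerCut r x y ≤ κ.kerCut s x y := by
  by_cases h : x = y
  · rw [h, kerCut_self, kerCut_self]
  · rw [κ.kerCut_eq hr h, κ.kerCut_eq (hr.trans_le hrs) h]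
    have := κ.J_anti (Set.mem_Ioi.2 hr) (Set.mem_Ioi.2 (hr.trans_le hrs)) hrs
    exact max_le_max (by linarith) le_rfl

theorem ker_le_kerCut_add {r : ℝ} (hr : 0 < r) (x y : V d) :
    κ.ker x y ≤ κ.kerCut r x y + κ.J r := by
  by_cases h : x = y
  · rw [h, ker_self, kerCut_self, zero_add]; exact κ.J_nonneg r hr
  · rw [κ.kerCut_eq hr h, κ.ker_of_ne h]
    linarith [le_max_left (κ.J (κ.nd x y) - κ.J r) 0]

theorem ker_add (x y z : V d) : κ.ker (x + z) (y + z) = κ.ker x y := by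
  simp [ker, nd_add_right]

theorem kerCut_add (r : ℝ) (x y z : V d) : κ.kerCut r (x + z) (y + z) = κ.kerCut r x y := by
  simp [kerCut, nd_add_right]

/-- Edge rates for the full kernel. -/
noncomputable def rate (β : ℝ) : Sym2 (V d) → ℝ≥0 :=
  Sym2.lift ⟨fun x y => (β * κ.ker x y).toNNReal, fun x y => by
    show (β * κ.ker x y).toNNReal = (β * κ.ker y x).toNNReal
    rw [κ.ker_symm x y]⟩

/-- Edge rates for the cut-off kernel. -/
noncomputable def rateCut (β r : ℝ) : Sym2 (V d) → ℝ≥0 :=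
  Sym2.lift ⟨fun x y => (β * κ.kerCut r x y).toNNReal, fun x y => by
    show (β * κ.kerCut r x y).toNNReal = (β * κ.kerCut r y x).toNNReal
    rw [κ.kerCut_symm r x y]⟩

theorem coe_rate {β : ℝ} (hβ : 0 ≤ β) (x y : V d) : (κ.rate β s(x, y) : ℝ) = β * κ.ker x y :=
  Real.coe_toNNReal _ (mul_nonneg hβ (κ.ker_nonneg x y))

theorem coe_rateCut {β : ℝ} (hβ : 0 ≤ β) (r : ℝ) (x y : V d) :
    (κ.rateCut β r s(x, y) : ℝ) = β * κ.kerCut r x y :=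
  Real.coe_toNNReal _ (mul_nonneg hβ (κ.kerCut_nonneg r x y))

theorem edgeP_eq {β : ℝ} (hβ : 0 ≤ β) : κ.edgeP β = fun e => edgeProb (κ.rate β e) := by
  ext e
  induction e with
  | h x y => rw [κ.coe_rate hβ]; rfl

theorem edgePCut_eq {β : ℝ} (hβ : 0 ≤ β) (r : ℝ) :
    κ.edgePCut β r = fun e => edgeProb (κ.rateCut β r e) := by
  ext e
  induction e with
  | h x y => rw [κ.coe_rateCut hβ]; rfl

theorem rateCut_mono {β β' r r' : ℝ} (hβ : 0 ≤ β) (h : β ≤ β') (hr : 0 < r) (hr' : r ≤ r') :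
    κ.rateCut β r ≤ κ.rateCut β' r' := by
  intro e
  induction e with
  | h x y =>
    rw [← NNReal.coe_le_coe, κ.coe_rateCut hβ, κ.coe_rateCut (hβ.trans h)]
    exact mul_le_mul h (κ.kerCut_mono hr hr' x y) (κ.kerCut_nonneg r x y) (hβ.trans h)

theorem rateCut_le_rate {β r : ℝ} (hβ : 0 ≤ β) (hr : 0 < r) : κ.rateCut β r ≤ κ.rate β := by
  intro e
  induction e with
  | h x y =>
    rw [← NNReal.coe_le_coe, κ.coe_rateCut hβ, κ.coe_rate hβ]
    exact mul_le_mul_of_nonneg_left (κ.kerCut_le hr x y) hβ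

/-! ## Asymptotics of the kernel -/

theorem exists_J_sub_bounds (hα : 0 < α) : ∃ s₀ : ℝ, 1 ≤ s₀ ∧ ∀ a b : ℝ, s₀ ≤ a → a ≤ b →
    1 / (2 * (d + α)) * (a ^ (-(d + α) : ℝ) - b ^ (-(d + α) : ℝ)) ≤ κ.J a - κ.J b ∧
      κ.J a - κ.J b ≤ 3 / (2 * (d + α)) * (a ^ (-(d + α) : ℝ) - b ^ (-(d + α) : ℝ)) := by
  have hD : (0 : ℝ) < d + α := by positivity
  have hδ := κ.δ_lim.eventually (Metric.ball_mem_nhds (0 : ℝ) (by norm_num : (0 : ℝ) < 1 / 2))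
  obtain ⟨s, hs⟩ := eventually_atTop.1 hδ
  refine ⟨max s 1, le_max_right _ _, fun a b ha hab => ?_⟩
  have hpos : ∀ {r : ℝ}, r ∈ Set.Ici (max s 1) → 0 < r := fun {r} hr =>
    one_pos.trans_le ((le_max_right _ _).trans hr)
  have hJ' : ∀ r ∈ Set.Ici (max s 1), 1 / 2 * r ^ (-(d + α) - 1 : ℝ) ≤ -κ.J' r ∧
      -κ.J' r ≤ 3 / 2 * r ^ (-(d + α) - 1 : ℝ) := by
    intro r hr
    have h1 := hs r ((le_max_left _ _).trans hr)
    rw [Real.dist_0_eq_abs, abs_lt] at h1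
    have h2 := κ.J'_eq r (hpos hr)
    rw [abs_of_nonpos (κ.J'_nonpos (hpos hr))] at h2
    rw [h2, show (-(d : ℝ) - α - 1) = -(d + α) - 1 by ring]
    have h3 : 0 < r ^ (-(d + α) - 1 : ℝ) := Real.rpow_pos_of_pos (hpos hr) _
    constructor
    · exact mul_le_mul_of_nonneg_right (by linarith [h1.1]) h3.le
    · exact mul_le_mul_of_nonneg_right (by linarith [h1.2]) h3.le
  have hder : ∀ k : ℝ, ∀ r ∈ Set.Ici (max s 1), HasDerivAt
      (fun r => κ.J r - k / (2 * (d + α)) * r ^ (-(d + α) : ℝ))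
      (κ.J' r + k / 2 * r ^ (-(d + α) - 1 : ℝ)) r := by
    intro k r hr
    have h1 := (Real.hasDerivAt_rpow_const (x := r) (p := (-(d + α) : ℝ))
      (Or.inl (hpos hr).ne')).const_mul (k / (2 * (d + α)))
    have h2 : κ.J' r + k / 2 * r ^ (-(d + α) - 1 : ℝ) = κ.J' r -
        k / (2 * (d + α)) * (-(d + α) * r ^ (-(d + α) - 1 : ℝ)) := by
      have := hD.ne'
      generalize r ^ (-(d + α) - 1 : ℝ) = z
      field_simp
      ring
    rw [h2]
    exact (κ.J_hasDeriv r (hpos hr)).sub h1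
  have hcont : ∀ k : ℝ, ContinuousOn (fun r => κ.J r - k / (2 * (d + α)) * r ^ (-(d + α) : ℝ))
      (Set.Ici (max s 1)) := fun k r hr => (hder k r hr).continuousAt.continuousWithinAt
  have hb : b ∈ Set.Ici (max s 1) := le_trans ha hab
  constructor
  · have := antitoneOn_of_hasDerivWithinAt_nonpos (convex_Ici (max s 1)) (hcont 1)
      (fun r hr => ((hder 1 r (interior_subset hr)).hasDerivWithinAt)) (fun r hr => by
        have := (hJ' r (interior_subset hr)).1
        linarith) (Set.mem_Ici.2 ha) hb hab
    simp only at this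
    linarith
  · have := monotoneOn_of_hasDerivWithinAt_nonneg (convex_Ici (max s 1)) (hcont 3)
      (fun r hr => ((hder 3 r (interior_subset hr)).hasDerivWithinAt)) (fun r hr => by
        have := (hJ' r (interior_subset hr)).2
        linarith) (Set.mem_Ici.2 ha) hb hab
    simp only at this
    linarith

theorem exists_J_diff (hα : 0 < α) : ∃ c s₁ : ℝ, 0 < c ∧ 1 ≤ s₁ ∧ ∀ s : ℝ, s₁ ≤ s →
    c * s ^ (-(d + α) : ℝ) ≤ κ.J (s / 2) - κ.J s := by
  obtain ⟨s₀, hs₀, h⟩ := κ.exists_J_sub_bounds hα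
  have hD : (0 : ℝ) < d + α := by positivity
  have h2 : (1 : ℝ) < (1 / 2) ^ (-(d + α) : ℝ) :=
    Real.one_lt_rpow_of_pos_of_lt_one_of_neg (by norm_num) (by norm_num) (by linarith)
  refine ⟨1 / (2 * (d + α)) * ((1 / 2) ^ (-(d + α) : ℝ) - 1), 2 * s₀, ?_, by linarith,
    fun s hs => ?_⟩
  · have := sub_pos.2 h2
    positivity
  · refine le_trans (le_of_eq ?_) (h (s / 2) s (by linarith) (by linarith)).1
    rw [show s / 2 = 1 / 2 * s by ring, Real.mul_rpow (by norm_num) (by linarith)]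
    ring

theorem exists_J_bounds (hα : 0 < α) (hJ : Tendsto κ.J atTop (nhds 0)) {m : ℝ} (hm : 0 < m) :
    ∃ c C : ℝ, 0 < c ∧ 0 < C ∧ ∀ s : ℝ, m ≤ s →
      c * s ^ (-(d + α) : ℝ) ≤ κ.J s ∧ κ.J s ≤ C * s ^ (-(d + α) : ℝ) := by
  obtain ⟨s₀, hs₀, h⟩ := κ.exists_J_sub_bounds hα
  have hD : (0 : ℝ) < d + α := by positivity
  have hlim : Tendsto (fun b : ℝ => b ^ (-(d + α) : ℝ)) atTop (nhds 0) :=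
    tendsto_rpow_neg_atTop hD
  have hlarge : ∀ a, s₀ ≤ a → 1 / (2 * (d + α)) * a ^ (-(d + α) : ℝ) ≤ κ.J a ∧
      κ.J a ≤ 3 / (2 * (d + α)) * a ^ (-(d + α) : ℝ) := by
    intro a ha
    constructor
    · have h1 : Tendsto (fun b : ℝ => 1 / (2 * (d + α)) *
          (a ^ (-(d + α) : ℝ) - b ^ (-(d + α) : ℝ))) atTop
          (nhds (1 / (2 * (d + α)) * (a ^ (-(d + α) : ℝ) - 0))) :=
        (hlim.const_sub _).const_mul _
      have h2 := le_of_tendsto_of_tendsto h1 (hJ.const_sub (κ.J a))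
        (eventually_atTop.2 ⟨a, fun b hb => (h a b ha hb).1⟩)
      simpa using h2
    · have h1 : Tendsto (fun b : ℝ => 3 / (2 * (d + α)) *
          (a ^ (-(d + α) : ℝ) - b ^ (-(d + α) : ℝ))) atTop
          (nhds (3 / (2 * (d + α)) * (a ^ (-(d + α) : ℝ) - 0))) :=
        (hlim.const_sub _).const_mul _
      have h2 := le_of_tendsto_of_tendsto (hJ.const_sub (κ.J a)) h1
        (eventually_atTop.2 ⟨a, fun b hb => (h a b ha hb).2⟩)
      simpa using h2
  have hs₀' : 0 < s₀ := by linarith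
  have hJs₀ : 0 < κ.J s₀ := lt_of_lt_of_le (by positivity) (hlarge s₀ le_rfl).1
  refine ⟨min (1 / (2 * (d + α))) (κ.J s₀ / m ^ (-(d + α) : ℝ)),
    max (3 / (2 * (d + α))) (κ.J m / s₀ ^ (-(d + α) : ℝ)), by positivity,
    lt_max_of_lt_left (by positivity), fun s hs => ?_⟩
  have hs0 : 0 < s := hm.trans_le hs
  rcases le_total s₀ s with h' | h'
  · obtain ⟨h1, h2⟩ := hlarge s h'
    constructor
    · refine le_trans ?_ h1
      gcongr
      exact min_le_left _ _
    · refine h2.trans ?_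
      gcongr
      exact le_max_left _ _
  · constructor
    · refine le_trans ?_ (κ.J_anti (Set.mem_Ioi.2 hs0) (Set.mem_Ioi.2 hs₀') h')
      calc _ ≤ κ.J s₀ / m ^ (-(d + α) : ℝ) * m ^ (-(d + α) : ℝ) := by
            have := Real.rpow_le_rpow_of_nonpos hm hs (by linarith : (-(d + α) : ℝ) ≤ 0)
            gcongr
            exact min_le_right _ _
        _ = _ := by field_simp
    · refine (κ.J_anti (Set.mem_Ioi.2 hm) (Set.mem_Ioi.2 hs0) hs).trans ?_
      have hJm : 0 ≤ κ.J m := κ.J_nonneg m hm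
      calc κ.J m = κ.J m / s₀ ^ (-(d + α) : ℝ) * s₀ ^ (-(d + α) : ℝ) := by
            have : s₀ ^ (-(d + α) : ℝ) ≠ 0 := (Real.rpow_pos_of_pos hs₀' _).ne'
            field_simp
        _ ≤ _ := by
            have := Real.rpow_le_rpow_of_nonpos hs0 h' (by linarith : (-(d + α) : ℝ) ≤ 0)
            gcongr
            exact le_max_right _ _

theorem percolates_of_J_ge (hd : 1 ≤ d) {ε β : ℝ} (hε : 0 < ε) (h : ∀ r, 0 < r → ε ≤ κ.J r)
    (hβ : 0 < β) : κ.percolates β := by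
  intro μ hμ
  rw [κ.edgeP_eq hβ.le] at hμ
  obtain rfl := hμ.eq_perc
  have : Infinite (V d) := by
    have : Nonempty (Fin d) := ⟨⟨0, hd⟩⟩
    exact Pi.infinite_of_right
  have hF : ∀ F : Finset (V d), perc (κ.rate β) {ω | cluster ω 0 ⊆ (F : Set (V d))} = 0 := by
    intro F
    have hn : ∀ n : ℕ, perc (κ.rate β) {ω | cluster ω 0 ⊆ (F : Set (V d))} ≤
        ENNReal.ofReal (Real.exp (-(n * (β * ε)))) := by
      intro n
      obtain ⟨T, hT, hcard⟩ := Set.Infinite.exists_subset_card_eq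
        (s := ((insert 0 F : Finset (V d)) : Set (V d))ᶜ)
        ((insert 0 F : Finset (V d)).finite_toSet.infinite_compl) n
      have hsub : {ω | cluster ω 0 ⊆ (F : Set (V d))} ⊆
          closedOn (T.image fun y => s((0 : V d), y)) := by
        intro ω hω e he
        obtain ⟨y, hy, rfl⟩ := Finset.mem_image.1 he
        rw [← Bool.not_eq_true]
        intro ho
        have := hω (show y ∈ cluster ω 0 from conn_of_open ho)
        have h2 := hT hy
        simp only [Finset.coe_insert, Set.mem_compl_iff, Set.mem_insert_iff, not_or] at h2
        exact h2.2 this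
      refine (measure_mono hsub).trans ?_
      rw [perc_closedOn]
      refine ENNReal.ofReal_le_ofReal (Real.exp_le_exp.2 (neg_le_neg ?_))
      rw [Finset.sum_image fun a _ b _ hab => by
        simp only [Sym2.eq_iff, true_and] at hab
        rcases hab with h | ⟨h, h'⟩
        · exact h
        · rw [h', ← h], ← hcard, ← nsmul_eq_mul]
      refine Finset.card_nsmul_le_sum _ _ _ fun y hy => ?_
      have h2 := hT hy
      simp only [Finset.coe_insert, Set.mem_compl_iff, Set.mem_insert_iff, not_or] at h2
      have hne : (0 : V d) ≠ y := fun h => h2.1 h.symm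
      rw [κ.coe_rate hβ.le, κ.ker_of_ne hne]
      exact mul_le_mul_of_nonneg_left (h _ (κ.nd_pos hne)) hβ.le
    refine le_antisymm (ge_of_tendsto' (x := atTop) ?_ hn) zero_le
    rw [← ENNReal.ofReal_zero]
    refine ENNReal.tendsto_ofReal (Real.tendsto_exp_neg_atTop_nhds_zero.comp ?_)
    exact tendsto_natCast_atTop_atTop.atTop_mul_const (by positivity)
  have hfin : perc (κ.rate β) {ω | (cluster ω (0 : V d)).Finite} = 0 := by
    refine measure_mono_null (t := ⋃ F : Finset (V d), {ω | cluster ω 0 ⊆ (F : Set (V d))}) ?_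
      (measure_iUnion_null hF)
    intro ω hω
    exact Set.mem_iUnion.2 ⟨Set.Finite.toFinset hω, by simp⟩
  rw [pos_iff_ne_zero]
  intro h0
  have h1 : perc (κ.rate β) Set.univ = 0 := by
    refine measure_mono_null (fun ω _ => ?_) (measure_union_null hfin h0)
    by_cases hω : (cluster ω (0 : V d)).Finite
    · exact Or.inl hω
    · exact Or.inr ⟨0, hω⟩
  simp at h1

theorem tendsto_J (hd : 1 ≤ d) (hβc : 0 < κ.betaC) : Tendsto κ.J atTop (nhds 0) := by
  have hex : ∀ ε > 0, ∃ r, 0 < r ∧ κ.J r < ε := by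
    by_contra! hne
    obtain ⟨ε, hε, h⟩ := hne
    have : κ.betaC ≤ κ.betaC / 2 := csInf_le ⟨0, fun β hβ => hβ.1⟩
      ⟨by positivity, κ.percolates_of_J_ge hd hε h (by positivity)⟩
    linarith
  rw [Metric.tendsto_atTop]
  intro ε hε
  obtain ⟨r, hr, hlt⟩ := hex ε hε
  refine ⟨r, fun s hs => ?_⟩
  have h1 := κ.J_anti (Set.mem_Ioi.2 hr) (Set.mem_Ioi.2 (hr.trans_le hs)) hs
  rw [Real.dist_0_eq_abs, abs_of_nonneg (κ.J_nonneg s (hr.trans_le hs))]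
  linarith

/-! ## Translation invariance -/

/-- Rates invariant under translations of the lattice. -/
def TransInv (t : Sym2 (V d) → ℝ≥0) : Prop := ∀ x y z, t s(x + z, y + z) = t s(x, y)

theorem transInv_rate (β : ℝ) : TransInv (κ.rate β) := fun x y z => by
  simp [rate, ker_add]

theorem transInv_rateCut (β r : ℝ) : TransInv (κ.rateCut β r) := fun x y z => by
  simp [rateCut, kerCut_add]

theorem conn_map_add {ω ω' : Config d} {z : V d} (h : ∀ a b, ω' s(a, b) = ω s(a + z, b + z))
    {x y : V d} : Conn ω' x y ↔ Conn ω (x + z) (y + z) := by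
  constructor
  · intro hc
    induction hc with
    | refl => exact conn_refl _ _
    | @tail b c _ hbc ih => exact ih.trans (conn_of_open (by rw [← h]; exact hbc))
  · intro hc
    have gen : ∀ u, Conn ω (x + z) u → Conn ω' x (u - z) := by
      intro u hu
      induction hu with
      | refl => simpa using conn_refl ω' x
      | @tail b c _ hbc ih =>
        refine ih.trans (conn_of_open ?_)
        rw [h]; simpa using hbc
    simpa using gen _ hc

/-- The translation of a configuration. -/
def shift (z : V d) (ω : Config d) : Config d := fun e => ω (e.map (· + z))

theorem conn_shift (z : V d) (ω : Config d) (x y : V d) :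
    Conn (shift z ω) x y ↔ Conn ω (x + z) (y + z) := conn_map_add fun _ _ => rfl

theorem shift_eq_merge (z : V d) : shift z = merge fun e => {e.map (· + z)} := by
  ext ω e; simp [shift, merge]

theorem measurable_shift (z : V d) : Measurable (shift z) := by
  rw [shift_eq_merge]; exact measurable_merge _

theorem map_shift {t : Sym2 (V d) → ℝ≥0} (ht : TransInv t) (z : V d) :
    (perc t).map (shift z) = perc t := by
  rw [shift_eq_merge]
  refine map_merge_perc _ _ _ (fun j k hjk => ?_) fun j => ?_
  · rw [Finset.disjoint_singleton]
    exact fun h => hjk (Sym2.map.injective (add_left_injective z) h)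
  · rw [Finset.sum_singleton]
    induction j with
    | h x y => exact (ht x y z).symm

theorem tau_add {t : Sym2 (V d) → ℝ≥0} (ht : TransInv t) (x y z : V d) :
    tau t (x + z) (y + z) = tau t x y := by
  conv_rhs => rw [tau, ← map_shift ht z,
    Measure.map_apply (measurable_shift z) (measurableSet_conn x y)]
  rw [tau]
  congr 1
  ext ω
  exact (conn_shift z ω x y).symm

theorem tau_eq_zero_sub {t : Sym2 (V d) → ℝ≥0} (ht : TransInv t) (x y : V d) :
    tau t x y = tau t 0 (y - x) := by
  have := tau_add ht 0 (y - x) x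
  simpa using this

theorem sus_eq {t : Sym2 (V d) → ℝ≥0} (ht : TransInv t) (x : V d) : sus t x = sus t 0 := by
  rw [sus, sus, ← (Equiv.subRight x).tsum_eq (fun y => tau t 0 y)]
  exact tsum_congr fun y => tau_eq_zero_sub ht x y

end Kernel

end LRP

namespace LRP

open scoped NNReal

section Indep

variable {ι : Type*}

theorem cutRate_add_compl (s : Set ι) (t : ι → ℝ≥0) : cutRate s t + cutRate sᶜ t = t := by
  ext e
  by_cases h : e ∈ s <;> simp [cutRate, h]

theorem cutRate_le (s : Set ι) (t : ι → ℝ≥0) : cutRate s t ≤ t := by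
  intro e
  by_cases h : e ∈ s <;> simp [cutRate, h]

theorem cutRate_mono (s : Set ι) {t u : ι → ℝ≥0} (h : t ≤ u) : cutRate s t ≤ cutRate s u := by
  intro e
  by_cases he : e ∈ s <;> simp [cutRate, he, h e]

theorem restr_sup_restr (s : Set ι) (ω η : ι → Bool) :
    restr s (restr s ω ⊔ restr sᶜ η) = restr s ω := by
  ext e
  by_cases h : e ∈ s <;> simp [restr, h]

theorem restr_compl_sup_restr (s : Set ι) (ω η : ι → Bool) :
    restr sᶜ (restr s ω ⊔ restr sᶜ η) = restr sᶜ η := by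
  ext e
  by_cases h : e ∈ s <;> simp [restr, h]

theorem perc_eq_lintegral_restr (s : Set ι) (t : ι → ℝ≥0) {A : Set (ι → Bool)}
    (hA : MeasurableSet A) :
    perc t A = ∫⁻ ω, perc t {η | restr s ω ⊔ restr sᶜ η ∈ A} ∂perc t := by
  have hm : MeasurableSet {p : (ι → Bool) × (ι → Bool) | p.1 ⊔ p.2 ∈ A} := measurable_sup hA
  conv_lhs => rw [← cutRate_add_compl s t]
  have hm' : Measurable fun ω => perc (cutRate sᶜ t) {η | ω ⊔ η ∈ A} :=
    measurable_measure_prodMk_left hm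
  rw [perc_add_apply _ _ hA, ← map_restr_perc s t, lintegral_map hm' (measurable_restr s)]
  refine lintegral_congr fun ω => ?_
  rw [← map_restr_perc]
  exact Measure.map_apply (measurable_restr _) (measurable_prodMk_left (x := restr s ω) hm)

/-- Events depending on disjoint sets of edges are independent. -/
theorem perc_inter_restr (s : Set ι) (t : ι → ℝ≥0) {A B : Set (ι → Bool)}
    (hA : MeasurableSet A) (hB : MeasurableSet B) :
    perc t {ω | restr s ω ∈ A ∧ restr sᶜ ω ∈ B} =
      perc t {ω | restr s ω ∈ A} * perc t {ω | restr sᶜ ω ∈ B} := by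
  have hA' : MeasurableSet {ω : ι → Bool | restr s ω ∈ A} := measurable_restr s hA
  have hB' : MeasurableSet {ω : ι → Bool | restr sᶜ ω ∈ B} := measurable_restr sᶜ hB
  rw [show {ω | restr s ω ∈ A ∧ restr sᶜ ω ∈ B} =
    {ω : ι → Bool | restr s ω ∈ A} ∩ {ω | restr sᶜ ω ∈ B} from rfl,
    perc_eq_lintegral_restr s t (hA'.inter hB'), mul_comm]
  rw [← setLIntegral_const, ← lintegral_indicator hA']
  refine lintegral_congr fun ω => ?_
  have h : {η | restr s ω ⊔ restr sᶜ η ∈ {ω | restr s ω ∈ A} ∩ {ω | restr sᶜ ω ∈ B}} =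
      {η | restr s ω ∈ A ∧ restr sᶜ η ∈ B} := by
    ext η
    change restr s _ ∈ A ∧ restr sᶜ _ ∈ B ↔ _
    rw [restr_sup_restr, restr_compl_sup_restr]
    rfl
  rw [h]
  by_cases h : restr s ω ∈ A <;> simp [Set.indicator, h]

end Indep

variable {W : Type*}

/-- The vertices of `Λ` whose cluster is contained in `Λ`. -/
noncomputable def inner (Λ : Finset W) (ω : Sym2 W → Bool) : Finset W :=
  Λ.filter fun z => cluster ω z ⊆ Λ

theorem mem_inner {Λ : Finset W} {ω : Sym2 W → Bool} {z : W} :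
    z ∈ inner Λ ω ↔ cluster ω z ⊆ Λ := by
  rw [inner, Finset.mem_filter]
  exact ⟨And.right, fun h => ⟨h (conn_refl ω z), h⟩⟩

theorem not_mem_inner {Λ : Finset W} {ω : Sym2 W → Bool} {z : W} :
    z ∉ inner Λ ω ↔ ∃ y, Conn ω z y ∧ y ∉ Λ := by
  rw [mem_inner, Set.not_subset]
  rfl

theorem mem_inner_of_conn {Λ : Finset W} {ω : Sym2 W → Bool} {z y : W} (h : Conn ω z y)
    (hz : z ∈ inner Λ ω) : y ∈ inner Λ ω := by
  rw [mem_inner] at hz ⊢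
  exact fun v hv => hz (h.trans hv)

/-- Removing the edges inside `inner Λ ω` does not affect it. -/
theorem inner_eq_of_restr {Λ S : Finset W} {ω : Sym2 W → Bool}
    (h : inner Λ (restr (inS (S : Set W))ᶜ ω) = S) : inner Λ ω = S := by
  ext z
  have h' : z ∈ S ↔ z ∈ inner Λ (restr (inS (S : Set W))ᶜ ω) := by rw [h]
  constructor
  · intro hz
    rw [h', mem_inner]
    exact fun y hy => mem_inner.1 hz (Conn.of_restr hy)
  · intro hz
    by_contra hn
    obtain ⟨y, hy, hyΛ⟩ := not_mem_inner.1 hn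
    have hyS : y ∉ (S : Set W) := fun hyS => by
      rw [Finset.mem_coe, ← h, mem_inner] at hyS
      exact hyΛ (hyS (conn_refl _ _))
    obtain ⟨a, ha, b, hb, hab, hby⟩ := conn_last_exit hy hz hyS
    have ha' : a ∈ inner Λ (restr (inS (S : Set W))ᶜ ω) := by rw [h]; exact ha
    rw [mem_inner] at ha'
    refine hyΛ (ha' ((conn_of_open (?_ : restr (inS (S : Set W))ᶜ ω s(a, b) = true)).trans
      (hby.mono ?_)))
    · rw [restr_apply]
      exact ⟨fun h => hb (mk_mem_inS.1 h).2, hab⟩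
    · exact restr_mono (fun e he he' => by
        induction e with
        | h p q => exact (mk_mem_inS.1 he).1 (mk_mem_inS.1 he').1) ω

theorem inner_restr {Λ : Finset W} {ω : Sym2 W → Bool} :
    inner Λ (restr (inS (inner Λ ω : Set W))ᶜ ω) = inner Λ ω := by
  ext z
  constructor
  · intro hz
    by_contra hn
    obtain ⟨y, hy, hyΛ⟩ := not_mem_inner.1 hn
    refine hyΛ (mem_inner.1 hz (?_ : Conn _ z y))
    clear hz hyΛ
    induction hy using Relation.ReflTransGen.head_induction_on with
    | refl => exact conn_refl _ _
    | @head a b hab _ ih =>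
      have hb : b ∉ inner Λ ω := fun hb =>
        hn (mem_inner_of_conn (conn_comm.1 (conn_of_open hab)) hb)
      refine (conn_of_open ?_).trans (ih hb)
      rw [restr_apply]
      exact ⟨fun h => hb (mk_mem_inS.1 h).2, hab⟩
  · intro hz
    rw [mem_inner] at hz ⊢
    exact fun y hy => hz (Conn.of_restr hy)

variable [Countable W]

theorem measurableSet_cluster_subset (z : W) (Λ : Set W) :
    MeasurableSet {ω : Sym2 W → Bool | cluster ω z ⊆ Λ} := by
  have : {ω : Sym2 W → Bool | cluster ω z ⊆ Λ} = ⋂ y : W, {ω | Conn ω z y → y ∈ Λ} := by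
    ext ω; simp [Set.subset_def, cluster]
  rw [this]
  refine MeasurableSet.iInter fun y => ?_
  by_cases h : y ∈ Λ
  · simp [h]
  · simp only [h, imp_false]; exact (measurableSet_conn z y).compl

theorem measurableSet_inner_eq (Λ S : Finset W) :
    MeasurableSet {ω : Sym2 W → Bool | inner Λ ω = S} := by
  have : {ω : Sym2 W → Bool | inner Λ ω = S} = ⋂ z : W, {ω | cluster ω z ⊆ Λ ↔ z ∈ S} := by
    ext ω; simp [Finset.ext_iff, mem_inner]
  rw [this]
  refine MeasurableSet.iInter fun y => ?_
  by_cases h : y ∈ S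
  · simpa [h] using measurableSet_cluster_subset y Λ
  · simp only [h, iff_false]; exact (measurableSet_cluster_subset y (Λ : Set W)).compl

theorem perc_inner_mul_le (t : Sym2 W → ℝ≥0) (Λ S : Finset W) (o a : W) :
    perc t {ω | inner Λ ω = S} * tau (cutRate (inS (S : Set W)) t) o a ≤
      perc t {ω | inner Λ ω = S ∧ Conn ω o a} := by
  have h1 : {ω : Sym2 W → Bool | inner Λ ω = S} =
      {ω | restr (inS (S : Set W))ᶜ ω ∈ {ω : Sym2 W → Bool | inner Λ ω = S}} := by
    ext ω
    constructor
    · rintro rfl; exact inner_restr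
    · exact inner_eq_of_restr
  have h2 : tau (cutRate (inS (S : Set W)) t) o a =
      perc t {ω | restr (inS (S : Set W)) ω ∈ {ω : Sym2 W → Bool | Conn ω o a}} := by
    rw [tau, ← map_restr_perc, Measure.map_apply (measurable_restr _) (measurableSet_conn _ _)]
    rfl
  rw [h1, h2, mul_comm, ← perc_inter_restr _ _ (measurableSet_conn _ _)
    (measurableSet_inner_eq _ _)]
  refine measure_mono fun ω hω => ⟨inner_eq_of_restr hω.2, Conn.of_restr hω.1⟩

theorem exp_neg_add_le {z m : ℝ} (hz : 0 ≤ z) (hm : z ≤ m) :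
    Real.exp (-z) + (1 - m) * z ≤ 1 := by
  have h1 : Real.exp (-z) ≤ (1 + z)⁻¹ := by
    rw [Real.exp_neg]
    exact inv_anti₀ (by linarith) (by linarith [Real.add_one_le_exp z])
  have h2 : (1 + z)⁻¹ ≤ 1 - z + z ^ 2 := by
    rw [inv_le_iff_one_le_mul₀ (by linarith)]
    nlinarith [pow_nonneg hz 3]
  nlinarith

/-- The boundary functional of Duminil-Copin and Tassion. -/
noncomputable def bdry (t j : Sym2 W → ℝ≥0) (o : W) (S F : Finset W) : ℝ≥0∞ :=
  ∑ a ∈ F, ∑ b ∈ F \ S, j s(a, b) * tau (cutRate (inS (S : Set W)) t) o a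

theorem perc_sprinkle_le (j : Sym2 W → ℝ≥0) (h m : ℝ≥0) {o : W} {Λ F : Finset W}
    {ω : Sym2 W → Bool} (hm : ∑ a ∈ F, ∑ b ∈ F, h * j s(a, b) ≤ m) (hm1 : m ≤ 1)
    (ho : o ∈ inner Λ ω) :
    perc (h • j) {η | cluster (ω ⊔ η) o ⊆ Λ} + (1 - m : ℝ≥0) * h *
      ∑ a ∈ F, ∑ b ∈ F \ inner Λ ω, j s(a, b) * (if Conn ω o a then 1 else 0 : ℝ≥0∞) ≤ 1 := by
  set P : Finset (W × W) := (F ×ˢ (F \ inner Λ ω)).filter fun p => Conn ω o p.1 with hP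
  set E : Finset (Sym2 W) := P.image fun p => s(p.1, p.2) with hE
  have hin : ∀ p ∈ P, p.1 ∈ inner Λ ω ∧ p.2 ∉ inner Λ ω ∧ p.1 ∈ F ∧ p.2 ∈ F ∧ Conn ω o p.1 := by
    intro p hp
    simp only [hP, Finset.mem_filter, Finset.mem_product, Finset.mem_sdiff] at hp
    exact ⟨mem_inner_of_conn hp.2 ho, hp.1.2.2, hp.1.1, hp.1.2.1, hp.2⟩
  have hsub : {η | cluster (ω ⊔ η) o ⊆ Λ} ⊆ closedOn E := by
    intro η hη e he
    obtain ⟨p, hp, rfl⟩ := Finset.mem_image.1 he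
    obtain ⟨h1, h2, -, -, h3⟩ := hin p hp
    rw [← Bool.not_eq_true]
    intro ho'
    obtain ⟨y, hy, hyΛ⟩ := not_mem_inner.1 h2
    refine hyΛ (hη (((h3.mono le_sup_left).trans (conn_of_open ?_)).trans (hy.mono le_sup_left)))
    simp [ho']
  have hinj : Set.InjOn (fun p : W × W => s(p.1, p.2)) P := by
    intro p hp q hq hpq
    simp only [Sym2.eq_iff] at hpq
    rcases hpq with ⟨h1, h2⟩ | ⟨h1, h2⟩
    · exact Prod.ext h1 h2
    · exact absurd (h1 ▸ (hin p hp).1) (hin q hq).2.1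
  have hsum : ∑ e ∈ E, ((h • j) e : ℝ) = ((h * ∑ p ∈ P, j s(p.1, p.2) : ℝ≥0) : ℝ) := by
    rw [hE, Finset.sum_image hinj, Finset.mul_sum]
    simp
  have hW : ∑ a ∈ F, ∑ b ∈ F \ inner Λ ω, j s(a, b) * (if Conn ω o a then 1 else 0 : ℝ≥0∞) =
      ((∑ p ∈ P, j s(p.1, p.2) : ℝ≥0) : ℝ≥0∞) := by
    rw [← Finset.sum_product', hP, Finset.sum_filter]
    push_cast
    exact Finset.sum_congr rfl fun p _ => by split_ifs <;> simp
  have hle : h * ∑ p ∈ P, j s(p.1, p.2) ≤ m := by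
    refine le_trans ?_ hm
    rw [Finset.mul_sum, ← Finset.sum_product']
    exact Finset.sum_le_sum_of_subset fun p hp =>
      Finset.mem_product.2 ⟨(hin p hp).2.2.1, (hin p hp).2.2.2.1⟩
  refine (add_le_add_left (measure_mono hsub) _).trans ?_
  rw [perc_closedOn, hsum, hW, mul_assoc, ← ENNReal.coe_mul, ← ENNReal.coe_mul,
    ← ENNReal.ofReal_coe_nnreal, ← ENNReal.ofReal_add (Real.exp_pos _).le (by positivity),
    ← ENNReal.ofReal_one]
  refine ENNReal.ofReal_le_ofReal ?_
  rw [NNReal.coe_mul (1 - m), NNReal.coe_sub hm1]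
  exact exp_neg_add_le (by positivity) (by exact_mod_cast hle)

theorem perc_sprinkle (t j : Sym2 W → ℝ≥0) (h m : ℝ≥0) (c : ℝ≥0∞) {o : W} {Λ F : Finset W}
    (hm : ∑ a ∈ F, ∑ b ∈ F, h * j s(a, b) ≤ m) (hm1 : m ≤ 1)
    (hc : ∀ S ⊆ Λ, o ∈ S → c ≤ bdry t j o S F) :
    perc (t + h • j) {ω | cluster ω o ⊆ Λ} +
      (1 - m : ℝ≥0) * h * c * perc t {ω | cluster ω o ⊆ Λ} ≤ perc t {ω | cluster ω o ⊆ Λ} := by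
  have hA := measurableSet_cluster_subset (o : W) (Λ : Set W)
  set Q : Finset (Finset W) := Λ.powerset.filter fun S => o ∈ S with hQ
  have hpart : perc t {ω | cluster ω o ⊆ Λ} = ∑ S ∈ Q, perc t {ω | inner Λ ω = S} := by
    rw [← measure_biUnion_finset]
    · congr 1
      ext ω
      simp only [Set.mem_iUnion, Set.mem_ofPred_eq, hQ, Finset.mem_filter, Finset.mem_powerset,
        exists_prop, exists_eq_right']
      rw [← mem_inner]
      exact ⟨fun h => ⟨Finset.filter_subset _ _, h⟩, And.right⟩
    · intro S _ S' _ hne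
      rw [Function.onFun, Set.disjoint_left]
      exact fun ω h1 h2 => hne (h1.symm.trans h2)
    · exact fun S _ => measurableSet_inner_eq Λ S
  set g : (Sym2 W → Bool) → ℝ≥0∞ := fun ω => ∑ S ∈ Q, ∑ a ∈ F, ∑ b ∈ F \ S,
    j s(a, b) * {ω | inner Λ ω = S ∧ Conn ω o a}.indicator 1 ω with hg
  have hmS : ∀ S a, MeasurableSet {ω : Sym2 W → Bool | inner Λ ω = S ∧ Conn ω o a} := fun S a =>
    (measurableSet_inner_eq Λ S).inter (measurableSet_conn o a)
  have hgm : ∀ S a b, Measurable fun ω => (j s(a, b) : ℝ≥0∞) *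
      {ω | inner Λ ω = S ∧ Conn ω o a}.indicator 1 ω := fun S a b =>
    (measurable_const.indicator (hmS S a)).const_mul _
  have hgmeas : Measurable g := Finset.measurable_fun_sum _ fun S _ =>
    Finset.measurable_fun_sum _ fun a _ => Finset.measurable_fun_sum _ fun b _ => hgm S a b
  have hgint : c * perc t {ω | cluster ω o ⊆ Λ} ≤ ∫⁻ ω, g ω ∂perc t := by
    rw [hg, lintegral_finsetSum' _ fun S _ => (Finset.measurable_fun_sum _ fun a _ =>
      Finset.measurable_fun_sum _ fun b _ => hgm S a b).aemeasurable, hpart, Finset.mul_sum]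
    refine Finset.sum_le_sum fun S hS => ?_
    rw [hQ, Finset.mem_filter, Finset.mem_powerset] at hS
    rw [lintegral_finsetSum _ fun a _ => Finset.measurable_fun_sum _ fun b _ => hgm S a b]
    refine (mul_le_mul_left (hc S hS.1 hS.2) _).trans ?_
    rw [bdry, Finset.sum_mul]
    refine Finset.sum_le_sum fun a _ => ?_
    rw [lintegral_finsetSum _ fun b _ => hgm S a b, Finset.sum_mul]
    refine Finset.sum_le_sum fun b _ => ?_
    rw [lintegral_const_mul _ (measurable_one.indicator (hmS S a)), lintegral_indicator_one (hmS S a),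
      mul_assoc, mul_comm (tau _ _ _)]
    exact mul_le_mul_right (perc_inner_mul_le t Λ S o a) _
  have hgval : ∀ ω, o ∈ inner Λ ω → g ω = ∑ a ∈ F, ∑ b ∈ F \ inner Λ ω,
      j s(a, b) * (if Conn ω o a then 1 else 0 : ℝ≥0∞) := by
    intro ω hω
    rw [hg]
    simp only
    rw [Finset.sum_eq_single (inner Λ ω)]
    · refine Finset.sum_congr rfl fun a _ => Finset.sum_congr rfl fun b _ => ?_
      simp [Set.indicator]
    · intro S _ hS
      refine Finset.sum_eq_zero fun a _ => Finset.sum_eq_zero fun b _ => ?_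
      simp [Set.indicator, hS.symm]
    · intro hn
      refine absurd (?_ : inner Λ ω ∈ Q) hn
      rw [hQ, Finset.mem_filter, Finset.mem_powerset]
      exact ⟨Finset.filter_subset _ _, hω⟩
  have hgzero : ∀ ω, o ∉ inner Λ ω → g ω = 0 := by
    intro ω hω
    refine Finset.sum_eq_zero fun S hS => Finset.sum_eq_zero fun a _ =>
      Finset.sum_eq_zero fun b _ => ?_
    rw [hQ, Finset.mem_filter] at hS
    have : inner Λ ω ≠ S := fun h => hω (h ▸ hS.2)
    simp [Set.indicator, this]
  calc _ ≤ (∫⁻ ω, perc (h • j) {η | cluster (ω ⊔ η) o ⊆ Λ} ∂perc t) +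
        ∫⁻ ω, (1 - m : ℝ≥0) * h * g ω ∂perc t := by
        rw [perc_add_apply _ _ hA, lintegral_const_mul _ hgmeas, mul_assoc]
        exact add_le_add le_rfl (mul_le_mul_right hgint _)
    _ = ∫⁻ ω, (perc (h • j) {η | cluster (ω ⊔ η) o ⊆ Λ} + (1 - m : ℝ≥0) * h * g ω) ∂perc t :=
        (lintegral_add_right _ (hgmeas.const_mul _)).symm
    _ ≤ ∫⁻ ω, {ω | cluster ω o ⊆ (Λ : Set W)}.indicator 1 ω ∂perc t := by
        refine lintegral_mono fun ω => ?_
        by_cases hω : o ∈ inner Λ ω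
        · rw [Set.indicator_of_mem (mem_inner.1 hω : ω ∈ {ω | cluster ω o ⊆ (Λ : Set W)}),
            hgval ω hω]
          exact perc_sprinkle_le j h m hm hm1 hω
        · have he : {η | cluster (ω ⊔ η) o ⊆ (Λ : Set W)} = ∅ := by
            ext η
            obtain ⟨y, hy, hyΛ⟩ := not_mem_inner.1 hω
            simp only [Set.mem_ofPred_eq, Set.mem_empty_iff_false, iff_false]
            exact fun hη => hyΛ (hη (hy.mono le_sup_left))
          rw [hgzero ω hω, he]
          simp
    _ = _ := lintegral_indicator_one hA

theorem bdry_mono {t t' j : Sym2 W → ℝ≥0} (h : t ≤ t') (o : W) (S F : Finset W) :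
    bdry t j o S F ≤ bdry t' j o S F :=
  Finset.sum_le_sum fun _ _ => Finset.sum_le_sum fun _ _ =>
    mul_le_mul_right (tau_mono (cutRate_mono _ h) _ _) _

theorem perc_cluster_subset_le_exp (j : Sym2 W → ℝ≥0) (β s c : ℝ≥0) {o : W} {Λ F : Finset W}
    (hc : ∀ S ⊆ Λ, o ∈ S → (c : ℝ≥0∞) ≤ bdry (β • j) j o S F) :
    perc ((β + s) • j) {ω | cluster ω o ⊆ Λ} ≤ ENNReal.ofReal (Real.exp (-(s * c))) := by
  set w : ℝ≥0 := ∑ a ∈ F, ∑ b ∈ F, j s(a, b) with hw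
  have hn : ∀ᶠ n : ℕ in atTop, perc ((β + s) • j) {ω | cluster ω o ⊆ Λ} ≤
      ENNReal.ofReal (Real.exp (-((1 - s * w / n) * (s * c)))) := by
    filter_upwards [eventually_ge_atTop (max 1 ⌈(s * w : ℝ≥0)⌉₊)] with n hn
    have hn0 : (0 : ℝ≥0) < n := by exact_mod_cast (le_max_left _ _).trans hn
    set h : ℝ≥0 := s / n with hh
    have hm1 : h * w ≤ 1 := by
      rw [hh, div_mul_eq_mul_div]
      refine div_le_one_of_le₀ ((Nat.le_ceil _).trans ?_) hn0.le
      exact_mod_cast (le_max_right _ _).trans hn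
    have hm : ∑ a ∈ F, ∑ b ∈ F, h * j s(a, b) ≤ h * w := by
      rw [hw, Finset.mul_sum]
      exact Finset.sum_le_sum fun a _ => by rw [Finset.mul_sum]
    set k : ℝ := (1 - h * w) * (h * c) with hk
    have hk0 : 0 ≤ k := mul_nonneg (sub_nonneg.2 (by exact_mod_cast hm1)) (by positivity)
    have step : ∀ i : ℕ, perc ((β + i * h) • j) {ω | cluster ω o ⊆ Λ} ≤
        ENNReal.ofReal (Real.exp (-(i * k))) := by
      intro i
      induction i with
      | zero => simpa using prob_le_one
      | succ i ih =>
        have h1 := perc_sprinkle ((β + i * h) • j) j h (h * w) c hm hm1 fun S hS ho =>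
          (hc S hS ho).trans (bdry_mono (fun e => mul_le_mul_left (le_add_right le_rfl) _) o S F)
        rw [show (β + i * h) • j + h • j = (β + (i + 1 : ℕ) * h) • j by
          rw [← add_smul]; congr 1; push_cast; ring] at h1
        set p' := perc ((β + (i + 1 : ℕ) * h) • j) {ω | cluster ω o ⊆ Λ}
        set p := perc ((β + i * h) • j) {ω | cluster ω o ⊆ Λ}
        have hp : p ≠ ∞ := measure_ne_top _ _
        have hp' : p' ≠ ∞ := measure_ne_top _ _
        have h2 : p'.toReal + k * p.toReal ≤ p.toReal := by
          have := ENNReal.toReal_mono hp h1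
          rw [ENNReal.toReal_add hp' (ENNReal.mul_ne_top (by finiteness) hp)] at this
          simp only [ENNReal.toReal_mul, ENNReal.coe_toReal, NNReal.coe_sub hm1] at this
          convert this using 2
          rw [hk]
          push_cast
          ring
        rw [← ENNReal.ofReal_toReal hp] at ih
        have ih' := (ENNReal.ofReal_le_ofReal_iff (Real.exp_pos _).le).1 ih
        rw [← ENNReal.ofReal_toReal hp']
        refine ENNReal.ofReal_le_ofReal ?_
        have h3 : 1 - k ≤ Real.exp (-k) := by linarith [Real.add_one_le_exp (-k)]
        calc p'.toReal ≤ p.toReal * (1 - k) := by linarith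
          _ ≤ p.toReal * Real.exp (-k) := mul_le_mul_of_nonneg_left h3 ENNReal.toReal_nonneg
          _ ≤ Real.exp (-(i * k)) * Real.exp (-k) :=
              mul_le_mul_of_nonneg_right ih' (Real.exp_pos _).le
          _ = _ := by rw [← Real.exp_add]; congr 1; push_cast; ring
    have hns := step n
    have e1 : (n : ℝ≥0) * h = s := by rw [hh]; field_simp
    have hn0' : (n : ℝ) ≠ 0 := by exact_mod_cast hn0.ne'
    rw [e1] at hns
    refine hns.trans (le_of_eq ?_)
    congr 3
    rw [hk, hh]
    push_cast
    field_simp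
  refine ge_of_tendsto (ENNReal.tendsto_ofReal ?_) hn
  refine (Real.continuous_exp.tendsto _).comp ?_
  have h1 : Tendsto (fun n : ℕ => (s * w : ℝ) / n) atTop (nhds 0) :=
    tendsto_const_div_atTop_nhds_zero_nat _
  have h2 := ((h1.const_sub 1).mul_const ((s : ℝ) * c)).neg
  simpa using h2

/-- The full boundary functional. -/
noncomputable def bdryInf (t j : Sym2 W → ℝ≥0) (o : W) (S : Finset W) : ℝ≥0∞ :=
  ∑' a, ∑' b, if b ∈ S then 0 else j s(a, b) * tau (cutRate (inS (S : Set W)) t) o a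

theorem exists_bdry_ge {t j : Sym2 W → ℝ≥0} {o : W} {S : Finset W} {c : ℝ≥0∞}
    (h : c < bdryInf t j o S) : ∃ F : Finset W, ∀ F', F ⊆ F' → c ≤ bdry t j o S F' := by
  rw [bdryInf, ← ENNReal.tsum_prod, ENNReal.tsum_eq_iSup_sum, lt_iSup_iff] at h
  obtain ⟨P, hP⟩ := h
  refine ⟨P.image Prod.fst ∪ P.image Prod.snd, fun F' hF => hP.le.trans ?_⟩
  have hb : bdry t j o S F' = ∑ p ∈ F' ×ˢ F', if p.2 ∈ S then 0 else
      j s(p.1, p.2) * tau (cutRate (inS (S : Set W)) t) o p.1 := by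
    rw [Finset.sum_product, bdry]
    refine Finset.sum_congr rfl fun a _ => ?_
    rw [← Finset.sum_subset (Finset.sdiff_subset (s := F') (t := S))]
    · exact Finset.sum_congr rfl fun b hb => by rw [if_neg (Finset.mem_sdiff.1 hb).2]
    · intro b hb hb'
      rw [if_pos]
      simpa [hb] using hb'
  rw [hb]
  refine Finset.sum_le_sum_of_subset fun p hp => Finset.mem_product.2 ⟨hF ?_, hF ?_⟩
  · exact Finset.mem_union_left _ (Finset.mem_image_of_mem _ hp)
  · exact Finset.mem_union_right _ (Finset.mem_image_of_mem _ hp)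

theorem perc_finite_lt_one (j : Sym2 W → ℝ≥0) (β s c : ℝ≥0) {o : W} (hs : 0 < s) (hc0 : 0 < c)
    (hc : ∀ S : Finset W, o ∈ S → (c : ℝ≥0∞) < bdryInf (β • j) j o S) :
    perc ((β + s) • j) {ω | (cluster ω o).Finite} < 1 := by
  have h1 : {ω : Sym2 W → Bool | (cluster ω o).Finite} =
      ⋃ Λ : Finset W, {ω | cluster ω o ⊆ Λ} := by
    ext ω
    simp only [Set.mem_ofPred_eq, Set.mem_iUnion]
    exact ⟨fun h => ⟨h.toFinset, by simp⟩, fun ⟨Λ, h⟩ => Λ.finite_toSet.subset h⟩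
  rw [h1, Directed.measure_iUnion]
  · refine lt_of_le_of_lt (iSup_le fun Λ => ?_)
      (?_ : ENNReal.ofReal (Real.exp (-(s * c))) < 1)
    · choose! F hF using fun S (hS : o ∈ S) => exists_bdry_ge (hc S hS)
      refine perc_cluster_subset_le_exp j β s c (F := Λ.powerset.biUnion F) fun S hS ho => ?_
      exact hF S ho _ (Finset.subset_biUnion_of_mem F (Finset.mem_powerset.2 hS))
    · rw [← ENNReal.ofReal_one]
      refine (ENNReal.ofReal_lt_ofReal_iff one_pos).2 (Real.exp_lt_one_iff.2 ?_)
      have : (0 : ℝ) < s * c := by exact_mod_cast mul_pos hs hc0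
      linarith
  · refine Monotone.directed_le fun Λ Λ' h ω hω => ?_
    exact Set.Subset.trans hω (Finset.coe_subset.2 h)

theorem tau_cutRate (s : Set (Sym2 W)) (t : Sym2 W → ℝ≥0) (x y : W) :
    tau (cutRate s t) x y = perc t {ω | Conn (restr s ω) x y} := by
  rw [tau, ← map_restr_perc, Measure.map_apply (measurable_restr _) (measurableSet_conn _ _)]
  rfl

theorem tau_inS_eq_zero {S : Set W} (t : Sym2 W → ℝ≥0) {x y : W} (hx : x ∈ S) (hy : y ∉ S) :
    tau (cutRate (inS S) t) x y = 0 := by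
  rw [tau_cutRate]
  refine measure_mono_null (t := ∅) (fun ω hω => hy (conn_inS_mem hx hω)) measure_empty

theorem sus_inS_le (S : Finset W) (t : Sym2 W → ℝ≥0) {x : W} (hx : x ∈ S) :
    sus (cutRate (inS (S : Set W)) t) x ≤ S.card := by
  rw [sus, tsum_eq_sum (s := S) fun y hy => tau_inS_eq_zero t (S := (S : Set W)) hx hy]
  refine (Finset.sum_le_sum fun y _ => tau_le_one _ x y).trans ?_
  simp

theorem sus_cutRate_finset_le (s : Finset (Sym2 W)) (t : Sym2 W → ℝ≥0) (x : W) :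
    sus (cutRate (s : Set (Sym2 W)) t) x ≤ ((1 + ∑ e ∈ s, e.toFinset.card : ℕ) : ℝ≥0∞) := by
  have h0 : ∀ y ∉ insert x (s.biUnion fun e => e.toFinset),
      tau (cutRate (s : Set (Sym2 W)) t) x y = 0 := by
    intro y hy
    simp only [Finset.mem_insert, Finset.mem_biUnion, Sym2.mem_toFinset, not_or, not_exists,
      not_and] at hy
    rw [tau_cutRate]
    refine measure_mono_null (t := ∅) (fun ω hω => ?_) measure_empty
    rcases Relation.ReflTransGen.cases_tail hω with h | ⟨b, -, hb⟩
    · exact hy.1 h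
    · rw [restr_apply] at hb
      exact hy.2 _ hb.1 (Sym2.mem_mk_right _ _)
  rw [sus, tsum_eq_sum h0]
  refine (Finset.sum_le_sum fun y _ => tau_le_one _ x y).trans ?_
  rw [Finset.sum_const, nsmul_one, Nat.cast_le]
  refine (Finset.card_insert_le _ _).trans ?_
  rw [add_comm]
  exact add_le_add le_rfl Finset.card_biUnion_le

theorem sus_le_of_cutRate {t : Sym2 W → ℝ≥0} {x : W} {C : ℝ≥0∞}
    (h : ∀ s : Finset (Sym2 W), sus (cutRate (s : Set (Sym2 W)) t) x ≤ C) : sus t x ≤ C := by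
  rw [sus, ENNReal.tsum_eq_iSup_sum]
  refine iSup_le fun F => ?_
  simp only [tau_eq_iSup t]
  rw [ENNReal.finsetSum_iSup]
  · exact iSup_le fun s => (ENNReal.sum_le_tsum F).trans (h s)
  · intro s s'
    refine ⟨s ∪ s', fun y => ⟨tau_mono ?_ x y, tau_mono ?_ x y⟩⟩ <;> intro e <;>
      simp only [cutRate, Finset.coe_union, Set.mem_union] <;> split_ifs <;> simp_all

/-- Summing the two-layer inequality over the endpoint. -/
theorem sus_add_le (t u : Sym2 W → ℝ≥0) (x : W) :
    sus (t + u) x ≤ sus t x + ∑' a, ∑' b, tau t x a * u s(a, b) * sus (t + u) b := by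
  calc _ ≤ ∑' y, (tau t x y + ∑' a, ∑' b, tau t x a * u s(a, b) * tau (t + u) b y) :=
        ENNReal.tsum_le_tsum fun y => tau_add_le t u x y
    _ = _ := by
        rw [ENNReal.tsum_add, ENNReal.tsum_comm]
        congr 1
        refine tsum_congr fun a => ?_
        rw [ENNReal.tsum_comm]
        refine tsum_congr fun b => ?_
        rw [ENNReal.tsum_mul_left]
        rfl

end LRP

namespace LRP

open scoped NNReal

namespace Kernel

variable {d : ℕ} {α : ℝ} (κ : Kernel d α)

/-! ## Sharpness of the phase transition -/

theorem map_shift_perc (t : Sym2 (V d) → ℝ≥0) (z : V d) :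
    (perc t).map (shift z) = perc fun e => t (e.map (· + z)) := by
  rw [shift_eq_merge]
  refine map_merge_perc _ _ _ (fun j k hjk => ?_) fun j => ?_
  · rw [Finset.disjoint_singleton]
    exact fun h => hjk (Sym2.map.injective (add_left_injective z) h)
  · rw [Finset.sum_singleton]

theorem tau_shift (t : Sym2 (V d) → ℝ≥0) (x y z : V d) :
    tau t (x + z) (y + z) = tau (fun e => t (e.map (· + z))) x y := by
  rw [tau, tau, ← map_shift_perc, Measure.map_apply (measurable_shift z) (measurableSet_conn x y)]
  congr 1
  ext ω
  exact (conn_shift z ω x y).symm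

theorem TransInv.map {t : Sym2 (V d) → ℝ≥0} (ht : TransInv t) (z : V d) (e : Sym2 (V d)) :
    t (e.map (· + z)) = t e := by
  induction e with
  | h x y => exact ht x y z

theorem bdryInf_shift {t : Sym2 (V d) → ℝ≥0} (ht : TransInv t) (S : Finset (V d)) (x : V d) :
    bdryInf t t x (S.image (· + x)) = bdryInf t t 0 S := by
  have hmem : ∀ y, y + x ∈ S.image (· + x) ↔ y ∈ S := fun y => by simp
  rw [bdryInf, bdryInf, ← (Equiv.addRight x).tsum_eq]
  refine tsum_congr fun a => ?_
  rw [← (Equiv.addRight x).tsum_eq]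
  refine tsum_congr fun b => ?_
  simp only [Equiv.coe_addRight, hmem, ht a b x]
  have h := tau_shift (cutRate (inS ((S.image (· + x) : Finset (V d)) : Set (V d))) t) 0 a x
  rw [zero_add] at h
  rw [h]
  congr 4
  ext e
  have : e.map (· + x) ∈ inS ((S.image (· + x) : Finset (V d)) : Set (V d)) ↔
      e ∈ inS (S : Set (V d)) := by
    induction e with
    | h p q => simp only [Sym2.map_mk, mk_mem_inS, Finset.mem_coe, hmem]
  simp only [cutRate, this, ht.map x e]

theorem sus_lt_top_of_bdry {t : Sym2 (V d) → ℝ≥0} (ht : TransInv t) {S : Finset (V d)}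
    (h0 : (0 : V d) ∈ S) (hS : bdryInf t t 0 S < 1) : sus t 0 < ∞ := by
  set φ := bdryInf t t 0 S with hφ
  refine lt_of_le_of_lt (b := (S.card : ℝ≥0∞) / (1 - φ))
    (sus_le_of_cutRate fun s => ?_) ?_
  · set t' := cutRate (s : Set (Sym2 (V d))) t with ht'
    set M := ⨆ x, sus t' x with hM
    have hMtop : M ≠ ∞ := ne_top_of_le_ne_top (ENNReal.natCast_ne_top _)
      (iSup_le fun x => sus_cutRate_finset_le s t x)
    have hrec : M ≤ S.card + φ * M := by
      refine iSup_le fun x => ?_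
      set Sx := S.image (· + x) with hSx
      have hx : x ∈ Sx := Finset.mem_image.2 ⟨0, h0, zero_add x⟩
      have h1 := sus_add_le (cutRate (inS (Sx : Set (V d))) t')
        (cutRate (inS (Sx : Set (V d)))ᶜ t') x
      rw [cutRate_add_compl] at h1
      refine h1.trans (add_le_add ((sus_inS_le Sx t' hx).trans ?_) ?_)
      · exact_mod_cast Finset.card_image_le
      · rw [hφ, ← bdryInf_shift ht S x, bdryInf, ← ENNReal.tsum_mul_right]
        refine ENNReal.tsum_le_tsum fun a => ?_
        rw [← ENNReal.tsum_mul_right]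
        refine ENNReal.tsum_le_tsum fun b => ?_
        by_cases ha : a ∈ Sx
        · by_cases hb : b ∈ Sx
          · have : cutRate (inS (Sx : Set (V d)))ᶜ t' s(a, b) = 0 := by
              rw [cutRate, if_neg]
              exact fun h => h (mk_mem_inS.2 ⟨ha, hb⟩)
            simp [this]
          · rw [if_neg hb, mul_comm (tau _ _ _)]
            refine mul_le_mul' (mul_le_mul' ?_ (tau_mono ?_ _ _)) (le_iSup (sus t') b)
            · exact ENNReal.coe_le_coe.2 ((cutRate_le _ _ _).trans (cutRate_le _ _ _))
            · exact cutRate_mono _ (cutRate_le _ _)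
        · rw [tau_inS_eq_zero t' (S := (Sx : Set (V d))) hx ha]
          simp
    refine (le_iSup (sus t') 0).trans ?_
    rw [ENNReal.le_div_iff_mul_le (Or.inl (tsub_pos_of_lt hS).ne')
      (Or.inl (ne_top_of_le_ne_top one_ne_top tsub_le_self)),
      ENNReal.mul_sub fun _ _ => hMtop, mul_one, mul_comm M φ, tsub_le_iff_right]
    exact hrec
  · exact ENNReal.div_lt_top (ENNReal.natCast_ne_top _) (tsub_pos_of_lt hS).ne'

theorem rate_eq_smul {β : ℝ} (hβ : 0 ≤ β) : κ.rate β = β.toNNReal • κ.rate 1 := by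
  ext e
  induction e with
  | h x y =>
    rw [κ.coe_rate hβ]
    simp [κ.coe_rate zero_le_one, hβ]

/-- The expected cluster size is finite below the critical point. -/
theorem sus_rate_lt_top {β : ℝ} (hβ : 0 < β) (hβc : β < κ.betaC) : sus (κ.rate β) 0 < ∞ := by
  by_contra hinf
  have hφ : ∀ S : Finset (V d), 0 ∈ S → 1 ≤ bdryInf (κ.rate β) (κ.rate β) 0 S := by
    intro S hS
    by_contra! h
    exact hinf (sus_lt_top_of_bdry (κ.transInv_rate β) hS h)
  set b : ℝ≥0 := β.toNNReal with hb
  have hb0 : 0 < b := Real.toNNReal_pos.2 hβ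
  have hrb : κ.rate β = b • κ.rate 1 := κ.rate_eq_smul hβ.le
  have hc : ∀ S : Finset (V d), 0 ∈ S →
      ((2 * b)⁻¹ : ℝ≥0) < bdryInf (b • κ.rate 1) (κ.rate 1) 0 S := by
    intro S hS
    have h1 := hφ S hS
    rw [hrb] at h1
    have h2 : bdryInf (b • κ.rate 1) (b • κ.rate 1) 0 S =
        b * bdryInf (b • κ.rate 1) (κ.rate 1) 0 S := by
      rw [bdryInf, bdryInf, ← ENNReal.tsum_mul_left]
      refine tsum_congr fun x => ?_
      rw [← ENNReal.tsum_mul_left]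
      refine tsum_congr fun y => ?_
      split_ifs
      · simp
      · simp [mul_assoc]
    rw [h2] at h1
    by_contra! h3
    have h4 : (1 : ℝ≥0∞) ≤ ((b * (2 * b)⁻¹ : ℝ≥0) : ℝ≥0∞) := by
      rw [ENNReal.coe_mul]
      exact h1.trans (mul_le_mul_right h3 _)
    have h5 : b * (2 * b)⁻¹ = (2⁻¹ : ℝ≥0) := by field_simp
    rw [h5] at h4
    have : (1 : ℝ≥0) ≤ 2⁻¹ := by exact_mod_cast h4
    exact absurd this (by norm_num)
  set β' := (β + κ.betaC) / 2 with hβ'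
  have hperc : κ.percolates β' := by
    intro μ hμ
    have hβ'0 : 0 ≤ β' := by rw [hβ']; linarith
    rw [κ.edgeP_eq hβ'0] at hμ
    obtain rfl := hμ.eq_perc
    have h1 := perc_finite_lt_one (κ.rate 1) b (β' - β).toNNReal (2 * b)⁻¹ (o := (0 : V d))
      (Real.toNNReal_pos.2 (by rw [hβ']; linarith)) (by positivity) hc
    rw [hb, ← Real.toNNReal_add hβ.le (by rw [hβ']; linarith), add_sub_cancel,
      ← κ.rate_eq_smul hβ'0] at h1
    rw [pos_iff_ne_zero]
    intro h0
    have h2 : perc (κ.rate β') Set.univ ≤ perc (κ.rate β') {ω | (cluster ω (0 : V d)).Finite} +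
        perc (κ.rate β') {ω | ∃ x : V d, (cluster ω x).Infinite} := by
      refine (measure_mono fun ω _ => ?_).trans (measure_union_le _ _)
      by_cases hω : (cluster ω (0 : V d)).Finite
      · exact Or.inl hω
      · exact Or.inr ⟨0, hω⟩
    rw [h0, add_zero, measure_univ] at h2
    exact absurd h1 (not_lt.2 h2)
  have : κ.betaC ≤ β' := csInf_le ⟨0, fun β hβ => hβ.1⟩ ⟨by rw [hβ']; linarith, hperc⟩
  rw [hβ'] at this
  linarith

end Kernel

end LRP

namespace LRP

open scoped NNReal

namespace Kernel

variable {d : ℕ} {α : ℝ} (κ : Kernel d α)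

/-! ## The susceptibility and the tail of the two-point function of the cut-off model -/

theorem J_pos (hα : 0 < α) (hJ : Tendsto κ.J atTop (nhds 0)) {r : ℝ} (hr : 0 < r) : 0 < κ.J r := by
  obtain ⟨c, C, hc, -, h⟩ := κ.exists_J_bounds hα hJ hr
  exact lt_of_lt_of_le (mul_pos hc (Real.rpow_pos_of_pos hr _)) (h r le_rfl).1

theorem sus_rateCut_lt_top (hα : 0 < α) (hJ : Tendsto κ.J atTop (nhds 0)) (hβc : 0 < κ.betaC)
    {r : ℝ} (hr : 0 < r) : sus (κ.rateCut κ.betaC r) 0 < ∞ := by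
  obtain ⟨c, hc, -, hcmin⟩ := κ.exists_min_nr
  have hJr := κ.J_pos hα hJ hr
  have hJc := κ.J_pos hα hJ hc
  set ε := min (1 / 2) (κ.J r / κ.J c) with hε
  have hε0 : 0 < ε := by positivity
  have hε1 : ε ≤ 1 / 2 := min_le_left _ _
  have hle : κ.rateCut κ.betaC r ≤ κ.rate ((1 - ε) * κ.betaC) := by
    intro e
    induction e with
    | h x y =>
      rw [← NNReal.coe_le_coe, κ.coe_rateCut hβc.le,
        κ.coe_rate (mul_nonneg (by linarith) hβc.le)]
      by_cases hxy : x = y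
      · rw [hxy, kerCut_self, ker_self]; simp
      · rw [κ.kerCut_eq hr hxy, κ.ker_of_ne hxy, mul_comm (1 - ε), mul_assoc]
        refine mul_le_mul_of_nonneg_left (max_le ?_ ?_) hβc.le
        · have h1 : κ.J (κ.nd x y) ≤ κ.J c := by
            refine κ.J_anti (Set.mem_Ioi.2 hc) (Set.mem_Ioi.2 (κ.nd_pos hxy)) ?_
            rw [nd_eq]
            exact hcmin _ (sub_ne_zero.2 hxy)
          have h2 : ε * κ.J (κ.nd x y) ≤ κ.J r := by
            calc ε * κ.J (κ.nd x y) ≤ κ.J r / κ.J c * κ.J c :=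
                  mul_le_mul (min_le_right _ _) h1 (κ.J_nonneg _ (κ.nd_pos hxy)) (by positivity)
              _ = κ.J r := by field_simp
          linarith
        · exact mul_nonneg (by linarith) (κ.J_nonneg _ (κ.nd_pos hxy))
  refine lt_of_le_of_lt (sus_mono hle 0) (κ.sus_rate_lt_top (by nlinarith) ?_)
  nlinarith

/-- The expected number of points of the cluster of the origin at distance at least `R`. -/
noncomputable def tail (t : Sym2 (V d) → ℝ≥0) (R : ℝ) : ℝ≥0∞ :=
  ∑' x, if R ≤ κ.nr x then tau t 0 x else 0

theorem tail_mono {t u : Sym2 (V d) → ℝ≥0} (h : t ≤ u) (R : ℝ) : κ.tail t R ≤ κ.tail u R := by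
  refine ENNReal.tsum_le_tsum fun x => ?_
  split_ifs
  · exact tau_mono h _ _
  · exact le_rfl

theorem exists_nr_le_enorm2 : ∃ b : ℝ, 0 < b ∧ ∀ x : V d, κ.nr x ≤ b * enorm2 x := by
  obtain ⟨b, hb, h⟩ := κ.exists_N_le
  refine ⟨b, hb, fun x => (h _).trans (mul_le_mul_of_nonneg_left ?_ hb.le)⟩
  refine (pi_norm_le_iff_of_nonneg (x := toR x) (r := enorm2 x) (Real.sqrt_nonneg _)).2 fun i => ?_
  rw [Real.norm_eq_abs]
  refine Real.abs_le_sqrt ?_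
  exact Finset.single_le_sum (f := fun i => (x i : ℝ) ^ 2) (fun _ _ => sq_nonneg _)
    (Finset.mem_univ i)

theorem exists_enorm2_le_nr : ∃ b : ℝ, 0 < b ∧ ∀ x : V d, enorm2 x ≤ b * κ.nr x := by
  obtain ⟨a, ha, h⟩ := κ.exists_le_N
  refine ⟨(d + 1) / a, by positivity, fun x => ?_⟩
  have h1 : ‖toR x‖ ≤ κ.nr x / a := by
    rw [le_div_iff₀ ha, mul_comm]; exact h _
  have h2 : enorm2 x ≤ (d + 1) * ‖toR x‖ := by
    refine Real.sqrt_le_iff.2 ⟨by positivity, ?_⟩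
    calc ∑ i, (x i : ℝ) ^ 2 ≤ ∑ i : Fin d, ‖toR x‖ ^ 2 := by
          refine Finset.sum_le_sum fun i _ => ?_
          rw [← sq_abs]
          exact pow_le_pow_left₀ (abs_nonneg _) (norm_le_pi_norm (toR x) i) 2
      _ = d * ‖toR x‖ ^ 2 := by simp
      _ ≤ ((d + 1) * ‖toR x‖) ^ 2 := by
          rw [mul_pow]
          refine mul_le_mul_of_nonneg_right ?_ (sq_nonneg _)
          nlinarith [(Nat.cast_nonneg d : (0 : ℝ) ≤ d)]
  calc enorm2 x ≤ (d + 1) * ‖toR x‖ := h2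
    _ ≤ (d + 1) * (κ.nr x / a) := mul_le_mul_of_nonneg_left h1 (by positivity)
    _ = _ := by ring

theorem enorm2_nonneg (x : V d) : 0 ≤ enorm2 x := Real.sqrt_nonneg _

theorem gyr_eq (t : Sym2 (V d) → ℝ≥0) (p : ℝ) :
    gyr (perc t) p = ∑' x, tau t 0 x * ENNReal.ofReal (enorm2 x ^ p) := by
  rw [← lintegral_tsum_cluster]
  refine lintegral_congr fun ω => ?_
  rw [tsum_subtype (cluster ω 0) fun x => ENNReal.ofReal (enorm2 x ^ p)]

theorem clMom_one (t : Sym2 (V d) → ℝ≥0) : clMom (perc t) 1 = sus t 0 := by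
  rw [← lintegral_eCard_cluster]
  simp [clMom]

theorem exists_tail_le (hα : 0 < α) (hJ : Tendsto κ.J atTop (nhds 0)) (hβc : 0 < κ.betaC)
    (hCL : κ.CL) {p : ℝ} (hp : 0 < p) : ∃ C : ℝ, 0 < C ∧ ∀ r : ℝ, 1 ≤ r → ∀ R : ℝ, 0 < R →
      κ.tail (κ.rateCut κ.betaC r) R ≤
        sus (κ.rateCut κ.betaC r) 0 * ENNReal.ofReal (C * (r / R) ^ p) := by
  obtain ⟨C, hC, h⟩ := hCL.2 p hp
  obtain ⟨b, hb, hnr⟩ := κ.exists_nr_le_enorm2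
  refine ⟨(b * C) ^ p, by positivity, fun r hr R hR => ?_⟩
  have hr0 : 0 < r := by linarith
  set t := κ.rateCut κ.betaC r with ht
  have hs0 : sus t 0 ≠ 0 := (one_pos.trans_le (one_le_sus t 0)).ne'
  have hst : sus t 0 ≠ ∞ := (κ.sus_rateCut_lt_top hα hJ hβc hr0).ne
  have h1 := h r hr (perc t) (by rw [κ.edgePCut_eq hβc.le]; exact isPerc_perc t)
  rw [xi, clMom_one] at h1
  have h2 : gyr (perc t) p ≤ sus t 0 * ENNReal.ofReal ((C * r) ^ p) := by
    have h3 := ENNReal.rpow_le_rpow h1 hp.le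
    rw [← ENNReal.rpow_mul, one_div_mul_cancel hp.ne', ENNReal.rpow_one,
      ENNReal.ofReal_rpow_of_nonneg (by positivity) hp.le, ENNReal.div_le_iff hs0 hst] at h3
    rwa [mul_comm]
  have h4 : κ.tail t R * ENNReal.ofReal ((R / b) ^ p) ≤ gyr (perc t) p := by
    rw [gyr_eq, tail, ← ENNReal.tsum_mul_right]
    refine ENNReal.tsum_le_tsum fun x => ?_
    split_ifs with hx
    · refine mul_le_mul_right (ENNReal.ofReal_le_ofReal
        (Real.rpow_le_rpow (by positivity) ?_ hp.le)) _
      rw [div_le_iff₀ hb, mul_comm]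
      exact hx.trans (hnr x)
    · simp
  have h5 : 0 < (R / b) ^ p := by positivity
  have h6 := h4.trans h2
  rw [← ENNReal.le_div_iff_mul_le (Or.inl (by simpa using h5)) (Or.inl ENNReal.ofReal_ne_top),
    mul_div_assoc, ← ENNReal.ofReal_div_of_pos h5] at h6
  refine h6.trans (le_of_eq ?_)
  congr 2
  rw [← Real.div_rpow (by positivity) (by positivity),
    ← Real.mul_rpow (by positivity) (by positivity)]
  congr 1
  field_simp

/-! ## Increments of the rates -/

theorem rateCut_add_sub {β r s : ℝ} (hβ : 0 ≤ β) (hr : 0 < r) (hrs : r ≤ s) :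
    κ.rateCut β r + (κ.rateCut β s - κ.rateCut β r) = κ.rateCut β s :=
  add_tsub_cancel_of_le (κ.rateCut_mono hβ le_rfl hr hrs)

theorem rateCut_add_rate_sub {β r : ℝ} (hβ : 0 ≤ β) (hr : 0 < r) :
    κ.rateCut β r + (κ.rate β - κ.rateCut β r) = κ.rate β :=
  add_tsub_cancel_of_le (κ.rateCut_le_rate hβ hr)

theorem rate_sub_le_J {β r : ℝ} (hβ : 0 ≤ β) (hr : 0 < r) (x y : V d) :
    ((κ.rate β - κ.rateCut β r) s(x, y) : ℝ≥0∞) ≤ ENNReal.ofReal (β * κ.J r) := by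
  rw [← ENNReal.ofReal_coe_nnreal]
  refine ENNReal.ofReal_le_ofReal ?_
  rw [Pi.sub_apply, NNReal.coe_sub_def, κ.coe_rate hβ, κ.coe_rateCut hβ]
  refine max_le ?_ (mul_nonneg hβ (κ.J_nonneg r hr))
  rw [← mul_sub]
  exact mul_le_mul_of_nonneg_left (by linarith [κ.ker_le_kerCut_add hr x y]) hβ

theorem rateCut_sub_le {β r s : ℝ} (hβ : 0 ≤ β) (hs : 0 < s) :
    κ.rateCut β s - κ.rateCut β r ≤ κ.rate β - κ.rateCut β r :=
  tsub_le_tsub_right (κ.rateCut_le_rate hβ hs) _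

theorem rateCut_eq_zero {β s : ℝ} {x y : V d} (h : s < κ.nd x y) : κ.rateCut β s s(x, y) = 0 := by
  have : κ.kerCut s x y = 0 := by
    rw [kerCut, if_neg]
    exact fun h' => absurd h'.2 (not_le.2 h)
  simp [rateCut, this]

theorem TransInv.sub {t u : Sym2 (V d) → ℝ≥0} (ht : TransInv t) (hu : TransInv u) :
    TransInv (t - u) := fun x y z => by
  rw [Pi.sub_apply, Pi.sub_apply, ht, hu]

theorem TransInv.add {t u : Sym2 (V d) → ℝ≥0} (ht : TransInv t) (hu : TransInv u) :
    TransInv (t + u) := fun x y z => by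
  rw [Pi.add_apply, Pi.add_apply, ht, hu]

/-- The total rate of the edges incident to the origin. -/
noncomputable def deg (u : Sym2 (V d) → ℝ≥0) : ℝ≥0∞ := ∑' x : V d, (u s(0, x) : ℝ≥0∞)

theorem deg_eq {u : Sym2 (V d) → ℝ≥0} (hu : TransInv u) (a : V d) :
    ∑' b : V d, (u s(a, b) : ℝ≥0∞) = deg u := by
  rw [deg, ← (Equiv.addRight a).tsum_eq]
  refine tsum_congr fun b => ?_
  have := hu 0 b a
  rw [zero_add] at this
  simp [this]

theorem exists_J_le (hα : 0 < α) (hJ : Tendsto κ.J atTop (nhds 0)) : ∃ C : ℝ, 0 < C ∧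
    ∀ r : ℝ, 1 ≤ r → κ.J r ≤ C * r ^ (-(d + α) : ℝ) := by
  obtain ⟨c, C, -, hC, h⟩ := κ.exists_J_bounds hα hJ one_pos
  exact ⟨C, hC, fun r hr => (h r hr).2⟩

theorem exists_deg_sub_le (hα : 0 < α) (hJ : Tendsto κ.J atTop (nhds 0)) : ∃ C : ℝ, 0 < C ∧
    ∀ β : ℝ, 0 ≤ β → ∀ r : ℝ, 1 ≤ r →
      deg (κ.rate β - κ.rateCut β r) ≤ ENNReal.ofReal (C * β * r ^ (-α)) := by
  obtain ⟨CJ, hCJ, hJle⟩ := κ.exists_J_le hα hJ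
  obtain ⟨Cc, hCc, -, hcard⟩ := κ.exists_card_le
  obtain ⟨Ct, hCt, htail⟩ := κ.exists_sum_tail hα
  refine ⟨CJ * (Cc + Ct), by positivity, fun β hβ r hr => ?_⟩
  have hr0 : 0 < r := by linarith
  have hpt : ∀ x : V d, ((κ.rate β - κ.rateCut β r) s(0, x) : ℝ≥0∞) ≤
      (if x ∈ (κ.fball r).erase 0 then ENNReal.ofReal (β * (CJ * r ^ (-(d + α) : ℝ))) else 0) +
        ENNReal.ofReal (β * CJ) *
          (if r ≤ κ.nr x then ENNReal.ofReal (κ.nr x ^ (-(d : ℝ) - α)) else 0) := by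
    intro x
    by_cases hx : x ∈ (κ.fball r).erase 0
    · rw [if_pos hx]
      refine le_add_right ((κ.rate_sub_le_J hβ hr0 0 x).trans (ENNReal.ofReal_le_ofReal ?_))
      exact mul_le_mul_of_nonneg_left (hJle r hr) hβ
    · refine le_add_left ?_
      by_cases hx0 : x = 0
      · subst hx0
        have : κ.rate β s((0 : V d), 0) = 0 := by
          rw [← NNReal.coe_eq_zero, κ.coe_rate hβ, ker_self, mul_zero]
        simp [this]
      · have hxr : r < κ.nr x := by
          simpa [hx0, mem_fball] using hx
        rw [if_pos hxr.le, ← ENNReal.ofReal_mul (by positivity)]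
        refine (ENNReal.coe_le_coe.2 (tsub_le_self (a := κ.rate β s(0, x)))).trans ?_
        rw [← ENNReal.ofReal_coe_nnreal, κ.coe_rate hβ, κ.ker_of_ne (Ne.symm hx0), nd_zero_left,
          mul_assoc]
        refine ENNReal.ofReal_le_ofReal (mul_le_mul_of_nonneg_left ?_ hβ)
        have := hJle _ (hr.trans hxr.le)
        rwa [show (-(d + α) : ℝ) = -(d : ℝ) - α by ring] at this
  refine (ENNReal.tsum_le_tsum hpt).trans ?_
  rw [ENNReal.tsum_add, tsum_indicator_finset _ _, ENNReal.tsum_mul_left]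
  refine (add_le_add le_rfl (mul_le_mul_right (htail r hr0) _)).trans ?_
  rw [← ENNReal.ofReal_mul (by positivity), ← ENNReal.ofReal_add (by positivity) (by positivity)]
  refine ENNReal.ofReal_le_ofReal ?_
  have h1 : (((κ.fball r).erase 0).card : ℝ) * (β * (CJ * r ^ (-(d + α) : ℝ))) ≤
      Cc * r ^ d * (β * (CJ * r ^ (-(d + α) : ℝ))) :=
    mul_le_mul_of_nonneg_right (hcard r hr0) (by positivity)
  have h2 : r ^ d * r ^ (-(d + α) : ℝ) = r ^ (-α) := by
    rw [← Real.rpow_natCast, ← Real.rpow_add hr0]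
    congr 1
    ring
  calc _ ≤ Cc * r ^ d * (β * (CJ * r ^ (-(d + α) : ℝ))) + β * CJ * (Ct * r ^ (-α)) := by
        linarith
    _ = Cc * β * CJ * (r ^ d * r ^ (-(d + α) : ℝ)) + β * CJ * (Ct * r ^ (-α)) := by ring
    _ = _ := by rw [h2]; ring

/-! ## Two-layer inequalities for translation-invariant rates -/

theorem sus_add_le_deg {t u : Sym2 (V d) → ℝ≥0} (ht : TransInv t) (hu : TransInv u) :
    sus (t + u) 0 ≤ sus t 0 + sus t 0 * deg u * sus (t + u) 0 := by
  refine (sus_add_le t u 0).trans (add_le_add le_rfl (le_of_eq ?_))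
  simp only [sus_eq (ht.add hu)]
  simp only [ENNReal.tsum_mul_right, ENNReal.tsum_mul_left, deg_eq hu]
  rfl

theorem tau_add_le_of_le {t u : Sym2 (V d) → ℝ≥0} (ht : TransInv t) (hu : TransInv u)
    {υ : ℝ≥0∞} (h : ∀ a b : V d, (u s(a, b) : ℝ≥0∞) ≤ υ) (x y : V d) :
    tau (t + u) x y ≤ tau t x y + υ * sus t 0 * sus (t + u) 0 := by
  refine (tau_add_le t u x y).trans (add_le_add le_rfl ?_)
  calc _ ≤ ∑' a, ∑' b, tau t x a * υ * tau (t + u) b y :=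
        ENNReal.tsum_le_tsum fun a => ENNReal.tsum_le_tsum fun b =>
          mul_le_mul_left (mul_le_mul_right (h a b) _) _
    _ = sus t x * υ * sus (t + u) y := by
        simp only [ENNReal.tsum_mul_left, ENNReal.tsum_mul_right, tau_comm (t + u) _ y]
        rfl
    _ = _ := by rw [sus_eq ht x, sus_eq (ht.add hu) y]; ring

end Kernel

end LRP

namespace LRP

open scoped NNReal

/-! ## Clusters inside a finite box -/

section Box

variable {W : Type*}

/-- The part of the cluster of `x` inside the finite set `Λ`. -/
noncomputable def cl (Λ : Finset W) (ω : Sym2 W → Bool) (x : W) : Finset W :=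
  Λ.filter fun y => Conn ω x y

theorem mem_cl {Λ : Finset W} {ω : Sym2 W → Bool} {x y : W} :
    y ∈ cl Λ ω x ↔ y ∈ Λ ∧ Conn ω x y := Finset.mem_filter

theorem cl_congr {Λ : Finset W} {ω : Sym2 W → Bool} {x y : W} (h : Conn ω x y) :
    cl Λ ω x = cl Λ ω y := by
  ext z
  rw [mem_cl, mem_cl]
  exact and_congr_right fun _ => ⟨fun h' => h.symm.trans h', fun h' => h.trans h'⟩

theorem inc_card_cl (Λ : Finset W) (n : ℕ) (x : W) :
    Inc {ω : Sym2 W → Bool | n ≤ (cl Λ ω x).card} := by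
  have : {ω : Sym2 W → Bool | n ≤ (cl Λ ω x).card} =
      ⋃ T : {T : Finset W // T ⊆ Λ ∧ n ≤ T.card}, ⋂ y ∈ T.1, {ω | Conn ω x y} := by
    ext ω
    simp only [Set.mem_ofPred_eq, Set.mem_iUnion, Set.mem_iInter]
    refine ⟨fun h => ⟨⟨cl Λ ω x, Finset.filter_subset _ _, h⟩, fun y hy => (mem_cl.1 hy).2⟩, ?_⟩
    rintro ⟨⟨T, hT, hn⟩, h⟩
    exact hn.trans (Finset.card_le_card fun y hy => mem_cl.2 ⟨hT hy, h y hy⟩)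
  rw [this]
  exact Inc.iUnion fun T => Inc.iInter_finset _ fun y => inc_conn x y

theorem restr_of_subset {ι : Type*} {s s' : Set ι} (h : s ⊆ s') (ω : ι → Bool) :
    restr s (restr s' ω) = restr s ω := by
  funext e
  rw [Bool.eq_iff_iff, restr_apply, restr_apply, restr_apply]
  exact ⟨fun he => ⟨he.1, he.2.2⟩, fun he => ⟨he.1, h he.1, he.2⟩⟩

/-- Removing the edge `s(v, w)` splits the cluster of `v` into the clusters of `v` and `w`. -/
theorem conn_erase {J : Set (Sym2 W)} {ω : Sym2 W → Bool} {v w y : W}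
    (h : Conn (restr J ω) v y) :
    Conn (restr (J \ {s(v, w)}) ω) v y ∨ Conn (restr (J \ {s(v, w)}) ω) w y := by
  induction h with
  | refl => exact Or.inl (conn_refl _ _)
  | @tail b c hb hbc ih =>
    by_cases he : s(b, c) = s(v, w)
    · rcases Sym2.eq_iff.1 he with ⟨-, rfl⟩ | ⟨-, rfl⟩
      · exact Or.inr (conn_refl _ _)
      · exact Or.inl (conn_refl _ _)
    · have hbc' : Conn (restr (J \ {s(v, w)}) ω) b c := by
        rw [restr_apply] at hbc
        refine conn_of_open ?_
        rw [restr_apply]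
        exact ⟨⟨hbc.1, he⟩, hbc.2⟩
      exact ih.imp (fun h' => h'.trans hbc') fun h' => h'.trans hbc'

/-- Splitting a large cluster: the configuration `ω` decomposes as `J ∪ Jᶜ` with a vertex `v` in
the `Jᶜ`-cluster of `x` whose `J`-cluster is of intermediate size. -/
theorem exists_split_aux (Λ : Finset W) {l : ℕ} (hl : 0 < l) (ω : Sym2 W → Bool) (x : W) (n : ℕ) :
    ∀ (J : Finset (Sym2 W)) (v : W), J.card ≤ n → Conn (restr (J : Set (Sym2 W))ᶜ ω) x v →
      (∀ y, Conn ω x y → Conn (restr (J : Set (Sym2 W))ᶜ ω) x y ∨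
        Conn (restr (J : Set (Sym2 W)) ω) v y) →
      l ≤ (cl Λ (restr (J : Set (Sym2 W)) ω) v).card →
      ∃ (J : Set (Sym2 W)) (v : W), l ≤ (cl Λ (restr J ω) v).card ∧
        (cl Λ (restr J ω) v).card < 2 * l ∧
        ∀ y, Conn ω x y → Conn (restr Jᶜ ω) x y ∨ Conn (restr J ω) v y := by
  induction n with
  | zero =>
    intro J v hJ h1 h2 h3
    refine ⟨J, v, h3, ?_, h2⟩
    have : J = ∅ := by simpa using hJ
    subst this
    have h4 : cl Λ (restr ((∅ : Finset (Sym2 W)) : Set (Sym2 W)) ω) v ⊆ {v} := by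
      intro y hy
      have := conn_inS_mem (S := {v}) (ω := ω) (x := v) (y := y) rfl
        ((mem_cl.1 hy).2.mono (restr_mono (by simp) _))
      simpa using this
    have := Finset.card_le_card h4
    rw [Finset.card_singleton] at this
    omega
  | succ n ih =>
    intro J v hJ h1 h2 h3
    by_cases hlt : (cl Λ (restr (J : Set (Sym2 W)) ω) v).card < 2 * l
    · exact ⟨J, v, h3, hlt, h2⟩
    push Not at hlt
    obtain ⟨w, hw, hvw⟩ : ∃ w, s(v, w) ∈ J ∧ ω s(v, w) = true := by
      by_contra! hno
      have h4 : cl Λ (restr (J : Set (Sym2 W)) ω) v ⊆ {v} := by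
        intro y hy
        rw [Finset.mem_singleton]
        have h5 := (mem_cl.1 hy).2
        induction h5 with
        | refl => rfl
        | tail hb hbc ih' =>
          rename_i b c
          exfalso
          by_cases hbv : b = v
          · subst hbv
            rw [restr_apply] at hbc
            exact hno c hbc.1 hbc.2
          · rcases Relation.ReflTransGen.cases_head hb with h | ⟨a, ha, -⟩
            · exact hbv h.symm
            · rw [restr_apply] at ha
              exact hno a ha.1 ha.2
      have := Finset.card_le_card h4
      rw [Finset.card_singleton] at this
      omega
    set e := s(v, w) with he
    have key : ∀ a b : W, (a = v ∧ b = w ∧ ¬ Conn (restr ((J : Set (Sym2 W)) \ {e}) ω) v w ∨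
        a = w ∧ b = v) →
        l ≤ (cl Λ (restr ((J : Set (Sym2 W)) \ {e}) ω) a).card →
        ∃ (J : Set (Sym2 W)) (v : W), l ≤ (cl Λ (restr J ω) v).card ∧
          (cl Λ (restr J ω) v).card < 2 * l ∧
          ∀ y, Conn ω x y → Conn (restr Jᶜ ω) x y ∨ Conn (restr J ω) v y := by
      intro a b hab hla
      set S := cluster (restr ((J : Set (Sym2 W)) \ {e}) ω) a with hS
      set J₂ : Finset (Sym2 W) := (J.erase e).filter (· ∈ inS S) with hJ₂
      have hJ₂' : (J₂ : Set (Sym2 W)) = inS S ∩ ((J : Set (Sym2 W)) \ {e}) := by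
        ext f
        simp only [hJ₂, Finset.coe_filter, Finset.mem_erase, Set.mem_ofPred_eq, Set.mem_inter_iff,
          Set.mem_sdiff, Finset.mem_coe, Set.mem_singleton_iff]
        tauto
      have hsub : (J₂ : Set (Sym2 W)) ⊆ J := by
        rw [hJ₂']
        exact fun f hf => hf.2.1
      have hc : ∀ y, Conn (restr ((J : Set (Sym2 W)) \ {e}) ω) a y →
          Conn (restr (J₂ : Set (Sym2 W)) ω) a y := by
        intro y hy
        have := conn_restr_cluster hy
        rw [← hS] at this
        refine this.mono ?_
        intro f
        rw [Bool.le_iff_imp, restr_apply, restr_apply, restr_apply, hJ₂']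
        exact fun h => ⟨⟨h.1, h.2.1⟩, h.2.2⟩
      have heJ : e ∉ (J₂ : Set (Sym2 W)) := by
        rw [hJ₂']
        simp
      have hcompl : ∀ y, Conn (restr (J : Set (Sym2 W))ᶜ ω) x y →
          Conn (restr (J₂ : Set (Sym2 W))ᶜ ω) x y := fun y hy =>
        hy.mono (restr_mono (Set.compl_subset_compl.2 hsub) ω)
      have hxv := hcompl v h1
      have hvw' : Conn (restr (J₂ : Set (Sym2 W))ᶜ ω) v w := by
        refine conn_of_open ?_
        rw [restr_apply]
        exact ⟨heJ, hvw⟩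
      have hxa : Conn (restr (J₂ : Set (Sym2 W))ᶜ ω) x a := by
        rcases hab with ⟨rfl, -, -⟩ | ⟨rfl, -⟩
        · exact hxv
        · exact hxv.trans hvw'
      have hxb : Conn (restr (J₂ : Set (Sym2 W))ᶜ ω) x b := by
        rcases hab with ⟨-, rfl, -⟩ | ⟨-, rfl⟩
        · exact hxv.trans hvw'
        · exact hxv
      have hcov : ∀ y, Conn ω x y → Conn (restr (J₂ : Set (Sym2 W))ᶜ ω) x y ∨
          Conn (restr (J₂ : Set (Sym2 W)) ω) a y := by
        intro y hy
        rcases h2 y hy with h | h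
        · exact Or.inl (hcompl y h)
        have hy' : Conn (restr ((J : Set (Sym2 W)) \ {e}) ω) a y ∨
            Conn (restr ((J : Set (Sym2 W)) \ {e}) ω) b y := by
          rcases conn_erase (w := w) h with h' | h' <;>
            rcases hab with ⟨rfl, rfl, -⟩ | ⟨rfl, rfl⟩ <;> simp only [he] <;> tauto
        rcases hy' with hy' | hy'
        · exact Or.inr (hc y hy')
        by_cases hconn : Conn (restr ((J : Set (Sym2 W)) \ {e}) ω) a b
        · exact Or.inr (hc y (hconn.trans hy'))
        left
        refine hxb.trans ?_
        refine (conn_restr_cluster hy').mono ?_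
        intro f
        rw [Bool.le_iff_imp, restr_apply, restr_apply, restr_apply]
        rintro ⟨hf1, hf2, hf3⟩
        refine ⟨fun hf4 => ?_, hf3⟩
        rw [hJ₂'] at hf4
        refine Set.disjoint_left.1 (disjoint_inS ?_) hf4.1 hf1
        rw [Set.disjoint_left]
        exact fun z hz hz' => hconn (Conn.trans (y := z) hz (Conn.symm hz'))
      refine ih J₂ a ?_ hxa hcov (hla.trans (Finset.card_le_card fun y hy => ?_))
      · have h4 : J₂.card ≤ (J.erase e).card := Finset.card_filter_le _ _
        rw [Finset.card_erase_of_mem hw] at h4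
        omega
      · exact mem_cl.2 ⟨(mem_cl.1 hy).1, hc y (mem_cl.1 hy).2⟩
    have hsum : 2 * l ≤ (cl Λ (restr ((J : Set (Sym2 W)) \ {e}) ω) v).card +
        (cl Λ (restr ((J : Set (Sym2 W)) \ {e}) ω) w).card := by
      refine hlt.trans (le_trans (Finset.card_le_card ?_) (Finset.card_union_le _ _))
      intro y hy
      rw [Finset.mem_union, mem_cl, mem_cl]
      rcases conn_erase (w := w) (mem_cl.1 hy).2 with h | h
      · exact Or.inl ⟨(mem_cl.1 hy).1, h⟩
      · exact Or.inr ⟨(mem_cl.1 hy).1, h⟩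
    by_cases hlw : l ≤ (cl Λ (restr ((J : Set (Sym2 W)) \ {e}) ω) w).card
    · exact key w v (Or.inr ⟨rfl, rfl⟩) hlw
    · refine key v w (Or.inl ⟨rfl, rfl, fun hconn => ?_⟩) (by omega)
      rw [cl_congr hconn] at hsum
      omega

theorem card_cl_subset_disj (Λ : Finset W) {l : ℕ} (hl : 0 < l) (x : W) :
    {ω : Sym2 W → Bool | 3 * l ≤ (cl Λ ω x).card} ⊆
      disj {ω | l ≤ (cl Λ ω x).card} (⋃ v, {ω | l ≤ (cl Λ ω v).card}) := by
  intro ω hω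
  obtain ⟨F, hF⟩ := (inc_card_cl Λ (3 * l) x).fin ω hω
  have i1 := inc_card_cl Λ l x
  have i2 : Inc (⋃ v, {ω : Sym2 W → Bool | l ≤ (cl Λ ω v).card}) :=
    Inc.iUnion fun v => inc_card_cl Λ l v
  refine (i1.disj i2).up (restr_le F ω) ?_
  set ω' := restr (F : Set (Sym2 W)) ω with hω'
  have hself : restr (F : Set (Sym2 W)) ω' = ω' := restr_of_subset le_rfl ω
  obtain ⟨J, v, h1, h2, h3⟩ := exists_split_aux Λ hl ω' x F.card F x le_rfl (conn_refl _ _)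
    (fun y hy => Or.inr (by rwa [hself])) (by
      rw [hself]
      exact le_trans (by omega) (show 3 * l ≤ _ from hF))
  have h4 : 3 * l ≤ (cl Λ (restr Jᶜ ω') x).card + (cl Λ (restr J ω') v).card := by
    refine le_trans (show 3 * l ≤ _ from hF) (le_trans (Finset.card_le_card ?_)
      (Finset.card_union_le _ _))
    intro y hy
    rw [Finset.mem_union, mem_cl, mem_cl]
    exact (h3 y (mem_cl.1 hy).2).imp (fun h => ⟨(mem_cl.1 hy).1, h⟩) fun h => ⟨(mem_cl.1 hy).1, h⟩
  refine mem_disj i2.up disjoint_compl_left (s := Jᶜ) (s' := J) ?_ ?_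
  · show l ≤ _
    omega
  · exact Set.mem_iUnion.2 ⟨v, h1⟩

end Box

end LRP

namespace LRP

open scoped NNReal

section Moments

variable {W : Type*}

theorem coe_card_cl (Λ : Finset W) (ω : Sym2 W → Bool) (x : W) :
    ((cl Λ ω x).card : ℝ≥0∞) = ∑ y ∈ Λ, if Conn ω x y then 1 else 0 := by
  rw [cl, Finset.card_filter]
  push_cast
  rfl

theorem measurable_conn_ite [Countable W] (x y : W) (a b : ℝ≥0∞) :
    Measurable fun ω : Sym2 W → Bool => if Conn ω x y then a else b :=
  Measurable.ite (measurableSet_conn x y) measurable_const measurable_const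

theorem measurable_card_cl [Countable W] (Λ : Finset W) (x : W) :
    Measurable fun ω : Sym2 W → Bool => (cl Λ ω x).card := by
  simp only [cl, Finset.card_filter]
  exact Finset.measurable_fun_sum _ fun y _ =>
    Measurable.ite (measurableSet_conn x y) measurable_const measurable_const

theorem measurable_of_card_cl [Countable W] (Λ : Finset W) (x : W) (f : ℕ → ℝ≥0∞) :
    Measurable fun ω : Sym2 W → Bool => f (cl Λ ω x).card :=
  (measurable_of_countable f).comp (measurable_card_cl Λ x)

theorem lintegral_conn [Countable W] (t : Sym2 W → ℝ≥0) (x y : W) :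
    ∫⁻ ω, (if Conn ω x y then 1 else 0) ∂perc t = tau t x y := by
  rw [tau, ← lintegral_indicator_one (measurableSet_conn x y)]
  refine lintegral_congr fun ω => ?_
  by_cases h : Conn ω x y <;> simp [h]

theorem lintegral_card_cl [Countable W] (t : Sym2 W → ℝ≥0) (Λ : Finset W) (x : W) :
    ∫⁻ ω, ((cl Λ ω x).card : ℝ≥0∞) ∂perc t = ∑ y ∈ Λ, tau t x y := by
  simp only [coe_card_cl]
  rw [lintegral_finsetSum _ fun y _ => measurable_conn_ite x y 1 0]
  simp only [lintegral_conn]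

/-- The expected number of connected pairs. -/
noncomputable def pairs (t : Sym2 W → ℝ≥0) (Λ Λ' : Finset W) : ℝ≥0∞ :=
  ∑ x ∈ Λ, ∑ y ∈ Λ', tau t x y

theorem pairs_ne_top (t : Sym2 W → ℝ≥0) (Λ Λ' : Finset W) : pairs t Λ Λ' ≠ ∞ := by
  refine ENNReal.sum_ne_top.2 fun x _ => ENNReal.sum_ne_top.2 fun y _ => ?_
  exact ((tau_le_one t x y).trans_lt one_lt_top).ne

theorem lintegral_sum_card_cl [Countable W] (t : Sym2 W → ℝ≥0) (Λ Λ' : Finset W) :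
    ∫⁻ ω, ∑ x ∈ Λ, ((cl Λ' ω x).card : ℝ≥0∞) ∂perc t = pairs t Λ Λ' := by
  rw [lintegral_finsetSum _ fun x _ => measurable_of_card_cl Λ' x fun n => n]
  simp only [lintegral_card_cl]
  rfl

theorem sq_le_sum_card_cl {Λ : Finset W} {ω : Sym2 W → Bool} {l : ℕ} {v : W}
    (h : l ≤ (cl Λ ω v).card) : (l : ℝ≥0∞) ^ 2 ≤ ∑ x ∈ Λ, ((cl Λ ω x).card : ℝ≥0∞) := by
  calc (l : ℝ≥0∞) ^ 2 ≤ ∑ x ∈ cl Λ ω v, (l : ℝ≥0∞) := by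
        rw [Finset.sum_const, nsmul_eq_mul, sq]
        gcongr
    _ ≤ ∑ x ∈ cl Λ ω v, ((cl Λ ω x).card : ℝ≥0∞) := by
        refine Finset.sum_le_sum fun x hx => ?_
        rw [← cl_congr (mem_cl.1 hx).2]
        exact_mod_cast h
    _ ≤ _ := Finset.sum_le_sum_of_subset (Finset.filter_subset _ _)

theorem perc_exists_card_cl_le [Countable W] (t : Sym2 W → ℝ≥0) (Λ : Finset W) (l : ℕ) :
    (l : ℝ≥0∞) ^ 2 * perc t (⋃ v, {ω | l ≤ (cl Λ ω v).card}) ≤ pairs t Λ Λ := by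
  rw [← lintegral_sum_card_cl]
  refine le_trans (mul_le_mul_right (measure_mono ?_) _) (mul_meas_ge_le_lintegral
    (Finset.measurable_fun_sum _ fun x _ => measurable_of_card_cl Λ x fun n => n) ((l : ℝ≥0∞) ^ 2))
  refine Set.iUnion_subset fun v ω hω => ?_
  exact sq_le_sum_card_cl hω

theorem perc_card_cl_triple_le [Countable W] (t : Sym2 W → ℝ≥0) (Λ : Finset W) {l : ℕ}
    (hl : 0 < l) {ε : ℝ≥0∞} (h : pairs t Λ Λ ≤ ε * (l : ℝ≥0∞) ^ 2) (x : W) :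
    perc t {ω | 3 * l ≤ (cl Λ ω x).card} ≤ ε * perc t {ω | l ≤ (cl Λ ω x).card} := by
  refine (measure_mono (card_cl_subset_disj Λ hl x)).trans ?_
  refine (perc_disj_le t (inc_card_cl Λ l x) (Inc.iUnion fun v => inc_card_cl Λ l v)).trans ?_
  rw [mul_comm]
  refine mul_le_mul_left ?_ _
  have h1 := (perc_exists_card_cl_le t Λ l).trans h
  have hl0 : ((l : ℝ≥0∞) ^ 2) ≠ 0 := by
    have : (l : ℝ≥0∞) ≠ 0 := by exact_mod_cast hl.ne'
    positivity
  have hlt : ((l : ℝ≥0∞) ^ 2) ≠ ∞ := by finiteness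
  rw [mul_comm] at h1
  exact (ENNReal.mul_le_mul_iff_left hl0 hlt).1 h1

/-- Universal tightness: the contribution of atypically large clusters is small. -/
theorem lintegral_card_cl_large_le [Countable W] (t : Sym2 W → ℝ≥0) (Λ : Finset W) {l : ℕ}
    (hl : 0 < l) (h : 150 * pairs t Λ Λ ≤ (l : ℝ≥0∞) ^ 2) (x : W) :
    8 * ∫⁻ ω, (if 3 * l ≤ (cl Λ ω x).card then ((cl Λ ω x).card : ℝ≥0∞) else 0) ∂perc t ≤
      ∑ y ∈ Λ, tau t x y := by
  set X : (Sym2 W → Bool) → ℕ := fun ω => (cl Λ ω x).card with hX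
  have hXm : Measurable X := measurable_card_cl Λ x
  set g : ℕ → ℝ≥0∞ := fun k => perc t {ω | 3 ^ k * l ≤ X ω} with hg
  have hstep : ∀ k, g (k + 1) ≤ (150⁻¹ : ℝ≥0∞) * g k := by
    intro k
    have := perc_card_cl_triple_le t Λ (l := 3 ^ k * l) (by positivity) (ε := 150⁻¹) ?_ x
    · simp only [hg, pow_succ']
      simpa only [mul_assoc] using this
    · rw [mul_comm, ← div_eq_mul_inv,
        ENNReal.le_div_iff_mul_le (Or.inl (by norm_num)) (Or.inl (by norm_num)), mul_comm]
      refine h.trans ?_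
      have : l ≤ 3 ^ k * l := Nat.le_mul_of_pos_left _ (by positivity)
      gcongr
  have hgk : ∀ k, g k ≤ (150⁻¹ : ℝ≥0∞) ^ k * g 0 := by
    intro k
    induction k with
    | zero => simp
    | succ k ih =>
      refine (hstep k).trans ?_
      rw [pow_succ', mul_assoc]
      exact mul_le_mul_right ih _
  have hpt : ∀ ω, (if 3 * l ≤ X ω then (X ω : ℝ≥0∞) else 0) ≤
      ∑' k : ℕ, (3 ^ (k + 2) * l : ℝ≥0∞) *
        ({ω | 3 ^ (k + 1) * l ≤ X ω}.indicator (fun _ => (1 : ℝ≥0∞)) ω) := by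
    intro ω
    split_ifs with h3
    · have hex : ∃ k : ℕ, X ω < 3 ^ (k + 2) * l := by
        refine ⟨X ω, ?_⟩
        calc X ω < 3 ^ X ω := Nat.lt_pow_self (by norm_num)
          _ ≤ 3 ^ (X ω + 2) := Nat.pow_le_pow_right (by norm_num) (by omega)
          _ ≤ _ := Nat.le_mul_of_pos_right _ hl
      have hk := Nat.find_spec hex
      set k := Nat.find hex with hkdef
      have hk' : 3 ^ (k + 1) * l ≤ X ω := by
        rcases Nat.eq_zero_or_pos k with h0 | h0
        · rw [h0]; simpa using h3
        · have := Nat.find_min hex (m := k - 1) (by omega)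
          push Not at this
          rwa [show k - 1 + 2 = k + 1 by omega] at this
      refine le_trans ?_ (ENNReal.le_tsum k)
      rw [Set.indicator_of_mem (by exact hk'), mul_one]
      exact_mod_cast hk.le
    · exact bot_le
  have hms : ∀ k : ℕ, MeasurableSet {ω | 3 ^ (k + 1) * l ≤ X ω} := fun k =>
    (inc_card_cl Λ (3 ^ (k + 1) * l) x).measurableSet
  have h1 : ∫⁻ ω, (if 3 * l ≤ X ω then (X ω : ℝ≥0∞) else 0) ∂perc t ≤
      ∑' k : ℕ, (3 ^ (k + 2) * l : ℝ≥0∞) * g (k + 1) := by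
    refine (lintegral_mono hpt).trans (le_of_eq ?_)
    rw [lintegral_tsum fun k => (((measurable_const (a := (1 : ℝ≥0∞))).indicator (hms k)).const_mul _).aemeasurable]
    refine tsum_congr fun k => ?_
    rw [lintegral_const_mul _ ((measurable_const (a := (1 : ℝ≥0∞))).indicator (hms k)), lintegral_indicator_const (hms k),
      one_mul]
  have h150 : (3 * 150⁻¹ : ℝ≥0∞) ≤ 2⁻¹ := by
    rw [← ENNReal.toReal_le_toReal (by finiteness) (by finiteness)]
    simp
    norm_num
  have h2 : ∑' k : ℕ, (3 ^ (k + 2) * l : ℝ≥0∞) * g (k + 1) ≤ (9 * 150⁻¹ * l * g 0) * 2 := by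
    rw [← ENNReal.tsum_geometric_two, ← ENNReal.tsum_mul_left]
    refine ENNReal.tsum_le_tsum fun k => ?_
    calc (3 ^ (k + 2) * l : ℝ≥0∞) * g (k + 1) ≤
          (3 ^ (k + 2) * l : ℝ≥0∞) * ((150⁻¹ : ℝ≥0∞) ^ (k + 1) * g 0) :=
          mul_le_mul_right (hgk _) _
      _ = (9 * 150⁻¹ * l * g 0) * (3 * 150⁻¹) ^ k := by rw [mul_pow]; ring
      _ ≤ _ := mul_le_mul_right (pow_le_pow_left₀ bot_le h150 k) _
  have h3 : (l : ℝ≥0∞) * g 0 ≤ ∑ y ∈ Λ, tau t x y := by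
    rw [← lintegral_card_cl]
    refine le_trans (mul_le_mul_right (measure_mono fun ω hω => ?_) _)
      (mul_meas_ge_le_lintegral (measurable_of_card_cl Λ x fun n => n) (l : ℝ≥0∞))
    have : 3 ^ 0 * l ≤ X ω := hω
    simp only [pow_zero, one_mul] at this
    show (l : ℝ≥0∞) ≤ _
    exact_mod_cast this
  calc _ ≤ 8 * ((9 * 150⁻¹ * l * g 0) * 2) := mul_le_mul_right (h1.trans h2) _
    _ = (144 * 150⁻¹) * (l * g 0) := by ring
    _ ≤ 1 * (l * g 0) := by
        refine mul_le_mul_left ?_ _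
        rw [← ENNReal.toReal_le_toReal (by finiteness) (by finiteness)]
        simp
        norm_num
    _ ≤ _ := by rwa [one_mul]

/-! ## Products over different clusters -/

theorem perc_conn_conn_not_conn_le [Countable W] (t : Sym2 W → ℝ≥0) (x y u v : W) :
    perc t {ω | Conn ω x u ∧ Conn ω y v ∧ ¬ Conn ω x y} ≤ tau t x u * tau t y v := by
  refine (measure_mono ?_).trans (perc_disj_le t (inc_conn x u) (inc_conn y v))
  rintro ω ⟨h1, h2, h3⟩
  refine mem_disj (inc_conn y v).up (disjoint_inS ?_)
    (conn_restr_cluster h1) (conn_restr_cluster h2)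
  rw [Set.disjoint_left]
  exact fun z hz hz' => h3 (Conn.trans (y := z) hz (Conn.symm hz'))

/-- Decoupling of distinct clusters. -/
theorem lintegral_card_cl_mul_le [Countable W] (t : Sym2 W → ℝ≥0) (Λ Λ' : Finset W) (x y : W) :
    ∫⁻ ω, (if Conn ω x y then 0 else ((cl Λ ω x).card : ℝ≥0∞) * (cl Λ' ω y).card) ∂perc t ≤
      (∑ u ∈ Λ, tau t x u) * ∑ v ∈ Λ', tau t y v := by
  have hm : ∀ u v, MeasurableSet {ω : Sym2 W → Bool | Conn ω x u ∧ Conn ω y v ∧ ¬ Conn ω x y} :=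
    fun u v => (measurableSet_conn x u).inter ((measurableSet_conn y v).inter
      (measurableSet_conn x y).compl)
  have : ∀ ω : Sym2 W → Bool,
      (if Conn ω x y then 0 else ((cl Λ ω x).card : ℝ≥0∞) * (cl Λ' ω y).card) =
        ∑ u ∈ Λ, ∑ v ∈ Λ', {ω : Sym2 W → Bool | Conn ω x u ∧ Conn ω y v ∧ ¬ Conn ω x y}.indicator
          (fun _ => (1 : ℝ≥0∞)) ω := by
    intro ω
    split_ifs with h
    · symm
      refine Finset.sum_eq_zero fun u _ => Finset.sum_eq_zero fun v _ => ?_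
      exact Set.indicator_of_notMem (fun h' => h'.2.2 h) _
    · rw [coe_card_cl, coe_card_cl, Finset.sum_mul_sum]
      refine Finset.sum_congr rfl fun u _ => Finset.sum_congr rfl fun v _ => ?_
      by_cases h1 : Conn ω x u <;> by_cases h2 : Conn ω y v <;> simp [h, h1, h2]
  simp only [this]
  rw [lintegral_finsetSum _ fun u _ => Finset.measurable_fun_sum _ fun v _ =>
    (measurable_const (a := (1 : ℝ≥0∞))).indicator (hm u v), Finset.sum_mul_sum]
  refine Finset.sum_le_sum fun u _ => ?_
  rw [lintegral_finsetSum _ fun v _ => (measurable_const (a := (1 : ℝ≥0∞))).indicator (hm u v)]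
  refine Finset.sum_le_sum fun v _ => ?_
  rw [lintegral_indicator_const (hm u v), one_mul]
  exact perc_conn_conn_not_conn_le t x y u v

end Moments

end LRP

namespace LRP

open scoped NNReal

/-- A second moment inequality. -/
theorem sq_lintegral_le {Ω : Type*} [MeasurableSpace Ω] {μ : Measure Ω} {f : Ω → ℝ≥0∞}
    (hf : AEMeasurable f μ) {S : Set Ω} (hS : MeasurableSet S) (h : ∀ ω, ω ∉ S → f ω = 0) :
    (∫⁻ ω, f ω ∂μ) ^ 2 ≤ (∫⁻ ω, f ω ^ 2 ∂μ) * μ S := by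
  have h1 := ENNReal.lintegral_mul_le_Lp_mul_Lq μ (Real.HolderConjugate.two_two) hf
    ((measurable_const (a := (1 : ℝ≥0∞))).indicator hS).aemeasurable
  have h2 : ∫⁻ ω, (f * S.indicator fun _ => (1 : ℝ≥0∞)) ω ∂μ = ∫⁻ ω, f ω ∂μ := by
    refine lintegral_congr fun ω => ?_
    by_cases hω : ω ∈ S
    · simp [hω]
    · simp [hω, h ω hω]
  have h3 : ∫⁻ ω, (S.indicator (fun _ => (1 : ℝ≥0∞)) ω) ^ (2 : ℝ) ∂μ = μ S := by
    rw [← lintegral_indicator_one hS]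
    refine lintegral_congr fun ω => ?_
    by_cases hω : ω ∈ S <;> simp [hω]
  rw [h2, h3] at h1
  refine (pow_le_pow_left₀ bot_le h1 2).trans (le_of_eq ?_)
  rw [mul_pow, ← ENNReal.rpow_natCast, ← ENNReal.rpow_natCast, ← ENNReal.rpow_mul,
    ← ENNReal.rpow_mul]
  simp

section Sprinkle

variable {W : Type*} [Countable W]

/-- Probability that sprinkled edges fail to connect two clusters. -/
theorem perc_sup_not_conn_le (u : Sym2 W → ℝ≥0) (υ : ℝ≥0) {Λ Λ' : Finset W}
    (hu : ∀ a ∈ Λ, ∀ b ∈ Λ', a ≠ b → υ ≤ u s(a, b)) (ω : Sym2 W → Bool) (x y : W) :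
    perc u {η | ¬ Conn (ω ⊔ η) x y} ≤
      ENNReal.ofReal (Real.exp (-(υ * ((cl Λ ω x).card * (cl Λ' ω y).card)))) := by
  by_cases hxy : Conn ω x y
  · have : {η : Sym2 W → Bool | ¬ Conn (ω ⊔ η) x y} = ∅ := by
      rw [Set.eq_empty_iff_forall_notMem]
      exact fun η hη => hη (hxy.mono le_sup_left)
    rw [this, measure_empty]
    exact bot_le
  have hne : ∀ a b, Conn ω x a → Conn ω y b → a ≠ b := by
    rintro a b ha hb rfl
    exact hxy (ha.trans hb.symm)
  set E : Finset (Sym2 W) := (cl Λ ω x ×ˢ cl Λ' ω y).image fun p => s(p.1, p.2) with hE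
  have hcard : E.card = (cl Λ ω x).card * (cl Λ' ω y).card := by
    rw [hE, Finset.card_image_of_injOn, Finset.card_product]
    rintro ⟨a, b⟩ hab ⟨a', b'⟩ hab' h
    simp only [Finset.coe_product, Set.mem_prod, Finset.mem_coe, mem_cl] at hab hab'
    rcases Sym2.eq_iff.1 h with h' | h'
    · exact Prod.ext h'.1 h'.2
    · exact absurd h'.1 (hne a b' hab.1.2 hab'.2.2)
  have hsub : {η : Sym2 W → Bool | ¬ Conn (ω ⊔ η) x y} ⊆ closedOn E := by
    intro η hη e he
    rw [hE, Finset.mem_image] at he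
    obtain ⟨⟨a, b⟩, hab, rfl⟩ := he
    rw [Finset.mem_product, mem_cl, mem_cl] at hab
    by_contra hopen
    rw [Bool.not_eq_false] at hopen
    refine hη (((hab.1.2).mono le_sup_left).trans (Conn.trans (y := b) (conn_of_open ?_)
      ((hab.2.2).symm.mono le_sup_left)))
    simp [hopen]
  refine (measure_mono hsub).trans ?_
  rw [perc_closedOn]
  refine ENNReal.ofReal_le_ofReal (Real.exp_le_exp.2 (neg_le_neg ?_))
  have h1 : ∀ e ∈ E, (υ : ℝ) ≤ u e := by
    intro e he
    rw [hE, Finset.mem_image] at he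
    obtain ⟨⟨a, b⟩, hab, rfl⟩ := he
    rw [Finset.mem_product, mem_cl, mem_cl] at hab
    exact_mod_cast hu a hab.1.1 b hab.2.1 (hne a b hab.1.2 hab.2.2)
  have h2 := Finset.card_nsmul_le_sum E _ _ h1
  rw [hcard, nsmul_eq_mul] at h2
  push_cast at h2
  linarith

theorem measurableSet_sup_conn (ω : Sym2 W → Bool) (x y : W) :
    MeasurableSet {η : Sym2 W → Bool | Conn (ω ⊔ η) x y} :=
  (measurable_sup.comp (measurable_const.prodMk measurable_id)) (measurableSet_conn x y)

theorem le_perc_sup_conn (u : Sym2 W → ℝ≥0) (υ : ℝ≥0) {Λ Λ' : Finset W}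
    (hu : ∀ a ∈ Λ, ∀ b ∈ Λ', a ≠ b → υ ≤ u s(a, b)) (ω : Sym2 W → Bool) (x y : W) :
    ENNReal.ofReal (1 - Real.exp (-(υ * ((cl Λ ω x).card * (cl Λ' ω y).card)))) ≤
      perc u {η | Conn (ω ⊔ η) x y} := by
  have h1 := perc_sup_not_conn_le u υ hu ω x y
  have h2 : perc u {η : Sym2 W → Bool | Conn (ω ⊔ η) x y} =
      1 - perc u {η | ¬ Conn (ω ⊔ η) x y} := by
    have := prob_compl_eq_one_sub (μ := perc u) (measurableSet_sup_conn ω x y).compl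
    rw [compl_compl] at this
    exact this
  rw [h2, ENNReal.ofReal_sub _ (Real.exp_pos _).le, ENNReal.ofReal_one]
  exact tsub_le_tsub_left h1 1

theorem div_le_one_sub_exp {z m : ℝ} (hz : 0 ≤ z) (hzm : z ≤ m) :
    z / (1 + m) ≤ 1 - Real.exp (-z) := by
  have h1 : Real.exp (-z) ≤ 1 / (1 + z) := by
    rw [Real.exp_neg, ← one_div]
    exact one_div_le_one_div_of_le (by linarith) (by linarith [Real.add_one_le_exp z])
  have h2 : z / (1 + m) ≤ z / (1 + z) := div_le_div_of_nonneg_left hz (by linarith) (by linarith)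
  have h3 : z / (1 + z) = 1 - 1 / (1 + z) := by field_simp; ring
  linarith

/-- A linear lower bound for the probability of connecting two clusters by sprinkling. -/
theorem mul_le_perc_sup_conn (u : Sym2 W → ℝ≥0) (υ : ℝ≥0) {Λ Λ' : Finset W}
    (hu : ∀ a ∈ Λ, ∀ b ∈ Λ', a ≠ b → υ ≤ u s(a, b)) (ω : Sym2 W → Bool) (x y : W) (m : ℕ) :
    υ * (((min (cl Λ ω x).card m : ℕ) : ℝ≥0∞) * (min (cl Λ' ω y).card m : ℕ)) ≤
      (1 + υ * (m : ℝ≥0∞) ^ 2) * perc u {η | Conn (ω ⊔ η) x y} := by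
  set a := min (cl Λ ω x).card m
  set b := min (cl Λ' ω y).card m
  have ha : (a : ℝ) ≤ (cl Λ ω x).card := by exact_mod_cast min_le_left _ _
  have hb : (b : ℝ) ≤ (cl Λ' ω y).card := by exact_mod_cast min_le_left _ _
  have ha' : (a : ℝ) ≤ m := by exact_mod_cast min_le_right _ _
  have hb' : (b : ℝ) ≤ m := by exact_mod_cast min_le_right _ _
  have h1 := div_le_one_sub_exp (z := υ * (a * b)) (m := υ * (m : ℝ) ^ 2) (by positivity) (by
    rw [sq]; gcongr)
  have h2 : ENNReal.ofReal (υ * (a * b) / (1 + υ * (m : ℝ) ^ 2)) ≤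
      perc u {η | Conn (ω ⊔ η) x y} := by
    refine le_trans (ENNReal.ofReal_le_ofReal (h1.trans ?_)) (le_perc_sup_conn u υ hu ω x y)
    gcongr
  refine le_trans (le_of_eq ?_) (mul_le_mul_right h2 _)
  have e1 : (1 + υ * (m : ℝ≥0∞) ^ 2) = ENNReal.ofReal (1 + υ * (m : ℝ) ^ 2) := by
    rw [ENNReal.ofReal_add (by positivity) (by positivity), ENNReal.ofReal_mul (by positivity),
      ENNReal.ofReal_pow (by positivity)]
    simp
  rw [e1, ← ENNReal.ofReal_mul (by positivity), mul_div_cancel₀ _ (by positivity),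
    ENNReal.ofReal_mul (by positivity), ENNReal.ofReal_mul (by positivity)]
  simp

theorem tau_add_eq_lintegral (t u : Sym2 W → ℝ≥0) (x y : W) :
    tau (t + u) x y = ∫⁻ ω, perc u {η | Conn (ω ⊔ η) x y} ∂perc t :=
  perc_add_apply t u (measurableSet_conn x y)

/-- The number of connected triples is controlled by the cluster sizes. -/
theorem sum_sum_conn (Λ : Finset W) (ω : Sym2 W → Bool) (f : ℕ → ℝ≥0∞) :
    ∑ x ∈ Λ, ∑ y ∈ Λ, (if Conn ω x y then f (cl Λ ω x).card * f (cl Λ ω y).card else 0) =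
      ∑ x ∈ Λ, ((cl Λ ω x).card : ℝ≥0∞) * f (cl Λ ω x).card ^ 2 := by
  refine Finset.sum_congr rfl fun x _ => ?_
  rw [← Finset.sum_filter, Finset.sum_congr rfl (g := fun _ => f (cl Λ ω x).card ^ 2)]
  · rw [Finset.sum_const, nsmul_eq_mul]
    rfl
  · intro y hy
    rw [← cl_congr (Finset.mem_filter.1 hy).2, sq]

theorem sq_sum_cl_eq (Λ : Finset W) (ω : Sym2 W → Bool) (f : ℕ → ℝ≥0∞) :
    (∑ x ∈ Λ, f (cl Λ ω x).card) ^ 2 =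
      ∑ x ∈ Λ, ((cl Λ ω x).card : ℝ≥0∞) * f (cl Λ ω x).card ^ 2 +
      ∑ x ∈ Λ, ∑ y ∈ Λ, (if Conn ω x y then 0 else f (cl Λ ω x).card * f (cl Λ ω y).card) := by
  rw [← sum_sum_conn, ← Finset.sum_add_distrib, sq, Finset.sum_mul_sum]
  refine Finset.sum_congr rfl fun x _ => ?_
  rw [← Finset.sum_add_distrib]
  refine Finset.sum_congr rfl fun y _ => ?_
  split_ifs <;> simp

/-- If small clusters carry half of the expected number of connected pairs, sprinkling increases
this number. -/
theorem sq_pairs_le_of_small (t u : Sym2 W → ℝ≥0) (υ : ℝ≥0) {Λ : Finset W} {m : ℕ}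
    (hu : ∀ a ∈ Λ, ∀ b ∈ Λ, a ≠ b → υ ≤ u s(a, b))
    (hm : 8 * (m : ℝ≥0∞) ^ 2 ≤ pairs t Λ Λ)
    (h : pairs t Λ Λ ≤ 2 * ∫⁻ ω, ∑ x ∈ Λ,
      (if (cl Λ ω x).card < m then ((cl Λ ω x).card : ℝ≥0∞) else 0) ∂perc t) :
    υ * pairs t Λ Λ ^ 2 ≤ 8 * ((1 + υ * (m : ℝ≥0∞) ^ 2) * pairs (t + u) Λ Λ) := by
  set f : ℕ → ℝ≥0∞ := fun n => if n < m then (n : ℝ≥0∞) else 0 with hf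
  set P := pairs t Λ Λ with hP
  have hmf : ∀ x, Measurable fun ω : Sym2 W → Bool => f (cl Λ ω x).card :=
    fun x => measurable_of_card_cl Λ x f
  have hmZ : Measurable fun ω : Sym2 W → Bool => ∑ x ∈ Λ, f (cl Λ ω x).card :=
    Finset.measurable_fun_sum _ fun x _ => hmf x
  have hml : ∀ x y, Measurable fun ω : Sym2 W → Bool =>
      if Conn ω x y then 0 else f (cl Λ ω x).card * f (cl Λ ω y).card := fun x y =>
    Measurable.ite (measurableSet_conn x y) measurable_const ((hmf x).mul (hmf y))
  have h1 : (∫⁻ ω, ∑ x ∈ Λ, f (cl Λ ω x).card ∂perc t) ^ 2 ≤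
      ∫⁻ ω, (∑ x ∈ Λ, f (cl Λ ω x).card) ^ 2 ∂perc t := by
    have := sq_lintegral_le (μ := perc t) hmZ.aemeasurable MeasurableSet.univ
      (fun ω hω => absurd (Set.mem_univ ω) hω)
    rwa [measure_univ, mul_one] at this
  simp only [sq_sum_cl_eq] at h1
  rw [lintegral_add_left (Finset.measurable_fun_sum _ fun x _ =>
    measurable_of_card_cl Λ x fun n => n * f n ^ 2)] at h1
  have h2 : ∫⁻ ω, ∑ x ∈ Λ, ((cl Λ ω x).card : ℝ≥0∞) * f (cl Λ ω x).card ^ 2 ∂perc t ≤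
      (m : ℝ≥0∞) ^ 2 * P := by
    rw [hP, ← lintegral_sum_card_cl, ← lintegral_const_mul _
      (Finset.measurable_fun_sum _ fun x _ => measurable_of_card_cl Λ x fun n => n)]
    refine lintegral_mono fun ω => ?_
    simp only [Finset.mul_sum]
    refine Finset.sum_le_sum fun x _ => ?_
    rw [mul_comm]
    refine mul_le_mul_left (pow_le_pow_left₀ bot_le ?_ 2) _
    simp only [hf]
    split_ifs with hlt
    · exact_mod_cast hlt.le
    · exact bot_le
  have h3 : υ * ∫⁻ ω, ∑ x ∈ Λ, ∑ y ∈ Λ, (if Conn ω x y then 0 else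
      f (cl Λ ω x).card * f (cl Λ ω y).card) ∂perc t ≤
      (1 + υ * (m : ℝ≥0∞) ^ 2) * pairs (t + u) Λ Λ := by
    have hm0 : (1 + υ * (m : ℝ≥0∞) ^ 2) ≠ ∞ := by finiteness
    rw [lintegral_finsetSum _ fun x _ => Finset.measurable_fun_sum _ fun y _ => hml x y, pairs,
      Finset.mul_sum, Finset.mul_sum]
    refine Finset.sum_le_sum fun x _ => ?_
    rw [lintegral_finsetSum _ fun y _ => hml x y, Finset.mul_sum, Finset.mul_sum]
    refine Finset.sum_le_sum fun y _ => ?_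
    rw [tau_add_eq_lintegral, ← lintegral_const_mul' _ _ hm0,
      ← lintegral_const_mul _ (hml x y)]
    refine lintegral_mono fun ω => le_trans ?_ (mul_le_perc_sup_conn u υ hu ω x y m)
    refine mul_le_mul_right ?_ _
    split_ifs with hc
    · exact bot_le
    have hfm : ∀ n : ℕ, f n ≤ ((min n m : ℕ) : ℝ≥0∞) := by
      intro n
      simp only [hf]
      split_ifs with hlt
      · rw [min_eq_left hlt.le]
      · exact bot_le
    exact mul_le_mul' (hfm _) (hfm _)
  set A := ∫⁻ ω, ∑ x ∈ Λ, f (cl Λ ω x).card ∂perc t with hA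
  set B := ∫⁻ ω, ∑ x ∈ Λ, ∑ y ∈ Λ, (if Conn ω x y then 0 else
      f (cl Λ ω x).card * f (cl Λ ω y).card) ∂perc t with hB
  have h4 : P ≤ 2 * A := h
  have hPt : P ≠ ∞ := pairs_ne_top t Λ Λ
  have h5 : P ^ 2 ≤ 8 * B := by
    have h6 : P ^ 2 ≤ 4 * ((m : ℝ≥0∞) ^ 2 * P + B) := by
      calc P ^ 2 ≤ (2 * A) ^ 2 := pow_le_pow_left₀ bot_le h4 2
        _ = 4 * A ^ 2 := by ring
        _ ≤ _ := mul_le_mul_right (h1.trans (add_le_add h2 le_rfl)) _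
    have h7 : 8 * ((m : ℝ≥0∞) ^ 2 * P) ≤ P ^ 2 := by
      rw [← mul_assoc, sq P]
      exact mul_le_mul_left hm _
    have h8 : P ^ 2 + P ^ 2 ≤ 8 * B + P ^ 2 := by
      calc P ^ 2 + P ^ 2 ≤ 4 * ((m : ℝ≥0∞) ^ 2 * P + B) + 4 * ((m : ℝ≥0∞) ^ 2 * P + B) :=
            add_le_add h6 h6
        _ = 8 * B + 8 * ((m : ℝ≥0∞) ^ 2 * P) := by ring
        _ ≤ _ := add_le_add le_rfl h7
    exact (ENNReal.add_le_add_iff_right (by finiteness)).1 h8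
  calc υ * P ^ 2 ≤ υ * (8 * B) := mul_le_mul_right h5 _
    _ = 8 * (υ * B) := by ring
    _ ≤ _ := mul_le_mul_right h3 _

end Sprinkle

end LRP

namespace LRP

open scoped NNReal

theorem exists_nat_sq {s : ℝ} (hs : 1 ≤ s) : ∃ l : ℕ, 0 < l ∧ s ≤ (l : ℝ) ^ 2 ∧
    (l : ℝ) ^ 2 ≤ 4 * s := by
  have h0 : 1 ≤ √s := Real.one_le_sqrt.2 hs
  have h1 := Nat.le_ceil (√s)
  have h2 := Nat.ceil_lt_add_one (by linarith : 0 ≤ √s)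
  have h3 := Real.sq_sqrt (by linarith : 0 ≤ s)
  refine ⟨⌈√s⌉₊, Nat.ceil_pos.2 (by linarith), ?_, ?_⟩ <;> nlinarith

/-- Chebyshev's inequality for the number of occurring events among weakly dependent ones. -/
theorem measureReal_forall_notMem_le {Ω ι : Type*} [MeasurableSpace Ω] {μ : Measure Ω}
    [IsProbabilityMeasure μ] (I : Finset ι) {S : ι → Set Ω} (hS : ∀ i, MeasurableSet (S i))
    {ε : ℝ} (hε : 0 ≤ ε) (h : ∀ i ∈ I, ∀ j ∈ I, i ≠ j →
      μ.real (S i ∩ S j) ≤ μ.real (S i) * μ.real (S j) + ε) :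
    μ.real {ω | ∀ i ∈ I, ω ∉ S i} * (∑ i ∈ I, μ.real (S i)) ^ 2 ≤
      (∑ i ∈ I, μ.real (S i)) + (I.card : ℝ) ^ 2 * ε := by
  set a := ∑ i ∈ I, μ.real (S i) with ha
  set E := {ω | ∀ i ∈ I, ω ∉ S i} with hE
  have hEm : MeasurableSet E := by
    have : E = ⋂ i ∈ I, (S i)ᶜ := by
      ext ω; simp [hE]
    rw [this]
    exact Finset.measurableSet_biInter _ fun i _ => (hS i).compl
  set g : ι → Ω → ℝ := fun i => (S i).indicator fun _ => 1 with hg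
  set gE : Ω → ℝ := E.indicator fun _ => 1 with hgE
  have hi : ∀ {T : Set Ω}, MeasurableSet T → Integrable (T.indicator fun _ => (1 : ℝ)) μ :=
    fun hT => (integrable_const 1).indicator hT
  have hgg : ∀ i j ω, g i ω * g j ω = (S i ∩ S j).indicator (fun _ => (1 : ℝ)) ω := by
    intro i j ω
    by_cases h1 : ω ∈ S i <;> by_cases h2 : ω ∈ S j <;> simp [hg, h1, h2]
  have hpt : ∀ ω, a ^ 2 * gE ω + 2 * a * ∑ i ∈ I, g i ω ≤
      a ^ 2 + ∑ i ∈ I, ∑ j ∈ I, (S i ∩ S j).indicator (fun _ => (1 : ℝ)) ω := by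
    intro ω
    have e1 : ∑ i ∈ I, ∑ j ∈ I, (S i ∩ S j).indicator (fun _ => (1 : ℝ)) ω =
        (∑ i ∈ I, g i ω) ^ 2 := by
      rw [sq, Finset.sum_mul_sum]
      exact Finset.sum_congr rfl fun i _ => Finset.sum_congr rfl fun j _ => (hgg i j ω).symm
    rw [e1]
    by_cases hω : ω ∈ E
    · have e2 : ∑ i ∈ I, g i ω = 0 := Finset.sum_eq_zero fun i hi' => by
        simp [hg, hω i hi']
      simp [hgE, hω, e2]
    · simp only [hgE, hω, not_false_eq_true, Set.indicator_of_notMem, mul_zero, zero_add]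
      nlinarith [sq_nonneg (a - ∑ i ∈ I, g i ω)]
  have hI := integral_mono (μ := μ)
    (((hi hEm).const_mul (a ^ 2)).add ((integrable_finsetSum I fun i _ => hi (hS i)).const_mul
      (2 * a)))
    ((integrable_const (a ^ 2)).add (integrable_finsetSum I fun i _ =>
      integrable_finsetSum I fun j _ => hi ((hS i).inter (hS j)))) hpt
  simp only [Pi.add_apply] at hI
  rw [integral_add ((hi hEm).const_mul (a ^ 2)) ((integrable_finsetSum I fun i _ =>
      hi (hS i)).const_mul (2 * a)),
    integral_add (integrable_const _) (integrable_finsetSum I fun i _ =>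
      integrable_finsetSum I fun j _ => hi ((hS i).inter (hS j))),
    integral_const_mul, integral_const_mul, integral_finsetSum I fun i _ => hi (hS i),
    integral_finsetSum I fun i _ => integrable_finsetSum I fun j _ => hi ((hS i).inter (hS j))]
    at hI
  have e3 : ∀ {T : Set Ω}, MeasurableSet T →
      ∫ ω, T.indicator (fun _ => (1 : ℝ)) ω ∂μ = μ.real T := fun hT => by
    rw [integral_indicator_const _ hT, smul_eq_mul, mul_one]
  have e4 : ∀ i ∈ I, ∫ ω, ∑ j ∈ I, (S i ∩ S j).indicator (fun _ => (1 : ℝ)) ω ∂μ =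
      ∑ j ∈ I, μ.real (S i ∩ S j) := fun i _ => by
    rw [integral_finsetSum I fun j _ => hi ((hS i).inter (hS j))]
    exact Finset.sum_congr rfl fun j _ => e3 ((hS i).inter (hS j))
  rw [Finset.sum_congr rfl e4, Finset.sum_congr rfl fun i _ => e3 (hS i), e3 hEm, ← ha] at hI
  have e5 : ∑ i ∈ I, ∑ j ∈ I, μ.real (S i ∩ S j) ≤
      ∑ i ∈ I, ∑ j ∈ I, (μ.real (S i) * μ.real (S j) + ε + if i = j then μ.real (S i) else 0) := by
    refine Finset.sum_le_sum fun i hi' => Finset.sum_le_sum fun j hj => ?_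
    by_cases hij : i = j
    · subst hij
      rw [Set.inter_self, if_pos rfl]
      have : 0 ≤ μ.real (S i) * μ.real (S i) := by positivity
      linarith
    · rw [if_neg hij, add_zero]
      exact h i hi' j hj hij
  simp only [Finset.sum_add_distrib, Finset.sum_ite_eq, Finset.sum_const, nsmul_eq_mul] at e5
  rw [← Finset.sum_mul_sum, ← ha, Finset.sum_congr rfl fun i hi' => if_pos hi', ← ha] at e5
  simp only [integral_const, probReal_univ, smul_eq_mul, one_mul] at hI
  nlinarith [hI, e5]

section Giants

variable {W : Type*} [Countable W]

/-- The event that some cluster has at least `m` points in `Λ`. -/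
def big (Λ : Finset W) (m : ℕ) : Set (Sym2 W → Bool) := ⋃ v, {ω | m ≤ (cl Λ ω v).card}

theorem inc_big (Λ : Finset W) (m : ℕ) : Inc (big Λ m) := Inc.iUnion fun v => inc_card_cl Λ m v

theorem mem_big {Λ : Finset W} {m : ℕ} {ω : Sym2 W → Bool} :
    ω ∈ big Λ m ↔ ∃ v, m ≤ (cl Λ ω v).card := Set.mem_iUnion

/-- If large clusters carry half of the expected number of connected pairs, then there is a large
cluster with probability bounded below. -/
theorem one_le_perc_big (t : Sym2 W → ℝ≥0) {Λ : Finset W} {m : ℕ} (h1 : 1 ≤ pairs t Λ Λ)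
    (h : pairs t Λ Λ ≤ 2 * ∫⁻ ω, ∑ x ∈ Λ,
      (if m ≤ (cl Λ ω x).card then ((cl Λ ω x).card : ℝ≥0∞) else 0) ∂perc t) :
    1 ≤ 40000 * perc t (big Λ m) := by
  set P := pairs t Λ Λ with hP
  have hPt : P ≠ ∞ := pairs_ne_top t Λ Λ
  have hP0 : P ≠ 0 := (one_pos.trans_le h1).ne'
  obtain ⟨l, hl, hl1, hl2⟩ := exists_nat_sq (s := 150 * P.toReal) (by
    have : (1 : ℝ) ≤ P.toReal := by
      rw [← ENNReal.toReal_one]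
      exact (ENNReal.toReal_le_toReal (by finiteness) hPt).2 h1
    linarith)
  have hlP : 150 * P ≤ (l : ℝ≥0∞) ^ 2 := by
    rw [← ENNReal.toReal_le_toReal (by finiteness) (by finiteness)]
    simpa using hl1
  have hlP' : (l : ℝ≥0∞) ^ 2 ≤ 600 * P := by
    rw [← ENNReal.toReal_le_toReal (by finiteness) (by finiteness)]
    simp only [toReal_pow, toReal_natCast, toReal_mul, toReal_ofNat]
    linarith
  set f : ℕ → ℝ≥0∞ := fun n => if m ≤ n ∧ n < 3 * l then (n : ℝ≥0∞) else 0 with hf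
  have hmf : ∀ x, Measurable fun ω : Sym2 W → Bool => f (cl Λ ω x).card :=
    fun x => measurable_of_card_cl Λ x f
  have hmZ : Measurable fun ω : Sym2 W → Bool => ∑ x ∈ Λ, f (cl Λ ω x).card :=
    Finset.measurable_fun_sum _ fun x _ => hmf x
  set Z := ∫⁻ ω, ∑ x ∈ Λ, f (cl Λ ω x).card ∂perc t with hZ
  set T := ∫⁻ ω, ∑ x ∈ Λ,
      (if 3 * l ≤ (cl Λ ω x).card then ((cl Λ ω x).card : ℝ≥0∞) else 0) ∂perc t with hT
  have hT8 : 8 * T ≤ P := by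
    rw [hT, lintegral_finsetSum _ fun x _ =>
      measurable_of_card_cl Λ x fun n => if 3 * l ≤ n then (n : ℝ≥0∞) else 0, Finset.mul_sum]
    exact Finset.sum_le_sum fun x _ => lintegral_card_cl_large_le t Λ hl hlP x
  have hPZ : 3 * P ≤ 8 * Z := by
    have e1 : P ≤ 2 * (Z + T) := by
      refine h.trans (mul_le_mul_right ?_ _)
      rw [hZ, hT, ← lintegral_add_left hmZ]
      refine lintegral_mono fun ω => ?_
      rw [← Finset.sum_add_distrib]
      refine Finset.sum_le_sum fun x _ => ?_
      simp only [hf]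
      by_cases h2 : m ≤ (cl Λ ω x).card <;> by_cases h3 : 3 * l ≤ (cl Λ ω x).card <;>
        simp [h2, h3, not_lt.2, not_le.1]
    have e2 : 3 * P + P ≤ 8 * Z + P := by
      calc 3 * P + P = 4 * P := by ring
        _ ≤ 4 * (2 * (Z + T)) := mul_le_mul_right e1 _
        _ = 8 * Z + 8 * T := by ring
        _ ≤ _ := add_le_add le_rfl hT8
    exact (ENNReal.add_le_add_iff_right hPt).1 e2
  have hZ0 : ∀ ω, ω ∉ big Λ m → ∑ x ∈ Λ, f (cl Λ ω x).card = 0 := by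
    intro ω hω
    refine Finset.sum_eq_zero fun x _ => ?_
    simp only [hf]
    rw [if_neg]
    exact fun h' => hω (mem_big.2 ⟨x, h'.1⟩)
  have hsq := sq_lintegral_le (μ := perc t) hmZ.aemeasurable (inc_big Λ m).measurableSet hZ0
  rw [← hZ] at hsq
  simp only [sq_sum_cl_eq] at hsq
  rw [lintegral_add_left (Finset.measurable_fun_sum _ fun x _ =>
    measurable_of_card_cl Λ x fun n => n * f n ^ 2)] at hsq
  have e1 : ∫⁻ ω, ∑ x ∈ Λ, ((cl Λ ω x).card : ℝ≥0∞) * f (cl Λ ω x).card ^ 2 ∂perc t ≤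
      9 * (l : ℝ≥0∞) ^ 2 * P := by
    rw [hP, ← lintegral_sum_card_cl, ← lintegral_const_mul _
      (Finset.measurable_fun_sum _ fun x _ => measurable_of_card_cl Λ x fun n => n)]
    refine lintegral_mono fun ω => ?_
    simp only [Finset.mul_sum]
    refine Finset.sum_le_sum fun x _ => ?_
    rw [mul_comm]
    refine mul_le_mul_left ?_ _
    rw [show 9 * (l : ℝ≥0∞) ^ 2 = (3 * l) ^ 2 by ring]
    refine pow_le_pow_left₀ bot_le ?_ 2
    simp only [hf]
    split_ifs with hlt
    · exact_mod_cast hlt.2.le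
    · exact bot_le
  have e2 : ∫⁻ ω, ∑ x ∈ Λ, ∑ y ∈ Λ, (if Conn ω x y then 0 else
      f (cl Λ ω x).card * f (cl Λ ω y).card) ∂perc t ≤ P ^ 2 := by
    have hfn : ∀ n, f n ≤ n := fun n => by
      simp only [hf]
      split_ifs
      · exact le_rfl
      · exact bot_le
    have hml : ∀ x y, Measurable fun ω : Sym2 W → Bool =>
        if Conn ω x y then 0 else f (cl Λ ω x).card * f (cl Λ ω y).card := fun x y =>
      Measurable.ite (measurableSet_conn x y) measurable_const ((hmf x).mul (hmf y))
    rw [lintegral_finsetSum _ fun x _ => Finset.measurable_fun_sum _ fun y _ => hml x y, sq, hP,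
      pairs, Finset.sum_mul_sum]
    refine Finset.sum_le_sum fun x _ => ?_
    rw [lintegral_finsetSum _ fun y _ => hml x y]
    refine Finset.sum_le_sum fun y _ => ?_
    refine le_trans (lintegral_mono fun ω => ?_) (lintegral_card_cl_mul_le t Λ Λ x y)
    dsimp only
    split_ifs
    · exact le_rfl
    · exact mul_le_mul' (hfn _) (hfn _)
  have e3 : 9 * P ^ 2 ≤ 345664 * perc t (big Λ m) * P ^ 2 := by
    calc 9 * P ^ 2 = (3 * P) ^ 2 := by ring
      _ ≤ (8 * Z) ^ 2 := pow_le_pow_left₀ bot_le hPZ 2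
      _ = 64 * Z ^ 2 := by ring
      _ ≤ 64 * ((9 * (600 * P) * P + P ^ 2) * perc t (big Λ m)) := by
          refine mul_le_mul_right (hsq.trans (mul_le_mul_left (add_le_add (e1.trans ?_) e2) _)) _
          gcongr
      _ = _ := by ring
  have e4 := (ENNReal.mul_le_mul_iff_left (pow_ne_zero 2 hP0) (by finiteness)).1 e3
  have hfin : perc t (big Λ m) ≠ ∞ := measure_ne_top _ _
  rw [← ENNReal.toReal_le_toReal (by finiteness) (by finiteness)] at e4 ⊢
  simp only [toReal_mul, toReal_ofNat, toReal_one] at e4 ⊢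
  linarith

theorem perc_big_inter_big_le (t : Sym2 W → ℝ≥0) (Λ Λ' : Finset W) (m : ℕ) :
    (m : ℝ≥0∞) ^ 2 * perc t (big Λ m ∩ big Λ' m) ≤
      (m : ℝ≥0∞) ^ 2 * (perc t (big Λ m) * perc t (big Λ' m)) + pairs t Λ Λ' := by
  set E := {ω : Sym2 W → Bool | (m : ℝ≥0∞) ^ 2 ≤ ∑ x ∈ Λ, ((cl Λ' ω x).card : ℝ≥0∞)} with hE
  have hsub : big Λ m ∩ big Λ' m ⊆ disj (big Λ m) (big Λ' m) ∪ E := by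
    rintro ω ⟨h1, h2⟩
    obtain ⟨v, hv⟩ := mem_big.1 h1
    obtain ⟨w, hw⟩ := mem_big.1 h2
    by_cases hvw : Conn ω v w
    · right
      rw [cl_congr hvw.symm] at hw
      calc (m : ℝ≥0∞) ^ 2 ≤ ∑ x ∈ cl Λ ω v, (m : ℝ≥0∞) := by
            rw [Finset.sum_const, nsmul_eq_mul, sq]
            gcongr
        _ ≤ ∑ x ∈ cl Λ ω v, ((cl Λ' ω x).card : ℝ≥0∞) := by
            refine Finset.sum_le_sum fun x hx => ?_
            rw [← cl_congr (mem_cl.1 hx).2]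
            exact_mod_cast hw
        _ ≤ _ := Finset.sum_le_sum_of_subset (Finset.filter_subset _ _)
    · left
      refine mem_disj (inc_big Λ' m).up (s := inS (cluster ω v))
        (s' := inS (cluster ω w)) (disjoint_inS ?_) ?_ ?_
      · rw [Set.disjoint_left]
        exact fun z hz hz' => hvw (Conn.trans (y := z) hz (Conn.symm hz'))
      · refine mem_big.2 ⟨v, hv.trans (Finset.card_le_card fun y hy => ?_)⟩
        exact mem_cl.2 ⟨(mem_cl.1 hy).1, conn_restr_cluster (mem_cl.1 hy).2⟩
      · refine mem_big.2 ⟨w, hw.trans (Finset.card_le_card fun y hy => ?_)⟩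
        exact mem_cl.2 ⟨(mem_cl.1 hy).1, conn_restr_cluster (mem_cl.1 hy).2⟩
  calc _ ≤ (m : ℝ≥0∞) ^ 2 * (perc t (disj (big Λ m) (big Λ' m)) + perc t E) :=
        mul_le_mul_right ((measure_mono hsub).trans (measure_union_le _ _)) _
    _ = (m : ℝ≥0∞) ^ 2 * perc t (disj (big Λ m) (big Λ' m)) + (m : ℝ≥0∞) ^ 2 * perc t E :=
        mul_add _ _ _
    _ ≤ _ := by
        refine add_le_add (mul_le_mul_right (perc_disj_le t (inc_big Λ m) (inc_big Λ' m)) _) ?_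
        rw [← lintegral_sum_card_cl]
        exact mul_meas_ge_le_lintegral (Finset.measurable_fun_sum _ fun x _ =>
          measurable_of_card_cl Λ' x fun n => n) _

/-- Consecutive windows of boxes each containing a large cluster can be joined by sprinkling. -/
theorem sq_mul_perc_chain_le (t u : Sym2 W → ℝ≥0) (υ : ℝ≥0) (Λ : ℕ → Finset W) (N n m : ℕ)
    (hu : ∀ k < n, ∀ i ∈ Finset.Ico (k * N) (k * N + N),
      ∀ j ∈ Finset.Ico ((k + 1) * N) ((k + 1) * N + N),
      ∀ a ∈ Λ i, ∀ b ∈ Λ j, a ≠ b → υ ≤ u s(a, b)) :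
    (m : ℝ≥0∞) ^ 2 * ENNReal.ofReal (1 - n * Real.exp (-(υ * (m : ℝ) ^ 2))) *
        perc t {ω | ∀ k ≤ n, ∃ i ∈ Finset.Ico (k * N) (k * N + N), ω ∈ big (Λ i) m} ≤
      ∑ i ∈ Finset.Ico 0 N, ∑ j ∈ Finset.Ico (n * N) (n * N + N),
        pairs (t + u) (Λ i) (Λ j) := by
  set G := {ω | ∀ k ≤ n, ∃ i ∈ Finset.Ico (k * N) (k * N + N), ω ∈ big (Λ i) m} with hG
  have hGm : MeasurableSet G := by
    have : G = ⋂ k ∈ Finset.range (n + 1), ⋃ i ∈ Finset.Ico (k * N) (k * N + N), big (Λ i) m := by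
      ext ω
      simp only [hG, Set.mem_ofPred_eq, Set.mem_iInter, Finset.mem_range, Nat.lt_succ_iff,
        Set.mem_iUnion, exists_prop]
    rw [this]
    exact Finset.measurableSet_biInter _ fun k _ => Finset.measurableSet_biUnion _ fun i _ =>
      (inc_big _ _).measurableSet
  have hmeas : ∀ x y, Measurable fun ω : Sym2 W → Bool => perc u {η | Conn (ω ⊔ η) x y} := by
    intro x y
    exact measurable_measure_prodMk_left (measurable_sup (measurableSet_conn x y))
  set F : (Sym2 W → Bool) → ℝ≥0∞ := fun ω => ∑ i ∈ Finset.Ico 0 N,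
    ∑ j ∈ Finset.Ico (n * N) (n * N + N), ∑ x ∈ Λ i, ∑ y ∈ Λ j,
      perc u {η | Conn (ω ⊔ η) x y} with hF
  have hFm : Measurable F := Finset.measurable_fun_sum _ fun i _ =>
    Finset.measurable_fun_sum _ fun j _ => Finset.measurable_fun_sum _ fun x _ =>
      Finset.measurable_fun_sum _ fun y _ => hmeas x y
  have hFint : ∫⁻ ω, F ω ∂perc t = ∑ i ∈ Finset.Ico 0 N,
      ∑ j ∈ Finset.Ico (n * N) (n * N + N), pairs (t + u) (Λ i) (Λ j) := by
    simp only [hF]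
    rw [lintegral_finsetSum _ fun i _ => Finset.measurable_fun_sum _ fun j _ =>
      Finset.measurable_fun_sum _ fun x _ => Finset.measurable_fun_sum _ fun y _ => hmeas x y]
    refine Finset.sum_congr rfl fun i _ => ?_
    rw [lintegral_finsetSum _ fun j _ =>
      Finset.measurable_fun_sum _ fun x _ => Finset.measurable_fun_sum _ fun y _ => hmeas x y]
    refine Finset.sum_congr rfl fun j _ => ?_
    rw [lintegral_finsetSum _ fun x _ => Finset.measurable_fun_sum _ fun y _ => hmeas x y]
    refine Finset.sum_congr rfl fun x _ => ?_
    rw [lintegral_finsetSum _ fun y _ => hmeas x y]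
    exact Finset.sum_congr rfl fun y _ => (tau_add_eq_lintegral t u x y).symm
  have hpt : ∀ ω ∈ G, (m : ℝ≥0∞) ^ 2 *
      ENNReal.ofReal (1 - n * Real.exp (-(υ * (m : ℝ) ^ 2))) ≤ F ω := by
    intro ω hω
    have hch : ∀ k : ℕ, ∃ z : W, ∃ i : ℕ, k ≤ n →
        i ∈ Finset.Ico (k * N) (k * N + N) ∧ m ≤ (cl (Λ i) ω z).card := by
      intro k
      by_cases hk : k ≤ n
      · obtain ⟨i, hi, hb⟩ := hω k hk
        obtain ⟨z, hz⟩ := mem_big.1 hb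
        exact ⟨z, i, fun _ => ⟨hi, hz⟩⟩
      · obtain ⟨i, hi, hb⟩ := hω 0 (Nat.zero_le _)
        obtain ⟨z, hz⟩ := mem_big.1 hb
        exact ⟨z, i, fun h => absurd h hk⟩
    choose z i hzi using hch
    have hedge : ∀ k < n, perc u {η | ¬ Conn (ω ⊔ η) (z k) (z (k + 1))} ≤
        ENNReal.ofReal (Real.exp (-(υ * (m : ℝ) ^ 2))) := by
      intro k hk
      obtain ⟨h1, h2⟩ := hzi k hk.le
      obtain ⟨h3, h4⟩ := hzi (k + 1) hk
      refine (perc_sup_not_conn_le u υ (hu k hk (i k) h1 (i (k + 1)) h3) ω _ _).trans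
        (ENNReal.ofReal_le_ofReal (Real.exp_le_exp.2 (neg_le_neg ?_)))
      have h2' : (m : ℝ) ≤ (cl (Λ (i k)) ω (z k)).card := by exact_mod_cast h2
      have h4' : (m : ℝ) ≤ (cl (Λ (i (k + 1))) ω (z (k + 1))).card := by exact_mod_cast h4
      rw [sq]
      gcongr
    have hall : perc u {η | ¬ Conn (ω ⊔ η) (z 0) (z n)} ≤
        ENNReal.ofReal (n * Real.exp (-(υ * (m : ℝ) ^ 2))) := by
      have hsub : {η : Sym2 W → Bool | ¬ Conn (ω ⊔ η) (z 0) (z n)} ⊆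
          ⋃ k ∈ Finset.range n, {η | ¬ Conn (ω ⊔ η) (z k) (z (k + 1))} := by
        intro η hη
        by_contra hno
        simp only [Set.mem_iUnion, Finset.mem_range, Set.mem_ofPred_eq, exists_prop, not_exists,
          not_and, not_not] at hno
        refine hη ?_
        have : ∀ k ≤ n, Conn (ω ⊔ η) (z 0) (z k) := by
          intro k
          induction k with
          | zero => exact fun _ => conn_refl _ _
          | succ k ih => exact fun hk => (ih (by omega)).trans (hno k (by omega))
        exact this n le_rfl
      refine (measure_mono hsub).trans ((measure_biUnion_finset_le _ _).trans ?_)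
      refine (Finset.sum_le_sum fun k hk => hedge k (Finset.mem_range.1 hk)).trans (le_of_eq ?_)
      rw [Finset.sum_const, Finset.card_range, nsmul_eq_mul, ENNReal.ofReal_mul (by positivity),
        ENNReal.ofReal_natCast]
    have hconn : ENNReal.ofReal (1 - n * Real.exp (-(υ * (m : ℝ) ^ 2))) ≤
        perc u {η | Conn (ω ⊔ η) (z 0) (z n)} := by
      have := prob_compl_eq_one_sub (μ := perc u) (measurableSet_sup_conn ω (z 0) (z n)).compl
      rw [compl_compl] at this
      rw [this, ENNReal.ofReal_sub _ (by positivity), ENNReal.ofReal_one]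
      exact tsub_le_tsub_left hall 1
    obtain ⟨h1, h2⟩ := hzi 0 (Nat.zero_le _)
    obtain ⟨h3, h4⟩ := hzi n le_rfl
    rw [zero_mul, zero_add] at h1
    calc _ ≤ (m : ℝ≥0∞) ^ 2 * perc u {η | Conn (ω ⊔ η) (z 0) (z n)} := mul_le_mul_right hconn _
      _ ≤ ∑ x ∈ cl (Λ (i 0)) ω (z 0), ∑ y ∈ cl (Λ (i n)) ω (z n),
          perc u {η | Conn (ω ⊔ η) (z 0) (z n)} := by
          simp only [Finset.sum_const, nsmul_eq_mul]
          rw [← mul_assoc, sq]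
          gcongr
      _ ≤ ∑ x ∈ cl (Λ (i 0)) ω (z 0), ∑ y ∈ cl (Λ (i n)) ω (z n),
          perc u {η | Conn (ω ⊔ η) x y} := by
          refine Finset.sum_le_sum fun x hx => Finset.sum_le_sum fun y hy => measure_mono ?_
          intro η hη
          exact (((mem_cl.1 hx).2.symm.mono le_sup_left).trans hη).trans
            ((mem_cl.1 hy).2.mono le_sup_left)
      _ ≤ ∑ x ∈ Λ (i 0), ∑ y ∈ Λ (i n), perc u {η | Conn (ω ⊔ η) x y} := by
          refine le_trans (Finset.sum_le_sum fun x _ =>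
            Finset.sum_le_sum_of_subset (Finset.filter_subset _ _)) ?_
          exact Finset.sum_le_sum_of_subset (Finset.filter_subset _ _)
      _ ≤ ∑ j ∈ Finset.Ico (n * N) (n * N + N), ∑ x ∈ Λ (i 0), ∑ y ∈ Λ j,
          perc u {η | Conn (ω ⊔ η) x y} :=
          Finset.single_le_sum (f := fun j => ∑ x ∈ Λ (i 0), ∑ y ∈ Λ j,
            perc u {η | Conn (ω ⊔ η) x y}) (fun _ _ => bot_le) h3
      _ ≤ F ω := Finset.single_le_sum (f := fun i => ∑ j ∈ Finset.Ico (n * N) (n * N + N),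
            ∑ x ∈ Λ i, ∑ y ∈ Λ j, perc u {η | Conn (ω ⊔ η) x y}) (fun _ _ => bot_le) h1
  rw [← hFint, ← lintegral_indicator_const hGm]
  refine lintegral_mono fun ω => ?_
  by_cases hω : ω ∈ G
  · simpa only [hω, Set.indicator_of_mem] using hpt ω hω
  · simp [hω]

end Giants

end LRP

namespace LRP
open scoped NNReal

/-! ## Windows of weakly correlated events -/

theorem half_le_measureReal_windows {Ω : Type*} [MeasurableSpace Ω] {μ : Measure Ω}
    [IsProbabilityMeasure μ] {n : ℕ} {S : ℕ → Set Ω} (hS : ∀ i, MeasurableSet (S i))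
    {ε p : ℝ} (hε : 0 ≤ ε) (hp : 0 < p) (hp1 : ∀ i, p ≤ μ.real (S i)) {N : ℕ}
    (hN : 4 * (n + 1) ≤ N * p) (hεp : 4 * (n + 1) * ε ≤ p ^ 2)
    (h : ∀ i j, i ≠ j → μ.real (S i ∩ S j) ≤ μ.real (S i) * μ.real (S j) + ε) :
    1 / 2 ≤ μ.real {ω | ∀ k ≤ n, ∃ i ∈ Finset.Ico (k * N) (k * N + N), ω ∈ S i} := by
  have hn : (0 : ℝ) < n + 1 := by positivity
  have hbad : ∀ k, μ.real {ω | ∀ i ∈ Finset.Ico (k * N) (k * N + N), ω ∉ S i} ≤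
      1 / (2 * (n + 1)) := by
    intro k
    have h1 := measureReal_forall_notMem_le (μ := μ) (Finset.Ico (k * N) (k * N + N)) hS hε
      fun i _ j _ hij => h i j hij
    set f := μ.real {ω | ∀ i ∈ Finset.Ico (k * N) (k * N + N), ω ∉ S i}
    have h2 : N * p ≤ ∑ i ∈ Finset.Ico (k * N) (k * N + N), μ.real (S i) := by
      have := Finset.card_nsmul_le_sum (Finset.Ico (k * N) (k * N + N)) (fun i => μ.real (S i)) p
        fun i _ => hp1 i
      simpa using this
    set s := ∑ i ∈ Finset.Ico (k * N) (k * N + N), μ.real (S i)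
    rw [Nat.card_Ico, Nat.add_sub_cancel_left] at h1
    have hs : 0 < s := lt_of_lt_of_le (by linarith) h2
    have h3 : (N : ℝ) ^ 2 * ε * (4 * (n + 1)) ≤ s ^ 2 := by
      calc (N : ℝ) ^ 2 * ε * (4 * (n + 1)) = N ^ 2 * (4 * (n + 1) * ε) := by ring
        _ ≤ N ^ 2 * p ^ 2 := by gcongr
        _ = (N * p) ^ 2 := by ring
        _ ≤ s ^ 2 := by
          have : 0 ≤ (N : ℝ) * p := by positivity
          gcongr
    have h4 : s * (4 * (n + 1)) ≤ s ^ 2 := by nlinarith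
    rw [le_div_iff₀ (by positivity)]
    have h5 : f * s ^ 2 * (4 * (n + 1)) ≤ 2 * s ^ 2 := by
      calc f * s ^ 2 * (4 * (n + 1)) ≤ (s + N ^ 2 * ε) * (4 * (n + 1)) := by gcongr
        _ ≤ 2 * s ^ 2 := by linarith
    have h6 : (0 : ℝ) < s ^ 2 := by positivity
    by_contra! hc
    nlinarith
  have hmeas : ∀ k, MeasurableSet {ω | ∃ i ∈ Finset.Ico (k * N) (k * N + N), ω ∈ S i} := by
    intro k
    have : {ω | ∃ i ∈ Finset.Ico (k * N) (k * N + N), ω ∈ S i} =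
        ⋃ i ∈ Finset.Ico (k * N) (k * N + N), S i := by ext; simp
    rw [this]
    exact Finset.measurableSet_biUnion _ fun i _ => hS i
  have hG : MeasurableSet {ω | ∀ k ≤ n, ∃ i ∈ Finset.Ico (k * N) (k * N + N), ω ∈ S i} := by
    have : {ω | ∀ k ≤ n, ∃ i ∈ Finset.Ico (k * N) (k * N + N), ω ∈ S i} =
        ⋂ k ∈ Finset.range (n + 1), {ω | ∃ i ∈ Finset.Ico (k * N) (k * N + N), ω ∈ S i} := by
      ext
      simp only [Set.mem_ofPred_eq, Set.mem_iInter, Finset.mem_range, Nat.lt_succ_iff]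
    rw [this]
    exact Finset.measurableSet_biInter _ fun k _ => hmeas k
  have hc := probReal_add_probReal_compl (μ := μ) hG
  have hsub : {ω | ∀ k ≤ n, ∃ i ∈ Finset.Ico (k * N) (k * N + N), ω ∈ S i}ᶜ ⊆
      ⋃ k ∈ Finset.range (n + 1), {ω | ∀ i ∈ Finset.Ico (k * N) (k * N + N), ω ∉ S i} := by
    intro ω hω
    simp only [Set.mem_compl_iff, Set.mem_ofPred_eq] at hω
    push Not at hω
    obtain ⟨k, hk, h⟩ := hω
    exact Set.mem_biUnion (x := k) (by simpa [Nat.lt_succ_iff] using hk) h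
  have hle : μ.real {ω | ∀ k ≤ n, ∃ i ∈ Finset.Ico (k * N) (k * N + N), ω ∈ S i}ᶜ ≤ 1 / 2 := by
    refine (measureReal_mono hsub (measure_ne_top _ _)).trans
      ((measureReal_biUnion_finset_le _ _).trans ((Finset.sum_le_sum fun k _ => hbad k).trans ?_))
    rw [Finset.sum_const, Finset.card_range, nsmul_eq_mul]
    push_cast
    apply le_of_eq
    field_simp
  linarith

namespace Kernel

variable {d : ℕ} {α : ℝ} (κ : Kernel d α)

/-! ## Boxes -/

/-- The ball of radius `ρ` centred at `z`. -/
noncomputable def box (ρ : ℝ) (z : V d) : Finset (V d) :=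
  (κ.fball ρ).map (addRightEmbedding z)

theorem mem_box {ρ : ℝ} {z x : V d} : x ∈ κ.box ρ z ↔ κ.nd x z ≤ ρ := by
  rw [nd_eq, box, Finset.mem_map]
  constructor
  · rintro ⟨a, ha, rfl⟩
    simpa [mem_fball] using ha
  · intro h
    exact ⟨x - z, κ.mem_fball.2 h, by simp⟩

theorem card_box (ρ : ℝ) (z : V d) : (κ.box ρ z).card = (κ.fball ρ).card := Finset.card_map _

theorem sum_box_tau {t : Sym2 (V d) → ℝ≥0} (ht : TransInv t) (ρ : ℝ) (z : V d) :
    ∑ y ∈ κ.box ρ z, tau t z y = ∑ y ∈ κ.fball ρ, tau t 0 y := by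
  rw [box, Finset.sum_map]
  refine Finset.sum_congr rfl fun y _ => ?_
  rw [tau_eq_zero_sub ht]
  simp

theorem pairs_box_self {t : Sym2 (V d) → ℝ≥0} (ht : TransInv t) (ρ : ℝ) (z : V d) :
    pairs t (κ.box ρ z) (κ.box ρ z) = pairs t (κ.fball ρ) (κ.fball ρ) := by
  simp only [pairs, box, Finset.sum_map, addRightEmbedding_apply, tau_add ht]

theorem sum_tau_le_sus {t : Sym2 (V d) → ℝ≥0} (ht : TransInv t) (Λ : Finset (V d)) (x : V d) :
    ∑ y ∈ Λ, tau t x y ≤ sus t 0 := by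
  rw [← sus_eq ht x]
  exact ENNReal.sum_le_tsum _

theorem pairs_le_card_mul_sus {t : Sym2 (V d) → ℝ≥0} (ht : TransInv t) (Λ Λ' : Finset (V d)) :
    pairs t Λ Λ' ≤ Λ.card * sus t 0 := by
  rw [← nsmul_eq_mul]
  exact Finset.sum_le_card_nsmul _ _ _ fun x _ => sum_tau_le_sus ht _ _

theorem tail_eq {t : Sym2 (V d) → ℝ≥0} (ht : TransInv t) (R : ℝ) (x : V d) :
    ∑' y, (if R ≤ κ.nd x y then tau t x y else 0) = κ.tail t R := by
  rw [tail, ← (Equiv.addRight x).tsum_eq]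
  refine tsum_congr fun y => ?_
  rw [nd_eq', tau_eq_zero_sub ht]
  simp

theorem pairs_le_card_mul_tail {t : Sym2 (V d) → ℝ≥0} (ht : TransInv t) {Λ Λ' : Finset (V d)}
    {R : ℝ} (h : ∀ a ∈ Λ, ∀ b ∈ Λ', R ≤ κ.nd a b) :
    pairs t Λ Λ' ≤ Λ.card * κ.tail t R := by
  rw [← nsmul_eq_mul]
  refine Finset.sum_le_card_nsmul _ _ _ fun x hx => ?_
  rw [← κ.tail_eq ht R x]
  refine le_trans (Finset.sum_le_sum fun y hy => ?_) (ENNReal.sum_le_tsum Λ')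
  rw [if_pos (h x hx y hy)]

/-- Most of the susceptibility comes from a ball outside of which the tail is small. -/
theorem sus_le_two_mul_sum {t : Sym2 (V d) → ℝ≥0} (hs : sus t 0 < ∞) {R : ℝ}
    (h : 2 * κ.tail t R ≤ sus t 0) : sus t 0 ≤ 2 * ∑ y ∈ κ.fball R, tau t 0 y := by
  have h1 : sus t 0 ≤ ∑ y ∈ κ.fball R, tau t 0 y + κ.tail t R := by
    have h0 : ∑ y ∈ κ.fball R, tau t 0 y = ∑' y, if y ∈ κ.fball R then tau t 0 y else 0 := by
      rw [tsum_eq_sum (s := κ.fball R) fun y hy => if_neg hy]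
      exact (Finset.sum_congr rfl fun y hy => if_pos hy).symm
    rw [sus, tail, h0, ← ENNReal.tsum_add]
    refine ENNReal.tsum_le_tsum fun y => ?_
    by_cases hy : y ∈ κ.fball R
    · rw [if_pos hy]; exact le_self_add
    · rw [mem_fball, not_le] at hy
      rw [if_pos hy.le]; exact le_add_self
  have hT : κ.tail t R ≠ ∞ := by
    intro hT
    rw [hT] at h
    simp at h
    exact hs.ne h
  have h2 : 2 * sus t 0 ≤ 2 * ∑ y ∈ κ.fball R, tau t 0 y + sus t 0 := by
    calc 2 * sus t 0 ≤ 2 * (∑ y ∈ κ.fball R, tau t 0 y + κ.tail t R) := by gcongr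
      _ ≤ _ := by rw [mul_add]; gcongr
  rw [two_mul (sus t 0)] at h2
  exact (ENNReal.add_le_add_iff_right hs.ne).1 h2

theorem card_mul_sus_le_pairs {t : Sym2 (V d) → ℝ≥0} (ht : TransInv t) (hs : sus t 0 < ∞) {R : ℝ}
    (h : 2 * κ.tail t R ≤ sus t 0) :
    (κ.fball R).card * sus t 0 ≤ 2 * pairs t (κ.fball (2 * R)) (κ.fball (2 * R)) := by
  by_cases hR : 0 ≤ R
  swap
  · have : κ.fball R = ∅ := by
      ext x; simp only [mem_fball, Finset.notMem_empty, iff_false, not_le]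
      exact lt_of_lt_of_le (not_le.1 hR) (κ.nr_nonneg x)
    simp [this]
  have h1 := κ.sus_le_two_mul_sum hs h
  have hsub : κ.fball R ⊆ κ.fball (2 * R) := fun x hx => by
    rw [mem_fball] at hx ⊢; linarith
  calc ((κ.fball R).card : ℝ≥0∞) * sus t 0 = ∑ x ∈ κ.fball R, sus t 0 := by simp
    _ ≤ ∑ x ∈ κ.fball R, 2 * ∑ y ∈ κ.fball (2 * R), tau t x y := by
      refine Finset.sum_le_sum fun x hx => h1.trans ?_
      gcongr 2 * ?_
      rw [← κ.sum_box_tau ht R x]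
      refine Finset.sum_le_sum_of_subset fun y hy => ?_
      rw [mem_box, nd_eq] at hy
      rw [mem_fball] at hx ⊢
      have := κ.nr_add_le (y - x) x
      rw [sub_add_cancel] at this
      linarith
    _ = 2 * ∑ x ∈ κ.fball R, ∑ y ∈ κ.fball (2 * R), tau t x y := by rw [Finset.mul_sum]
    _ ≤ _ := by
      gcongr 2 * ?_
      exact Finset.sum_le_sum_of_subset hsub

end Kernel

end LRP

namespace LRP
open scoped NNReal

/-- If translated boxes carry many pairs that are connected below a given scale, and different
boxes are weakly correlated, then sprinkling connects far away boxes. -/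
theorem le_sum_pairs_of_sprinkle {W : Type*} [Countable W] (t u : Sym2 W → ℝ≥0) {υ : ℝ≥0}
    {Λ : ℕ → Finset W} {n N m : ℕ} {S c a δ : ℝ} (hN : N = 160000 * (n + 1)) (hn : 1 ≤ n)
    (hc : 0 < c) (hc1 : 32 * c ≤ 1) (hS1 : 1 ≤ S) (hδ : 0 ≤ δ) (ha : 0 ≤ a)
    (hS : ∀ i, pairs t (Λ i) (Λ i) = ENNReal.ofReal S)
    (hm : c * S ≤ (m : ℝ) ^ 2) (hm4 : (m : ℝ) ^ 2 ≤ 4 * (c * S))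
    (hυ : 2 * n ≤ υ * (m : ℝ) ^ 2)
    (hu0 : ∀ i, ∀ x ∈ Λ i, ∀ y ∈ Λ i, x ≠ y → υ ≤ u s(x, y))
    (hu : ∀ k < n, ∀ i ∈ Finset.Ico (k * N) (k * N + N),
      ∀ j ∈ Finset.Ico ((k + 1) * N) ((k + 1) * N + N),
      ∀ x ∈ Λ i, ∀ y ∈ Λ j, x ≠ y → υ ≤ u s(x, y))
    (hs : ∀ i, pairs (t + u) (Λ i) (Λ i) ≤ ENNReal.ofReal (a * S)) (hca : 64 * c * a < 1)
    (hfar : ∀ i j, i ≠ j → pairs t (Λ i) (Λ j) ≤ ENNReal.ofReal (δ * S))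
    (hδc : 4 * (n + 1) * δ * 40000 ^ 2 ≤ c) :
    ENNReal.ofReal (c * S / 4) ≤ ∑ i ∈ Finset.Ico 0 N, ∑ j ∈ Finset.Ico (n * N) (n * N + N),
      pairs (t + u) (Λ i) (Λ j) := by
  have hn' : (1 : ℝ) ≤ n := by exact_mod_cast hn
  have hSpos : 0 < S := by linarith
  have hcS : 0 < c * S := by positivity
  have hm2 : (0 : ℝ) < (m : ℝ) ^ 2 := by linarith
  have hυ0 : 0 < (υ : ℝ) := by
    rcases (NNReal.coe_nonneg υ).lt_or_eq with h | h
    · exact h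
    · rw [← h] at hυ; linarith
  have hm2E : ((m : ℝ≥0∞)) ^ 2 = ENNReal.ofReal ((m : ℝ) ^ 2) := by
    rw [ENNReal.ofReal_pow (by positivity), ENNReal.ofReal_natCast]
  have hυE : (υ : ℝ≥0∞) = ENNReal.ofReal υ := by rw [ENNReal.ofReal_coe_nnreal]
  have hbig : ∀ i, 1 / 40000 ≤ (perc t).real (big (Λ i) m) := by
    intro i
    have hsplit : pairs t (Λ i) (Λ i) =
        ∫⁻ ω, ∑ x ∈ Λ i, (if (cl (Λ i) ω x).card < m then ((cl (Λ i) ω x).card : ℝ≥0∞) else 0)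
          ∂perc t +
        ∫⁻ ω, ∑ x ∈ Λ i, (if m ≤ (cl (Λ i) ω x).card then ((cl (Λ i) ω x).card : ℝ≥0∞) else 0)
          ∂perc t := by
      rw [← lintegral_add_left, ← lintegral_sum_card_cl]
      · refine lintegral_congr fun ω => ?_
        rw [← Finset.sum_add_distrib]
        refine Finset.sum_congr rfl fun x _ => ?_
        by_cases h : (cl (Λ i) ω x).card < m
        · rw [if_pos h, if_neg (not_le.2 h), add_zero]
        · rw [if_neg h, if_pos (not_lt.1 h), zero_add]
      · exact Finset.measurable_fun_sum _ fun x _ =>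
          measurable_of_card_cl (Λ i) x fun k => if k < m then (k : ℝ≥0∞) else 0
    rcases le_total (∫⁻ ω, ∑ x ∈ Λ i, (if m ≤ (cl (Λ i) ω x).card then
        ((cl (Λ i) ω x).card : ℝ≥0∞) else 0) ∂perc t)
      (∫⁻ ω, ∑ x ∈ Λ i, (if (cl (Λ i) ω x).card < m then
        ((cl (Λ i) ω x).card : ℝ≥0∞) else 0) ∂perc t) with h | h
    · exfalso
      have h8 : 8 * (m : ℝ≥0∞) ^ 2 ≤ pairs t (Λ i) (Λ i) := by
        rw [hS, hm2E, show (8 : ℝ≥0∞) = ENNReal.ofReal 8 by simp,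
          ← ENNReal.ofReal_mul (by norm_num)]
        exact ENNReal.ofReal_le_ofReal (by nlinarith)
      have h1 := sq_pairs_le_of_small t u υ (hu0 i) h8
        ((hsplit.le.trans (add_le_add_right h _)).trans_eq (two_mul _).symm)
      have h2 := h1.trans (mul_le_mul_right (mul_le_mul_right (hs i) _) _)
      rw [hS, hm2E, hυE, show (8 : ℝ≥0∞) = ENNReal.ofReal 8 by simp,
        show (1 : ℝ≥0∞) = ENNReal.ofReal 1 by simp, ← ENNReal.ofReal_pow hSpos.le,
        ← ENNReal.ofReal_mul hυ0.le, ← ENNReal.ofReal_mul hυ0.le,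
        ← ENNReal.ofReal_add (by norm_num) (by positivity),
        ← ENNReal.ofReal_mul (by positivity), ← ENNReal.ofReal_mul (by positivity),
        ENNReal.ofReal_le_ofReal_iff (by positivity)] at h2
      have h3 : 1 + υ * (m : ℝ) ^ 2 ≤ 8 * υ * (c * S) := by
        have : υ * (m : ℝ) ^ 2 ≤ υ * (4 * (c * S)) := by gcongr
        linarith
      have h4 : (υ : ℝ) * S ^ 2 ≤ (64 * c * a) * (υ * S ^ 2) := by
        calc (υ : ℝ) * S ^ 2 ≤ _ := h2
          _ ≤ 8 * (8 * υ * (c * S) * (a * S)) := by gcongr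
          _ = _ := by ring
      have h5 : 0 < (υ : ℝ) * S ^ 2 := by positivity
      nlinarith
    · have h1 := one_le_perc_big t (Λ := Λ i) (m := m) (by rw [hS]; simpa using hS1)
        ((hsplit.le.trans (add_le_add_left h _)).trans_eq (two_mul _).symm)
      have h2 := ENNReal.toReal_mono (by finiteness) h1
      rw [ENNReal.toReal_mul] at h2
      simp only [toReal_one, toReal_ofNat] at h2
      rw [measureReal_def]
      linarith
  have hcorr : ∀ i j, i ≠ j → (perc t).real (big (Λ i) m ∩ big (Λ j) m) ≤
      (perc t).real (big (Λ i) m) * (perc t).real (big (Λ j) m) + δ / c := by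
    intro i j hij
    have h1 := (perc_big_inter_big_le t (Λ i) (Λ j) m).trans (add_le_add_right (hfar i j hij) _)
    have h2 := ENNReal.toReal_mono (by finiteness) h1
    rw [ENNReal.toReal_add (by finiteness) (by finiteness), ENNReal.toReal_mul,
      ENNReal.toReal_mul, ENNReal.toReal_mul, ENNReal.toReal_ofReal (by positivity), hm2E,
      ENNReal.toReal_ofReal (by positivity)] at h2
    rw [measureReal_def, measureReal_def, measureReal_def]
    have h3 : δ * S ≤ (m : ℝ) ^ 2 * (δ / c) := by
      calc δ * S = c * S * (δ / c) := by field_simp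
        _ ≤ _ := by gcongr
    refine le_of_mul_le_mul_left ?_ hm2
    rw [mul_add]
    linarith
  have hhalf := half_le_measureReal_windows (μ := perc t) (n := n) (N := N)
    (fun i => (inc_big (Λ i) m).measurableSet) (by positivity : 0 ≤ δ / c)
    (by norm_num : (0 : ℝ) < 1 / 40000) hbig (by rw [hN]; push_cast; linarith)
    (by
      rw [mul_div_assoc', div_le_iff₀ hc]
      nlinarith) hcorr
  refine le_trans ?_ (sq_mul_perc_chain_le t u υ Λ N n m hu)
  set G := {ω : Sym2 W → Bool | ∀ k ≤ n, ∃ i ∈ Finset.Ico (k * N) (k * N + N), ω ∈ big (Λ i) m}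
  have hG : ENNReal.ofReal (1 / 2) ≤ perc t G := by
    rw [measureReal_def] at hhalf
    exact (ENNReal.ofReal_le_iff_le_toReal (measure_ne_top _ _)).2 hhalf
  have hexp : (1 : ℝ) / 2 ≤ 1 - n * Real.exp (-(υ * (m : ℝ) ^ 2)) := by
    have hx : 0 < υ * (m : ℝ) ^ 2 := by positivity
    have h1 : υ * (m : ℝ) ^ 2 ≤ Real.exp (υ * (m : ℝ) ^ 2) := by
      linarith [Real.add_one_le_exp (υ * (m : ℝ) ^ 2)]
    have h2 : Real.exp (-(υ * (m : ℝ) ^ 2)) ≤ (υ * (m : ℝ) ^ 2)⁻¹ := by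
      rw [Real.exp_neg]; exact inv_anti₀ hx h1
    have h3 : n * Real.exp (-(υ * (m : ℝ) ^ 2)) ≤ n * (υ * (m : ℝ) ^ 2)⁻¹ := by gcongr
    have h4 : n * (υ * (m : ℝ) ^ 2)⁻¹ ≤ 1 / 2 := by
      rw [← div_eq_mul_inv, div_le_iff₀ hx]; linarith
    linarith
  calc ENNReal.ofReal (c * S / 4) ≤ ENNReal.ofReal ((m : ℝ) ^ 2 * (1 / 2) * (1 / 2)) :=
        ENNReal.ofReal_le_ofReal (by linarith)
    _ = (m : ℝ≥0∞) ^ 2 * ENNReal.ofReal (1 / 2) * ENNReal.ofReal (1 / 2) := by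
      rw [hm2E, ← ENNReal.ofReal_mul (by positivity), ← ENNReal.ofReal_mul (by positivity)]
    _ ≤ _ := by gcongr

namespace Kernel

variable {d : ℕ} {α : ℝ} (κ : Kernel d α)

theorem nr_nsmul (k : ℕ) (v : V d) : κ.nr (k • v) = k * κ.nr v := by
  have : toR (k • v) = (k : ℝ) • toR v := by
    ext i; simp [toR]
  rw [nr, this, map_smul_eq_mul, nr]
  simp

theorem exists_step (hd : 1 ≤ d) : ∃ w : ℝ, 0 < w ∧ ∀ s : ℝ, w ≤ s →
    ∃ v : V d, s ≤ κ.nr v ∧ κ.nr v ≤ 2 * s := by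
  let e : V d := Pi.single ⟨0, hd⟩ 1
  have he : e ≠ 0 := by simp [e]
  have hw := κ.nr_pos he
  refine ⟨κ.nr e, hw, fun s hs => ⟨⌈s / κ.nr e⌉₊ • e, ?_, ?_⟩⟩
  · rw [nr_nsmul]
    exact (div_le_iff₀ hw).1 (Nat.le_ceil _)
  · rw [nr_nsmul]
    have h1 := Nat.ceil_lt_add_one (div_nonneg (hw.le.trans hs) hw.le)
    calc (⌈s / κ.nr e⌉₊ : ℝ) * κ.nr e ≤ (s / κ.nr e + 1) * κ.nr e := by gcongr
      _ = s + κ.nr e := by field_simp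
      _ ≤ 2 * s := by linarith

theorem exists_le_rateCut_sub (hα : 0 < α) : ∃ c s₁ : ℝ, 0 < c ∧ 1 ≤ s₁ ∧
    ∀ β r s : ℝ, 0 ≤ β → s₁ ≤ s → 0 < r → r ≤ s / 2 → ∀ x y : V d, x ≠ y → κ.nd x y ≤ s / 2 →
      β * (c * s ^ (-(d + α) : ℝ)) ≤ ((κ.rateCut β s - κ.rateCut β r) s(x, y) : ℝ≥0) := by
  obtain ⟨c, s₁, hc, hs₁, h⟩ := κ.exists_J_diff hα
  refine ⟨c, s₁, hc, hs₁, fun β r s hβ hs hr hrs x y hxy hd => ?_⟩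
  have hs0 : 0 < s := by linarith
  have hdp := κ.nd_pos hxy
  rw [Pi.sub_apply, NNReal.coe_sub (κ.rateCut_mono hβ le_rfl hr (by linarith) _),
    κ.coe_rateCut hβ, κ.coe_rateCut hβ, ← mul_sub]
  refine mul_le_mul_of_nonneg_left ((h s hs).trans ?_) hβ
  rw [κ.kerCut_eq hs0 hxy, κ.kerCut_eq hr hxy]
  have h1 : κ.J (s / 2) ≤ κ.J (κ.nd x y) := κ.J_anti hdp (Set.mem_Ioi.2 (by linarith)) hd
  have h2 : κ.J (s / 2) ≤ κ.J r := κ.J_anti hr (Set.mem_Ioi.2 (by linarith)) hrs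
  rcases max_cases (κ.J (κ.nd x y) - κ.J r) 0 with h3 | h3 <;>
    rcases max_cases (κ.J (κ.nd x y) - κ.J s) 0 with h4 | h4 <;> linarith

end Kernel

/-- A large enough negative power beats any polynomial. -/
theorem eventually_mul_rpow_le {K q b : ℝ} (hK : 0 ≤ K) (hq : 0 ≤ q) (hb : 0 ≤ b) :
    ∀ᶠ n : ℕ in atTop, K * ((n : ℝ) + 1) ^ q * (b / n) ^ (q + 1) ≤ 1 := by
  filter_upwards [eventually_ge_atTop 1,
    eventually_ge_atTop ⌈K * 2 ^ q * b ^ (q + 1)⌉₊] with n hn hn2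
  have hn' : (1 : ℝ) ≤ n := by exact_mod_cast hn
  have hn0 : (0 : ℝ) < n := by linarith
  have h2 : K * 2 ^ q * b ^ (q + 1) ≤ n := Nat.ceil_le.1 hn2
  calc K * ((n : ℝ) + 1) ^ q * (b / n) ^ (q + 1) ≤ K * (2 * n) ^ q * (b / n) ^ (q + 1) := by
        gcongr; linarith
    _ = K * 2 ^ q * b ^ (q + 1) / n := by
      rw [Real.mul_rpow (by norm_num) hn0.le, Real.div_rpow hb hn0.le, Real.rpow_add hn0,
        Real.rpow_one]
      have : (n : ℝ) ^ q ≠ 0 := (Real.rpow_pos_of_pos hn0 q).ne'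
      field_simp
    _ ≤ 1 := by rw [div_le_one hn0]; exact h2

end LRP

namespace LRP
open scoped NNReal

namespace Kernel

variable {d : ℕ} {α : ℝ} (κ : Kernel d α)

theorem exists_two_mul_tail_le (hα : 0 < α) (hJ : Tendsto κ.J atTop (nhds 0)) (hβc : 0 < κ.betaC)
    (hCL : κ.CL) : ∃ C : ℝ, 1 ≤ C ∧ ∀ r : ℝ, 1 ≤ r →
      2 * κ.tail (κ.rateCut κ.betaC r) (C * r) ≤ sus (κ.rateCut κ.betaC r) 0 := by
  obtain ⟨C, hC, h⟩ := κ.exists_tail_le hα hJ hβc hCL one_pos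
  refine ⟨max 1 (2 * C), le_max_left _ _, fun r hr => ?_⟩
  have hr0 : 0 < r := by linarith
  have hM : 0 < max 1 (2 * C) := by positivity
  calc 2 * κ.tail (κ.rateCut κ.betaC r) (max 1 (2 * C) * r) ≤
      2 * (sus (κ.rateCut κ.betaC r) 0 * ENNReal.ofReal (1 / 2)) := by
        refine mul_le_mul_right ((h r hr _ (by positivity)).trans (mul_le_mul_right
          (ENNReal.ofReal_le_ofReal ?_) _)) _
        rw [Real.rpow_one, show C * (r / (max 1 (2 * C) * r)) = C / max 1 (2 * C) by field_simp,
          div_le_div_iff₀ hM (by norm_num)]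
        linarith [le_max_right 1 (2 * C)]
    _ = sus (κ.rateCut κ.betaC r) 0 := by
      rw [mul_left_comm, show (2 : ℝ≥0∞) = ENNReal.ofReal 2 by simp,
        ← ENNReal.ofReal_mul (by norm_num)]
      norm_num

theorem exists_box (hα : 0 < α) (hJ : Tendsto κ.J atTop (nhds 0)) (hβc : 0 < κ.betaC)
    (hCL : κ.CL) : ∃ C₀ c₁ C₁ : ℝ, 1 ≤ C₀ ∧ 0 < c₁ ∧ c₁ ≤ C₁ ∧ ∀ r : ℝ, 1 ≤ r →
      ((κ.fball (2 * (C₀ * r))).card : ℝ) ≤ C₁ * r ^ d ∧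
      c₁ * r ^ d * (sus (κ.rateCut κ.betaC r) 0).toReal ≤
        (pairs (κ.rateCut κ.betaC r) (κ.fball (2 * (C₀ * r))) (κ.fball (2 * (C₀ * r)))).toReal ∧
      (sus (κ.rateCut κ.betaC r) 0).toReal ≤ 2 * C₁ * r ^ d := by
  obtain ⟨C₀, hC₀, h₀⟩ := κ.exists_two_mul_tail_le hα hJ hβc hCL
  obtain ⟨Cc, hCc, hcard, -⟩ := κ.exists_card_le
  obtain ⟨cc, hcc, hcard'⟩ := κ.exists_le_card
  refine ⟨C₀, min (cc * C₀ ^ d / 2) (Cc * (2 * C₀) ^ d), Cc * (2 * C₀) ^ d, hC₀, by positivity,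
    min_le_right _ _, fun r hr => ?_⟩
  have hr0 : 0 < r := by linarith
  have hfin := κ.sus_rateCut_lt_top hα hJ hβc hr0
  have hcd : ((κ.fball (2 * (C₀ * r))).card : ℝ) ≤ Cc * (2 * C₀) ^ d * r ^ d := by
    refine (hcard _ (by nlinarith)).trans_eq ?_
    rw [← mul_assoc 2, mul_pow (2 * C₀), mul_assoc]
  refine ⟨hcd, ?_, ?_⟩
  · have h1 := ENNReal.toReal_mono (ENNReal.mul_ne_top (by finiteness) (pairs_ne_top _ _ _))
      (κ.card_mul_sus_le_pairs (κ.transInv_rateCut κ.betaC r) hfin (h₀ r hr))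
    rw [ENNReal.toReal_mul, ENNReal.toReal_mul, ENNReal.toReal_natCast] at h1
    simp only [toReal_ofNat] at h1
    have h2 : min (cc * C₀ ^ d / 2) (Cc * (2 * C₀) ^ d) * r ^ d ≤
        (κ.fball (C₀ * r)).card / 2 := by
      calc min (cc * C₀ ^ d / 2) (Cc * (2 * C₀) ^ d) * r ^ d ≤ cc * C₀ ^ d / 2 * r ^ d := by
            gcongr; exact min_le_left _ _
        _ = cc * (C₀ * r) ^ d / 2 := by rw [mul_pow]; ring
        _ ≤ _ := by gcongr; exact hcard' _ (by positivity)
    have h3 := mul_le_mul_of_nonneg_right h2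
      (ENNReal.toReal_nonneg (a := sus (κ.rateCut κ.betaC r) 0))
    linarith
  · have h1 := κ.sus_le_two_mul_sum hfin (h₀ r hr)
    have h2 : ∑ y ∈ κ.fball (C₀ * r), tau (κ.rateCut κ.betaC r) 0 y ≤
        (κ.fball (2 * (C₀ * r))).card := by
      calc ∑ y ∈ κ.fball (C₀ * r), tau (κ.rateCut κ.betaC r) 0 y ≤
          ∑ y ∈ κ.fball (2 * (C₀ * r)), tau (κ.rateCut κ.betaC r) 0 y := by
            refine Finset.sum_le_sum_of_subset fun y hy => ?_
            rw [mem_fball] at hy ⊢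
            nlinarith
        _ ≤ _ := by
          refine (Finset.sum_le_card_nsmul _ _ 1 fun y _ => tau_le_one _ _ _).trans_eq ?_
          simp
    have h3 := ENNReal.toReal_mono (by finiteness) (h1.trans (mul_le_mul_right h2 2))
    rw [ENNReal.toReal_mul, ENNReal.toReal_natCast] at h3
    simp only [toReal_ofNat] at h3
    linarith

theorem nd_nsmul (v : V d) (i j : ℕ) (h : i ≤ j) :
    κ.nd (i • v) (j • v) = ((j : ℝ) - i) * κ.nr v := by
  rw [nd_eq', sub_eq_add_neg, ← sub_nsmul v h, nr_nsmul, Nat.cast_sub h]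

theorem box_nd_bounds {ρ : ℝ} {z w a b : V d} (ha : a ∈ κ.box ρ z) (hb : b ∈ κ.box ρ w) :
    κ.nd z w - 2 * ρ ≤ κ.nd a b ∧ κ.nd a b ≤ κ.nd z w + 2 * ρ := by
  rw [mem_box] at ha hb
  have h1 := κ.nd_triangle a z b
  have h2 := κ.nd_triangle z w b
  have h3 := κ.nd_triangle z a w
  have h4 := κ.nd_triangle a b w
  rw [κ.nd_symm w b] at h2
  rw [κ.nd_symm z a] at h3
  constructor <;> linarith

theorem exists_growth_constants {q H D₁ D₂ : ℝ} (w : ℝ) (hq : 0 < q) (hH : 1 ≤ H) (hD₁ : 0 < D₁)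
    (hD₂ : 0 < D₂) : ∃ (n : ℕ) (B c : ℝ), w ≤ n ∧ B = 1600000 * ((n : ℝ) + 1) ^ 2 ∧ 1 ≤ B ^ q ∧
      0 < c ∧ 32 * c ≤ 1 ∧ 64 * c * (2 * H * B ^ q) < 1 ∧
      4 * (n + 1) * (H * D₁ * (2 / n) ^ (2 * q + 1 + 1)) * 40000 ^ 2 ≤ c ∧
      160000 * ((n : ℝ) + 1) * (160000 * (n + 1)) *
        (2 * H * B ^ q * (D₂ * (80 / n) ^ (4 * q + 2 + 1))) ≤ c / 8 := by
  have hev₁ := eventually_mul_rpow_le (K := 4 * 40000 ^ 2 * 256 * H ^ 2 * D₁ * 1600000 ^ q)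
    (q := 2 * q + 1) (b := 2) (by positivity) (by positivity) (by norm_num)
  have hev₂ := eventually_mul_rpow_le
    (K := 4096 * 160000 ^ 2 * H ^ 2 * D₂ * (1600000 ^ q) ^ 2)
    (q := 4 * q + 2) (b := 80) (by positivity) (by positivity) (by norm_num)
  obtain ⟨n, hn₁, hn₂, hnw⟩ := (hev₁.and (hev₂.and (eventually_ge_atTop ⌈w⌉₊))).exists
  refine ⟨n, 1600000 * ((n : ℝ) + 1) ^ 2,
    1 / (256 * H * (1600000 * ((n : ℝ) + 1) ^ 2) ^ q), Nat.ceil_le.1 hnw, rfl, ?_⟩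
  have hBq1 : (1 : ℝ) ≤ (1600000 * ((n : ℝ) + 1) ^ 2) ^ q :=
    Real.one_le_rpow (by nlinarith [Nat.cast_nonneg (α := ℝ) n]) hq.le
  have hBq : (1600000 * ((n : ℝ) + 1) ^ 2) ^ q = 1600000 ^ q * ((n : ℝ) + 1) ^ (2 * q) := by
    rw [Real.mul_rpow (by norm_num) (by positivity), ← Real.rpow_natCast,
      ← Real.rpow_mul (by positivity)]
    norm_num
  have h2 : ((n : ℝ) + 1) ^ (4 * q + 2) = (((n : ℝ) + 1) ^ (2 * q)) ^ 2 * (n + 1) ^ 2 := by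
    rw [Real.rpow_add (by positivity), ← Real.rpow_natCast (((n : ℝ) + 1) ^ (2 * q)),
      ← Real.rpow_mul (by positivity)]
    norm_num
    left
    ring_nf
  have h1 : ((n : ℝ) + 1) ^ (2 * q + 1) = ((n : ℝ) + 1) ^ (2 * q) * (n + 1) := by
    rw [Real.rpow_add (by positivity), Real.rpow_one]
  rw [h1] at hn₁
  rw [h2] at hn₂
  rw [hBq] at hBq1 ⊢
  clear hBq h1 h2 hev₁ hev₂ hnw
  generalize (2 / (n : ℝ)) ^ (2 * q + 1 + 1) = Z₁ at hn₁ ⊢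
  generalize (80 / (n : ℝ)) ^ (4 * q + 2 + 1) = Z₂ at hn₂ ⊢
  have hP : 0 < ((n : ℝ) + 1) ^ (2 * q) := by positivity
  have hM : (0 : ℝ) < 1600000 ^ q := by positivity
  generalize ((n : ℝ) + 1) ^ (2 * q) = P at *
  generalize (1600000 : ℝ) ^ q = M at *
  generalize (n : ℝ) = y at *
  have hT : 0 < H * (M * P) := by positivity
  have hT1 : 1 ≤ H * (M * P) := by nlinarith
  refine ⟨hBq1, by positivity, ?_, ?_, ?_, ?_⟩
  · rw [mul_one_div, div_le_one (by positivity)]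
    nlinarith
  · have : 64 * (1 / (256 * H * (M * P))) * (2 * H * (M * P)) = 1 / 2 := by
      rw [mul_one_div, div_mul_eq_mul_div, div_eq_div_iff (by positivity) (by norm_num)]
      ring
    rw [this]; norm_num
  · rw [le_div_iff₀ (by positivity)]
    refine le_trans (le_of_eq ?_) hn₁
    ring
  · rw [div_div, le_div_iff₀ (by positivity)]
    refine le_trans (le_of_eq ?_) hn₂
    ring

theorem box_nd_le_of_step {r ρ : ℝ} {n N : ℕ} {v : V d} (hr : 0 < r) (hn : 1 ≤ n)
    (hN : N = 160000 * (n + 1)) (hv2 : κ.nr v ≤ 2 * (n * r)) (hρ : 2 * ρ ≤ n * r / 2) {i j : ℕ}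
    (hij : i ≤ j) (hji : j ≤ i + 2 * N) {x y : V d} (hx : x ∈ κ.box ρ (i • v))
    (hy : y ∈ κ.box ρ (j • v)) : κ.nd x y ≤ 1600000 * ((n : ℝ) + 1) ^ 2 * r / 2 := by
  have h1 := (κ.box_nd_bounds hx hy).2
  rw [κ.nd_nsmul v i j hij] at h1
  have hNr : (N : ℝ) = 160000 * (n + 1) := by rw [hN]; push_cast; ring
  have hj : (j : ℝ) ≤ i + 2 * N := by exact_mod_cast hji
  have hi : (i : ℝ) ≤ j := by exact_mod_cast hij
  have hn' : (1 : ℝ) ≤ n := by exact_mod_cast hn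
  have h2 : (j - i) * κ.nr v ≤ 2 * (160000 * (n + 1)) * (2 * (n * r)) := by
    have h0 : 0 ≤ (j : ℝ) - i := by linarith
    have := κ.nr_nonneg v
    gcongr
    linarith
  have h5 : 2 * (160000 * ((n : ℝ) + 1)) * (2 * n) + n / 2 ≤
    1600000 * ((n : ℝ) + 1) ^ 2 / 2 := by nlinarith
  have := mul_le_mul_of_nonneg_right h5 hr.le
  linarith

theorem le_box_nd_of_ne {r ρ : ℝ} {n : ℕ} {v : V d} (hv : n * r ≤ κ.nr v)
    (hρ : 2 * ρ ≤ n * r / 2) {i j : ℕ} (hij : i ≠ j) {x y : V d} (hx : x ∈ κ.box ρ (i • v))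
    (hy : y ∈ κ.box ρ (j • v)) : n * r / 2 ≤ κ.nd x y := by
  have h1 := (κ.box_nd_bounds hx hy).1
  have h2 : n * r ≤ κ.nd (i • v) (j • v) := by
    rcases lt_or_gt_of_ne hij with h | h
    · rw [κ.nd_nsmul v i j h.le]
      have : (i : ℝ) + 1 ≤ j := by exact_mod_cast h
      nlinarith [κ.nr_nonneg v]
    · rw [κ.nd_symm, κ.nd_nsmul v j i h.le]
      have : (j : ℝ) + 1 ≤ i := by exact_mod_cast h
      nlinarith [κ.nr_nonneg v]
  linarith

theorem le_box_nd_of_far {r ρ : ℝ} {n N : ℕ} {v : V d} (hr : 0 < r) (hn : 8 ≤ n)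
    (hN : N = 160000 * (n + 1)) (hv : n * r ≤ κ.nr v) (hρ : 2 * ρ ≤ n * r / 2) {i j : ℕ}
    (hi : i ≤ N) (hj : n * N ≤ j) {x y : V d} (hx : x ∈ κ.box ρ (i • v))
    (hy : y ∈ κ.box ρ (j • v)) : 1600000 * ((n : ℝ) + 1) ^ 2 * r * n / 80 ≤ κ.nd x y := by
  have h1 := (κ.box_nd_bounds hx hy).1
  rw [κ.nd_nsmul v i j (by nlinarith)] at h1
  have hNr : (N : ℝ) = 160000 * (n + 1) := by rw [hN]; push_cast; ring
  have hi' : (i : ℝ) ≤ 160000 * (n + 1) := by rw [← hNr]; exact_mod_cast hi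
  have hj' : (n : ℝ) * (160000 * (n + 1)) ≤ j := by rw [← hNr]; exact_mod_cast hj
  have hn' : (8 : ℝ) ≤ n := by exact_mod_cast hn
  have h2 : (n : ℝ) / 2 * (160000 * (n + 1)) ≤ j - i := by nlinarith
  have h3 : (n : ℝ) / 2 * (160000 * (n + 1)) * (n * r) ≤ (j - i) * κ.nr v := by
    have : 0 ≤ (j : ℝ) - i := le_trans (by positivity) h2
    gcongr
  have h5 : 1600000 * ((n : ℝ) + 1) ^ 2 / 80 + 1 / 2 ≤
    (n : ℝ) / 2 * (160000 * (n + 1)) := by nlinarith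
  have := mul_le_mul_of_nonneg_right h5 (by positivity : 0 ≤ n * r)
  linarith

theorem pairs_box_le_tail {t : Sym2 (V d) → ℝ≥0} (ht : TransInv t) {ρ D X k M R : ℝ}
    (hX : 0 ≤ X) (hM : 0 ≤ M) (hcard : ((κ.fball ρ).card : ℝ) * X ≤ k) {z w : V d}
    (hR : ∀ a ∈ κ.box ρ z, ∀ b ∈ κ.box ρ w, R ≤ κ.nd a b)
    (htail : κ.tail t R ≤ ENNReal.ofReal X * ENNReal.ofReal D) (hD : k * D ≤ M) :
    pairs t (κ.box ρ z) (κ.box ρ w) ≤ ENNReal.ofReal M := by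
  refine (κ.pairs_le_card_mul_tail ht hR).trans ?_
  rw [κ.card_box, ← ENNReal.ofReal_natCast]
  refine (mul_le_mul_right htail _).trans ?_
  rw [← mul_assoc, ← ENNReal.ofReal_mul (by positivity), ← ENNReal.ofReal_mul (by positivity)]
  refine ENNReal.ofReal_le_ofReal ?_
  rcases le_total 0 D with h | h
  · exact (mul_le_mul_of_nonneg_right hcard h).trans hD
  · exact (mul_nonpos_of_nonneg_of_nonpos (by positivity) h).trans hM

set_option maxHeartbeats 800000 in
/-- At some fixed multiplicative distance, a large susceptibility has to grow quickly. -/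
theorem exists_growth (hd : 1 ≤ d) (hα : 0 < α) (hJ : Tendsto κ.J atTop (nhds 0))
    (hβc : 0 < κ.betaC) (hCL : κ.CL) : ∃ B A r₀ : ℝ, 1 < B ∧ 0 < A ∧ 1 ≤ r₀ ∧
      ∀ r : ℝ, r₀ ≤ r → A * r ^ α ≤ (sus (κ.rateCut κ.betaC r) 0).toReal →
        2 * B ^ (d + α : ℝ) * (sus (κ.rateCut κ.betaC r) 0).toReal <
          (sus (κ.rateCut κ.betaC (B * r)) 0).toReal := by
  obtain ⟨C₀, c₁, C₁, hC₀, hc₁, hcC₁, hbox⟩ := κ.exists_box hα hJ hβc hCL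
  obtain ⟨cJ, s₁, hcJ, hs₁, hsub⟩ := κ.exists_le_rateCut_sub hα
  obtain ⟨w, hw, hstep⟩ := κ.exists_step hd
  have hC₁ : 0 < C₁ := by linarith
  obtain ⟨q, hq⟩ : ∃ q : ℝ, q = d + α := ⟨_, rfl⟩
  rw [← hq] at hsub ⊢
  have hq0 : 0 < q := by rw [hq]; positivity
  obtain ⟨D₁, hD₁, htail₁⟩ := κ.exists_tail_le hα hJ hβc hCL (p := 2 * q + 1 + 1) (by positivity)
  obtain ⟨D₂, hD₂, htail₂⟩ := κ.exists_tail_le hα hJ hβc hCL (p := 4 * q + 2 + 1) (by positivity)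
  obtain ⟨H, hH⟩ : ∃ H : ℝ, H * c₁ = C₁ := ⟨C₁ / c₁, div_mul_cancel₀ _ hc₁.ne'⟩
  have hH1 : 1 ≤ H := le_of_mul_le_mul_right (by linarith : 1 * c₁ ≤ H * c₁) hc₁
  obtain ⟨n, B, c, hnw, hB, hBq1, hc0, hc32, hca, hδc, hfarc⟩ :=
    exists_growth_constants (max (8 * C₀) w) hq0 hH1 hD₁ hD₂
  have hnC : 8 * C₀ ≤ n := (le_max_left _ _).trans hnw
  replace hnw : w ≤ n := (le_max_right _ _).trans hnw
  have hn8 : (8 : ℝ) ≤ n := by linarith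
  have hn8' : 8 ≤ n := by exact_mod_cast hn8
  have hn0 : (0 : ℝ) < n := by linarith
  have hB1 : 4 < B := by rw [hB]; linarith [sq_nonneg (n : ℝ)]
  have hB0 : 0 < B := by linarith
  obtain ⟨E, hE⟩ : ∃ E : ℝ, E = κ.betaC * cJ * B ^ (-q) * c * c₁ := ⟨_, rfl⟩
  have hE0 : 0 < E := by rw [hE]; positivity
  obtain ⟨G, hG⟩ : ∃ G : ℝ, E * G = 2 * n := ⟨2 * n / E, mul_div_cancel₀ _ hE0.ne'⟩
  obtain ⟨L, hL⟩ : ∃ L : ℝ, c * c₁ * L = 1 := ⟨1 / (c * c₁), mul_one_div_cancel (by positivity)⟩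
  obtain ⟨N, hN⟩ : ∃ N : ℕ, N = 160000 * (n + 1) := ⟨_, rfl⟩
  have hNr : (N : ℝ) = 160000 * (n + 1) := by rw [hN]; push_cast; ring
  have hG0 : 0 < G := pos_of_mul_pos_right (a := E) (by rw [hG]; positivity) hE0.le
  refine ⟨B, max G L, s₁, by linarith, lt_max_of_lt_left hG0, hs₁, fun r hr hA => ?_⟩
  by_contra! hY
  have hr1 : 1 ≤ r := by linarith
  have hr0 : 0 < r := by linarith
  have h4r : 4 * r ≤ B * r := mul_le_mul_of_nonneg_right hB1.le hr0.le
  have hs1 : 1 ≤ B * r := by linarith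
  have hs0 : 0 < B * r := by linarith
  obtain ⟨hcard, hSlo, -⟩ := hbox r hr1
  have hXE := ENNReal.ofReal_toReal (κ.sus_rateCut_lt_top hα hJ hβc hr0).ne
  have hYE := ENNReal.ofReal_toReal (κ.sus_rateCut_lt_top hα hJ hβc hs0).ne
  have hX0 : 0 ≤ (sus (κ.rateCut κ.betaC r) 0).toReal := ENNReal.toReal_nonneg
  have hY0 : 0 ≤ (sus (κ.rateCut κ.betaC (B * r)) 0).toReal := ENNReal.toReal_nonneg
  have htu := κ.rateCut_add_sub hβc.le hr0 (by linarith : r ≤ B * r)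
  have hsub' := hsub κ.betaC r (B * r) hβc.le (by linarith) hr0 (by linarith)
  have htail₁' := htail₁ r hr1 (n * r / 2) (by positivity)
  have htail₂' := htail₂ (B * r) hs1 (B * r * n / 80) (by positivity)
  rw [show B * r / (B * r * n / 80) = 80 / n by
    rw [div_eq_div_iff (by positivity) (by positivity)]; ring, ← hYE] at htail₂'
  rw [show r / (n * r / 2) = 2 / n by
    rw [div_eq_div_iff (by positivity) (by positivity)]; ring, ← hXE] at htail₁'
  have htI : TransInv (κ.rateCut κ.betaC r) := κ.transInv_rateCut _ _
  have htI' : TransInv (κ.rateCut κ.betaC (B * r)) := κ.transInv_rateCut _ _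
  generalize κ.rateCut κ.betaC (B * r) - κ.rateCut κ.betaC r = u at *
  generalize κ.rateCut κ.betaC r = t at *
  generalize κ.rateCut κ.betaC (B * r) = t' at *
  subst htu
  have hSE := ENNReal.ofReal_toReal (pairs_ne_top t (κ.fball (2 * (C₀ * r)))
    (κ.fball (2 * (C₀ * r))))
  generalize (pairs t (κ.fball (2 * (C₀ * r))) (κ.fball (2 * (C₀ * r)))).toReal = S at *
  generalize (sus t 0).toReal = X at *
  generalize (sus (t + u) 0).toReal = Y at *
  have hρ2 : 2 * (2 * (C₀ * r)) ≤ n * r / 2 := by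
    linarith [mul_le_mul_of_nonneg_right hnC hr0.le]
  generalize 2 * (C₀ * r) = ρ at *
  have hHS : C₁ * r ^ d * X ≤ H * S := by
    have := mul_le_mul_of_nonneg_left hSlo (by linarith : 0 ≤ H)
    rw [← hH]
    linarith
  have hHY : C₁ * r ^ d * Y ≤ 2 * H * B ^ q * S := by
    have h1 := mul_le_mul_of_nonneg_left hY (by positivity : 0 ≤ C₁ * r ^ d)
    have h2 := mul_le_mul_of_nonneg_left hHS (by positivity : 0 ≤ 2 * B ^ q)
    linarith
  have hcX : ((κ.fball ρ).card : ℝ) * X ≤ H * S := (by gcongr : _ ≤ _).trans hHS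
  have hcY : ((κ.fball ρ).card : ℝ) * Y ≤ 2 * H * B ^ q * S := (by gcongr : _ ≤ _).trans hHY
  have hrq : r ^ d * r ^ α = r ^ q := by rw [hq, Real.rpow_add hr0, Real.rpow_natCast]
  have hrq1 : 1 ≤ r ^ q := Real.one_le_rpow hr1 hq0.le
  have hSA : ∀ a : ℝ, a ≤ max G L → c₁ * a * r ^ q ≤ S := by
    intro a ha
    calc c₁ * a * r ^ q = c₁ * r ^ d * (a * r ^ α) := by rw [← hrq]; ring
      _ ≤ c₁ * r ^ d * (max G L * r ^ α) := by gcongr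
      _ ≤ c₁ * r ^ d * X := by gcongr
      _ ≤ S := hSlo
  have hcS1 : 1 ≤ c * S := by
    have h1 := mul_le_mul_of_nonneg_left (hSA _ (le_max_right _ _)) hc0.le
    have h2 : c * (c₁ * L * r ^ q) = r ^ q := by linear_combination r ^ q * hL
    linarith
  have hS1 : 1 ≤ S := by
    by_contra! h
    linarith [mul_lt_mul_of_pos_left h hc0]
  obtain ⟨m, -, hm, hm4⟩ := exists_nat_sq hcS1
  obtain ⟨v, hv, hv2⟩ := hstep (n * r) (hnw.trans (le_mul_of_one_le_right hn0.le hr1))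
  obtain ⟨υ, hυc⟩ : ∃ υ : ℝ≥0, (υ : ℝ) = κ.betaC * (cJ * (B * r) ^ (-q)) :=
    ⟨Real.toNNReal (κ.betaC * (cJ * (B * r) ^ (-q))), Real.coe_toNNReal _ (by positivity)⟩
  have hυm : 2 * n ≤ υ * (m : ℝ) ^ 2 := by
    have h1 : r ^ (-q) * r ^ q = 1 := by
      rw [← Real.rpow_add hr0, neg_add_cancel, Real.rpow_zero]
    have h2 : (υ : ℝ) * (c * (c₁ * G * r ^ q)) = 2 * n := by
      rw [hυc, Real.mul_rpow hB0.le hr0.le, ← hG, hE]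
      linear_combination κ.betaC * cJ * B ^ (-q) * c * c₁ * G * h1
    rw [← h2]
    have h3 := mul_le_mul_of_nonneg_left (hSA _ (le_max_left _ _)) hc0.le
    exact mul_le_mul_of_nonneg_left (h3.trans hm) υ.coe_nonneg
  have huυ : ∀ x y : V d, x ≠ y → κ.nd x y ≤ B * r / 2 → υ ≤ u s(x, y) := by
    intro x y hxy hle
    rw [← NNReal.coe_le_coe, hυc]
    exact hsub' x y hxy hle
  have hn1 : 1 ≤ n := by omega
  have hn2 : (0 : ℝ) ≤ 2 / n := by positivity
  have hn80 : (0 : ℝ) ≤ 80 / n := by positivity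
  rw [hB] at huυ htail₂'
  have hsum := le_sum_pairs_of_sprinkle t u (υ := υ) (Λ := fun i => κ.box ρ (i • v)) (n := n)
    (N := N) (m := m) (S := S) (c := c) (a := 2 * H * B ^ q)
    (δ := H * D₁ * (2 / n) ^ (2 * q + 1 + 1)) hN hn1
    hc0 hc32 hS1 (by have := Real.rpow_nonneg hn2 (2 * q + 1 + 1); positivity) (by positivity)
    (fun i => by rw [κ.pairs_box_self htI, hSE]) hm hm4 hυm
    (fun i x hx y hy hxy => huυ x y hxy
      (κ.box_nd_le_of_step hr0 hn1 hN hv2 hρ2 le_rfl (by omega) hx hy))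
    ?_ ?_ hca ?_ hδc
  · have hfar : ∀ i ∈ Finset.Ico 0 N, ∀ j ∈ Finset.Ico (n * N) (n * N + N),
        pairs (t + u) (κ.box ρ (i • v)) (κ.box ρ (j • v)) ≤
          ENNReal.ofReal (2 * H * B ^ q * S * (D₂ * (80 / n) ^ (4 * q + 2 + 1))) := by
      intro i hi j hj
      rw [Finset.mem_Ico] at hi hj
      exact κ.pairs_box_le_tail htI' hY0
        (by have := Real.rpow_nonneg hn80 (4 * q + 2 + 1); positivity) hcY
        (fun a ha b hb => κ.le_box_nd_of_far hr0 hn8' hN hv hρ2 hi.2.le hj.1 ha hb) htail₂' le_rfl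
    have h1 := hsum.trans (Finset.sum_le_sum fun i hi => Finset.sum_le_sum fun j hj =>
      hfar i hi j hj)
    rw [Finset.sum_const, Finset.sum_const, Nat.card_Ico, Nat.card_Ico, Nat.add_sub_cancel_left,
      Nat.sub_zero, nsmul_eq_mul, nsmul_eq_mul, ← ENNReal.ofReal_natCast,
      ← ENNReal.ofReal_mul (by positivity), ← ENNReal.ofReal_mul (by positivity),
      ENNReal.ofReal_le_ofReal_iff (by
        have := Real.rpow_nonneg hn80 (4 * q + 2 + 1); positivity), hNr] at h1
    have h2 := mul_le_mul_of_nonneg_right hfarc (by linarith : 0 ≤ S)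
    linarith
  · intro k hk i hi j hj x hx y hy hxy
    rw [Finset.mem_Ico] at hi hj
    have : (k + 1) * N = k * N + N := by ring
    exact huυ x y hxy (κ.box_nd_le_of_step hr0 hn1 hN hv2 hρ2 (by omega) (by omega) hx hy)
  · intro i
    refine (pairs_le_card_mul_sus htI' _ _).trans ?_
    rw [κ.card_box, ← hYE, ← ENNReal.ofReal_natCast, ← ENNReal.ofReal_mul (by positivity)]
    exact ENNReal.ofReal_le_ofReal hcY
  · intro i j hij
    exact κ.pairs_box_le_tail htI hX0
      (by have := Real.rpow_nonneg hn2 (2 * q + 1 + 1); positivity) hcX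
      (fun a ha b hb => κ.le_box_nd_of_ne hv hρ2 hij ha hb) htail₁' (by linarith)

/-- The mean-field type upper bound on the susceptibility of the cut-off model. -/
theorem exists_sus_le (hd : 1 ≤ d) (hα : 0 < α) (hJ : Tendsto κ.J atTop (nhds 0))
    (hβc : 0 < κ.betaC) (hCL : κ.CL) : ∃ C : ℝ, 0 < C ∧ ∀ r : ℝ, 1 ≤ r →
      sus (κ.rateCut κ.betaC r) 0 ≤ ENNReal.ofReal (C * r ^ α) := by
  obtain ⟨B, A, r₀, hB, hA, hr₀, hgrow⟩ := κ.exists_growth hd hα hJ hβc hCL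
  obtain ⟨C₀, c₁, C₁, hC₀, hc₁, hcC₁, hbox⟩ := κ.exists_box hα hJ hβc hCL
  have hB0 : 0 < B := by linarith
  have key : ∀ r : ℝ, r₀ ≤ r → (sus (κ.rateCut κ.betaC r) 0).toReal ≤ A * r ^ α := by
    intro r hr
    by_contra! hc
    have hr0 : 0 < r := by linarith
    set Q : ℝ := 2 * B ^ (d + α : ℝ) with hQ
    have hQα : B ^ α ≤ Q := by
      have : B ^ α ≤ B ^ (d + α : ℝ) := Real.rpow_le_rpow_of_exponent_le hB.le (by simp)
      have : 0 < B ^ (d + α : ℝ) := by positivity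
      linarith
    have hQd : 2 * B ^ d ≤ Q := by
      have : B ^ (d : ℝ) ≤ B ^ (d + α : ℝ) :=
        Real.rpow_le_rpow_of_exponent_le hB.le (by linarith)
      rw [Real.rpow_natCast] at this
      linarith
    have hQ0 : 0 < Q := by positivity
    have hX : 0 < (sus (κ.rateCut κ.betaC r) 0).toReal := lt_trans (by positivity) hc
    have hind : ∀ k : ℕ, A * (B ^ k * r) ^ α ≤ (sus (κ.rateCut κ.betaC (B ^ k * r)) 0).toReal ∧
        Q ^ k * (sus (κ.rateCut κ.betaC r) 0).toReal ≤
          (sus (κ.rateCut κ.betaC (B ^ k * r)) 0).toReal := by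
      intro k
      induction k with
      | zero => simpa using hc.le
      | succ k ih =>
        have hk : r₀ ≤ B ^ k * r := by
          have : 1 ≤ B ^ k := one_le_pow₀ hB.le
          nlinarith
        have h1 := (hgrow _ hk ih.1).le
        rw [← mul_assoc, ← pow_succ'] at h1
        constructor
        · refine le_trans ?_ h1
          calc A * (B ^ (k + 1) * r) ^ α = B ^ α * (A * (B ^ k * r) ^ α) := by
                rw [pow_succ', mul_assoc, Real.mul_rpow hB0.le (by positivity)]; ring
            _ ≤ Q * _ := by gcongr; exact ih.1
        · refine le_trans ?_ h1
          rw [pow_succ', mul_assoc]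
          gcongr
          exact ih.2
    have hup : ∀ k : ℕ, 2 ^ k * (sus (κ.rateCut κ.betaC r) 0).toReal ≤ 2 * C₁ * r ^ d := by
      intro k
      have hBk : 1 ≤ B ^ k := one_le_pow₀ hB.le
      have h1 := (hind k).2.trans (hbox (B ^ k * r) (by nlinarith)).2.2
      have h2 : (2 * B ^ d) ^ k * (sus (κ.rateCut κ.betaC r) 0).toReal ≤
        2 * C₁ * (B ^ k * r) ^ d := le_trans (by gcongr) h1
      rw [mul_pow, mul_pow, ← pow_mul, ← pow_mul, mul_comm k d] at h2
      have h3 : 0 < B ^ (d * k) := by positivity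
      nlinarith
    obtain ⟨k, hk⟩ := pow_unbounded_of_one_lt
      (2 * C₁ * r ^ d / (sus (κ.rateCut κ.betaC r) 0).toReal) (one_lt_two (α := ℝ))
    rw [div_lt_iff₀ hX] at hk
    linarith [hup k]
  refine ⟨A * r₀ ^ α, by positivity, fun r hr => ?_⟩
  have hr0 : 0 < r := by linarith
  refine (ENNReal.le_ofReal_iff_toReal_le (κ.sus_rateCut_lt_top hα hJ hβc hr0).ne
    (by positivity)).2 ?_
  have h1 : 1 ≤ r ^ α := Real.one_le_rpow hr hα.le
  have h2 : 1 ≤ r₀ ^ α := Real.one_le_rpow hr₀ hα.le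
  rcases le_total r₀ r with h | h
  · refine (key r h).trans ?_
    have : 0 < A * r ^ α := by positivity
    nlinarith
  · refine (ENNReal.toReal_mono (κ.sus_rateCut_lt_top hα hJ hβc (by linarith)).ne
      (sus_mono (κ.rateCut_mono hβc.le le_rfl hr0 h) 0)).trans ((key r₀ le_rfl).trans ?_)
    have : 0 < A * r₀ ^ α := by positivity
    nlinarith

end Kernel

end LRP

namespace LRP
open scoped NNReal

namespace Kernel

variable {d : ℕ} {α : ℝ} (κ : Kernel d α)

theorem tail_eq' {t : Sym2 (V d) → ℝ≥0} (ht : TransInv t) (R : ℝ) (y : V d) :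
    ∑' b, (if R ≤ κ.nd b y then tau t b y else 0) = κ.tail t R := by
  rw [← κ.tail_eq ht R y]
  simp only [κ.nd_symm y, tau_comm t y]

theorem tau_add_le_tails {t u : Sym2 (V d) → ℝ≥0} (ht : TransInv t) (hu : TransInv u) {υ : ℝ≥0∞}
    (h : ∀ a b : V d, (u s(a, b) : ℝ≥0∞) ≤ υ) {R : ℝ} {x y : V d}
    (hR : ∀ a b : V d, u s(a, b) ≠ 0 → R ≤ κ.nd x a ∨ R ≤ κ.nd b y) :
    tau (t + u) x y ≤ tau t x y +
      υ * (κ.tail t R * sus (t + u) 0 + sus t 0 * κ.tail (t + u) R) := by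
  refine (tau_add_le t u x y).trans (add_le_add le_rfl ?_)
  have hy : ∑' b, tau (t + u) b y = sus (t + u) 0 := by
    simp only [tau_comm (t + u) _ y]
    exact sus_eq (ht.add hu) y
  calc _ ≤ ∑' a, ∑' b, υ * ((if R ≤ κ.nd x a then tau t x a else 0) * tau (t + u) b y +
          tau t x a * (if R ≤ κ.nd b y then tau (t + u) b y else 0)) := by
        refine ENNReal.tsum_le_tsum fun a => ENNReal.tsum_le_tsum fun b => ?_
        by_cases h0 : u s(a, b) = 0
        · simp [h0]
        · rw [mul_comm (tau t x a), mul_assoc]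
          refine mul_le_mul' (h a b) ?_
          rcases hR a b h0 with h1 | h1
          · rw [if_pos h1]; exact le_self_add
          · rw [if_pos h1]; exact le_add_self
    _ = υ * ((∑' a, if R ≤ κ.nd x a then tau t x a else 0) * (∑' b, tau (t + u) b y) +
          (∑' a, tau t x a) * ∑' b, if R ≤ κ.nd b y then tau (t + u) b y else 0) := by
        simp only [ENNReal.tsum_mul_left, ENNReal.tsum_mul_right, ENNReal.tsum_add]
    _ = _ := by
        rw [κ.tail_eq ht, κ.tail_eq' (ht.add hu), hy, ← sus_eq ht x]
        rfl

theorem tau_add_le_far {t u : Sym2 (V d) → ℝ≥0} (ht : TransInv t) (hu : TransInv u)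
    {υ υ' G : ℝ≥0∞} (h : ∀ a b : V d, (u s(a, b) : ℝ≥0∞) ≤ υ) {R R' : ℝ} {x y : V d}
    (hG : ∀ b, R' ≤ κ.nd b y → tau (t + u) b y ≤ G)
    (hR : ∀ a b : V d, κ.nd x a < R → κ.nd b y < R' → (u s(a, b) : ℝ≥0∞) ≤ υ') :
    tau (t + u) x y ≤ tau t x y +
      (κ.tail t R * υ * sus (t + u) 0 + sus t 0 * deg u * G + sus t 0 * υ' * sus (t + u) 0) := by
  refine (tau_add_le t u x y).trans (add_le_add le_rfl ?_)
  have hy : ∑' b, tau (t + u) b y = sus (t + u) 0 := by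
    simp only [tau_comm (t + u) _ y]
    exact sus_eq (ht.add hu) y
  calc _ ≤ ∑' a, ∑' b, ((if R ≤ κ.nd x a then tau t x a else 0) * υ * tau (t + u) b y +
          tau t x a * (u s(a, b) * G) + tau t x a * υ' * tau (t + u) b y) := by
        refine ENNReal.tsum_le_tsum fun a => ENNReal.tsum_le_tsum fun b => ?_
        rcases le_or_gt R (κ.nd x a) with h1 | h1
        · rw [if_pos h1, add_assoc]
          exact (mul_le_mul_left (mul_le_mul_right (h a b) _) _).trans le_self_add
        · rcases le_or_gt R' (κ.nd b y) with h2 | h2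
          · rw [add_assoc, mul_assoc]
            exact (mul_le_mul_right (mul_le_mul_right (hG b h2) _) _).trans
              (le_self_add.trans le_add_self)
          · exact (mul_le_mul_left (mul_le_mul_right (hR a b h1 h2) _) _).trans le_add_self
    _ = _ := by
        simp only [ENNReal.tsum_mul_left, ENNReal.tsum_mul_right, ENNReal.tsum_add, hy,
          deg_eq hu, κ.tail_eq ht]
        have : ∑' a, tau t x a = sus t 0 := sus_eq ht x
        rw [this]
        ring

/-- Pointwise control of the connection probabilities when the cut-off scale is doubled. -/
theorem exists_tau_double_le (hd : 1 ≤ d) (hα : 0 < α) (hJ : Tendsto κ.J atTop (nhds 0))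
    (hβc : 0 < κ.betaC) (hCL : κ.CL) : ∃ C : ℝ, 0 < C ∧ ∀ s : ℝ, 1 ≤ s → ∀ x y : V d, x ≠ y →
      tau (κ.rateCut κ.betaC (2 * s)) x y ≤ tau (κ.rateCut κ.betaC s) x y +
        ENNReal.ofReal (C * s ^ (α - d)) ∧
      tau (κ.rateCut κ.betaC (2 * s)) x y ≤ tau (κ.rateCut κ.betaC s) x y +
        ENNReal.ofReal (C * (s ^ (2 * α) * κ.nd x y ^ (-(d + α)))) := by
  obtain ⟨A, hA, hsus⟩ := κ.exists_sus_le hd hα hJ hβc hCL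
  obtain ⟨T, hT, htail⟩ := κ.exists_tail_le hα hJ hβc hCL (p := d + α) (by positivity)
  obtain ⟨M, hM, hJle⟩ := κ.exists_J_le hα hJ
  have hq0 : (0 : ℝ) < d + α := by positivity
  set C : ℝ := 2 * κ.betaC * M * A ^ 2 * (2 ^ α) ^ 2 * (1 + T) * 6 ^ (d + α) with hC
  have h6 : (1 : ℝ) ≤ 6 ^ (d + α) := Real.one_le_rpow (by norm_num) hq0.le
  have hC0 : 0 < C := by positivity
  refine ⟨C, hC0, fun s hs x y hxy => ?_⟩
  have hs0 : 0 < s := by linarith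
  have hR := κ.nd_pos hxy
  have hu : TransInv (κ.rateCut κ.betaC (2 * s) - κ.rateCut κ.betaC s) :=
    (κ.transInv_rateCut _ _).sub (κ.transInv_rateCut _ _)
  have hadd := κ.rateCut_add_sub hβc.le hs0 (by linarith : s ≤ 2 * s)
  have hυ : ∀ a b : V d, ((κ.rateCut κ.betaC (2 * s) - κ.rateCut κ.betaC s) s(a, b) : ℝ≥0∞) ≤
      ENNReal.ofReal (κ.betaC * (M * s ^ (-(d + α)))) := fun a b =>
    (ENNReal.coe_le_coe.2 (κ.rateCut_sub_le hβc.le (by linarith) s(a, b))).trans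
      ((κ.rate_sub_le_J hβc.le hs0 a b).trans (ENNReal.ofReal_le_ofReal
        (mul_le_mul_of_nonneg_left (hJle s hs) hβc.le)))
  have h2s := hsus (2 * s) (by linarith)
  have hmono := sus_mono (κ.rateCut_mono hβc.le le_rfl hs0 (by linarith : s ≤ 2 * s)) (0 : V d)
  have hX : 0 < s ^ α := by positivity
  have hY : 0 < s ^ (d + α) := by positivity
  have e1 : s ^ (-(d + α)) = (s ^ (d + α))⁻¹ := Real.rpow_neg hs0.le _
  have e2 : (2 * s) ^ α = 2 ^ α * s ^ α := Real.mul_rpow (by norm_num) hs0.le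
  have e3 : s ^ (2 * α) = (s ^ α) ^ 2 := by
    rw [mul_comm, Real.rpow_mul hs0.le]; norm_num
  have e4 : s ^ (α - d) = s ^ (2 * α) * s ^ (-(d + α)) := by
    rw [← Real.rpow_add hs0]; ring_nf
  have h1 : tau (κ.rateCut κ.betaC (2 * s)) x y ≤ tau (κ.rateCut κ.betaC s) x y +
      ENNReal.ofReal (2 * κ.betaC * M * A ^ 2 * (2 ^ α) ^ 2 * s ^ (α - d)) := by
    have h := tau_add_le_of_le (κ.transInv_rateCut κ.betaC s) hu hυ x y
    rw [hadd] at h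
    refine h.trans (add_le_add le_rfl ?_)
    calc _ ≤ ENNReal.ofReal (κ.betaC * (M * s ^ (-(d + α)))) * ENNReal.ofReal (A * (2 * s) ^ α) *
          ENNReal.ofReal (A * (2 * s) ^ α) := by gcongr; exact hmono.trans h2s
      _ ≤ _ := by
        rw [← ENNReal.ofReal_mul (by positivity), ← ENNReal.ofReal_mul (by positivity), e4, e3, e2]
        refine ENNReal.ofReal_le_ofReal ?_
        have : 0 < κ.betaC * M * A ^ 2 * (2 ^ α) ^ 2 * ((s ^ α) ^ 2 * s ^ (-(d + α))) := by
          positivity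
        linarith
  have hC1 : 2 * κ.betaC * M * A ^ 2 * (2 ^ α) ^ 2 * 6 ^ (d + α) ≤ C := by
    rw [hC]
    exact mul_le_mul_of_nonneg_right (le_mul_of_one_le_right (by positivity) (by linarith))
      (by positivity)
  refine ⟨h1.trans (add_le_add le_rfl (ENNReal.ofReal_le_ofReal ?_)), ?_⟩
  · gcongr
    refine le_trans ?_ hC1
    exact le_mul_of_one_le_right (by positivity) h6
  rcases le_total (κ.nd x y) (6 * s) with h | h
  · refine h1.trans (add_le_add le_rfl (ENNReal.ofReal_le_ofReal ?_))
    rw [e4]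
    have h2 : s ^ (-(d + α)) ≤ 6 ^ (d + α) * κ.nd x y ^ (-(d + α)) := by
      have : (6 * s) ^ (-(d + α)) ≤ κ.nd x y ^ (-(d + α)) :=
        Real.rpow_le_rpow_of_nonpos hR h (by linarith)
      rw [Real.mul_rpow (by norm_num) hs0.le, Real.rpow_neg (by norm_num)] at this
      have h7 := mul_le_mul_of_nonneg_left this (by positivity : (0 : ℝ) ≤ 6 ^ (d + α))
      rwa [← mul_assoc, mul_inv_cancel₀ (by positivity), one_mul] at h7
    calc _ ≤ 2 * κ.betaC * M * A ^ 2 * (2 ^ α) ^ 2 *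
          (s ^ (2 * α) * (6 ^ (d + α) * κ.nd x y ^ (-(d + α)))) := by gcongr
      _ = 2 * κ.betaC * M * A ^ 2 * (2 ^ α) ^ 2 * 6 ^ (d + α) *
          (s ^ (2 * α) * κ.nd x y ^ (-(d + α))) := by ring
      _ ≤ _ := by gcongr
  · have hsupp : ∀ a b : V d, (κ.rateCut κ.betaC (2 * s) - κ.rateCut κ.betaC s) s(a, b) ≠ 0 →
        κ.nd x y / 3 ≤ κ.nd x a ∨ κ.nd x y / 3 ≤ κ.nd b y := by
      intro a b hab
      by_contra! hc
      refine hab ?_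
      have h1 := κ.nd_triangle x a y
      have h2 := κ.nd_triangle a b y
      rw [Pi.sub_apply, κ.rateCut_eq_zero (by linarith), zero_tsub]
    have h2 := κ.tau_add_le_tails (κ.transInv_rateCut κ.betaC s) hu hυ hsupp
    rw [hadd] at h2
    refine h2.trans (add_le_add le_rfl ?_)
    have h3 := htail (2 * s) (by linarith) (κ.nd x y / 3) (by positivity)
    have h4 : κ.tail (κ.rateCut κ.betaC (2 * s)) (κ.nd x y / 3) ≤
        ENNReal.ofReal (A * (2 * s) ^ α) * ENNReal.ofReal
          (T * (6 ^ (d + α) * s ^ (d + α) * κ.nd x y ^ (-(d + α)))) := by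
      refine h3.trans (mul_le_mul' h2s (ENNReal.ofReal_le_ofReal ?_))
      rw [show 2 * s / (κ.nd x y / 3) = 6 * s * (κ.nd x y)⁻¹ by field_simp; norm_num,
        Real.mul_rpow (by positivity) (by positivity), Real.mul_rpow (by norm_num) hs0.le,
        Real.inv_rpow hR.le, Real.rpow_neg hR.le]
    have h5 := κ.tail_mono (κ.rateCut_mono hβc.le le_rfl hs0 (by linarith : s ≤ 2 * s))
      (κ.nd x y / 3)
    calc _ ≤ ENNReal.ofReal (κ.betaC * (M * s ^ (-(d + α)))) *
          (2 * (ENNReal.ofReal (A * (2 * s) ^ α) * (ENNReal.ofReal (A * (2 * s) ^ α) *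
            ENNReal.ofReal (T * (6 ^ (d + α) * s ^ (d + α) * κ.nd x y ^ (-(d + α))))))) := by
          refine mul_le_mul_right ?_ _
          refine (add_le_add ?_ ?_).trans_eq (two_mul _).symm
          · rw [mul_comm]
            exact mul_le_mul' h2s (h5.trans h4)
          · exact mul_le_mul' (hmono.trans h2s) h4
      _ ≤ _ := by
        rw [show (2 : ℝ≥0∞) = ENNReal.ofReal 2 by simp, ← ENNReal.ofReal_mul (by positivity),
          ← ENNReal.ofReal_mul (by positivity), ← ENNReal.ofReal_mul (by positivity),
          ← ENNReal.ofReal_mul (by positivity), e3, e2, e1]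
        refine ENNReal.ofReal_le_ofReal ?_
        have e5 : (s ^ (d + α))⁻¹ * s ^ (d + α) = 1 := inv_mul_cancel₀ hY.ne'
        have hZ : 0 ≤ κ.nd x y ^ (-(d + α)) := by positivity
        have h8 : 0 ≤ 2 * κ.betaC * M * A ^ 2 * (2 ^ α) ^ 2 * 6 ^ (d + α) *
            ((s ^ α) ^ 2 * κ.nd x y ^ (-(d + α))) := by positivity
        rw [hC]
        refine le_of_sub_nonneg (h8.trans_eq ?_)
        linear_combination (2 * κ.betaC * M * A ^ 2 * (2 ^ α) ^ 2 * 6 ^ (d + α) * T *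
            ((s ^ α) ^ 2 * κ.nd x y ^ (-(d + α)))) * e5

end Kernel

end LRP

namespace LRP
open scoped NNReal

namespace Kernel

variable {d : ℕ} {α : ℝ} (κ : Kernel d α)

theorem tau_le_tail {t : Sym2 (V d) → ℝ≥0} (ht : TransInv t) (x y : V d) :
    tau t x y ≤ κ.tail t (κ.nd x y) := by
  rw [← κ.tail_eq ht (κ.nd x y) x]
  refine le_trans ?_ (ENNReal.le_tsum y)
  rw [if_pos le_rfl]

theorem exists_tau_pow_le (hd : 1 ≤ d) (hα : 0 < α) (hJ : Tendsto κ.J atTop (nhds 0))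
    (hβc : 0 < κ.betaC) (hCL : κ.CL) : ∃ C : ℝ, 0 < C ∧ ∀ (k : ℕ) (x y : V d), x ≠ y →
      tau (κ.rateCut κ.betaC (2 ^ k)) x y ≤
        ENNReal.ofReal (C * (((2 : ℝ) ^ k) ^ (2 * α) * κ.nd x y ^ (-(d + α)))) := by
  obtain ⟨A, hA, hsus⟩ := κ.exists_sus_le hd hα hJ hβc hCL
  obtain ⟨T, hT, htail⟩ := κ.exists_tail_le hα hJ hβc hCL (p := d + α) (by positivity)
  obtain ⟨D, hD, hdouble⟩ := κ.exists_tau_double_le hd hα hJ hβc hCL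
  have h4 : (1 : ℝ) < 2 ^ (2 * α) := Real.one_lt_rpow (by norm_num) (by positivity)
  obtain ⟨C, hC⟩ : ∃ C, C = A * T + D / (2 ^ (2 * α) - 1) := ⟨_, rfl⟩
  have h5 : 0 < D / (2 ^ (2 * α) - 1) := div_pos hD (by linarith)
  have hAT : 0 < A * T := by positivity
  have hDC : D ≤ C * (2 ^ (2 * α) - 1) := by
    rw [← div_le_iff₀ (by linarith)]
    linarith
  refine ⟨C, by linarith, fun k x y hxy => ?_⟩
  have hR := κ.nd_pos hxy
  have hZ : 0 ≤ κ.nd x y ^ (-(d + α)) := by positivity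
  have hC0 : 0 < C := by linarith
  induction k with
  | zero =>
    refine (κ.tau_le_tail (κ.transInv_rateCut _ _) x y).trans ?_
    simp only [pow_zero, Real.one_rpow, one_mul]
    refine (htail 1 le_rfl _ hR).trans ((mul_le_mul_left (hsus 1 le_rfl) _).trans ?_)
    rw [← ENNReal.ofReal_mul (by positivity), Real.one_rpow, one_div, Real.inv_rpow hR.le,
      ← Real.rpow_neg hR.le, mul_one, ← mul_assoc]
    exact ENNReal.ofReal_le_ofReal (mul_le_mul_of_nonneg_right (by linarith) hZ)
  | succ k ih =>
    have h1 := (hdouble (2 ^ k) (one_le_pow₀ (by norm_num)) x y hxy).2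
    rw [pow_succ']
    refine h1.trans ((add_le_add ih le_rfl).trans ?_)
    rw [← ENNReal.ofReal_add (by positivity) (by positivity),
      Real.mul_rpow (by norm_num) (by positivity)]
    refine ENNReal.ofReal_le_ofReal ?_
    have := mul_le_mul_of_nonneg_right hDC
      (by positivity : 0 ≤ ((2 : ℝ) ^ k) ^ (2 * α) * κ.nd x y ^ (-(d + α)))
    linarith

theorem exists_tau_pow_le_of_lt (hd : 1 ≤ d) (hα : 0 < α) (hαd : α < d)
    (hJ : Tendsto κ.J atTop (nhds 0)) (hβc : 0 < κ.betaC) (hCL : κ.CL) : ∃ C : ℝ, 0 < C ∧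
      ∀ (k n : ℕ) (x y : V d), k ≤ n → 2 ^ k ≤ κ.nd x y → κ.nd x y ≤ 2 * 2 ^ k →
        tau (κ.rateCut κ.betaC (2 ^ n)) x y ≤
          ENNReal.ofReal (C * κ.nd x y ^ (α - d)) := by
  obtain ⟨A, hA, hpow⟩ := κ.exists_tau_pow_le hd hα hJ hβc hCL
  obtain ⟨D, hD, hdouble⟩ := κ.exists_tau_double_le hd hα hJ hβc hCL
  have h4 : (2 : ℝ) ^ (α - d) < 1 := Real.rpow_lt_one_of_one_lt_of_neg (by norm_num) (by linarith)
  have h2pos : (0 : ℝ) < 2 ^ (α - d) := by positivity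
  obtain ⟨E, hE⟩ : ∃ E : ℝ, E * (1 - 2 ^ (α - d)) = D := ⟨D / (1 - 2 ^ (α - d)),
    div_mul_cancel₀ _ (by linarith)⟩
  have hE0 : 0 < E := by
    refine pos_of_mul_pos_left (b := 1 - (2 : ℝ) ^ (α - d)) (by linarith) (by linarith)
  refine ⟨A + E * (2 ^ (α - d))⁻¹, by positivity, fun k n x y hkn hk hk2 => ?_⟩
  have hR : 0 < κ.nd x y := lt_of_lt_of_le (by positivity) hk
  have hxy : x ≠ y := by
    rintro rfl
    rw [κ.nd_self] at hR
    exact lt_irrefl _ hR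
  have key : tau (κ.rateCut κ.betaC (2 ^ n)) x y ≤ ENNReal.ofReal (A * κ.nd x y ^ (α - d) +
      E * (((2 : ℝ) ^ k) ^ (α - d) - ((2 : ℝ) ^ n) ^ (α - d))) := by
    induction n, hkn using Nat.le_induction with
    | base =>
      refine (hpow k x y hxy).trans (ENNReal.ofReal_le_ofReal ?_)
      rw [sub_self, mul_zero, add_zero]
      refine mul_le_mul_of_nonneg_left ?_ hA.le
      calc ((2 : ℝ) ^ k) ^ (2 * α) * κ.nd x y ^ (-(d + α)) ≤
          κ.nd x y ^ (2 * α) * κ.nd x y ^ (-(d + α)) := by gcongr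
        _ = _ := by rw [← Real.rpow_add hR]; ring_nf
    | succ n hkn ih =>
      have h1 := (hdouble (2 ^ n) (one_le_pow₀ (by norm_num)) x y hxy).1
      rw [pow_succ']
      have h5 : ((2 : ℝ) ^ n) ^ (α - d) ≤ ((2 : ℝ) ^ k) ^ (α - d) :=
        Real.rpow_le_rpow_of_nonpos (by positivity) (pow_le_pow_right₀ (by norm_num) hkn)
          (by linarith)
      have h6 : 0 ≤ E * (((2 : ℝ) ^ k) ^ (α - d) - ((2 : ℝ) ^ n) ^ (α - d)) :=
        mul_nonneg hE0.le (by linarith)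
      refine h1.trans ((add_le_add ih le_rfl).trans ?_)
      rw [← ENNReal.ofReal_add (by positivity) (by positivity),
        Real.mul_rpow (by norm_num) (by positivity), ← hE]
      refine ENNReal.ofReal_le_ofReal (le_of_eq ?_)
      ring
  refine key.trans (ENNReal.ofReal_le_ofReal ?_)
  have h7 : ((2 : ℝ) ^ k) ^ (α - d) ≤ (2 ^ (α - d))⁻¹ * κ.nd x y ^ (α - d) := by
    have : (2 * (2 : ℝ) ^ k) ^ (α - d) ≤ κ.nd x y ^ (α - d) :=
      Real.rpow_le_rpow_of_nonpos hR hk2 (by linarith)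
    rw [Real.mul_rpow (by norm_num) (by positivity)] at this
    rw [inv_mul_eq_div, le_div_iff₀ h2pos]
    linarith
  have h8 := mul_le_mul_of_nonneg_left h7 hE0.le
  have h9 : 0 ≤ E * ((2 : ℝ) ^ n) ^ (α - d) := by positivity
  linarith

theorem exists_tau_rate_le (hα : 0 < α) (hJ : Tendsto κ.J atTop (nhds 0)) (hβc : 0 < κ.betaC) :
    ∃ C : ℝ, 0 < C ∧ ∀ β r X : ℝ, 0 < β → β ≤ κ.betaC → 1 ≤ r → 0 ≤ X →
      sus (κ.rate β) 0 ≤ ENNReal.ofReal X → ∀ x y : V d,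
        tau (κ.rate β) x y ≤ tau (κ.rateCut κ.betaC r) x y +
          ENNReal.ofReal (C * (X ^ 2 * r ^ (-(d + α)))) := by
  obtain ⟨M, hM, hJle⟩ := κ.exists_J_le hα hJ
  refine ⟨κ.betaC * M, by positivity, fun β r X hβ hββ hr hX hsus x y => ?_⟩
  have hr0 : 0 < r := by linarith
  have hυ : ∀ a b : V d, ((κ.rate β - κ.rateCut β r) s(a, b) : ℝ≥0∞) ≤
      ENNReal.ofReal (κ.betaC * (M * r ^ (-(d + α)))) := fun a b =>
    (κ.rate_sub_le_J hβ.le hr0 a b).trans (ENNReal.ofReal_le_ofReal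
        (mul_le_mul hββ (hJle r hr) (κ.J_nonneg r hr0) hβc.le))
  have h := tau_add_le_of_le (κ.transInv_rateCut β r)
    ((κ.transInv_rate β).sub (κ.transInv_rateCut β r)) hυ x y
  rw [κ.rateCut_add_rate_sub hβ.le hr0] at h
  refine h.trans (add_le_add (tau_mono (κ.rateCut_mono hβ.le hββ hr0 le_rfl) _ _) ?_)
  calc _ ≤ ENNReal.ofReal (κ.betaC * (M * r ^ (-(d + α)))) * ENNReal.ofReal X *
        ENNReal.ofReal X := by
        gcongr
        exact (sus_mono (κ.rateCut_le_rate hβ.le hr0) _).trans hsus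
    _ ≤ _ := by
        rw [← ENNReal.ofReal_mul (by positivity), ← ENNReal.ofReal_mul (by positivity)]
        exact ENNReal.ofReal_le_ofReal (le_of_eq (by ring))

theorem exists_tau_le_near (hd : 1 ≤ d) (hα : 0 < α) (hJ : Tendsto κ.J atTop (nhds 0))
    (hβc : 0 < κ.betaC) (hCL : κ.CL) : ∃ C : ℝ, 0 < C ∧ ∀ β ξ : ℝ, 0 < β → β ≤ κ.betaC → 1 ≤ ξ →
      sus (κ.rate β) 0 = ENNReal.ofReal (ξ ^ α) → ∀ x y : V d, x ≠ y → κ.nd x y ≤ ξ →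
        tau (κ.rate β) x y ≤ ENNReal.ofReal (C * κ.nd x y ^ (α - d)) := by
  obtain ⟨m, hm, hm1, hmin⟩ := κ.exists_min_nr
  rcases le_or_gt (d : ℝ) α with hαd | hαd
  · refine ⟨(m ^ (α - d))⁻¹, by positivity, fun β ξ _ _ _ _ x y hxy _ => ?_⟩
    refine (tau_le_one _ _ _).trans ?_
    rw [← ENNReal.ofReal_one]
    refine ENNReal.ofReal_le_ofReal ?_
    rw [inv_mul_eq_div, one_le_div (by positivity)]
    exact Real.rpow_le_rpow hm.le (κ.nd_eq x y ▸ hmin _ (sub_ne_zero.2 hxy)) (by linarith)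
  obtain ⟨A, hA, hpow⟩ := κ.exists_tau_pow_le_of_lt hd hα hαd hJ hβc hCL
  obtain ⟨D, hD, hrate⟩ := κ.exists_tau_rate_le hα hJ hβc
  refine ⟨1 + A + D * 2 ^ (d + α), by positivity, fun β ξ hβ hββ hξ hsus x y hxy hR => ?_⟩
  have hR0 := κ.nd_pos hxy
  have hZ : 0 < κ.nd x y ^ (α - d) := by positivity
  have hP : (0 : ℝ) < 2 ^ (d + α) := by positivity
  rcases le_total (κ.nd x y) 1 with h1 | h1
  · refine (tau_le_one _ _ _).trans ?_
    rw [← ENNReal.ofReal_one]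
    refine ENNReal.ofReal_le_ofReal ?_
    have h2 : 1 ≤ κ.nd x y ^ (α - d) :=
      Real.one_le_rpow_of_pos_of_le_one_of_nonpos hR0 h1 (by linarith)
    have h3 : 0 ≤ (A + D * 2 ^ (d + α)) * κ.nd x y ^ (α - d) := by positivity
    linarith
  obtain ⟨k, hk, hk2⟩ := exists_nat_pow_near h1 one_lt_two
  obtain ⟨n, hn, hn2⟩ := exists_nat_pow_near hξ one_lt_two
  have hkn : k ≤ n := by
    have : (2 : ℝ) ^ k < 2 ^ (n + 1) := by linarith
    exact Nat.lt_succ_iff.1 ((pow_lt_pow_iff_right₀ (one_lt_two : (1 : ℝ) < 2)).1 this)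
  rw [pow_succ'] at hk2 hn2
  have hξ0 : 0 < ξ := by linarith
  refine (hrate β (2 ^ n) (ξ ^ α) hβ hββ (one_le_pow₀ (by norm_num)) (by positivity)
    hsus.le x y).trans ((add_le_add (hpow k n x y hkn hk hk2.le) le_rfl).trans ?_)
  rw [← ENNReal.ofReal_add (by positivity) (by positivity)]
  refine ENNReal.ofReal_le_ofReal ?_
  have h2 : ((2 : ℝ) ^ n) ^ (-(d + α)) ≤ 2 ^ (d + α) * ξ ^ (-(d + α)) := by
    have : (2 * (2 : ℝ) ^ n) ^ (-(d + α)) ≤ ξ ^ (-(d + α)) :=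
      Real.rpow_le_rpow_of_nonpos hξ0 hn2.le (by linarith)
    rw [Real.mul_rpow (by norm_num) (by positivity), Real.rpow_neg (by norm_num)] at this
    rwa [inv_mul_le_iff₀ hP] at this
  have h3 : (ξ ^ α) ^ 2 * ((2 : ℝ) ^ n) ^ (-(d + α)) ≤ 2 ^ (d + α) * κ.nd x y ^ (α - d) := by
    calc (ξ ^ α) ^ 2 * ((2 : ℝ) ^ n) ^ (-(d + α)) ≤
        (ξ ^ α) ^ 2 * (2 ^ (d + α) * ξ ^ (-(d + α))) := by gcongr
      _ = 2 ^ (d + α) * ξ ^ (α - d) := by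
        rw [mul_left_comm, ← Real.rpow_natCast, ← Real.rpow_mul hξ0.le, ← Real.rpow_add hξ0]
        push_cast
        ring_nf
      _ ≤ _ := by
        refine mul_le_mul_of_nonneg_left ?_ hP.le
        exact Real.rpow_le_rpow_of_nonpos hR0 hR (by linarith)
  have h4 := mul_le_mul_of_nonneg_left h3 hD.le
  linarith

end Kernel

end LRP

namespace LRP

open scoped NNReal

namespace Kernel

variable {d : ℕ} {α : ℝ} (κ : Kernel d α)

theorem exists_tau_far_step (hd : 1 ≤ d) (hα : 0 < α) (hJ : Tendsto κ.J atTop (nhds 0))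
    (hβc : 0 < κ.betaC) (hCL : κ.CL) : ∃ D : ℝ, 0 < D ∧ ∀ β ξ : ℝ, 0 < β → β ≤ κ.betaC → 1 ≤ ξ →
      sus (κ.rate β) 0 = ENNReal.ofReal (ξ ^ α) → ∀ ρ G : ℝ, 2 * ξ ≤ ρ → 0 ≤ G →
        (∀ x y : V d, ρ / 2 ≤ κ.nd x y → tau (κ.rate β) x y ≤ ENNReal.ofReal G) →
        ∀ x y : V d, ρ ≤ κ.nd x y → tau (κ.rate β) x y ≤
          ENNReal.ofReal (D * ((ξ ^ α) ^ 2 * ρ ^ (-(d + α))) + (2 * 2 ^ (d + α))⁻¹ * G) := by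
  obtain ⟨A, hA, hsusle⟩ := κ.exists_sus_le hd hα hJ hβc hCL
  obtain ⟨T, hT, htail⟩ := κ.exists_tail_le hα hJ hβc hCL (p := d + α) (by positivity)
  obtain ⟨M, hM, hJle⟩ := κ.exists_J_le hα hJ
  obtain ⟨_, M', _, hM', hJle'⟩ := κ.exists_J_bounds hα hJ (m := 1 / 2) (by norm_num)
  obtain ⟨B, hB, hdeg⟩ := κ.exists_deg_sub_le hα hJ
  obtain ⟨P, hP, hpow⟩ := κ.exists_tau_pow_le hd hα hJ hβc hCL
  obtain ⟨a, ha⟩ := pow_unbounded_of_one_lt (B * κ.betaC * 2 ^ α * (2 * 2 ^ (d + α)))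
    (Real.one_lt_rpow (by norm_num : (1 : ℝ) < 2) hα)
  obtain ⟨b, hb⟩ : ∃ b, b = κ.betaC := ⟨_, rfl⟩
  obtain ⟨E, hE⟩ : ∃ E : ℝ, E = (2 ^ α) ^ a := ⟨_, rfl⟩
  rw [← hb] at ha hβc
  rw [← hE] at ha
  have hE0 : 0 < E := by rw [hE]; positivity
  refine ⟨P * E ^ 2 + A * T * 4 ^ (d + α) * b * M * E + b * M' * 4 ^ (d + α), by positivity,
    fun β ξ hβ hββ hξ hsus ρ G hρ hG0 hG x y hxy => ?_⟩
  obtain ⟨n, hn, hn2⟩ := exists_nat_pow_near hξ one_lt_two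
  rw [pow_succ'] at hn2
  have hξ0 : 0 < ξ := by linarith
  have hρ0 : 0 < ρ := by linarith
  have hxy' : x ≠ y := by
    rintro rfl
    rw [κ.nd_self] at hxy
    linarith
  obtain ⟨r, hr⟩ : ∃ r : ℝ, r = 2 ^ (a + n) := ⟨_, rfl⟩
  have hr1 : 1 ≤ r := by rw [hr]; exact one_le_pow₀ (by norm_num)
  have hr0 : 0 < r := by linarith
  have hrα : r ^ α = E * ((2 : ℝ) ^ n) ^ α := by
    rw [hr, hE, pow_add, Real.mul_rpow (by positivity) (by positivity), ← Real.rpow_natCast,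
      ← Real.rpow_natCast (2 ^ α) a, ← Real.rpow_mul (by norm_num), ← Real.rpow_mul (by norm_num),
      mul_comm α]
  have hX : 0 < ξ ^ α := by positivity
  have hrle : r ^ α ≤ E * ξ ^ α := by
    rw [hrα]
    gcongr
  have hrge : E * ξ ^ α ≤ 2 ^ α * r ^ α := by
    have : ξ ^ α ≤ (2 * 2 ^ n) ^ α := by gcongr
    rw [Real.mul_rpow (by norm_num) (by positivity)] at this
    rw [hrα]
    calc _ ≤ E * (2 ^ α * ((2 : ℝ) ^ n) ^ α) := by gcongr
      _ = _ := by ring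
  have hυ : ∀ a' b' : V d, ((κ.rate β - κ.rateCut β r) s(a', b') : ℝ≥0∞) ≤
      ENNReal.ofReal (b * (M * r ^ (-(d + α)))) := fun a' b' =>
    (κ.rate_sub_le_J hβ.le hr0 a' b').trans (ENNReal.ofReal_le_ofReal
        (hb ▸ mul_le_mul hββ (hJle r hr1) (κ.J_nonneg r hr0) (hb ▸ hβc.le)))
  have hυ' : ∀ a' b' : V d, κ.nd x a' < ρ / 4 → κ.nd b' y < ρ / 2 →
      ((κ.rate β - κ.rateCut β r) s(a', b') : ℝ≥0∞) ≤
        ENNReal.ofReal (b * (M' * (ρ / 4) ^ (-(d + α)))) := by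
    intro a' b' h1 h2
    have h3 := κ.nd_triangle x a' y
    have h4 := κ.nd_triangle a' b' y
    have h5 : ρ / 4 ≤ κ.nd a' b' := by linarith
    refine (ENNReal.coe_le_coe.2 (tsub_le_self : (κ.rate β - κ.rateCut β r) s(a', b') ≤
      κ.rate β s(a', b'))).trans ?_
    rw [← ENNReal.ofReal_coe_nnreal, κ.coe_rate hβ.le]
    refine ENNReal.ofReal_le_ofReal ?_
    have hne : a' ≠ b' := by
      rintro rfl
      rw [κ.nd_self] at h5
      linarith
    rw [κ.ker_of_ne hne]
    have h6 : κ.J (κ.nd a' b') ≤ κ.J (ρ / 4) :=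
      κ.J_anti (by simp; linarith) (by simp; linarith) h5
    exact hb ▸ mul_le_mul hββ (h6.trans (hJle' _ (by linarith)).2) (κ.J_nonneg _ (by linarith))
      (hb ▸ hβc.le)
  have h := κ.tau_add_le_far (κ.transInv_rateCut β r)
    ((κ.transInv_rate β).sub (κ.transInv_rateCut β r)) hυ (R := ρ / 4) (R' := ρ / 2)
    (G := ENNReal.ofReal G) (x := x) (y := y)
    (fun c hc => by rw [κ.rateCut_add_rate_sub hβ.le hr0]; exact hG _ _ hc) hυ'
  rw [κ.rateCut_add_rate_sub hβ.le hr0] at h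
  have hst : sus (κ.rateCut β r) 0 ≤ ENNReal.ofReal (ξ ^ α) :=
    (sus_mono (κ.rateCut_le_rate hβ.le hr0) _).trans hsus.le
  have hcut := κ.rateCut_mono hβ.le hββ hr0 (le_refl r)
  have hρq : 0 < ρ ^ (-(d + α)) := by positivity
  have hrq : r ^ (-(d + α)) = (r ^ (d + α))⁻¹ := Real.rpow_neg hr0.le _
  have hrq0 : 0 < r ^ (d + α) := by positivity
  have t0 : tau (κ.rateCut β r) x y ≤
      ENNReal.ofReal (P * E ^ 2 * ((ξ ^ α) ^ 2 * ρ ^ (-(d + α)))) := by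
    refine (tau_mono hcut _ _).trans ((hr ▸ hpow (a + n) x y hxy').trans
      (ENNReal.ofReal_le_ofReal ?_))
    have e1 : r ^ (2 * α) ≤ E ^ 2 * (ξ ^ α) ^ 2 := by
      rw [mul_comm, Real.rpow_mul hr0.le, ← mul_pow]
      simpa using pow_le_pow_left₀ (by positivity) hrle 2
    have e2 : κ.nd x y ^ (-(d + α)) ≤ ρ ^ (-(d + α)) :=
      Real.rpow_le_rpow_of_nonpos hρ0 hxy (by linarith [(Nat.cast_nonneg d : (0 : ℝ) ≤ d)])
    have e3 := κ.nd_pos hxy'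
    calc _ ≤ P * ((E ^ 2 * (ξ ^ α) ^ 2) * ρ ^ (-(d + α))) := by gcongr
      _ = _ := by ring
  have t1 : κ.tail (κ.rateCut β r) (ρ / 4) * ENNReal.ofReal (b * (M * r ^ (-(d + α)))) *
      sus (κ.rate β) 0 ≤ ENNReal.ofReal (A * T * 4 ^ (d + α) * b * M * E *
        ((ξ ^ α) ^ 2 * ρ ^ (-(d + α)))) := by
    have e1 := (κ.tail_mono hcut (ρ / 4)).trans ((htail r hr1 (ρ / 4) (by positivity)).trans
      (mul_le_mul_left (hsusle r hr1) _))
    have e2 : (r / (ρ / 4)) ^ (d + α) = 4 ^ (d + α) * r ^ (d + α) * ρ ^ (-(d + α)) := by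
      rw [show r / (ρ / 4) = 4 * r * ρ⁻¹ by rw [div_div_eq_mul_div]; ring,
        Real.mul_rpow (by positivity) (by positivity), Real.mul_rpow (by norm_num) hr0.le,
        Real.inv_rpow hρ0.le, Real.rpow_neg hρ0.le]
    rw [e2] at e1
    rw [hsus]
    refine (mul_le_mul_left (mul_le_mul_left e1 _) _).trans ?_
    rw [← ENNReal.ofReal_mul (by positivity), ← ENNReal.ofReal_mul (by positivity),
      ← ENNReal.ofReal_mul (by positivity)]
    refine ENNReal.ofReal_le_ofReal ?_
    calc _ = A * T * 4 ^ (d + α) * b * M * (r ^ α * ξ ^ α * ρ ^ (-(d + α))) *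
          (r ^ (d + α) * (r ^ (d + α))⁻¹) := by rw [hrq]; ring
      _ ≤ A * T * 4 ^ (d + α) * b * M * ((E * ξ ^ α) * ξ ^ α * ρ ^ (-(d + α))) * 1 := by
        rw [mul_inv_cancel₀ hrq0.ne']
        gcongr
      _ = _ := by ring
  have t2 : sus (κ.rateCut β r) 0 * deg (κ.rate β - κ.rateCut β r) * ENNReal.ofReal G ≤
      ENNReal.ofReal ((2 * 2 ^ (d + α))⁻¹ * G) := by
    rw [ENNReal.ofReal_mul (by positivity)]
    refine mul_le_mul_left ?_ _
    refine (mul_le_mul' hst (hdeg β hβ.le r hr1)).trans ?_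
    rw [← ENNReal.ofReal_mul (by positivity)]
    refine ENNReal.ofReal_le_ofReal ?_
    have hrα0 : 0 < r ^ α := by positivity
    rw [Real.rpow_neg hr0.le]
    have hQ : (0 : ℝ) < 2 * 2 ^ (d + α) := by positivity
    rw [← one_mul (2 * _ : ℝ)⁻¹, le_mul_inv_iff₀ hQ]
    have e3 : ξ ^ α * (r ^ α)⁻¹ ≤ 2 ^ α / E := by
      rw [← div_eq_mul_inv, div_le_div_iff₀ hrα0 hE0]
      linarith
    calc _ = B * β * (ξ ^ α * (r ^ α)⁻¹) * (2 * 2 ^ (d + α)) := by ring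
      _ ≤ B * b * (2 ^ α / E) * (2 * 2 ^ (d + α)) := by
        gcongr
        exact hb ▸ hββ
      _ = (B * b * 2 ^ α * (2 * 2 ^ (d + α))) / E := by ring
      _ ≤ 1 := (div_le_one hE0).2 ha.le
  have t3 : sus (κ.rateCut β r) 0 * ENNReal.ofReal (b * (M' * (ρ / 4) ^ (-(d + α)))) *
      sus (κ.rate β) 0 ≤ ENNReal.ofReal (b * M' * 4 ^ (d + α) *
        ((ξ ^ α) ^ 2 * ρ ^ (-(d + α)))) := by
    rw [hsus]
    refine (mul_le_mul_left (mul_le_mul_left hst _) _).trans ?_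
    rw [← ENNReal.ofReal_mul (by positivity), ← ENNReal.ofReal_mul (by positivity)]
    refine ENNReal.ofReal_le_ofReal (le_of_eq ?_)
    rw [div_eq_mul_inv, Real.mul_rpow hρ0.le (by norm_num), Real.inv_rpow (by norm_num),
      Real.rpow_neg (by norm_num : (0 : ℝ) ≤ 4), inv_inv]
    ring
  have hZ : 0 < (ξ ^ α) ^ 2 * ρ ^ (-(d + α)) := by positivity
  refine (h.trans (add_le_add t0 (add_le_add (add_le_add t1 t2) t3))).trans ?_
  rw [← ENNReal.ofReal_add (by positivity) (by positivity),
    ← ENNReal.ofReal_add (by positivity) (by positivity),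
    ← ENNReal.ofReal_add (by positivity) (by positivity)]
  exact ENNReal.ofReal_le_ofReal (le_of_eq (by ring))

theorem exists_tau_le_far (hd : 1 ≤ d) (hα : 0 < α) (hJ : Tendsto κ.J atTop (nhds 0))
    (hβc : 0 < κ.betaC) (hCL : κ.CL) : ∃ C : ℝ, 0 < C ∧ ∀ β ξ : ℝ, 0 < β → β ≤ κ.betaC → 1 ≤ ξ →
      sus (κ.rate β) 0 = ENNReal.ofReal (ξ ^ α) → ∀ x y : V d, ξ ≤ κ.nd x y →
        tau (κ.rate β) x y ≤ ENNReal.ofReal (C * ((ξ ^ α) ^ 2 * κ.nd x y ^ (-(d + α)))) := by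
  obtain ⟨D, hD, hstep⟩ := κ.exists_tau_far_step hd hα hJ hβc hCL
  obtain ⟨B, hB, hrate⟩ := κ.exists_tau_rate_le hα hJ hβc
  obtain ⟨P, hP, hpow⟩ := κ.exists_tau_pow_le hd hα hJ hβc hCL
  have hq : (0 : ℝ) < d + α := by positivity
  have h2q : (0 : ℝ) < 2 ^ (d + α) := by positivity
  obtain ⟨M, hM⟩ : ∃ M, M = 2 * D + P + B * 2 ^ (d + α) := ⟨_, rfl⟩
  have hM0 : 0 < M := by rw [hM]; positivity
  refine ⟨M * 2 ^ (d + α), by positivity, fun β ξ hβ hββ hξ hsus => ?_⟩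
  have hξ0 : 0 < ξ := by linarith
  have hclaim : ∀ k : ℕ, ∀ x y : V d, 2 ^ k * ξ ≤ κ.nd x y →
      tau (κ.rate β) x y ≤ ENNReal.ofReal (M * ((ξ ^ α) ^ 2 * (2 ^ k * ξ) ^ (-(d + α)))) := by
    intro k
    induction k with
    | zero =>
      intro x y hxy
      rw [pow_zero, one_mul] at hxy ⊢
      obtain ⟨n, hn, hn2⟩ := exists_nat_pow_near hξ one_lt_two
      rw [pow_succ'] at hn2
      have hxy' : x ≠ y := by
        rintro rfl
        rw [κ.nd_self] at hxy
        linarith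
      refine (hrate β (2 ^ n) (ξ ^ α) hβ hββ (one_le_pow₀ (by norm_num)) (by positivity)
        hsus.le x y).trans ((add_le_add (hpow n x y hxy') le_rfl).trans ?_)
      rw [← ENNReal.ofReal_add (by have := κ.nd_nonneg x y; positivity) (by positivity)]
      refine ENNReal.ofReal_le_ofReal ?_
      have h2 : ((2 : ℝ) ^ n) ^ (-(d + α)) ≤ 2 ^ (d + α) * ξ ^ (-(d + α)) := by
        have : (2 * (2 : ℝ) ^ n) ^ (-(d + α)) ≤ ξ ^ (-(d + α)) :=
          Real.rpow_le_rpow_of_nonpos hξ0 hn2.le (by linarith)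
        rw [Real.mul_rpow (by norm_num) (by positivity), Real.rpow_neg (by norm_num)] at this
        rwa [inv_mul_le_iff₀ h2q] at this
      have h3 : κ.nd x y ^ (-(d + α)) ≤ ξ ^ (-(d + α)) :=
        Real.rpow_le_rpow_of_nonpos hξ0 hxy (by linarith)
      have h4 : ((2 : ℝ) ^ n) ^ (2 * α) ≤ (ξ ^ α) ^ 2 := by
        rw [← Real.rpow_natCast (ξ ^ α), ← Real.rpow_mul hξ0.le, mul_comm 2 α]
        push_cast
        gcongr
      have hZ : 0 < (ξ ^ α) ^ 2 * ξ ^ (-(d + α)) := by positivity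
      calc _ ≤ P * ((ξ ^ α) ^ 2 * ξ ^ (-(d + α))) +
            B * ((ξ ^ α) ^ 2 * (2 ^ (d + α) * ξ ^ (-(d + α)))) := by
            have := κ.nd_nonneg x y
            gcongr
        _ = (P + B * 2 ^ (d + α)) * ((ξ ^ α) ^ 2 * ξ ^ (-(d + α))) := by ring
        _ ≤ _ := by
          gcongr
          rw [hM]
          linarith
    | succ k ih =>
      intro x y hxy
      have h1 : (1 : ℝ) ≤ 2 ^ k := one_le_pow₀ (by norm_num)
      have h2 : ξ ≤ 2 ^ k * ξ := le_mul_of_one_le_left hξ0.le h1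
      have e : (2 : ℝ) ^ (k + 1) * ξ = 2 * (2 ^ k * ξ) := by ring
      obtain ⟨ρ, hρ⟩ : ∃ ρ, ρ = 2 ^ k * ξ := ⟨_, rfl⟩
      rw [e, ← hρ] at hxy ⊢
      rw [← hρ] at ih h2
      have hρ0 : 0 < ρ := by linarith
      refine (hstep β ξ hβ hββ hξ hsus (2 * ρ) (M * ((ξ ^ α) ^ 2 * ρ ^ (-(d + α))))
        (by linarith) (by positivity) (fun x y h => ih x y (by linarith)) x y hxy).trans
        (ENNReal.ofReal_le_ofReal ?_)
      have e2 : ρ ^ (-(d + α)) = 2 ^ (d + α) * (2 * ρ) ^ (-(d + α)) := by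
        rw [Real.mul_rpow (by norm_num) hρ0.le, Real.rpow_neg (by norm_num : (0 : ℝ) ≤ 2),
          mul_inv_cancel_left₀ h2q.ne']
      rw [e2]
      have hZ : 0 < (ξ ^ α) ^ 2 * (2 * ρ) ^ (-(d + α)) := by positivity
      calc _ = D * ((ξ ^ α) ^ 2 * (2 * ρ) ^ (-(d + α))) + M / 2 *
            ((2 ^ (d + α))⁻¹ * 2 ^ (d + α)) * ((ξ ^ α) ^ 2 * (2 * ρ) ^ (-(d + α))) := by
            rw [mul_inv]; ring
        _ = (D + M / 2) * ((ξ ^ α) ^ 2 * (2 * ρ) ^ (-(d + α))) := by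
            rw [inv_mul_cancel₀ h2q.ne']; ring
        _ ≤ _ := by
          refine mul_le_mul_of_nonneg_right ?_ hZ.le
          have : 0 < B * 2 ^ (d + α) := by positivity
          linarith
  intro x y hxy
  obtain ⟨k, hk, hk2⟩ := exists_nat_pow_near ((one_le_div hξ0).2 hxy) one_lt_two
  rw [le_div_iff₀ hξ0] at hk
  rw [div_lt_iff₀ hξ0, pow_succ', mul_assoc] at hk2
  refine (hclaim k x y hk).trans (ENNReal.ofReal_le_ofReal ?_)
  have h1 : 0 < κ.nd x y := by linarith
  have h2 : ((2 : ℝ) ^ k * ξ) ^ (-(d + α)) ≤ 2 ^ (d + α) * κ.nd x y ^ (-(d + α)) := by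
    have : (2 * ((2 : ℝ) ^ k * ξ)) ^ (-(d + α)) ≤ κ.nd x y ^ (-(d + α)) :=
      Real.rpow_le_rpow_of_nonpos h1 hk2.le (by linarith)
    rw [Real.mul_rpow (by norm_num) (by positivity),
      Real.rpow_neg (by norm_num : (0 : ℝ) ≤ 2)] at this
    rwa [inv_mul_le_iff₀ h2q] at this
  calc _ ≤ M * ((ξ ^ α) ^ 2 * (2 ^ (d + α) * κ.nd x y ^ (-(d + α)))) := by gcongr
    _ = _ := by ring

theorem exists_tau_le (hd : 1 ≤ d) (hα : 0 < α) (hJ : Tendsto κ.J atTop (nhds 0))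
    (hβc : 0 < κ.betaC) (hCL : κ.CL) : ∃ C : ℝ, 0 < C ∧ ∀ β ξ : ℝ, 0 < β → β ≤ κ.betaC → 1 ≤ ξ →
      sus (κ.rate β) 0 = ENNReal.ofReal (ξ ^ α) → ∀ x y : V d, x ≠ y →
        tau (κ.rate β) x y ≤ ENNReal.ofReal (C * κ.nd x y ^ (-(d : ℝ) + α) *
          max 1 (κ.nd x y / ξ) ^ (-(2 * α))) := by
  obtain ⟨B, hB, hnear⟩ := κ.exists_tau_le_near hd hα hJ hβc hCL
  obtain ⟨D, hD, hfar⟩ := κ.exists_tau_le_far hd hα hJ hβc hCL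
  refine ⟨B + D, by positivity, fun β ξ hβ hββ hξ hsus x y hxy => ?_⟩
  have hξ0 : 0 < ξ := by linarith
  have hR := κ.nd_pos hxy
  rcases le_total (κ.nd x y) ξ with h | h
  · refine (hnear β ξ hβ hββ hξ hsus x y hxy h).trans (ENNReal.ofReal_le_ofReal ?_)
    rw [max_eq_left ((div_le_one hξ0).2 h), Real.one_rpow, mul_one,
      show -(d : ℝ) + α = α - d by ring]
    gcongr
    linarith
  · refine (hfar β ξ hβ hββ hξ hsus x y h).trans (ENNReal.ofReal_le_ofReal ?_)
    rw [max_eq_right ((one_le_div hξ0).2 h), Real.div_rpow hR.le hξ0.le,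
      Real.rpow_neg hξ0.le, div_inv_eq_mul]
    have e1 : ξ ^ (2 * α) = (ξ ^ α) ^ 2 := by
      rw [mul_comm, Real.rpow_mul hξ0.le]; norm_num
    have e2 : κ.nd x y ^ (-(d + α)) = κ.nd x y ^ (-(d : ℝ) + α) * κ.nd x y ^ (-(2 * α)) := by
      rw [← Real.rpow_add hR]; ring_nf
    rw [e1, e2]
    calc _ = D * (κ.nd x y ^ (-(d : ℝ) + α) * (κ.nd x y ^ (-(2 * α)) * (ξ ^ α) ^ 2)) := by ring
      _ ≤ (B + D) * (κ.nd x y ^ (-(d : ℝ) + α) * (κ.nd x y ^ (-(2 * α)) * (ξ ^ α) ^ 2)) := by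
        gcongr
        linarith
      _ = _ := by ring

end Kernel

end LRP

namespace LRP

open scoped NNReal

theorem natCast_min_eq_sum (n m : ℕ) :
    ((min n m : ℕ) : ℝ≥0∞) = ∑ i ∈ Finset.range m, if i + 1 ≤ n then 1 else 0 := by
  rw [Finset.sum_boole]
  congr 1
  rw [← Finset.card_range (min n m)]
  congr 1
  ext i
  simp only [Finset.mem_range, Finset.mem_filter]
  omega

theorem lintegral_min_card_cl_mul_le {W : Type*} [Countable W] (t : Sym2 W → ℝ≥0)
    (Λ Λ' : Finset W) (x y : W) (m : ℕ) :
    (∫⁻ ω, ((min (cl Λ ω x).card m : ℕ) : ℝ≥0∞) ∂perc t) *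
      (∫⁻ ω, ((min (cl Λ' ω y).card m : ℕ) : ℝ≥0∞) ∂perc t) ≤
      ∫⁻ ω, ((min (cl Λ ω x).card m : ℕ) : ℝ≥0∞) * ((min (cl Λ' ω y).card m : ℕ) : ℝ≥0∞)
        ∂perc t := by
  have hA : ∀ (Λ : Finset W) (x : W) (i : ℕ),
      Measurable fun ω : Sym2 W → Bool => if i + 1 ≤ (cl Λ ω x).card then (1 : ℝ≥0∞) else 0 :=
    fun Λ x i => measurable_of_card_cl Λ x fun n => if i + 1 ≤ n then 1 else 0
  have hI : ∀ s : Set (Sym2 W → Bool), MeasurableSet s →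
      ∫⁻ ω, (if ω ∈ s then (1 : ℝ≥0∞) else 0) ∂perc t = perc t s := fun s hs => by
    rw [← lintegral_indicator_one hs]
    exact lintegral_congr fun ω => by simp [Set.indicator_apply]
  have hI1 : ∀ (Λ : Finset W) (x : W) (i : ℕ),
      ∫⁻ ω, (if i + 1 ≤ (cl Λ ω x).card then (1 : ℝ≥0∞) else 0) ∂perc t =
        perc t {ω | i + 1 ≤ (cl Λ ω x).card} := fun Λ x i =>
    (lintegral_congr fun ω => by congr).trans (hI _ (inc_card_cl Λ (i + 1) x).measurableSet)
  have hAB : ∀ i j : ℕ, Measurable fun ω : Sym2 W → Bool =>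
      (if i + 1 ≤ (cl Λ ω x).card then (1 : ℝ≥0∞) else 0) *
        if j + 1 ≤ (cl Λ' ω y).card then (1 : ℝ≥0∞) else 0 := fun i j =>
    (hA Λ x i).mul (hA Λ' y j)
  simp only [natCast_min_eq_sum, Finset.sum_mul_sum]
  rw [lintegral_finsetSum _ fun i _ => hA _ _ _, lintegral_finsetSum _ fun i _ => hA _ _ _,
    Finset.sum_mul_sum,
    lintegral_finsetSum _ fun i _ => Finset.measurable_fun_sum _ fun j _ => hAB i j]
  refine Finset.sum_le_sum fun i _ => ?_
  rw [lintegral_finsetSum _ fun j _ => hAB i j]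
  refine Finset.sum_le_sum fun j _ => ?_
  rw [hI1, hI1]
  refine (perc_mul_le_inter t (inc_card_cl Λ (i + 1) x) (inc_card_cl Λ' (j + 1) y)).trans ?_
  rw [← hI _ ((inc_card_cl Λ (i + 1) x).measurableSet.inter
    (inc_card_cl Λ' (j + 1) y).measurableSet)]
  refine lintegral_mono fun ω => ?_
  by_cases hω : ω ∈ {ω | i + 1 ≤ (cl Λ ω x).card} ∩ {ω | j + 1 ≤ (cl Λ' ω y).card}
  · have h1 : i + 1 ≤ (cl Λ ω x).card := hω.1
    have h2 : j + 1 ≤ (cl Λ' ω y).card := hω.2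
    exact le_of_eq (by rw [if_pos hω, if_pos h1, if_pos h2, mul_one])
  · rw [if_neg hω]
    exact bot_le

theorem mul_lintegral_min_card_cl_le_tau_add {W : Type*} [Countable W] (t u : Sym2 W → ℝ≥0)
    {υ : ℝ≥0} {Λ Λ' : Finset W} (hu : ∀ a ∈ Λ, ∀ b ∈ Λ', a ≠ b → υ ≤ u s(a, b)) (x y : W) (m : ℕ) :
    υ * ((∫⁻ ω, ((min (cl Λ ω x).card m : ℕ) : ℝ≥0∞) ∂perc t) *
      (∫⁻ ω, ((min (cl Λ' ω y).card m : ℕ) : ℝ≥0∞) ∂perc t)) ≤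
      (1 + υ * (m : ℝ≥0∞) ^ 2) * tau (t + u) x y := by
  refine (mul_le_mul_right (lintegral_min_card_cl_mul_le t Λ Λ' x y m) _).trans ?_
  rw [tau_add_eq_lintegral, ← lintegral_const_mul' _ _ coe_ne_top,
    ← lintegral_const_mul' _ _ (by finiteness)]
  exact lintegral_mono fun ω => mul_le_perc_sup_conn u υ hu ω x y m

theorem sum_tau_le_two_mul_lintegral_min {W : Type*} [Countable W] (t : Sym2 W → ℝ≥0)
    (Λ : Finset W) {l : ℕ} (hl : 0 < l) (h : 150 * pairs t Λ Λ ≤ (l : ℝ≥0∞) ^ 2) (x : W) :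
    ∑ y ∈ Λ, tau t x y ≤ 2 * ∫⁻ ω, ((min (cl Λ ω x).card (3 * l) : ℕ) : ℝ≥0∞) ∂perc t := by
  have h1 := lintegral_card_cl_large_le t Λ hl h x
  have h2 : ∑ y ∈ Λ, tau t x y ≤ (∫⁻ ω, ((min (cl Λ ω x).card (3 * l) : ℕ) : ℝ≥0∞) ∂perc t) +
      ∫⁻ ω, (if 3 * l ≤ (cl Λ ω x).card then ((cl Λ ω x).card : ℝ≥0∞) else 0) ∂perc t := by
    rw [← lintegral_card_cl, ← lintegral_add_left
      (measurable_of_card_cl Λ x fun n => ((min n (3 * l) : ℕ) : ℝ≥0∞))]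
    refine lintegral_mono fun ω => ?_
    split_ifs with h
    · exact le_add_self
    · rw [min_eq_left (by omega)]
      exact le_self_add
  have hfin : ∑ y ∈ Λ, tau t x y ≠ ∞ :=
    ENNReal.sum_ne_top.2 fun y _ => ((tau_le_one t x y).trans_lt one_lt_top).ne
  generalize ∑ y ∈ Λ, tau t x y = S at *
  generalize (∫⁻ ω, ((min (cl Λ ω x).card (3 * l) : ℕ) : ℝ≥0∞) ∂perc t) = A at *
  generalize (∫⁻ ω, (if 3 * l ≤ (cl Λ ω x).card then ((cl Λ ω x).card : ℝ≥0∞) else 0) ∂perc t) = B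
    at *
  rcases eq_or_ne A ∞ with rfl | hA
  · simp
  have hB : B ≠ ∞ := by
    rintro rfl
    simp at h1
    exact hfin h1
  rw [← ENNReal.toReal_le_toReal (by finiteness) (by finiteness)] at h1 h2 ⊢
  rw [ENNReal.toReal_mul] at h1 ⊢
  rw [ENNReal.toReal_add hA hB] at h2
  simp only [ENNReal.toReal_ofNat] at *
  linarith [ENNReal.toReal_nonneg (a := B), ENNReal.toReal_nonneg (a := A)]

namespace Kernel

variable {d : ℕ} {α : ℝ} (κ : Kernel d α)

theorem exists_le_sus (hα : 0 < α) (hJ : Tendsto κ.J atTop (nhds 0)) (hβc : 0 < κ.betaC) :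
    ∃ c : ℝ, 0 < c ∧ ∀ β ξ r : ℝ, 0 < β → β ≤ κ.betaC → 1 ≤ r → r ≤ ξ →
      sus (κ.rate β) 0 = ENNReal.ofReal (ξ ^ α) →
        ENNReal.ofReal (c * r ^ α) ≤ sus (κ.rateCut β r) 0 := by
  obtain ⟨B, hB, hdeg⟩ := κ.exists_deg_sub_le hα hJ
  refine ⟨(1 + B * κ.betaC)⁻¹, by positivity, fun β ξ r hβ hββ hr hrξ hsus => ?_⟩
  have hr0 : 0 < r := by linarith
  have hξ0 : 0 < ξ := by linarith
  have h := sus_add_le_deg (κ.transInv_rateCut β r)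
    ((κ.transInv_rate β).sub (κ.transInv_rateCut β r))
  rw [κ.rateCut_add_rate_sub hβ.le hr0, hsus] at h
  have hS : sus (κ.rateCut β r) 0 ≠ ∞ := by
    have := sus_mono (κ.rateCut_le_rate hβ.le hr0 : κ.rateCut β r ≤ κ.rate β) (0 : V d)
    rw [hsus] at this
    exact ne_top_of_le_ne_top ENNReal.ofReal_ne_top this
  obtain ⟨S, hS0, hSS⟩ : ∃ S : ℝ, 0 ≤ S ∧ sus (κ.rateCut β r) 0 = ENNReal.ofReal S :=
    ⟨_, ENNReal.toReal_nonneg, (ENNReal.ofReal_toReal hS).symm⟩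
  rw [hSS] at h ⊢
  refine ENNReal.ofReal_le_ofReal ?_
  have h2 := h.trans (add_le_add le_rfl (mul_le_mul_left (mul_le_mul_right (hdeg β hβ.le r hr) _) _))
  rw [← ENNReal.ofReal_mul hS0, ← ENNReal.ofReal_mul (by positivity),
    ← ENNReal.ofReal_add hS0 (by positivity), ENNReal.ofReal_le_ofReal_iff (by positivity)] at h2
  have hrα : 0 < r ^ α := by positivity
  have hξα : 0 < ξ ^ α := by positivity
  rw [Real.rpow_neg hr0.le] at h2
  have hle : r ^ α ≤ ξ ^ α := by gcongr
  rw [inv_mul_le_iff₀ (by positivity)]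
  have h3 : ξ ^ α * r ^ α ≤ S * (r ^ α + B * β * ξ ^ α) := by
    calc ξ ^ α * r ^ α ≤ (S + S * (B * β * (r ^ α)⁻¹) * ξ ^ α) * r ^ α := by gcongr
      _ = S * (r ^ α + B * β * ξ ^ α * ((r ^ α)⁻¹ * r ^ α)) := by ring
      _ = _ := by rw [inv_mul_cancel₀ hrα.ne', mul_one]
  have h4 : S * (r ^ α + B * β * ξ ^ α) ≤ S * (ξ ^ α + B * κ.betaC * ξ ^ α) := by gcongr
  refine le_of_mul_le_mul_left ?_ hξα
  calc ξ ^ α * r ^ α ≤ _ := h3.trans h4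
    _ = _ := by ring

theorem exists_le_sum_tau (hd : 1 ≤ d) (hα : 0 < α) (hJ : Tendsto κ.J atTop (nhds 0))
    (hβc : 0 < κ.betaC) (hCL : κ.CL) : ∃ c K : ℝ, 0 < c ∧ 1 ≤ K ∧ ∀ β ξ r : ℝ, 0 < β →
      β ≤ κ.betaC → 1 ≤ r → r ≤ ξ → sus (κ.rate β) 0 = ENNReal.ofReal (ξ ^ α) →
        ENNReal.ofReal (c * r ^ α) ≤ ∑ y ∈ κ.fball (K * r), tau (κ.rateCut β r) 0 y := by
  obtain ⟨c, hc, hle⟩ := κ.exists_le_sus hα hJ hβc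
  obtain ⟨A, hA, hsusle⟩ := κ.exists_sus_le hd hα hJ hβc hCL
  obtain ⟨T, hT, htail⟩ := κ.exists_tail_le hα hJ hβc hCL (p := 1) one_pos
  refine ⟨c / 2, 1 + 2 * A * T / c, by positivity, le_add_of_nonneg_right (by positivity),
    fun β ξ r hβ hββ hr hrξ hsus => ?_⟩
  obtain ⟨K, hK⟩ : ∃ K, K = 1 + 2 * A * T / c := ⟨_, rfl⟩
  rw [← hK]
  have hK0 : 0 < K := by rw [hK]; positivity
  have hr0 : 0 < r := by linarith
  have h1 := hle β ξ r hβ hββ hr hrξ hsus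
  have hfin : sus (κ.rateCut β r) 0 < ∞ := by
    have := sus_mono (κ.rateCut_le_rate hβ.le hr0 : κ.rateCut β r ≤ κ.rate β) (0 : V d)
    rw [hsus] at this
    exact this.trans_lt ENNReal.ofReal_lt_top
  have h2 : 2 * κ.tail (κ.rateCut β r) (K * r) ≤ sus (κ.rateCut β r) 0 := by
    refine le_trans ?_ h1
    refine (mul_le_mul_right ((κ.tail_mono (κ.rateCut_mono hβ.le hββ hr0 le_rfl) _).trans
      ((htail r hr _ (by positivity)).trans (mul_le_mul_left (hsusle r hr) _))) _).trans ?_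
    rw [← ENNReal.ofReal_ofNat 2, ← ENNReal.ofReal_mul (by positivity),
      ← ENNReal.ofReal_mul (by norm_num)]
    refine ENNReal.ofReal_le_ofReal ?_
    rw [Real.rpow_one, div_mul_cancel_right₀ hr0.ne']
    have h3 : 2 * A * T * K⁻¹ ≤ c := by
      rw [← div_eq_mul_inv, div_le_iff₀ hK0, hK, mul_add, mul_div_cancel₀ _ hc.ne']
      linarith
    calc _ = 2 * A * T * K⁻¹ * r ^ α := by ring
      _ ≤ _ := by gcongr
  have h3 := κ.sus_le_two_mul_sum hfin h2
  have h4 := h1.trans h3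
  rw [show c * r ^ α = 2 * (c / 2 * r ^ α) by ring, ENNReal.ofReal_mul (by norm_num),
    ENNReal.ofReal_ofNat] at h4
  exact (ENNReal.mul_le_mul_iff_right (by norm_num) (by norm_num)).1 h4

end Kernel

end LRP

namespace LRP

open scoped NNReal

namespace Kernel

variable {d : ℕ} {α : ℝ} (κ : Kernel d α)

theorem mul_J_le_rate_sub {β r s : ℝ} (hβ : 0 ≤ β) (hr : 0 < r) (hrs : r ≤ s) {x y : V d}
    (hxy : x ≠ y) (h : κ.nd x y ≤ s) :
    β * κ.J s ≤ ((κ.rate β - κ.rateCut β r) s(x, y) : ℝ≥0) := by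
  have h1 : κ.J s ≤ κ.J (κ.nd x y) :=
    κ.J_anti (Set.mem_Ioi.2 (κ.nd_pos hxy)) (Set.mem_Ioi.2 (by linarith)) h
  have h2 : κ.J s ≤ κ.J r := κ.J_anti (Set.mem_Ioi.2 hr) (Set.mem_Ioi.2 (by linarith)) hrs
  have h0 := κ.J_nonneg s (by linarith)
  rw [Pi.sub_apply, NNReal.coe_sub (κ.rateCut_le_rate hβ hr _), κ.coe_rate hβ, κ.coe_rateCut hβ,
    κ.ker_of_ne hxy, κ.kerCut_eq hr hxy, ← mul_sub]
  refine mul_le_mul_of_nonneg_left ?_ hβ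
  rcases max_cases (κ.J (κ.nd x y) - κ.J r) 0 with h | h <;> linarith

theorem exists_le_tau_of_one_le (hd : 1 ≤ d) (hα : 0 < α) (hJ : Tendsto κ.J atTop (nhds 0))
    (hβc : 0 < κ.betaC) (hCL : κ.CL) : ∃ c : ℝ, 0 < c ∧ ∀ β ξ : ℝ, κ.betaC / 2 ≤ β →
      β ≤ κ.betaC → 1 ≤ ξ → sus (κ.rate β) 0 = ENNReal.ofReal (ξ ^ α) → ∀ x y : V d,
        1 ≤ κ.nd x y → ENNReal.ofReal (c * (((min (κ.nd x y) ξ) ^ α) ^ 2 *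
          κ.nd x y ^ (-(d + α)))) ≤ tau (κ.rate β) x y := by
  obtain ⟨c₀, K, hc₀, hK, hsum⟩ := κ.exists_le_sum_tau hd hα hJ hβc hCL
  obtain ⟨A, hA, hsusle⟩ := κ.exists_sus_le hd hα hJ hβc hCL
  obtain ⟨Q, hQ, hcard, -⟩ := κ.exists_card_le
  obtain ⟨cJ, _, hcJ, -, hJb⟩ := κ.exists_J_bounds hα hJ one_pos
  obtain ⟨b, hb⟩ : ∃ b, b = κ.betaC := ⟨_, rfl⟩
  obtain ⟨H, hH⟩ : ∃ H, H = 150 * (Q * K ^ d * A) + 1 := ⟨_, rfl⟩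
  obtain ⟨c₁, hc₁⟩ : ∃ c₁, c₁ = b / 2 * (cJ * (2 * K + 1) ^ (-(d + α))) := ⟨_, rfl⟩
  have hK0 : 0 < K := by linarith
  rw [← hb] at hβc
  have hc₁0 : 0 < c₁ := by rw [hc₁]; positivity
  have hH0 : 1 ≤ H := by rw [hH]; exact le_add_of_nonneg_left (by positivity)
  refine ⟨(1 + 36 * H * c₁)⁻¹ * (c₁ * (c₀ / 2) ^ 2), by positivity,
    fun β ξ hβ hββ hξ hsus x y hxy => ?_⟩
  obtain ⟨R, hR⟩ : ∃ R, R = κ.nd x y := ⟨_, rfl⟩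
  obtain ⟨r, hr⟩ : ∃ r, r = min R ξ := ⟨_, rfl⟩
  rw [← hR] at hxy ⊢
  rw [← hr]
  have hr1 : 1 ≤ r := hr ▸ le_min hxy hξ
  have hrR : r ≤ R := hr ▸ min_le_left _ _
  have hrξ : r ≤ ξ := hr ▸ min_le_right _ _
  have hr0 : 0 < r := by linarith
  have hR0 : 0 < R := by linarith
  have hβ0 : 0 < β := by linarith
  have hq : (0 : ℝ) < d + α := by positivity
  have hrq : 1 ≤ r ^ (d + α) := Real.one_le_rpow hr1 hq.le
  obtain ⟨l, hl, hl1, hl2⟩ := exists_nat_sq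
    (one_le_mul_of_one_le_of_one_le hH0 hrq : 1 ≤ H * r ^ (d + α))
  have ht := κ.transInv_rateCut β r
  have hpairs : 150 * pairs (κ.rateCut β r) (κ.fball (K * r)) (κ.fball (K * r)) ≤
      (l : ℝ≥0∞) ^ 2 := by
    have h1 : sus (κ.rateCut β r) 0 ≤ ENNReal.ofReal (A * r ^ α) :=
      (sus_mono (κ.rateCut_mono hβ0.le hββ hr0 le_rfl) _).trans (hsusle r hr1)
    have h2 : ((κ.fball (K * r)).card : ℝ≥0∞) ≤ ENNReal.ofReal (Q * (K * r) ^ d) := by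
      rw [← ENNReal.ofReal_natCast]
      exact ENNReal.ofReal_le_ofReal (hcard _ (one_le_mul_of_one_le_of_one_le hK hr1))
    refine (mul_le_mul_right ((pairs_le_card_mul_sus ht _ _).trans (mul_le_mul' h2 h1)) _).trans ?_
    rw [← ENNReal.ofReal_ofNat 150, ← ENNReal.ofReal_mul (by positivity),
      ← ENNReal.ofReal_mul (by norm_num), ← ENNReal.ofReal_natCast, ← ENNReal.ofReal_pow
        (by positivity)]
    refine ENNReal.ofReal_le_ofReal (le_trans ?_ hl1)
    rw [Real.rpow_add hr0, Real.rpow_natCast, mul_pow, hH]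
    have h3 : 0 ≤ r ^ d * r ^ α := by positivity
    linarith
  have hmin : ∀ z : V d, ENNReal.ofReal (c₀ / 2 * r ^ α) ≤
      ∫⁻ ω, ((min (cl (κ.box (K * r) z) ω z).card (3 * l) : ℕ) : ℝ≥0∞)
        ∂perc (κ.rateCut β r) := fun z => by
    have h1 := hsum β ξ r hβ0 hββ hr1 hrξ hsus
    rw [← κ.sum_box_tau ht (K * r) z] at h1
    have h2 := h1.trans (sum_tau_le_two_mul_lintegral_min _ _ hl
      (by rw [κ.pairs_box_self ht]; exact hpairs) z)
    rw [show c₀ * r ^ α = 2 * (c₀ / 2 * r ^ α) by ring, ENNReal.ofReal_mul (by norm_num),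
      ENNReal.ofReal_ofNat] at h2
    exact (ENNReal.mul_le_mul_iff_right (by norm_num) (by norm_num)).1 h2
  have hu : ∀ a ∈ κ.box (K * r) x, ∀ b' ∈ κ.box (K * r) y, a ≠ b' →
      (c₁ * R ^ (-(d + α))).toNNReal ≤ (κ.rate β - κ.rateCut β r) s(a, b') := by
    intro a ha b' hb' hab
    rw [κ.mem_box] at ha hb'
    have h1 := κ.nd_triangle a x b'
    have h2 := κ.nd_triangle x y b'
    rw [κ.nd_symm y b', ← hR] at h2
    have h3 : K * r ≤ K * R := by gcongr
    have h4 : κ.nd a b' ≤ (2 * K + 1) * R := by linarith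
    have h5 : R ≤ (2 * K + 1) * R := le_mul_of_one_le_left hR0.le (by linarith)
    rw [Real.toNNReal_le_iff_le_coe]
    refine le_trans ?_ (κ.mul_J_le_rate_sub hβ0.le hr0 (hrR.trans h5) hab h4)
    rw [hc₁, mul_assoc, mul_assoc, ← Real.mul_rpow (by positivity) hR0.le]
    exact mul_le_mul (hb ▸ hβ) (hJb _ (by linarith)).1 (by positivity) hβ0.le
  have h := mul_lintegral_min_card_cl_le_tau_add (κ.rateCut β r) (κ.rate β - κ.rateCut β r)
    hu x y (3 * l)
  rw [κ.rateCut_add_rate_sub hβ0.le hr0] at h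
  have h6 : (1 + ((c₁ * R ^ (-(d + α))).toNNReal : ℝ≥0∞) * ((3 * l : ℕ) : ℝ≥0∞) ^ 2) ≤
      ENNReal.ofReal (1 + 36 * H * c₁) := by
    have e : ((c₁ * R ^ (-(d + α))).toNNReal : ℝ≥0∞) = ENNReal.ofReal (c₁ * R ^ (-(d + α))) := rfl
    rw [e, ← ENNReal.ofReal_natCast, ← ENNReal.ofReal_pow (by positivity),
      ← ENNReal.ofReal_mul (by positivity), ← ENNReal.ofReal_one,
      ← ENNReal.ofReal_add (by norm_num) (by positivity)]
    refine ENNReal.ofReal_le_ofReal (add_le_add le_rfl ?_)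
    have h7 : R ^ (-(d + α)) ≤ r ^ (-(d + α)) :=
      Real.rpow_le_rpow_of_nonpos hr0 hrR (by linarith)
    push_cast
    calc c₁ * R ^ (-(d + α)) * (3 * (l : ℝ)) ^ 2 = c₁ * 9 * (R ^ (-(d + α)) * (l : ℝ) ^ 2) := by
          ring
      _ ≤ c₁ * 9 * (r ^ (-(d + α)) * (4 * (H * r ^ (d + α)))) := by gcongr
      _ = 36 * H * c₁ * (r ^ (-(d + α)) * r ^ (d + α)) := by ring
      _ = 36 * H * c₁ := by
        rw [← Real.rpow_add hr0, neg_add_cancel, Real.rpow_zero, mul_one]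
  have h8 := (mul_le_mul_right (mul_le_mul' (hmin x) (hmin y)) _).trans
    (h.trans (mul_le_mul_left h6 _))
  rw [mul_assoc (1 + 36 * H * c₁)⁻¹, ENNReal.ofReal_mul (by positivity),
    ENNReal.ofReal_inv_of_pos (by positivity), mul_comm, ← div_eq_mul_inv,
    ENNReal.div_le_iff' (by simp; positivity) ENNReal.ofReal_ne_top]
  refine le_trans (le_of_eq ?_) h8
  rw [← ENNReal.ofReal_mul (by positivity)]
  change _ = ENNReal.ofReal _ * _
  rw [← ENNReal.ofReal_mul (by positivity)]
  congr 1
  ring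

theorem exists_le_tau (hd : 1 ≤ d) (hα : 0 < α) (hJ : Tendsto κ.J atTop (nhds 0))
    (hβc : 0 < κ.betaC) (hCL : κ.CL) : ∃ c : ℝ, 0 < c ∧ ∀ β ξ : ℝ, κ.betaC / 2 ≤ β →
      β ≤ κ.betaC → 1 ≤ ξ → sus (κ.rate β) 0 = ENNReal.ofReal (ξ ^ α) → ∀ x y : V d, x ≠ y →
        ENNReal.ofReal (c * κ.nd x y ^ (-(d : ℝ) + α) * max 1 (κ.nd x y / ξ) ^ (-(2 * α))) ≤
          tau (κ.rate β) x y := by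
  obtain ⟨c, hc, hle⟩ := κ.exists_le_tau_of_one_le hd hα hJ hβc hCL
  obtain ⟨m, hm, hm1, hmin⟩ := κ.exists_min_nr
  have hJ1 := κ.J_pos hα hJ one_pos
  obtain ⟨p, hp⟩ : ∃ p, p = 1 - Real.exp (-(κ.betaC / 2 * κ.J 1)) := ⟨_, rfl⟩
  have hp0 : 0 < p := by
    rw [hp, sub_pos, Real.exp_lt_one_iff]
    have : 0 < κ.betaC / 2 * κ.J 1 := by positivity
    linarith
  refine ⟨min c (p * (1 + m ^ (-(d : ℝ) + α))⁻¹), lt_min hc (by positivity),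
    fun β ξ hβ hββ hξ hsus x y hxy => ?_⟩
  have hξ0 : 0 < ξ := by linarith
  have hβ0 : 0 < β := by linarith
  have hR := κ.nd_pos hxy
  rcases le_total 1 (κ.nd x y) with h1 | h1
  · refine le_trans (ENNReal.ofReal_le_ofReal ?_) (hle β ξ hβ hββ hξ hsus x y h1)
    rw [mul_assoc]
    have e2 : κ.nd x y ^ (-(d : ℝ) + α) = (κ.nd x y ^ α) ^ 2 * κ.nd x y ^ (-(d + α)) := by
      rw [← Real.rpow_natCast (κ.nd x y ^ α), ← Real.rpow_mul hR.le, ← Real.rpow_add hR]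
      push_cast
      ring_nf
    refine mul_le_mul (min_le_left _ _) (le_of_eq ?_) (by positivity) hc.le
    rcases le_total (κ.nd x y) ξ with h | h
    · rw [max_eq_left ((div_le_one hξ0).2 h), Real.one_rpow, mul_one, min_eq_left h, e2]
    · rw [max_eq_right ((one_le_div hξ0).2 h), min_eq_right h, Real.div_rpow hR.le hξ0.le,
        Real.rpow_neg hξ0.le, div_inv_eq_mul, Real.rpow_neg hR.le, e2]
      have e3 : ∀ s : ℝ, 0 < s → s ^ (2 * α) = (s ^ α) ^ 2 := fun s hs => by
        rw [mul_comm, Real.rpow_mul hs.le]; norm_num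
      rw [e3 _ hR, e3 _ hξ0]
      have h2 : (κ.nd x y ^ α) ^ 2 ≠ 0 := by positivity
      calc _ = (κ.nd x y ^ α) ^ 2 * ((κ.nd x y ^ α) ^ 2)⁻¹ *
            ((ξ ^ α) ^ 2 * κ.nd x y ^ (-(d + α))) := by ring
        _ = _ := by rw [mul_inv_cancel₀ h2, one_mul]
  · have h2 : ENNReal.ofReal p ≤ tau (κ.rate β) x y := by
      refine le_trans ?_ (measure_mono (fun ω hω => conn_of_open hω :
        {ω : Sym2 (V d) → Bool | ω s(x, y) = true} ⊆ {ω | Conn ω x y}))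
      rw [perc_open_singleton, κ.coe_rate hβ0.le, κ.ker_of_ne hxy, hp]
      refine ENNReal.ofReal_le_ofReal ?_
      have h3 : κ.J 1 ≤ κ.J (κ.nd x y) :=
        κ.J_anti (Set.mem_Ioi.2 hR) (Set.mem_Ioi.2 one_pos) h1
      gcongr
    refine le_trans (ENNReal.ofReal_le_ofReal ?_) h2
    rw [max_eq_left ((div_le_one hξ0).2 (h1.trans hξ)), Real.one_rpow, mul_one]
    have h4 : κ.nd x y ^ (-(d : ℝ) + α) ≤ 1 + m ^ (-(d : ℝ) + α) := by
      rcases le_total 0 (-(d : ℝ) + α) with h | h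
      · exact (Real.rpow_le_one hR.le h1 h).trans (le_add_of_nonneg_right (by positivity))
      · exact (Real.rpow_le_rpow_of_nonpos hm
          (κ.nd_eq x y ▸ hmin _ (sub_ne_zero.2 hxy)) h).trans (by linarith)
    have h5 : 0 < 1 + m ^ (-(d : ℝ) + α) := by positivity
    calc _ ≤ p * (1 + m ^ (-(d : ℝ) + α))⁻¹ * (1 + m ^ (-(d : ℝ) + α)) :=
          mul_le_mul (min_le_right _ _) h4 (by positivity) (by positivity)
      _ = p := by rw [mul_assoc, inv_mul_cancel₀ h5.ne', mul_one]

end Kernel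

end LRP

namespace LRP

open scoped NNReal

namespace Kernel

variable {d : ℕ} {α : ℝ} (κ : Kernel d α)

theorem iSup_isPerc {β : ℝ} (hβ : 0 ≤ β) (f : Measure (Config d) → ℝ≥0∞) :
    ⨆ μ ∈ {μ : Measure (Config d) | IsPerc μ (κ.edgeP β)}, f μ = f (perc (κ.rate β)) := by
  refine le_antisymm (iSup₂_le fun μ hμ => ?_) ?_
  · rw [Set.mem_ofPred_eq, κ.edgeP_eq hβ] at hμ
    rw [hμ.eq_perc]
  · refine le_iSup₂_of_le (perc (κ.rate β)) ?_ le_rfl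
    rw [Set.mem_ofPred_eq, κ.edgeP_eq hβ]
    exact isPerc_perc _

theorem xiFull_eq {β : ℝ} (hβ : 0 ≤ β) (p : ℝ) : κ.xiFull β p = xi (perc (κ.rate β)) p :=
  κ.iSup_isPerc hβ _

theorem chi_eq {β : ℝ} (hβ : 0 ≤ β) : κ.chi β = sus (κ.rate β) 0 := by
  rw [chi, mom, κ.iSup_isPerc hβ, clMom_one]

theorem one_le_xiStar {β : ℝ} (hα : 0 < α) (hβ : 0 < β) (hβc : β < κ.betaC) :
    1 ≤ κ.xiStar β := by
  have h : 1 ≤ (sus (κ.rate β) 0).toReal := by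
    rw [← ENNReal.toReal_one]
    exact ENNReal.toReal_mono (κ.sus_rate_lt_top hβ hβc).ne (one_le_sus _ _)
  rw [xiStar, κ.chi_eq hβ.le]
  exact Real.one_le_rpow h (by positivity)

theorem sus_eq_xiStar {β : ℝ} (hα : 0 < α) (hβ : 0 < β) (hβc : β < κ.betaC) :
    sus (κ.rate β) 0 = ENNReal.ofReal (κ.xiStar β ^ α) := by
  rw [xiStar, κ.chi_eq hβ.le, ← Real.rpow_mul ENNReal.toReal_nonneg, inv_mul_cancel₀ hα.ne',
    Real.rpow_one, ENNReal.ofReal_toReal (κ.sus_rate_lt_top hβ hβc).ne]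

theorem exists_gyr_le {p : ℝ} (hp : 0 < p) (hpα : p < α) {C : ℝ} (hC : 0 < C) :
    ∃ D : ℝ, 0 < D ∧ ∀ (t : Sym2 (V d) → ℝ≥0) (ξ : ℝ), 0 < ξ →
      (∀ x : V d, x ≠ 0 → tau t 0 x ≤ ENNReal.ofReal (C * κ.nr x ^ (-(d : ℝ) + α) *
        max 1 (κ.nr x / ξ) ^ (-(2 * α)))) →
      gyr (perc t) p ≤ ENNReal.ofReal (D * ξ ^ (α + p)) := by
  obtain ⟨B, hB, hnr⟩ := κ.exists_enorm2_le_nr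
  obtain ⟨H, hH, hhead⟩ := κ.exists_sum_head (a := α + p) (by linarith)
  obtain ⟨T, hT, htail⟩ := κ.exists_sum_tail (a := α - p) (by linarith)
  refine ⟨C * B ^ p * (H + T), by positivity, fun t ξ hξ h => ?_⟩
  rw [gyr_eq]
  have hterm : ∀ x : V d, tau t 0 x * ENNReal.ofReal (enorm2 x ^ p) ≤
      ENNReal.ofReal (C * B ^ p) * (if x ≠ 0 ∧ κ.nr x ≤ ξ then
        ENNReal.ofReal (κ.nr x ^ (-(d : ℝ) + (α + p))) else 0) +
      ENNReal.ofReal (C * B ^ p * ξ ^ (2 * α)) * (if ξ ≤ κ.nr x then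
        ENNReal.ofReal (κ.nr x ^ (-(d : ℝ) - (α - p))) else 0) := by
    intro x
    by_cases hx : x = 0
    · have : enorm2 (0 : V d) = 0 := by simp [enorm2]
      rw [hx, this, Real.zero_rpow hp.ne']
      simp
    have hR := κ.nr_pos hx
    have h1 : enorm2 x ^ p ≤ B ^ p * κ.nr x ^ p := by
      rw [← Real.mul_rpow hB.le hR.le]
      exact Real.rpow_le_rpow (enorm2_nonneg x) (hnr x) hp.le
    have h2 := mul_le_mul' (h x hx) (ENNReal.ofReal_le_ofReal h1)
    rw [← ENNReal.ofReal_mul (by positivity)] at h2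
    refine h2.trans ?_
    rcases le_total (κ.nr x) ξ with h3 | h3
    · refine le_trans (le_of_eq ?_) le_self_add
      rw [if_pos ⟨hx, h3⟩, max_eq_left ((div_le_one hξ).2 h3), Real.one_rpow,
        ← ENNReal.ofReal_mul (by positivity), ← add_assoc, Real.rpow_add hR _ p]
      congr 1
      ring
    · refine le_trans (le_of_eq ?_) le_add_self
      rw [if_pos h3, max_eq_right ((one_le_div hξ).2 h3), ← ENNReal.ofReal_mul (by positivity),
        Real.div_rpow hR.le hξ.le, Real.rpow_neg hξ.le, div_inv_eq_mul,
        show -(d : ℝ) - (α - p) = (-(d : ℝ) + α) + -(2 * α) + p by ring, Real.rpow_add hR _ p,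
        Real.rpow_add hR _ (-(2 * α))]
      congr 1
      ring
  refine (ENNReal.tsum_le_tsum hterm).trans ?_
  rw [ENNReal.tsum_add, ENNReal.tsum_mul_left, ENNReal.tsum_mul_left]
  refine (add_le_add (mul_le_mul_right (hhead ξ hξ) _) (mul_le_mul_right (htail ξ hξ) _)).trans ?_
  rw [← ENNReal.ofReal_mul (by positivity), ← ENNReal.ofReal_mul (by positivity),
    ← ENNReal.ofReal_add (by positivity) (by positivity)]
  refine ENNReal.ofReal_le_ofReal (le_of_eq ?_)
  have e : ξ ^ (α + p) = ξ ^ (2 * α) * ξ ^ (-(α - p)) := by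
    rw [← Real.rpow_add hξ]; ring_nf
  rw [mul_add (C * B ^ p), add_mul, mul_assoc (C * B ^ p) T, e]
  ring

theorem exists_le_gyr (hd : 1 ≤ d) (hα : 0 < α) {p : ℝ} (hp : 0 < p) {c : ℝ} (hc : 0 < c) :
    ∃ D : ℝ, 0 < D ∧ ∀ (t : Sym2 (V d) → ℝ≥0) (ξ : ℝ), 1 ≤ ξ →
      (∀ x : V d, x ≠ 0 → ENNReal.ofReal (c * κ.nr x ^ (-(d : ℝ) + α) *
        max 1 (κ.nr x / ξ) ^ (-(2 * α))) ≤ tau t 0 x) →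
      ENNReal.ofReal (D * ξ ^ (α + p)) ≤ gyr (perc t) p := by
  obtain ⟨B, hB, hnr⟩ := κ.exists_nr_le_enorm2
  obtain ⟨Q, hQ, hcard, -⟩ := κ.exists_card_le
  obtain ⟨q, hq, hcard'⟩ := κ.exists_le_card
  obtain ⟨K, hK⟩ : ∃ K, K = 1 + (Q + 1) / q := ⟨_, rfl⟩
  have hK1 : 1 ≤ K := by rw [hK]; exact le_add_of_nonneg_right (by positivity)
  have hK0 : 0 < K := by linarith
  refine ⟨c * K ^ (-(d + α)) * (B ^ p)⁻¹, by positivity, fun t ξ hξ h => ?_⟩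
  have hξ0 : 0 < ξ := by linarith
  rw [gyr_eq]
  have hS : ξ ^ d ≤ ((κ.fball (K * ξ) \ κ.fball ξ).card : ℝ) := by
    have h1 := hcard' (K * ξ) (by positivity)
    have h2 := hcard ξ hξ
    have h3 : (κ.fball (K * ξ)).card ≤
        (κ.fball (K * ξ) \ κ.fball ξ).card + (κ.fball ξ).card := by
      have := Finset.le_card_sdiff (κ.fball ξ) (κ.fball (K * ξ))
      omega
    have h3' : ((κ.fball (K * ξ)).card : ℝ) ≤
        (κ.fball (K * ξ) \ κ.fball ξ).card + (κ.fball ξ).card := by exact_mod_cast h3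
    have h4 : Q + 1 ≤ q * K ^ d := by
      have h5 : K ≤ K ^ d := le_self_pow₀ hK1 (by omega)
      have h6 : q * K = q + (Q + 1) := by rw [hK, mul_add, mul_div_cancel₀ _ hq.ne', mul_one]
      have h7 := mul_le_mul_of_nonneg_left h5 hq.le
      linarith
    have h5 : (Q + 1) * ξ ^ d ≤ q * K ^ d * ξ ^ d := by gcongr
    rw [mul_pow] at h1
    linarith
  have hterm : ∀ x ∈ κ.fball (K * ξ) \ κ.fball ξ,
      ENNReal.ofReal (c * K ^ (-(d + α)) * (B ^ p)⁻¹ * ξ ^ (α - d + p)) ≤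
        tau t 0 x * ENNReal.ofReal (enorm2 x ^ p) := by
    intro x hx
    rw [Finset.mem_sdiff, κ.mem_fball, κ.mem_fball, not_le] at hx
    obtain ⟨hxK, hxξ⟩ := hx
    have hR : 0 < κ.nr x := by linarith
    have hx0 : x ≠ 0 := by
      rintro rfl
      rw [κ.nr_zero] at hR
      exact hR.false
    have h1 : (B ^ p)⁻¹ * ξ ^ p ≤ enorm2 x ^ p := by
      rw [inv_mul_le_iff₀ (by positivity), ← Real.mul_rpow hB.le (enorm2_nonneg x)]
      exact Real.rpow_le_rpow hξ0.le (hxξ.le.trans (hnr x)) hp.le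
    refine le_trans ?_ (mul_le_mul' (h x hx0) (ENNReal.ofReal_le_ofReal h1))
    rw [← ENNReal.ofReal_mul (by positivity)]
    refine ENNReal.ofReal_le_ofReal ?_
    have h2 : K ^ (-(d + α)) * ξ ^ (-(d + α)) ≤ κ.nr x ^ (-(d + α)) := by
      rw [← Real.mul_rpow hK0.le hξ0.le]
      exact Real.rpow_le_rpow_of_nonpos hR hxK
        (by linarith [(Nat.cast_nonneg d : (0 : ℝ) ≤ d)])
    rw [max_eq_right ((one_le_div hξ0).2 hxξ.le), Real.div_rpow hR.le hξ0.le,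
      Real.rpow_neg hξ0.le, div_inv_eq_mul]
    have e1 : κ.nr x ^ (-(d + α)) = κ.nr x ^ (-(d : ℝ) + α) * κ.nr x ^ (-(2 * α)) := by
      rw [← Real.rpow_add hR]; ring_nf
    have e2 : ξ ^ (α - d + p) = ξ ^ (-(d + α)) * ξ ^ (2 * α) * ξ ^ p := by
      rw [← Real.rpow_add hξ0, ← Real.rpow_add hξ0]; ring_nf
    rw [e2]
    calc _ = c * (K ^ (-(d + α)) * ξ ^ (-(d + α))) * ξ ^ (2 * α) * ((B ^ p)⁻¹ * ξ ^ p) := by ring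
      _ ≤ c * κ.nr x ^ (-(d + α)) * ξ ^ (2 * α) * ((B ^ p)⁻¹ * ξ ^ p) := by gcongr
      _ = _ := by rw [e1]; ring
  refine le_trans ?_ (ENNReal.sum_le_tsum (κ.fball (K * ξ) \ κ.fball ξ))
  refine le_trans ?_ (Finset.sum_le_sum hterm)
  rw [Finset.sum_const, nsmul_eq_mul, ← ENNReal.ofReal_natCast, ← ENNReal.ofReal_mul (by positivity)]
  refine ENNReal.ofReal_le_ofReal ?_
  have e3 : ξ ^ (α + p) = ξ ^ d * ξ ^ (α - d + p) := by
    rw [← Real.rpow_natCast, ← Real.rpow_add hξ0]; ring_nf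
  rw [e3]
  calc _ = ξ ^ d * (c * K ^ (-(d + α)) * (B ^ p)⁻¹ * ξ ^ (α - d + p)) := by ring
    _ ≤ _ := by gcongr

theorem ofReal_rpow_xi {D p ξ : ℝ} (hD : 0 < D) (hp : 0 < p) (hξ : 0 < ξ) :
    (ENNReal.ofReal (D * ξ ^ (α + p)) / ENNReal.ofReal (ξ ^ α)) ^ (1 / p) =
      ENNReal.ofReal (D ^ (1 / p) * ξ) := by
  rw [← ENNReal.ofReal_div_of_pos (by positivity), Real.rpow_add hξ, ← mul_assoc, mul_right_comm,
    mul_div_cancel_right₀ _ (by positivity), ENNReal.ofReal_rpow_of_pos (by positivity),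
    Real.mul_rpow hD.le (by positivity), ← Real.rpow_mul hξ.le, mul_one_div_cancel hp.ne',
    Real.rpow_one]

end Kernel

end LRP

namespace LRP

/-- Suppose (CL) holds and set `ξ*(β) = χ(β)^{1/α}`.  Then
`P_β(x ↔ y) ≍ ‖x-y‖^{-d+α} (1 ∨ ‖x-y‖/ξ*(β))^{-2α}` for every `β_c/2 ≤ β < β_c`
and all distinct `x, y ∈ ℤ^d`.  As a consequence, `ξ_p(β) ≍_p ξ*(β)` for all
`0 < p < α` and `β_c/2 ≤ β < β_c`. -/
theorem statement8 (d : ℕ) (α : ℝ) (hd : 1 ≤ d) (hα : 0 < α) (κ : Kernel d α)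
    (hCL : κ.CL) :
    (∃ c C : ℝ, 0 < c ∧ 0 < C ∧
      ∀ β : ℝ, κ.betaC / 2 ≤ β → β < κ.betaC → ∀ x y : V d, x ≠ y →
        ∀ μ : Measure (Config d), IsPerc μ (κ.edgeP β) →
          ENNReal.ofReal (c * κ.nd x y ^ (-(d : ℝ) + α) *
              max 1 (κ.nd x y / κ.xiStar β) ^ (-(2 * α))) ≤ μ {ω | Conn ω x y} ∧
            μ {ω | Conn ω x y} ≤
              ENNReal.ofReal (C * κ.nd x y ^ (-(d : ℝ) + α) *
                max 1 (κ.nd x y / κ.xiStar β) ^ (-(2 * α)))) ∧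
    (∀ p : ℝ, 0 < p → p < α → ∃ c C : ℝ, 0 < c ∧ 0 < C ∧
      ∀ β : ℝ, κ.betaC / 2 ≤ β → β < κ.betaC →
        ENNReal.ofReal (c * κ.xiStar β) ≤ κ.xiFull β p ∧
          κ.xiFull β p ≤ ENNReal.ofReal (C * κ.xiStar β)) := by
  by_cases hβc : 0 < κ.betaC
  swap
  · have vac : ∀ β : ℝ, κ.betaC / 2 ≤ β → β < κ.betaC → False := fun β h1 h2 => hβc (by linarith)
    exact ⟨⟨1, 1, one_pos, one_pos, fun β h1 h2 => (vac β h1 h2).elim⟩,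
      fun p _ _ => ⟨1, 1, one_pos, one_pos, fun β h1 h2 => (vac β h1 h2).elim⟩⟩
  have hJ := κ.tendsto_J hd hβc
  obtain ⟨C, hC, hup⟩ := κ.exists_tau_le hd hα hJ hβc hCL
  obtain ⟨c, hc, hlow⟩ := κ.exists_le_tau hd hα hJ hβc hCL
  refine ⟨⟨c, C, hc, hC, fun β h1 h2 x y hxy μ hμ => ?_⟩, fun p hp hpα => ?_⟩
  · have hβ : 0 < β := by linarith
    have hξ := κ.one_le_xiStar hα hβ h2
    have hs := κ.sus_eq_xiStar hα hβ h2
    rw [κ.edgeP_eq hβ.le] at hμ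
    rw [hμ.eq_perc]
    exact ⟨hlow β _ h1 h2.le hξ hs x y hxy, hup β _ hβ h2.le hξ hs x y hxy⟩
  · obtain ⟨D, hD, hDle⟩ := κ.exists_gyr_le hp hpα hC
    obtain ⟨D', hD', hDge⟩ := κ.exists_le_gyr hd hα hp hc
    refine ⟨D' ^ (1 / p), D ^ (1 / p), by positivity, by positivity, fun β h1 h2 => ?_⟩
    have hβ : 0 < β := by linarith
    have hξ := κ.one_le_xiStar hα hβ h2
    have hξ0 : 0 < κ.xiStar β := by linarith
    have hs := κ.sus_eq_xiStar hα hβ h2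
    have hnd : ∀ x : V d, κ.nd 0 x = κ.nr x := fun x => by rw [κ.nd_eq', sub_zero]
    rw [κ.xiFull_eq hβ.le, xi, Kernel.clMom_one, hs, ← Kernel.ofReal_rpow_xi (α := α) hD' hp hξ0,
      ← Kernel.ofReal_rpow_xi (α := α) hD hp hξ0]
    have hp' : 0 ≤ 1 / p := by positivity
    constructor
    · refine ENNReal.rpow_le_rpow (ENNReal.div_le_div_right (hDge _ _ hξ fun x hx => ?_) _) hp'
      rw [← hnd]
      exact hlow β _ h1 h2.le hξ hs 0 x hx.symm
    · refine ENNReal.rpow_le_rpow (ENNReal.div_le_div_right (hDle _ _ hξ0 fun x hx => ?_) _) hp'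
      rw [← hnd]
      exact hup β _ hβ h2.le hξ hs 0 x hx.symm

end LRP
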